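/- Let Ω ⊂⊂ ℂⁿ (n ≥ 2) be a bounded pseudoconvex domain with C^k (k ≥ 3)-smooth boundary. For a defining function ρ of Ω, let α_ρ be the D'Angelo 1-form of ρ and ω_ρ = π_{1,0} α_ρ its (1,0)-component. Then DF(Ω) = sup over defining functions ρ of { η₁ ∈ (0,1) : ( (η₁/(1−η₁)) (ω_ρ ∧ ω̄_ρ) − ∂̄ω_ρ )(L, L̄) ≤ 0 for all p ∈ Σ and all L ∈ Null_p }, where Σ is the set of weakly pseudoconvex boundary points and Null_p is the null space of the Levi form at p. -/

import Mathlib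

open Complex
open scoped ComplexOrder

noncomputable section

/-- Points of ℂⁿ. -/
abbrev Pt (n : ℕ) := Fin n → ℂ

/-- Wirtinger derivative ∂f/∂z_j at z (junk value if f is not differentiable). -/
def dZ (n : ℕ) (f : Pt n → ℂ) (j : Fin n) (z : Pt n) : ℂ :=
  (1 / 2 : ℂ) * (fderiv ℝ f z (Pi.single j 1) - Complex.I * fderiv ℝ f z (Pi.single j Complex.I))

/-- Wirtinger derivative ∂f/∂z̄_j at z. -/
def dZb (n : ℕ) (f : Pt n → ℂ) (j : Fin n) (z : Pt n) : ℂ :=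
  (1 / 2 : ℂ) * (fderiv ℝ f z (Pi.single j 1) + Complex.I * fderiv ℝ f z (Pi.single j Complex.I))

/-- Complexification of a real-valued function. -/
def cR (n : ℕ) (ρ : Pt n → ℝ) : Pt n → ℂ := fun z => (ρ z : ℂ)

/-- Levi form of ρ at z: Levi_ρ(X,Y) = Σ_{j,k} ∂²ρ/∂z_j∂z̄_k X_j conj(Y_k), where X, Y are
(1,0)-vectors given by their coefficient tuples. -/
def levi (n : ℕ) (ρ : Pt n → ℝ) (z : Pt n) (X Y : Fin n → ℂ) : ℂ :=
  ∑ j, ∑ k, dZ n (fun w => dZb n (cR n ρ) k w) j z * X j * (starRingEnd ℂ) (Y k)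

/-- Holomorphic tangent space T^{1,0}_p(∂Ω) (for boundary points p), described via a defining
function: (1,0)-vectors X with Σ_j X_j ∂ρ/∂z_j(p) = 0. -/
def T10 (n : ℕ) (ρ : Pt n → ℝ) (p : Pt n) : Set (Fin n → ℂ) :=
  {X | ∑ j, X j * dZ n (cR n ρ) j p = 0}

/-- Null space of the Levi form inside T^{1,0}_p(∂Ω). -/
def nullSp (n : ℕ) (ρ : Pt n → ℝ) (p : Pt n) : Set (Fin n → ℂ) :=
  {X | X ∈ T10 n ρ p ∧ ∀ Y ∈ T10 n ρ p, levi n ρ p X Y = 0}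

/-- ρ is a C^s defining function of Ω on the neighborhood V of the closure of Ω. -/
def IsDefining (n : ℕ) (s : ℕ∞) (Ω : Set (Pt n)) (ρ : Pt n → ℝ) (V : Set (Pt n)) : Prop :=
  IsOpen V ∧ closure Ω ⊆ V ∧ ContDiffOn ℝ s ρ V ∧
    Ω = {z | z ∈ V ∧ ρ z < 0} ∧ ∀ z ∈ frontier Ω, fderiv ℝ ρ z ≠ 0

/-- Strict plurisubharmonicity on a set, via positivity of the Levi form. -/
def StrictPSHOn (n : ℕ) (f : Pt n → ℝ) (s : Set (Pt n)) : Prop :=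
  ∀ z ∈ s, ∀ X : Fin n → ℂ, X ≠ 0 → 0 < (levi n f z X X).re

/-- Diederich–Fornaess exponent of a defining function ρ (0 if the defining set is empty). -/
def DFexp (n : ℕ) (ρ : Pt n → ℝ) (Ω : Set (Pt n)) : ℝ :=
  sSup {η : ℝ | 0 < η ∧ η < 1 ∧ StrictPSHOn n (fun z => -((-ρ z) ^ η)) Ω}

/-- Diederich–Fornaess index of Ω: supremum over all (C¹) defining functions. -/
def DFindex (n : ℕ) (Ω : Set (Pt n)) : ℝ :=
  sSup {e : ℝ | ∃ ρ V, IsDefining n 1 Ω ρ V ∧ e = DFexp n ρ Ω}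

/-- Steinness exponent of a defining function ρ (⊤ = ∞ if the defining set is empty). -/
def Sexp (n : ℕ) (ρ : Pt n → ℝ) (Ω : Set (Pt n)) : EReal :=
  sInf {e : EReal | ∃ η : ℝ, 1 < η ∧
    (∃ U : Set (Pt n), IsOpen U ∧ frontier Ω ⊆ U ∧
      StrictPSHOn n (fun z => ρ z ^ η) ((closure Ω)ᶜ ∩ U)) ∧ e = (η : EReal)}

/-- Steinness index of Ω: infimum over all (C¹) defining functions. -/
def Sindex (n : ℕ) (Ω : Set (Pt n)) : EReal :=
  sInf {e : EReal | ∃ ρ V, IsDefining n 1 Ω ρ V ∧ e = Sexp n ρ Ω}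

/-- A complex vector field Σ_j a_j ∂/∂z_j + Σ_j b_j ∂/∂z̄_j on ℂⁿ, recorded by its
coefficient functions. -/
structure VF (n : ℕ) where
  a : Pt n → Fin n → ℂ
  b : Pt n → Fin n → ℂ

/-- Action of a complex vector field on a function. -/
def VF.app {n : ℕ} (V : VF n) (f : Pt n → ℂ) (z : Pt n) : ℂ :=
  ∑ j, V.a z j * dZ n f j z + ∑ j, V.b z j * dZb n f j z

/-- The value of a vector field at a point, as a pair ((1,0)-part, (0,1)-part). -/
def VF.atPt {n : ℕ} (V : VF n) (p : Pt n) : (Fin n → ℂ) × (Fin n → ℂ) := (V.a p, V.b p)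

/-- A complex 1-form Σ_j w_j dz_j + Σ_j t_j dz̄_j on ℂⁿ. -/
structure Form1 (n : ℕ) where
  w : Pt n → Fin n → ℂ
  t : Pt n → Fin n → ℂ

/-- Value of a 1-form at a point on a complex tangent vector (pair of (1,0) and (0,1) parts). -/
def Form1.eval {n : ℕ} (η : Form1 n) (z : Pt n) (X : (Fin n → ℂ) × (Fin n → ℂ)) : ℂ :=
  ∑ j, η.w z j * X.1 j + ∑ j, η.t z j * X.2 j

/-- Pairing of a 1-form with a vector field. -/
def Form1.app {n : ℕ} (η : Form1 n) (V : VF n) (z : Pt n) : ℂ :=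
  η.eval z (V.atPt z)

/-- Lie bracket of complex vector fields. -/
def VF.bracket {n : ℕ} (V W : VF n) : VF n :=
  ⟨fun z j => V.app (fun w => W.a w j) z - W.app (fun w => V.a w j) z,
   fun z j => V.app (fun w => W.b w j) z - W.app (fun w => V.b w j) z⟩

/-- Levi-Civita covariant derivative ∇_V W of the Euclidean metric (componentwise derivative). -/
def covD {n : ℕ} (V W : VF n) : VF n :=
  ⟨fun z j => V.app (fun w => W.a w j) z, fun z j => V.app (fun w => W.b w j) z⟩

/-- Lie derivative of a 1-form along a vector field, in coordinates. -/
def lieD {n : ℕ} (T : VF n) (η : Form1 n) : Form1 n :=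
  ⟨fun z j => T.app (fun w => η.w w j) z + ∑ m, η.w z m * dZ n (fun w => T.a w m) j z
      + ∑ m, η.t z m * dZ n (fun w => T.b w m) j z,
   fun z j => T.app (fun w => η.t w j) z + ∑ m, η.w z m * dZb n (fun w => T.a w m) j z
      + ∑ m, η.t z m * dZb n (fun w => T.b w m) j z⟩

/-- Negation of a 1-form. -/
def Form1.neg {n : ℕ} (η : Form1 n) : Form1 n := ⟨fun z j => -η.w z j, fun z j => -η.t z j⟩

/-- Σ_j |∂ρ/∂z_j|². -/
def gradSq (n : ℕ) (ρ : Pt n → ℝ) (z : Pt n) : ℝ :=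
  ∑ j, Complex.normSq (dZ n (cR n ρ) j z)

/-- Norm of the real gradient of ρ: ‖∇ρ‖ = 2 (Σ_j |∂ρ/∂z_j|²)^{1/2}. -/
def gradNorm (n : ℕ) (ρ : Pt n → ℝ) (z : Pt n) : ℝ := 2 * Real.sqrt (gradSq n ρ z)

/-- The (1,0) field L_n = (Σ|∂ρ/∂z_j|²)⁻¹ Σ_j (∂ρ/∂z̄_j) ∂/∂z_j. -/
def LnVF (n : ℕ) (ρ : Pt n → ℝ) : VF n :=
  ⟨fun z j => dZb n (cR n ρ) j z / (gradSq n ρ z : ℂ), fun _ _ => 0⟩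

/-- The (1,0) field N = (Σ|∂ρ/∂z_j|²)^{-1/2} Σ_j (∂ρ/∂z̄_j) ∂/∂z_j. -/
def NVF (n : ℕ) (ρ : Pt n → ℝ) : VF n :=
  ⟨fun z j => dZb n (cR n ρ) j z / ((Real.sqrt (gradSq n ρ z) : ℝ) : ℂ), fun _ _ => 0⟩

/-- T = L_n − conj(L_n). -/
def TVF (n : ℕ) (ρ : Pt n → ℝ) : VF n :=
  ⟨fun z j => (LnVF n ρ).a z j, fun z j => -(starRingEnd ℂ) ((LnVF n ρ).a z j)⟩

/-- η = (1/2)(∂ρ − ∂̄ρ). -/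
def etaF (n : ℕ) (ρ : Pt n → ℝ) : Form1 n :=
  ⟨fun z j => (1 / 2 : ℂ) * dZ n (cR n ρ) j z,
   fun z j => -(1 / 2 : ℂ) * dZb n (cR n ρ) j z⟩

/-- The D'Angelo 1-form α_ρ = −Lie_T η of a defining function ρ. -/
def dAngelo (n : ℕ) (ρ : Pt n → ℝ) : Form1 n := Form1.neg (lieD (TVF n ρ) (etaF n ρ))

/-- Evaluation of the (1,0)-part ∂η of the exterior derivative of a 1-form on two
complex tangent vectors. -/
def delEval {n : ℕ} (η : Form1 n) (X Y : (Fin n → ℂ) × (Fin n → ℂ)) (z : Pt n) : ℂ :=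
  (∑ m, ∑ l, dZ n (fun w => η.w w l) m z * (X.1 m * Y.1 l - Y.1 m * X.1 l)) +
  (∑ m, ∑ l, dZ n (fun w => η.t w l) m z * (X.1 m * Y.2 l - Y.1 m * X.2 l))

/-- Evaluation of ∂̄η of a 1-form η on two complex tangent vectors. -/
def delbEval {n : ℕ} (η : Form1 n) (X Y : (Fin n → ℂ) × (Fin n → ℂ)) (z : Pt n) : ℂ :=
  (∑ m, ∑ l, dZb n (fun w => η.w w l) m z * (X.2 m * Y.1 l - Y.2 m * X.1 l)) +
  (∑ m, ∑ l, dZb n (fun w => η.t w l) m z * (X.2 m * Y.2 l - Y.2 m * X.2 l))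

/-- Evaluation of dη = ∂η + ∂̄η. -/
def dEval {n : ℕ} (η : Form1 n) (X Y : (Fin n → ℂ) × (Fin n → ℂ)) (z : Pt n) : ℂ :=
  delEval η X Y z + delbEval η X Y z

/-- Evaluation of d^c η = i(∂̄ − ∂)η. -/
def dcEval {n : ℕ} (η : Form1 n) (X Y : (Fin n → ℂ) × (Fin n → ℂ)) (z : Pt n) : ℂ :=
  Complex.I * (delbEval η X Y z - delEval η X Y z)

/-- Evaluation of ω ∧ ω̄ on two complex tangent vectors, where ω = π_{1,0} η is the
(1,0)-component of the real 1-form η. -/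
def omegaWedge {n : ℕ} (η : Form1 n) (X Y : (Fin n → ℂ) × (Fin n → ℂ)) (z : Pt n) : ℂ :=
  (∑ j, η.w z j * X.1 j) * (∑ j, (starRingEnd ℂ) (η.w z j) * Y.2 j) -
  (∑ j, η.w z j * Y.1 j) * (∑ j, (starRingEnd ℂ) (η.w z j) * X.2 j)

/-- Evaluation of ∂̄ω where ω = π_{1,0} η. -/
def delbOmega {n : ℕ} (η : Form1 n) (X Y : (Fin n → ℂ) × (Fin n → ℂ)) (z : Pt n) : ℂ :=
  delbEval ⟨η.w, fun _ _ => 0⟩ X Y z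

/-- The standard Euclidean complex Hermitian metric g on complexified tangent vectors
(so that g(∂/∂z_j, ∂/∂z_j) = 1/2). -/
def gMet {n : ℕ} (X Y : (Fin n → ℂ) × (Fin n → ℂ)) : ℂ :=
  (1 / 2 : ℂ) * (∑ j, X.1 j * (starRingEnd ℂ) (Y.1 j) + ∑ j, X.2 j * (starRingEnd ℂ) (Y.2 j))

/-- The real gradient ∇ρ as a complex vector field: 2Σ_j (∂ρ/∂z̄_j ∂/∂z_j + ∂ρ/∂z_j ∂/∂z̄_j). -/
def gradVF (n : ℕ) (ρ : Pt n → ℝ) : VF n :=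
  ⟨fun z j => 2 * dZb n (cR n ρ) j z, fun z j => 2 * dZ n (cR n ρ) j z⟩

/-- Pseudoconvexity of Ω (w.r.t. the defining function ρ): the Levi form is positive
semidefinite on the holomorphic tangent spaces of the boundary. -/
def LeviPseudoconvex (n : ℕ) (ρ : Pt n → ℝ) (Ω : Set (Pt n)) : Prop :=
  ∀ p ∈ frontier Ω, ∀ X ∈ T10 n ρ p, 0 ≤ (levi n ρ p X X).re

/-- The set Σ of weakly pseudoconvex boundary points. -/
def weakPts (n : ℕ) (ρ : Pt n → ℝ) (Ω : Set (Pt n)) : Set (Pt n) :=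
  {p | p ∈ frontier Ω ∧ ∃ X ∈ T10 n ρ p, X ≠ 0 ∧ levi n ρ p X X = 0}

/-- Action of a complex tangent vector at p on a function. -/
def vecApp (n : ℕ) (X : (Fin n → ℂ) × (Fin n → ℂ)) (f : Pt n → ℂ) (p : Pt n) : ℂ :=
  ∑ j, X.1 j * dZ n f j p + ∑ j, X.2 j * dZb n f j p

/-- Pushforward (complexified differential) of a complex tangent vector at p by a map f. -/
def push (n : ℕ) (f : Pt n → Pt n) (p : Pt n) (X : (Fin n → ℂ) × (Fin n → ℂ)) :
    (Fin n → ℂ) × (Fin n → ℂ) :=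
  (fun l => vecApp n X (fun w => f w l) p,
   fun l => vecApp n X (fun w => (starRingEnd ℂ) (f w l)) p)

/-- Conjugation of a coefficient tuple. -/
def conjVec {n : ℕ} (X : Fin n → ℂ) : Fin n → ℂ := fun j => (starRingEnd ℂ) (X j)

/-- A C^k CR-diffeomorphism between ∂Ω₁ and ∂Ω₂, presented by a C^k map f on a
neighborhood U₁ of ∂Ω₁ together with a C^k local inverse g: f maps ∂Ω₁ onto ∂Ω₂
diffeomorphically and its differential maps T^{1,0}(∂Ω₁) into T^{1,0}(∂Ω₂). -/
def IsCRDiffeo (n : ℕ) (k : ℕ∞) (Ω₁ Ω₂ : Set (Pt n)) (ρ₁ ρ₂ : Pt n → ℝ)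
    (f g : Pt n → Pt n) (U₁ U₂ : Set (Pt n)) : Prop :=
  IsOpen U₁ ∧ IsOpen U₂ ∧ frontier Ω₁ ⊆ U₁ ∧ frontier Ω₂ ⊆ U₂ ∧
  (∀ l, ContDiffOn ℝ k (fun z => f z l) U₁) ∧
  (∀ l, ContDiffOn ℝ k (fun z => g z l) U₂) ∧
  f '' frontier Ω₁ = frontier Ω₂ ∧
  (∀ p ∈ frontier Ω₁, g (f p) = p) ∧ (∀ q ∈ frontier Ω₂, f (g q) = q) ∧
  (∀ p ∈ frontier Ω₁, ∀ L ∈ T10 n ρ₁ p,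
    (push n f p (L, 0)).2 = 0 ∧ (push n f p (L, 0)).1 ∈ T10 n ρ₂ (f p))

/-- The 1-form d^c ψ = i(∂̄ψ − ∂ψ) of a real function ψ. -/
def dcForm (n : ℕ) (ψ : Pt n → ℝ) : Form1 n :=
  ⟨fun z j => -Complex.I * dZ n (cR n ψ) j z, fun z j => Complex.I * dZb n (cR n ψ) j z⟩

end

section

open scoped ContDiff Topology

/-- The Wirtinger derivative of `f` along the `(1,0)`-vector `X`. -/
noncomputable def pW {n : ℕ} (f : Pt n → ℂ) (X z : Pt n) : ℂ :=
  (1 / 2 : ℂ) * (fderiv ℝ f z X - I * fderiv ℝ f z (I • X))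

/-- The conjugate Wirtinger derivative of `f` along the conjugate of `X`. -/
noncomputable def pB {n : ℕ} (f : Pt n → ℂ) (X z : Pt n) : ℂ :=
  (1 / 2 : ℂ) * (fderiv ℝ f z X + I * fderiv ℝ f z (I • X))

/-- A quarter of the Laplacian of a real function along the complex line spanned by `X`. -/
noncomputable def hs {n : ℕ} (f : Pt n → ℝ) (X z : Pt n) : ℝ :=
  (1 / 4 : ℝ) * (fderiv ℝ (fun y => fderiv ℝ f y X) z X +
    fderiv ℝ (fun y => fderiv ℝ f y (I • X)) z (I • X))

section wirtinger

variable {n : ℕ} {f g : Pt n → ℂ} {X Y z : Pt n}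

lemma I_smul_I_smul (X : Pt n) : I • I • X = -X := by
  rw [smul_smul, I_mul_I, neg_one_smul]

lemma complex_smul_eq_re_add_im (a : ℂ) (X : Pt n) : a • X = a.re • X + a.im • (I • X) := by
  funext j
  simp only [Pi.smul_apply, Pi.add_apply, smul_eq_mul, real_smul]
  nth_rewrite 1 [← re_add_im a]
  ring

lemma pW_add_left (f : Pt n → ℂ) (X Y z : Pt n) : pW f (X + Y) z = pW f X z + pW f Y z := by
  simp only [pW, smul_add, map_add]; ring

lemma pB_add_left (f : Pt n → ℂ) (X Y z : Pt n) : pB f (X + Y) z = pB f X z + pB f Y z := by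
  simp only [pB, smul_add, map_add]; ring

lemma pW_smul_left (f : Pt n → ℂ) (a : ℂ) (X z : Pt n) : pW f (a • X) z = a * pW f X z := by
  have h2 : I • a • X = a.re • (I • X) - a.im • X := by
    rw [complex_smul_eq_re_add_im a X, smul_add, smul_comm I a.re, smul_comm I a.im,
      I_smul_I_smul, smul_neg, sub_eq_add_neg]
  simp only [pW, h2]
  rw [complex_smul_eq_re_add_im a X]
  simp only [map_add, map_sub, map_smul, real_smul]
  nth_rewrite 5 [← re_add_im a]
  linear_combination ((1/2 : ℂ)) * a.im * fderiv ℝ f z (I • X) * I_mul_I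

lemma pB_smul_left (f : Pt n → ℂ) (a : ℂ) (X z : Pt n) :
    pB f (a • X) z = (starRingEnd ℂ) a * pB f X z := by
  have h2 : I • a • X = a.re • (I • X) - a.im • X := by
    rw [complex_smul_eq_re_add_im a X, smul_add, smul_comm I a.re, smul_comm I a.im,
      I_smul_I_smul, smul_neg, sub_eq_add_neg]
  have h3 : (starRingEnd ℂ) a = a.re - a.im * I := by
    apply Complex.ext <;> simp
  simp only [pB, h2, h3]
  rw [complex_smul_eq_re_add_im a X]
  simp only [map_add, map_sub, map_smul, real_smul]
  linear_combination ((1/2 : ℂ)) * a.im * fderiv ℝ f z (I • X) * I_mul_I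

lemma pW_neg_left (f : Pt n → ℂ) (X z : Pt n) : pW f (-X) z = -pW f X z := by
  rw [← neg_one_smul ℂ X, pW_smul_left]; ring

lemma pW_sub_left (f : Pt n → ℂ) (X Y z : Pt n) : pW f (X - Y) z = pW f X z - pW f Y z := by
  rw [sub_eq_add_neg, pW_add_left, pW_neg_left, sub_eq_add_neg]

lemma pt_eq_sum (X : Pt n) : X = ∑ j, X j • (Pi.single j 1 : Pt n) := by
  funext i
  simp [Finset.sum_apply, Pi.single_apply]

lemma I_smul_single (j : Fin n) : I • (Pi.single j 1 : Pt n) = Pi.single j I := by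
  funext i
  simp [Pi.single_apply]

lemma dZ_eq_pW (f : Pt n → ℂ) (j : Fin n) (z : Pt n) : dZ n f j z = pW f (Pi.single j 1) z := by
  rw [dZ, pW, I_smul_single]

lemma dZb_eq_pB (f : Pt n → ℂ) (j : Fin n) (z : Pt n) : dZb n f j z = pB f (Pi.single j 1) z := by
  rw [dZb, pB, I_smul_single]

lemma pW_sum_left {ι : Type*} (s : Finset ι) (f : Pt n → ℂ) (X : ι → Pt n) (z : Pt n) :
    pW f (∑ j ∈ s, X j) z = ∑ j ∈ s, pW f (X j) z := by
  classical
  induction s using Finset.induction_on with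
  | empty => simp [pW]
  | insert a s ha ih => rw [Finset.sum_insert ha, Finset.sum_insert ha, pW_add_left, ih]

lemma pB_sum_left {ι : Type*} (s : Finset ι) (f : Pt n → ℂ) (X : ι → Pt n) (z : Pt n) :
    pB f (∑ j ∈ s, X j) z = ∑ j ∈ s, pB f (X j) z := by
  classical
  induction s using Finset.induction_on with
  | empty => simp [pB]
  | insert a s ha ih => rw [Finset.sum_insert ha, Finset.sum_insert ha, pB_add_left, ih]

lemma pW_eq_sum (f : Pt n → ℂ) (X z : Pt n) : pW f X z = ∑ j, X j * dZ n f j z := by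
  conv_lhs => rw [pt_eq_sum X, pW_sum_left]
  simp only [pW_smul_left, dZ_eq_pW]

lemma pB_eq_sum (f : Pt n → ℂ) (X z : Pt n) :
    pB f X z = ∑ j, (starRingEnd ℂ) (X j) * dZb n f j z := by
  conv_lhs => rw [pt_eq_sum X, pB_sum_left]
  simp only [pB_smul_left, dZb_eq_pB]

lemma pW_mul (hf : DifferentiableAt ℝ f z) (hg : DifferentiableAt ℝ g z) :
    pW (fun y => f y * g y) X z = f z * pW g X z + g z * pW f X z := by
  have : fderiv ℝ (fun y => f y * g y) z = f z • fderiv ℝ g z + g z • fderiv ℝ f z :=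
    fderiv_mul hf hg
  simp only [pW, this, add_apply, smul_apply, smul_eq_mul]
  ring

lemma pB_mul (hf : DifferentiableAt ℝ f z) (hg : DifferentiableAt ℝ g z) :
    pB (fun y => f y * g y) X z = f z * pB g X z + g z * pB f X z := by
  have : fderiv ℝ (fun y => f y * g y) z = f z • fderiv ℝ g z + g z • fderiv ℝ f z :=
    fderiv_mul hf hg
  simp only [pB, this, add_apply, smul_apply, smul_eq_mul]
  ring

lemma pW_add (hf : DifferentiableAt ℝ f z) (hg : DifferentiableAt ℝ g z) :
    pW (fun y => f y + g y) X z = pW f X z + pW g X z := by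
  have : fderiv ℝ (fun y => f y + g y) z = fderiv ℝ f z + fderiv ℝ g z := fderiv_add hf hg
  simp only [pW, this, add_apply]
  ring

lemma pW_sub (hf : DifferentiableAt ℝ f z) (hg : DifferentiableAt ℝ g z) :
    pW (fun y => f y - g y) X z = pW f X z - pW g X z := by
  have : fderiv ℝ (fun y => f y - g y) z = fderiv ℝ f z - fderiv ℝ g z := fderiv_sub hf hg
  simp only [pW, this, sub_apply]
  ring

lemma pW_const_mul (a : ℂ) (hf : DifferentiableAt ℝ f z) :
    pW (fun y => a * f y) X z = a * pW f X z := by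
  have : fderiv ℝ (fun y => a * f y) z = a • fderiv ℝ f z := fderiv_const_mul hf a
  simp only [pW, this, smul_apply, smul_eq_mul]
  ring

lemma pB_const_mul (a : ℂ) (hf : DifferentiableAt ℝ f z) :
    pB (fun y => a * f y) X z = a * pB f X z := by
  have : fderiv ℝ (fun y => a * f y) z = a • fderiv ℝ f z := fderiv_const_mul hf a
  simp only [pB, this, smul_apply, smul_eq_mul]
  ring

lemma pW_sum {ι : Type*} (s : Finset ι) {F : ι → Pt n → ℂ}
    (hF : ∀ i ∈ s, DifferentiableAt ℝ (F i) z) :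
    pW (fun y => ∑ i ∈ s, F i y) X z = ∑ i ∈ s, pW (F i) X z := by
  have : fderiv ℝ (fun y => ∑ i ∈ s, F i y) z = ∑ i ∈ s, fderiv ℝ (F i) z := fderiv_fun_sum hF
  simp only [pW, this, sum_apply, Finset.mul_sum, ← Finset.sum_sub_distrib]

lemma pB_sum {ι : Type*} (s : Finset ι) {F : ι → Pt n → ℂ}
    (hF : ∀ i ∈ s, DifferentiableAt ℝ (F i) z) :
    pB (fun y => ∑ i ∈ s, F i y) X z = ∑ i ∈ s, pB (F i) X z := by
  have : fderiv ℝ (fun y => ∑ i ∈ s, F i y) z = ∑ i ∈ s, fderiv ℝ (F i) z := fderiv_fun_sum hF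
  simp only [pB, this, sum_apply, Finset.mul_sum, ← Finset.sum_add_distrib]

lemma fderiv_conj_apply (hf : DifferentiableAt ℝ f z) :
    fderiv ℝ (fun y => (starRingEnd ℂ) (f y)) z X = (starRingEnd ℂ) (fderiv ℝ f z X) := by
  have h := ((conjCLE : ℂ →L[ℝ] ℂ).hasFDerivAt (x := f z)).comp z hf.hasFDerivAt
  have h' : HasFDerivAt (fun y => (starRingEnd ℂ) (f y))
    ((conjCLE : ℂ →L[ℝ] ℂ).comp (fderiv ℝ f z)) z := h
  rw [h'.fderiv]; simp

lemma pW_conj (hf : DifferentiableAt ℝ f z) :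
    pW (fun y => (starRingEnd ℂ) (f y)) X z = (starRingEnd ℂ) (pB f X z) := by
  simp only [pW, pB, fderiv_conj_apply hf, map_mul, map_add, conj_I, map_div₀, map_one, map_ofNat]
  ring

lemma pB_conj (hf : DifferentiableAt ℝ f z) :
    pB (fun y => (starRingEnd ℂ) (f y)) X z = (starRingEnd ℂ) (pW f X z) := by
  simp only [pW, pB, fderiv_conj_apply hf, map_mul, map_sub, conj_I, map_div₀, map_one, map_ofNat]
  ring

lemma pW_congr (h : f =ᶠ[𝓝 z] g) : pW f X z = pW g X z := by
  simp only [pW, h.fderiv_eq]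

lemma pB_congr (h : f =ᶠ[𝓝 z] g) : pB f X z = pB g X z := by
  simp only [pB, h.fderiv_eq]

lemma pW_const (a : ℂ) : pW (fun _ : Pt n => a) X z = 0 := by simp [pW]

lemma ContDiffAt.fderiv_apply_const {F : Type*} [NormedAddCommGroup F] [NormedSpace ℝ F]
    {f : Pt n → F} {m k : WithTop ℕ∞} (hf : ContDiffAt ℝ k f z) (h : m + 1 ≤ k) (X : Pt n) :
    ContDiffAt ℝ m (fun y => fderiv ℝ f y X) z :=
  (hf.fderiv_right h).clm_apply contDiffAt_const

lemma ContDiffAt.pW_right {m k : WithTop ℕ∞} (hf : ContDiffAt ℝ k f z) (h : m + 1 ≤ k) (X : Pt n) :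
    ContDiffAt ℝ m (pW f X) z :=
  (contDiffAt_const (c := (1 / 2 : ℂ))).mul ((hf.fderiv_apply_const h X).sub
    ((contDiffAt_const (c := (I : ℂ))).mul (hf.fderiv_apply_const h (I • X : Pt n))))

lemma ContDiffAt.pB_right {m k : WithTop ℕ∞} (hf : ContDiffAt ℝ k f z) (h : m + 1 ≤ k) (X : Pt n) :
    ContDiffAt ℝ m (pB f X) z :=
  (contDiffAt_const (c := (1 / 2 : ℂ))).mul ((hf.fderiv_apply_const h X).add
    ((contDiffAt_const (c := (I : ℂ))).mul (hf.fderiv_apply_const h (I • X : Pt n))))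

lemma fderiv_fderiv_apply {F : Type*} [NormedAddCommGroup F] [NormedSpace ℝ F]
    {f : Pt n → F} (hf : DifferentiableAt ℝ (fderiv ℝ f) z) :
    fderiv ℝ (fun y => fderiv ℝ f y X) z Y = fderiv ℝ (fderiv ℝ f) z Y X := by
  have h : HasFDerivAt (fun y => fderiv ℝ f y X)
    ((ContinuousLinearMap.apply ℝ F X).comp (fderiv ℝ (fderiv ℝ f) z)) z :=
    ((ContinuousLinearMap.apply ℝ F X).hasFDerivAt).comp z hf.hasFDerivAt
  rw [h.fderiv]; rfl

lemma ContDiffAt.differentiableAt_fderiv {F : Type*} [NormedAddCommGroup F] [NormedSpace ℝ F]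
    {f : Pt n → F} (hf : ContDiffAt ℝ 2 f z) : DifferentiableAt ℝ (fderiv ℝ f) z :=
  (hf.fderiv_right (m := 1) (by norm_num)).differentiableAt (by norm_num)

lemma ContDiffAt.fderiv_comm {F : Type*} [NormedAddCommGroup F] [NormedSpace ℝ F]
    {f : Pt n → F} (hf : ContDiffAt ℝ 2 f z) (X Y : Pt n) :
    fderiv ℝ (fun y => fderiv ℝ f y X) z Y = fderiv ℝ (fun y => fderiv ℝ f y Y) z X := by
  rw [fderiv_fderiv_apply hf.differentiableAt_fderiv, fderiv_fderiv_apply hf.differentiableAt_fderiv]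
  exact (hf.isSymmSndFDerivAt (by simp)) Y X

lemma fderiv_pW_apply (hf : ContDiffAt ℝ 2 f z) : fderiv ℝ (pW f X) z Y = (1 / 2 : ℂ) *
    (fderiv ℝ (fun y => fderiv ℝ f y X) z Y - I * fderiv ℝ (fun y => fderiv ℝ f y (I • X)) z Y) := by
  have h1 := ((hf.fderiv_apply_const (m := 1) (by norm_num) X).differentiableAt (by norm_num))
  have h2 := ((hf.fderiv_apply_const (m := 1) (by norm_num) (I • X)).differentiableAt (by norm_num))
  have := ((h1.hasFDerivAt.sub (h2.hasFDerivAt.const_mul I)).const_mul (1 / 2 : ℂ)).fderiv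
  have h3 : pW f X = fun y => (1 / 2 : ℂ) * (fderiv ℝ f y X - I * fderiv ℝ f y (I • X)) := rfl
  rw [h3]
  erw [this]
  simp

lemma fderiv_pB_apply (hf : ContDiffAt ℝ 2 f z) : fderiv ℝ (pB f X) z Y = (1 / 2 : ℂ) *
    (fderiv ℝ (fun y => fderiv ℝ f y X) z Y + I * fderiv ℝ (fun y => fderiv ℝ f y (I • X)) z Y) := by
  have h1 := ((hf.fderiv_apply_const (m := 1) (by norm_num) X).differentiableAt (by norm_num))
  have h2 := ((hf.fderiv_apply_const (m := 1) (by norm_num) (I • X)).differentiableAt (by norm_num))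
  have := ((h1.hasFDerivAt.add (h2.hasFDerivAt.const_mul I)).const_mul (1 / 2 : ℂ)).fderiv
  have h3 : pB f X = fun y => (1 / 2 : ℂ) * (fderiv ℝ f y X + I * fderiv ℝ f y (I • X)) := rfl
  rw [h3]
  erw [this]
  simp [mul_add]

lemma pW_pW_comm (hf : ContDiffAt ℝ 2 f z) (X Y : Pt n) :
    pW (pW f X) Y z = pW (pW f Y) X z := by
  rw [pW, pW, fderiv_pW_apply hf, fderiv_pW_apply hf, fderiv_pW_apply hf, fderiv_pW_apply hf,
    hf.fderiv_comm Y X, hf.fderiv_comm Y (I • X), hf.fderiv_comm (I • Y) X,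
    hf.fderiv_comm (I • Y) (I • X)]
  ring

lemma pW_pB_comm (hf : ContDiffAt ℝ 2 f z) (X Y : Pt n) :
    pW (pB f X) Y z = pB (pW f Y) X z := by
  rw [pW, pB, fderiv_pW_apply hf, fderiv_pW_apply hf, fderiv_pB_apply hf, fderiv_pB_apply hf,
    hf.fderiv_comm Y X, hf.fderiv_comm Y (I • X), hf.fderiv_comm (I • Y) X,
    hf.fderiv_comm (I • Y) (I • X)]
  ring

lemma pB_pB_comm (hf : ContDiffAt ℝ 2 f z) (X Y : Pt n) :
    pB (pB f X) Y z = pB (pB f Y) X z := by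
  rw [pB, pB, fderiv_pB_apply hf, fderiv_pB_apply hf, fderiv_pB_apply hf, fderiv_pB_apply hf,
    hf.fderiv_comm Y X, hf.fderiv_comm Y (I • X), hf.fderiv_comm (I • Y) X,
    hf.fderiv_comm (I • Y) (I • X)]
  ring

end wirtinger

section real_functions

variable {n : ℕ} {r : Pt n → ℝ} {z p L X Y : Pt n}

lemma ContDiffAt.cR {k : WithTop ℕ∞} (h : ContDiffAt ℝ k r z) : ContDiffAt ℝ k (cR n r) z :=
  (ofRealCLM.contDiff (n := k)).contDiffAt.comp z h

lemma differentiableAt_cR : DifferentiableAt ℝ (cR n r) z ↔ DifferentiableAt ℝ r z := by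
  constructor
  · intro h
    exact (reCLM.differentiableAt (x := cR n r z)).comp z h
  · intro h
    exact (ofRealCLM.differentiableAt (x := r z)).comp z h

lemma fderiv_cR_apply (r : Pt n → ℝ) (z X : Pt n) : fderiv ℝ (cR n r) z X = (fderiv ℝ r z X : ℂ) := by
  by_cases h : DifferentiableAt ℝ r z
  · have := ((ofRealCLM.hasFDerivAt (x := r z)).comp z h.hasFDerivAt).fderiv
    have h2 : cR n r = ofRealCLM ∘ r := rfl
    rw [h2, this]; simp
  · rw [fderiv_zero_of_not_differentiableAt h,
      fderiv_zero_of_not_differentiableAt (mt differentiableAt_cR.1 h)]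
    simp

lemma pW_cR (r : Pt n → ℝ) (X z : Pt n) :
    pW (cR n r) X z = (1 / 2 : ℂ) * (fderiv ℝ r z X - I * fderiv ℝ r z (I • X)) := by
  simp only [pW, fderiv_cR_apply]

lemma pB_cR (r : Pt n → ℝ) (X z : Pt n) :
    pB (cR n r) X z = (1 / 2 : ℂ) * (fderiv ℝ r z X + I * fderiv ℝ r z (I • X)) := by
  simp only [pB, fderiv_cR_apply]

lemma conj_pW_cR (r : Pt n → ℝ) (X z : Pt n) :
    (starRingEnd ℂ) (pW (cR n r) X z) = pB (cR n r) X z := by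
  simp only [pB_cR, pW_cR, map_mul, map_sub, conj_I, map_div₀, map_one, map_ofNat, conj_ofReal]
  ring

lemma two_mul_re_pW_cR (r : Pt n → ℝ) (X z : Pt n) : 2 * (pW (cR n r) X z).re = fderiv ℝ r z X := by
  rw [pW_cR]; simp

lemma normSq_pW_cR (r : Pt n → ℝ) (X z : Pt n) :
    normSq (pW (cR n r) X z) = (1 / 4) * ((fderiv ℝ r z X) ^ 2 + (fderiv ℝ r z (I • X)) ^ 2) := by
  rw [pW_cR, normSq_apply]; simp; ring

lemma levi_eq (h : ContDiffAt ℝ 2 r z) (X Y : Pt n) :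
    levi n r z X Y = pW (pB (cR n r) Y) X z := by
  have h1 : pB (cR n r) Y = fun y => ∑ k, (starRingEnd ℂ) (Y k) * dZb n (cR n r) k y := by
    funext y; exact pB_eq_sum _ _ _
  have hd : ∀ k, DifferentiableAt ℝ (dZb n (cR n r) k) z := by
    intro k
    have : dZb n (cR n r) k = pB (cR n r) (Pi.single k 1) := by
      funext y; exact dZb_eq_pB _ _ _
    rw [this]
    exact (h.cR.pB_right (m := 1) (by norm_num) _).differentiableAt (by norm_num)
  rw [h1, pW_sum _ (fun k _ => (hd k).const_mul _), levi, Finset.sum_comm]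
  refine Finset.sum_congr rfl fun k _ => ?_
  rw [pW_const_mul _ (hd k), pW_eq_sum, Finset.mul_sum]
  refine Finset.sum_congr rfl fun j _ => ?_
  ring

lemma fderiv_fderiv_cR (r : Pt n → ℝ) (z X Y : Pt n) :
    fderiv ℝ (fun y => fderiv ℝ (cR n r) y X) z Y = (fderiv ℝ (fun y => fderiv ℝ r y X) z Y : ℂ) := by
  have : (fun y => fderiv ℝ (cR n r) y X) = cR n (fun y => fderiv ℝ r y X) := by
    funext y; exact fderiv_cR_apply _ _ _
  rw [this, fderiv_cR_apply]

lemma pW_pB_cR_self (h : ContDiffAt ℝ 2 r z) (X : Pt n) :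
    pW (pB (cR n r) X) X z = (hs r X z : ℂ) := by
  rw [pW, fderiv_pB_apply h.cR, fderiv_pB_apply h.cR, fderiv_fderiv_cR, fderiv_fderiv_cR,
    fderiv_fderiv_cR, fderiv_fderiv_cR, h.fderiv_comm X (I • X), hs]
  push_cast
  linear_combination (-(1/4 : ℂ)) * (fderiv ℝ (fun y => fderiv ℝ r y (I • X)) z (I • X)) * I_mul_I

lemma levi_self_eq_hs (h : ContDiffAt ℝ 2 r z) (X : Pt n) : levi n r z X X = (hs r X z : ℂ) := by
  rw [levi_eq h, pW_pB_cR_self h]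

lemma pB_pW_cR_eq_conj (h : ContDiffAt ℝ 2 r z) (X Y : Pt n) :
    pB (pW (cR n r) X) Y z = (starRingEnd ℂ) (pW (pB (cR n r) X) Y z) := by
  rw [← pB_conj ((h.cR.pB_right (m := 1) (by norm_num) _).differentiableAt (by norm_num))]
  simp only [← conj_pW_cR, conj_conj]

lemma levi_conj (h : ContDiffAt ℝ 2 r z) (X Y : Pt n) :
    (starRingEnd ℂ) (levi n r z X Y) = levi n r z Y X := by
  rw [levi_eq h, levi_eq h, ← pB_pW_cR_eq_conj h, ← pW_pB_comm h.cR]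

lemma mem_T10_iff : X ∈ T10 n r p ↔ pW (cR n r) X p = 0 := by
  rw [pW_eq_sum]; rfl

lemma levi_add_right (r : Pt n → ℝ) (z X Y Z : Pt n) :
    levi n r z X (Y + Z) = levi n r z X Y + levi n r z X Z := by
  simp only [levi, Pi.add_apply, map_add, mul_add, Finset.sum_add_distrib]

lemma levi_add_left (r : Pt n → ℝ) (z X Y Z : Pt n) :
    levi n r z (X + Y) Z = levi n r z X Z + levi n r z Y Z := by
  simp only [levi, Pi.add_apply, mul_add, add_mul, Finset.sum_add_distrib]

lemma levi_smul_right (r : Pt n → ℝ) (z X Y : Pt n) (a : ℂ) :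
    levi n r z X (a • Y) = (starRingEnd ℂ) a * levi n r z X Y := by
  simp only [levi, Pi.smul_apply, smul_eq_mul, map_mul, Finset.mul_sum]
  refine Finset.sum_congr rfl fun j _ => Finset.sum_congr rfl fun k _ => by ring

lemma levi_smul_left (r : Pt n → ℝ) (z X Y : Pt n) (a : ℂ) :
    levi n r z (a • X) Y = a * levi n r z X Y := by
  simp only [levi, Pi.smul_apply, smul_eq_mul, Finset.mul_sum]
  refine Finset.sum_congr rfl fun j _ => Finset.sum_congr rfl fun k _ => by ring

lemma gradSq_eq_zero_iff : gradSq n r z = 0 ↔ fderiv ℝ r z = 0 := by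
  constructor
  · intro h
    rw [gradSq, Finset.sum_eq_zero_iff_of_nonneg (fun _ _ => normSq_nonneg _)] at h
    ext X
    rw [← two_mul_re_pW_cR, pW_eq_sum, Finset.sum_eq_zero]
    · simp
    · intro j hj
      rw [normSq_eq_zero.1 (h j hj), mul_zero]
  · intro h
    rw [gradSq, Finset.sum_eq_zero]
    intro j _
    rw [dZ_eq_pW, pW_cR, h]; simp

end real_functions

/-- The `(1,0)`-vector `L_n` at a point. -/
noncomputable def nrm {n : ℕ} (r : Pt n → ℝ) (p : Pt n) : Pt n :=
  fun m => dZb n (cR n r) m p / (gradSq n r p : ℂ)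

/-- The Levi form of `L` against the normal vector. -/
noncomputable def wv {n : ℕ} (r : Pt n → ℝ) (p L : Pt n) : ℂ := pW (pB (cR n r) (nrm r p)) L p

/-- The symmetric second derivative of `r` along `L` and the normal vector. -/
noncomputable def sv {n : ℕ} (r : Pt n → ℝ) (p L : Pt n) : ℂ := pW (pW (cR n r) (nrm r p)) L p

/-- The negative of `∂̄ω` on a null vector `L`, up to conjugation. -/
noncomputable def kc {n : ℕ} (r : Pt n → ℝ) (p L : Pt n) : ℂ :=
  pW (pW (pB (cR n r) L) L) (nrm r p) p - (starRingEnd ℂ) (wv r p L) * sv r p L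

section dangelo

variable {n : ℕ} {r : Pt n → ℝ} {z p L X Y : Pt n}

lemma gradSq_eq_sum (r : Pt n → ℝ) (z : Pt n) :
    (gradSq n r z : ℂ) = ∑ j, dZ n (cR n r) j z * dZb n (cR n r) j z := by
  rw [gradSq]; push_cast
  refine Finset.sum_congr rfl fun j _ => ?_
  rw [dZb_eq_pB, ← conj_pW_cR, ← dZ_eq_pW, mul_conj]

lemma pW_nrm (h : gradSq n r p ≠ 0) : pW (cR n r) (nrm r p) p = 1 := by
  have h' : (gradSq n r p : ℂ) ≠ 0 := by exact_mod_cast h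
  rw [pW_eq_sum, ← div_self h']
  conv_rhs => lhs; rw [gradSq_eq_sum]
  rw [Finset.sum_div]
  refine Finset.sum_congr rfl fun j _ => ?_
  rw [nrm]; ring

lemma VF.app_eq_pW_sub_pB (r : Pt n → ℝ) (g : Pt n → ℂ) (z : Pt n) :
    (TVF n r).app g z = pW g (nrm r z) z - pB g (nrm r z) z := by
  rw [pW_eq_sum, pB_eq_sum, VF.app, sub_eq_add_neg, ← Finset.sum_neg_distrib]
  congr 1
  refine Finset.sum_congr rfl fun j _ => ?_
  simp only [TVF, neg_mul]; rfl

lemma dZ_fun (f : Pt n → ℂ) (j : Fin n) : dZ n f j = pW f (Pi.single j 1) := by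
  funext y; exact dZ_eq_pW _ _ _

lemma dZb_fun (f : Pt n → ℂ) (j : Fin n) : dZb n f j = pB f (Pi.single j 1) := by
  funext y; exact dZb_eq_pB _ _ _

lemma contDiffAt_gradSq {k m : WithTop ℕ∞} (h : ContDiffAt ℝ k r z) (hm : m + 1 ≤ k) :
    ContDiffAt ℝ m (fun y => (gradSq n r y : ℂ)) z := by
  simp only [gradSq_eq_sum, dZ_fun, dZb_fun]
  exact ContDiffAt.sum fun j _ => (h.cR.pW_right hm _).mul (h.cR.pB_right hm _)

lemma contDiffAt_nrm_apply {k m : WithTop ℕ∞} (h : ContDiffAt ℝ k r z) (hm : m + 1 ≤ k)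
    (hg : gradSq n r z ≠ 0) (j : Fin n) : ContDiffAt ℝ m (fun y => nrm r y j) z := by
  simp only [nrm, dZb_fun]
  simp only [div_eq_mul_inv]
  exact (h.cR.pB_right hm _).mul ((contDiffAt_gradSq h hm).inv (by exact_mod_cast hg))

lemma contDiffAt_nrm {k m : WithTop ℕ∞} (h : ContDiffAt ℝ k r z) (hm : m + 1 ≤ k)
    (hg : gradSq n r z ≠ 0) : ContDiffAt ℝ m (nrm r) z :=
  contDiffAt_pi.2 fun j => contDiffAt_nrm_apply h hm hg j

lemma eventually_gradSq_ne_zero (h : ContDiffAt ℝ 1 r z) (hg : gradSq n r z ≠ 0) :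
    ∀ᶠ y in 𝓝 z, gradSq n r y ≠ 0 := by
  have : ContinuousAt (fun y => (gradSq n r y : ℂ)) z :=
    (contDiffAt_gradSq (m := 0) h (by norm_num)).continuousAt
  have h0 : (gradSq n r z : ℂ) ≠ 0 := by exact_mod_cast hg
  filter_upwards [this.eventually_ne h0] with y hy
  exact_mod_cast hy

lemma sum_pW_nrm (h : gradSq n r z ≠ 0) :
    ∑ m, pW (cR n r) (Pi.single m 1) z * nrm r z m = 1 := by
  refine Eq.trans ?_ (pW_nrm h)
  rw [pW_eq_sum]
  refine Finset.sum_congr rfl fun j _ => ?_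
  rw [dZ_eq_pW, mul_comm]

lemma sum_mul_pW_pB (h : ContDiffAt ℝ 2 r z) (X Y : Pt n) :
    ∑ m, (starRingEnd ℂ) (Y m) * pW (pB (cR n r) (Pi.single m 1)) X z =
      pW (pB (cR n r) Y) X z := by
  have h1 : pB (cR n r) Y = fun y => ∑ k, (starRingEnd ℂ) (Y k) * pB (cR n r) (Pi.single k 1) y := by
    funext y; rw [pB_eq_sum]; simp only [dZb_eq_pB]
  have hd : ∀ k : Fin n, DifferentiableAt ℝ (pB (cR n r) (Pi.single k 1)) z := fun k =>
    (h.cR.pB_right (m := 1) (by norm_num) _).differentiableAt (by norm_num)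
  rw [h1, pW_sum _ (fun k _ => (hd k).const_mul _)]
  refine Finset.sum_congr rfl fun k _ => ?_
  rw [pW_const_mul _ (hd k)]

lemma sum_mul_pW_pW (h : ContDiffAt ℝ 2 r z) (X Y : Pt n) :
    ∑ m, Y m * pW (pW (cR n r) (Pi.single m 1)) X z = pW (pW (cR n r) Y) X z := by
  have h1 : pW (cR n r) Y = fun y => ∑ k, Y k * pW (cR n r) (Pi.single k 1) y := by
    funext y; rw [pW_eq_sum]; simp only [dZ_eq_pW]
  have hd : ∀ k : Fin n, DifferentiableAt ℝ (pW (cR n r) (Pi.single k 1)) z := fun k =>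
    (h.cR.pW_right (m := 1) (by norm_num) _).differentiableAt (by norm_num)
  rw [h1, pW_sum _ (fun k _ => (hd k).const_mul _)]
  refine Finset.sum_congr rfl fun k _ => ?_
  rw [pW_const_mul _ (hd k)]

/-- Differentiating `∂r(N) = 1`. -/
lemma sum_pW_mul_pW_nrm (h : ContDiffAt ℝ 2 r z) (hg : gradSq n r z ≠ 0) (X : Pt n) :
    ∑ m, pW (cR n r) (Pi.single m 1) z * pW (fun y => nrm r y m) X z =
      -pW (pW (cR n r) (nrm r z)) X z := by
  have hev : (fun y => ∑ m, pW (cR n r) (Pi.single m 1) y * nrm r y m) =ᶠ[𝓝 z] fun _ => 1 := by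
    filter_upwards [eventually_gradSq_ne_zero (h.of_le (by norm_num)) hg] with y hy
    exact sum_pW_nrm hy
  have h0 := pW_congr (X := X) hev
  have hd : ∀ k : Fin n, DifferentiableAt ℝ (pW (cR n r) (Pi.single k 1)) z := fun k =>
    (h.cR.pW_right (m := 1) (by norm_num) _).differentiableAt (by norm_num)
  have hN : ∀ k : Fin n, DifferentiableAt ℝ (fun y => nrm r y k) z := fun k =>
    (contDiffAt_nrm_apply (m := 1) h (by norm_num) hg k).differentiableAt (by norm_num)
  rw [pW_const, pW_sum _ (fun k _ => (hd k).fun_mul (hN k))] at h0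
  rw [← sum_mul_pW_pW h]
  simp only [pW_mul (hd _) (hN _), Finset.sum_add_distrib] at h0
  linear_combination h0

lemma sum_pB_mul_pW_conj_nrm (h : ContDiffAt ℝ 2 r z) (hg : gradSq n r z ≠ 0) (X : Pt n) :
    ∑ m, pB (cR n r) (Pi.single m 1) z * pW (fun y => (starRingEnd ℂ) (nrm r y m)) X z =
      -pW (pB (cR n r) (nrm r z)) X z := by
  have hev : (fun y => ∑ m, pB (cR n r) (Pi.single m 1) y * (starRingEnd ℂ) (nrm r y m))
      =ᶠ[𝓝 z] fun _ => 1 := by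
    filter_upwards [eventually_gradSq_ne_zero (h.of_le (by norm_num)) hg] with y hy
    have := congrArg (starRingEnd ℂ) (sum_pW_nrm hy)
    simpa only [map_sum, map_mul, conj_pW_cR, map_one] using this
  have h0 := pW_congr (X := X) hev
  have hd : ∀ k : Fin n, DifferentiableAt ℝ (pB (cR n r) (Pi.single k 1)) z := fun k =>
    (h.cR.pB_right (m := 1) (by norm_num) _).differentiableAt (by norm_num)
  have hN : ∀ k : Fin n, DifferentiableAt ℝ (fun y => (starRingEnd ℂ) (nrm r y k)) z := fun k =>
    (conjCLE : ℂ →L[ℝ] ℂ).differentiableAt.comp z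
    ((contDiffAt_nrm_apply (m := 1) h (by norm_num) hg k).differentiableAt (by norm_num))
  rw [pW_const, pW_sum _ (fun k _ => (hd k).fun_mul (hN k))] at h0
  rw [← sum_mul_pW_pB h]
  simp only [pW_mul (hd _) (hN _), Finset.sum_add_distrib] at h0
  linear_combination h0

lemma dAngelo_w (h : ContDiffAt ℝ 2 r z) (hg : gradSq n r z ≠ 0) (j : Fin n) :
    (dAngelo n r).w z j = pW (pB (cR n r) (nrm r z)) (Pi.single j 1) z := by
  have hd : ∀ k : Fin n, DifferentiableAt ℝ (pW (cR n r) (Pi.single k 1)) z := fun k =>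
    (h.cR.pW_right (m := 1) (by norm_num) _).differentiableAt (by norm_num)
  have hN : ∀ k : Fin n, DifferentiableAt ℝ (fun y => (starRingEnd ℂ) (nrm r y k)) z := fun k =>
    (conjCLE : ℂ →L[ℝ] ℂ).differentiableAt.comp z
    ((contDiffAt_nrm_apply (m := 1) h (by norm_num) hg k).differentiableAt (by norm_num))
  have e1 : (TVF n r).app (fun y => (1 / 2 : ℂ) * pW (cR n r) (Pi.single j 1) y) z =
      (1 / 2 : ℂ) * (pW (pW (cR n r) (nrm r z)) (Pi.single j 1) z -
        pW (pB (cR n r) (nrm r z)) (Pi.single j 1) z) := by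
    rw [VF.app_eq_pW_sub_pB, pW_const_mul _ (hd j), pB_const_mul _ (hd j), pW_pW_comm h.cR,
      ← pW_pB_comm h.cR]
    ring
  have e2 := sum_pW_mul_pW_nrm h hg (Pi.single j 1)
  have e3 := sum_pB_mul_pW_conj_nrm h hg (Pi.single j 1)
  simp only [dAngelo, Form1.neg, lieD, etaF, dZ_fun, dZb_fun]
  rw [e1]
  have e4 : ∑ m, 1 / 2 * pW (cR n r) (Pi.single m 1) z *
      pW (fun w => (TVF n r).a w m) (Pi.single j 1) z =
      (1 / 2 : ℂ) * -pW (pW (cR n r) (nrm r z)) (Pi.single j 1) z := by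
    rw [← e2, Finset.mul_sum]
    refine Finset.sum_congr rfl fun m _ => ?_
    rw [mul_assoc]; rfl
  have e5 : ∑ m, -(1 / 2) * pB (cR n r) (Pi.single m 1) z *
      pW (fun w => (TVF n r).b w m) (Pi.single j 1) z =
      (1 / 2 : ℂ) * -pW (pB (cR n r) (nrm r z)) (Pi.single j 1) z := by
    rw [← e3, Finset.mul_sum]
    refine Finset.sum_congr rfl fun m _ => ?_
    have : (fun w => (TVF n r).b w m) = fun y => (-1 : ℂ) * (starRingEnd ℂ) (nrm r y m) := by
      funext y; simp only [TVF, neg_mul, one_mul]; rfl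
    rw [this, pW_const_mul _ (hN m)]
    ring
  rw [e4, e5]
  ring

lemma sum_dAngelo_w (h : ContDiffAt ℝ 2 r z) (hg : gradSq n r z ≠ 0) (L : Pt n) :
    ∑ j, (dAngelo n r).w z j * L j = wv r z L := by
  rw [wv, pW_eq_sum]
  refine Finset.sum_congr rfl fun j _ => ?_
  rw [dAngelo_w h hg, dZ_eq_pW, mul_comm]

lemma omegaWedge_dAngelo (h : ContDiffAt ℝ 2 r z) (hg : gradSq n r z ≠ 0) (L : Pt n) :
    omegaWedge (dAngelo n r) (L, 0) (0, conjVec L) z = (normSq (wv r z L) : ℂ) := by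
  have := sum_dAngelo_w h hg L
  have h2 := congrArg (starRingEnd ℂ) this
  rw [map_sum] at h2
  simp only [map_mul] at h2
  simp only [omegaWedge, conjVec, Pi.zero_apply, mul_zero, Finset.sum_const_zero, sub_zero]
  rw [this, h2, mul_conj]

lemma kc_dAngelo (h : ContDiffAt ℝ 3 r z) (hg : gradSq n r z ≠ 0) (hL : L ∈ nullSp n r z) :
    delbOmega (dAngelo n r) (L, 0) (0, conjVec L) z = -(starRingEnd ℂ) (kc r z L) := by
  have h2 : ContDiffAt ℝ 2 r z := h.of_le (by norm_num)
  have hevg := eventually_gradSq_ne_zero (h.of_le (by norm_num)) hg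
  have hevC : ∀ᶠ y in 𝓝 z, ContDiffAt ℝ 3 r y := h.eventually (by simp)
  have hpp : ∀ m : Fin n, ContDiffAt ℝ 1 (pW (pB (cR n r) (Pi.single m 1)) L) z := fun m =>
    (h.cR.pB_right (m := 2) (by norm_num) _).pW_right (by norm_num) _
  have hNc : ∀ k : Fin n, DifferentiableAt ℝ (fun y => nrm r y k) z := fun k =>
    ((contDiffAt_nrm_apply (m := 2) h (by norm_num) hg k).differentiableAt (by norm_num))
  have hN : ∀ k : Fin n, DifferentiableAt ℝ (fun y => (starRingEnd ℂ) (nrm r y k)) z := fun k =>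
    (conjCLE : ℂ →L[ℝ] ℂ).differentiableAt.comp z (hNc k)
  have hw : ∀ l, (fun y => (dAngelo n r).w y l) =ᶠ[𝓝 z]
      fun y => ∑ m, (starRingEnd ℂ) (nrm r y m) *
        pW (pB (cR n r) (Pi.single m 1)) (Pi.single l 1) y := by
    intro l
    filter_upwards [hevg, hevC] with y hy hy'
    rw [dAngelo_w (hy'.of_le (by norm_num)) hy, sum_mul_pW_pB (hy'.of_le (by norm_num))]
  have hwd : ∀ l, DifferentiableAt ℝ (fun y => (dAngelo n r).w y l) z := by
    intro l
    refine DifferentiableAt.congr_of_eventuallyEq ?_ (hw l)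
    refine DifferentiableAt.fun_sum fun m _ => (hN m).mul ?_
    exact ((h.cR.pB_right (m := 2) (by norm_num) _).pW_right (m := 1) (by norm_num) _).differentiableAt
      (by norm_num)
  have hW : (fun y => ∑ l, (dAngelo n r).w y l * L l) =ᶠ[𝓝 z]
      fun y => ∑ m, (starRingEnd ℂ) (nrm r y m) * pW (pB (cR n r) (Pi.single m 1)) L y := by
    filter_upwards [hevg, hevC] with y hy hy'
    rw [sum_dAngelo_w (hy'.of_le (by norm_num)) hy, sum_mul_pW_pB (hy'.of_le (by norm_num))]; rfl
  have e1 : delbOmega (dAngelo n r) (L, 0) (0, conjVec L) z =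
      -pB (fun y => ∑ l, (dAngelo n r).w y l * L l) L z := by
    rw [pB_eq_sum]
    simp only [delbOmega, delbEval, conjVec, Pi.zero_apply, zero_mul, zero_sub, mul_zero, sub_zero,
      Finset.sum_const_zero, add_zero, dZb_fun]
    rw [← Finset.sum_neg_distrib]
    refine Finset.sum_congr rfl fun m _ => ?_
    have : pB (fun y => ∑ l, (dAngelo n r).w y l * L l) (Pi.single m 1) z =
        ∑ l, pB (fun y => (dAngelo n r).w y l) (Pi.single m 1) z * L l := by
      rw [pB_sum _ (fun l _ => (hwd l).mul_const _)]
      refine Finset.sum_congr rfl fun l _ => ?_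
      simp only [mul_comm _ (L l)]
      rw [pB_const_mul _ (hwd l)]
    rw [this, Finset.mul_sum, ← Finset.sum_neg_distrib]
    refine Finset.sum_congr rfl fun l _ => ?_
    ring
  rw [e1, pB_congr hW, pB_sum _ (fun m _ => (hN m).fun_mul ((hpp m).differentiableAt (by norm_num)))]
  simp only [pB_mul (hN _) ((hpp _).differentiableAt (by norm_num)), Finset.sum_add_distrib]
  have e2 : ∑ m, (starRingEnd ℂ) (nrm r z m) * pB (pW (pB (cR n r) (Pi.single m 1)) L) L z =
      (starRingEnd ℂ) (pW (pW (pB (cR n r) L) L) (nrm r z) z) := by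
    have a1 : pW (pB (cR n r) L) L =ᶠ[𝓝 z] fun y => (starRingEnd ℂ) (pW (pB (cR n r) L) L y) := by
      filter_upwards [hevC] with y hy
      rw [pW_pB_cR_self (hy.of_le (by norm_num)), conj_ofReal]
    have hdl : DifferentiableAt ℝ (pW (pB (cR n r) L) L) z :=
      ((h.cR.pB_right (m := 2) (by norm_num) _).pW_right (m := 1) (by norm_num) _).differentiableAt
      (by norm_num)
    rw [← pB_conj hdl, ← pB_congr a1, pB_eq_sum]
    refine Finset.sum_congr rfl fun m _ => ?_
    rw [dZb_eq_pB]
    congr 1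
    have a2 : pW (pB (cR n r) (Pi.single m 1)) L =ᶠ[𝓝 z] pB (pW (cR n r) L) (Pi.single m 1) := by
      filter_upwards [hevC] with y hy
      rw [pW_pB_comm (hy.of_le (by norm_num) : ContDiffAt ℝ 2 r y).cR]
    have a3 : pW (pB (cR n r) L) L =ᶠ[𝓝 z] pB (pW (cR n r) L) L := by
      filter_upwards [hevC] with y hy
      rw [pW_pB_comm (hy.of_le (by norm_num) : ContDiffAt ℝ 2 r y).cR]
    rw [pB_congr a2, pB_congr a3, pB_pB_comm (h.cR.pW_right (m := 2) (by norm_num) _)]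
  have e3 : ∑ m, pW (pB (cR n r) (Pi.single m 1)) L z * pB (fun y => (starRingEnd ℂ) (nrm r y m)) L z
      = -((starRingEnd ℂ) (sv r z L) * wv r z L) := by
    set v : Pt n := fun m => pW (fun y => nrm r y m) L z with hv
    have b1 : ∑ m, pW (pB (cR n r) (Pi.single m 1)) L z *
        pB (fun y => (starRingEnd ℂ) (nrm r y m)) L z = levi n r z L v := by
      rw [levi_eq h2, ← sum_mul_pW_pB h2]
      refine Finset.sum_congr rfl fun m _ => ?_
      rw [pB_conj (hNc m), mul_comm]
    have b2 : pW (cR n r) v z = -sv r z L := by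
      rw [sv, ← sum_pW_mul_pW_nrm h2 hg, pW_eq_sum]
      refine Finset.sum_congr rfl fun m _ => ?_
      rw [dZ_eq_pW, mul_comm]
    have b3 : v + sv r z L • nrm r z ∈ T10 n r z := by
      rw [mem_T10_iff, pW_add_left, pW_smul_left, b2, pW_nrm hg]; ring
    have b4 := hL.2 _ b3
    rw [levi_add_right, levi_smul_right, levi_eq h2 L (nrm r z)] at b4
    rw [b1]
    change _ + _ * wv r z L = 0 at b4
    linear_combination b4
  rw [e2, e3, kc, map_sub, map_mul, conj_conj]
  ring

end dangelo

section chain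

variable {n : ℕ} {r f ψ : Pt n → ℝ} {z p L X Y : Pt n} {φ : ℝ → ℝ}

lemma fderiv_comp_real_apply (hf : DifferentiableAt ℝ f z) (hφ : DifferentiableAt ℝ φ (f z)) :
    fderiv ℝ (fun y => φ (f y)) z X = deriv φ (f z) * fderiv ℝ f z X := by
  have := (hφ.hasDerivAt.comp_hasFDerivAt z hf.hasFDerivAt).fderiv
  have h2 : (fun y => φ (f y)) = φ ∘ f := rfl
  rw [h2, this]; simp

lemma pW_comp_real (hf : DifferentiableAt ℝ f z) (hφ : DifferentiableAt ℝ φ (f z)) :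
    pW (cR n (fun y => φ (f y))) X z = deriv φ (f z) * pW (cR n f) X z := by
  rw [pW_cR, pW_cR, fderiv_comp_real_apply hf hφ, fderiv_comp_real_apply hf hφ]
  push_cast; ring

lemma hs_comp (hf : ContDiffAt ℝ 2 f z) (hφ : ContDiffAt ℝ 2 φ (f z)) :
    hs (fun y => φ (f y)) X z =
      deriv φ (f z) * hs f X z + deriv (deriv φ) (f z) * normSq (pW (cR n f) X z) := by
  have key : ∀ Y : Pt n, fderiv ℝ (fun y => fderiv ℝ (fun y => φ (f y)) y Y) z Y =
      deriv φ (f z) * fderiv ℝ (fun y => fderiv ℝ f y Y) z Y +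
      deriv (deriv φ) (f z) * (fderiv ℝ f z Y) ^ 2 := by
    intro Y
    have h1 : (fun y => fderiv ℝ (fun y => φ (f y)) y Y) =ᶠ[𝓝 z]
        fun y => deriv φ (f y) * fderiv ℝ f y Y := by
      filter_upwards [hf.eventually (by simp),
        hf.continuousAt.eventually (hφ.eventually (by simp))] with y hy hy'
      exact fderiv_comp_real_apply (hy.differentiableAt (by norm_num))
        (hy'.differentiableAt (by norm_num))
    have hd : DifferentiableAt ℝ (deriv φ) (f z) :=
      (((hφ.fderiv_right (m := 1) (by norm_num)).clm_apply
        (contDiffAt_const (c := (1 : ℝ)))).differentiableAt (by norm_num))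
    have hfz := hf.differentiableAt (by norm_num)
    have h2 := (hd.hasDerivAt.comp_hasFDerivAt z hfz.hasFDerivAt).mul
      ((hf.fderiv_apply_const (m := 1) (by norm_num) Y).differentiableAt (by norm_num)).hasFDerivAt
    rw [h1.fderiv_eq]
    have h3 : (fun y => deriv φ (f y) * fderiv ℝ f y Y) =
      (deriv φ ∘ f) * (fun y => fderiv ℝ f y Y) := rfl
    rw [h3, h2.fderiv]
    simp
    ring
  rw [hs, key, key, hs, normSq_pW_cR]
  ring

end chain

section transformation

variable {n : ℕ} {r ψ : Pt n → ℝ} {z p L X Y : Pt n}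

lemma cR_mul (r u : Pt n → ℝ) : cR n (fun y => r y * u y) = fun y => cR n r y * cR n u y := by
  funext y; simp [cR]

lemma contDiffAt_exp_comp {k : WithTop ℕ∞} (h : ContDiffAt ℝ k ψ z) :
    ContDiffAt ℝ k (fun y => Real.exp (ψ y)) z := Real.contDiff_exp.contDiffAt.comp z h

lemma pW_mul_of_eq_zero {u : Pt n → ℝ} (hr : DifferentiableAt ℝ r p) (hu : DifferentiableAt ℝ u p)
    (h0 : r p = 0) : pW (cR n (fun y => r y * u y)) X p = u p * pW (cR n r) X p := by
  rw [cR_mul, pW_mul (differentiableAt_cR.2 hr) (differentiableAt_cR.2 hu)]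
  simp [cR, h0]

lemma pB_mul_of_eq_zero {u : Pt n → ℝ} (hr : DifferentiableAt ℝ r p) (hu : DifferentiableAt ℝ u p)
    (h0 : r p = 0) : pB (cR n (fun y => r y * u y)) X p = u p * pB (cR n r) X p := by
  rw [cR_mul, pB_mul (differentiableAt_cR.2 hr) (differentiableAt_cR.2 hu)]
  simp [cR, h0]

lemma pW_cR_exp (hψ : DifferentiableAt ℝ ψ p) :
    pW (cR n (fun y => Real.exp (ψ y))) X p = Real.exp (ψ p) * pW (cR n ψ) X p := by
  rw [pW_comp_real hψ Real.differentiableAt_exp, Real.deriv_exp]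

lemma pB_cR_exp (hψ : DifferentiableAt ℝ ψ p) :
    pB (cR n (fun y => Real.exp (ψ y))) X p = Real.exp (ψ p) * pB (cR n ψ) X p := by
  rw [← conj_pW_cR, pW_cR_exp hψ, map_mul, conj_ofReal, conj_pW_cR]

lemma hs_exp (hψ : ContDiffAt ℝ 2 ψ p) :
    hs (fun y => Real.exp (ψ y)) X p = Real.exp (ψ p) * (hs ψ X p + normSq (pW (cR n ψ) X p)) := by
  rw [hs_comp hψ Real.contDiff_exp.contDiffAt]
  simp only [Real.deriv_exp]; ring

lemma mem_T10_mul_exp (hr : DifferentiableAt ℝ r p) (hψ : DifferentiableAt ℝ ψ p) (h0 : r p = 0) :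
    X ∈ T10 n (fun y => r y * Real.exp (ψ y)) p ↔ X ∈ T10 n r p := by
  rw [mem_T10_iff, mem_T10_iff, pW_mul_of_eq_zero hr hψ.exp h0, mul_eq_zero]
  simp

lemma gradSq_mul_exp (hr : DifferentiableAt ℝ r p) (hψ : DifferentiableAt ℝ ψ p) (h0 : r p = 0) :
    gradSq n (fun y => r y * Real.exp (ψ y)) p = Real.exp (ψ p) ^ 2 * gradSq n r p := by
  simp only [gradSq, dZ_eq_pW, pW_mul_of_eq_zero hr hψ.exp h0, normSq_mul, normSq_ofReal,
    Finset.mul_sum, sq]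

lemma nrm_mul_exp (hr : DifferentiableAt ℝ r p) (hψ : DifferentiableAt ℝ ψ p) (h0 : r p = 0) :
    nrm (fun y => r y * Real.exp (ψ y)) p = ((Real.exp (-ψ p) : ℝ) : ℂ) • nrm r p := by
  funext m
  simp only [nrm, dZb_eq_pB, pB_mul_of_eq_zero hr hψ.exp h0, gradSq_mul_exp hr hψ h0,
    Pi.smul_apply, smul_eq_mul, Real.exp_neg]
  have : (Real.exp (ψ p) : ℂ) ≠ 0 := by exact_mod_cast Real.exp_ne_zero _
  push_cast at this ⊢
  by_cases hg : (gradSq n r p : ℂ) = 0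
  · simp [hg]
  · field_simp

lemma pB_mul_eventually {u : Pt n → ℝ} (hr : ContDiffAt ℝ 1 r p) (hu : ContDiffAt ℝ 1 u p)
    (Y : Pt n) : pB (cR n (fun y => r y * u y)) Y =ᶠ[𝓝 p]
      fun y => cR n r y * pB (cR n u) Y y + cR n u y * pB (cR n r) Y y := by
  filter_upwards [hr.eventually (by simp), hu.eventually (by simp)] with y hy hy'
  rw [cR_mul, pB_mul (hy.cR.differentiableAt (by norm_num)) (hy'.cR.differentiableAt (by norm_num))]

lemma pW_mul_eventually {u : Pt n → ℝ} (hr : ContDiffAt ℝ 1 r p) (hu : ContDiffAt ℝ 1 u p)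
    (Y : Pt n) : pW (cR n (fun y => r y * u y)) Y =ᶠ[𝓝 p]
      fun y => cR n r y * pW (cR n u) Y y + cR n u y * pW (cR n r) Y y := by
  filter_upwards [hr.eventually (by simp), hu.eventually (by simp)] with y hy hy'
  rw [cR_mul, pW_mul (hy.cR.differentiableAt (by norm_num)) (hy'.cR.differentiableAt (by norm_num))]

lemma pW_pB_mul {u : Pt n → ℝ} (hr : ContDiffAt ℝ 2 r p) (hu : ContDiffAt ℝ 2 u p) (X Y : Pt n) :
    pW (pB (cR n (fun y => r y * u y)) Y) X p =
      cR n r p * pW (pB (cR n u) Y) X p + pB (cR n u) Y p * pW (cR n r) X p +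
      (cR n u p * pW (pB (cR n r) Y) X p + pB (cR n r) Y p * pW (cR n u) X p) := by
  have d1 := hr.cR.differentiableAt (by norm_num)
  have d2 := hu.cR.differentiableAt (by norm_num)
  have d3 := (hr.cR.pB_right (m := 1) (by norm_num) Y).differentiableAt (by norm_num)
  have d4 := (hu.cR.pB_right (m := 1) (by norm_num) Y).differentiableAt (by norm_num)
  rw [pW_congr (pB_mul_eventually (hr.of_le (by norm_num)) (hu.of_le (by norm_num)) Y),
    pW_add (d1.fun_mul d4) (d2.fun_mul d3), pW_mul d1 d4, pW_mul d2 d3]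

lemma pW_pW_mul {u : Pt n → ℝ} (hr : ContDiffAt ℝ 2 r p) (hu : ContDiffAt ℝ 2 u p) (X Y : Pt n) :
    pW (pW (cR n (fun y => r y * u y)) Y) X p =
      cR n r p * pW (pW (cR n u) Y) X p + pW (cR n u) Y p * pW (cR n r) X p +
      (cR n u p * pW (pW (cR n r) Y) X p + pW (cR n r) Y p * pW (cR n u) X p) := by
  have d1 := hr.cR.differentiableAt (by norm_num)
  have d2 := hu.cR.differentiableAt (by norm_num)
  have d3 := (hr.cR.pW_right (m := 1) (by norm_num) Y).differentiableAt (by norm_num)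
  have d4 := (hu.cR.pW_right (m := 1) (by norm_num) Y).differentiableAt (by norm_num)
  rw [pW_congr (pW_mul_eventually (hr.of_le (by norm_num)) (hu.of_le (by norm_num)) Y),
    pW_add (d1.fun_mul d4) (d2.fun_mul d3), pW_mul d1 d4, pW_mul d2 d3]

lemma levi_mul_exp (hr : ContDiffAt ℝ 2 r p) (hψ : ContDiffAt ℝ 2 ψ p) (h0 : r p = 0)
    (hX : X ∈ T10 n r p) (hY : Y ∈ T10 n r p) :
    levi n (fun y => r y * Real.exp (ψ y)) p X Y = Real.exp (ψ p) * levi n r p X Y := by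
  have hu := contDiffAt_exp_comp hψ
  rw [levi_eq (hr.mul hu), levi_eq hr, pW_pB_mul hr hu]
  rw [mem_T10_iff] at hX hY
  have hY' : pB (cR n r) Y p = 0 := by rw [← conj_pW_cR, hY, map_zero]
  rw [hX, hY']
  simp [cR, h0]

lemma nullSp_mul_exp (hr : ContDiffAt ℝ 2 r p) (hψ : ContDiffAt ℝ 2 ψ p) (h0 : r p = 0) :
    X ∈ nullSp n (fun y => r y * Real.exp (ψ y)) p ↔ X ∈ nullSp n r p := by
  have hr1 := hr.differentiableAt (by norm_num)
  have hψ1 := hψ.differentiableAt (by norm_num)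
  have he : (Real.exp (ψ p) : ℂ) ≠ 0 := by exact_mod_cast Real.exp_ne_zero _
  constructor
  · rintro ⟨h1, h2⟩
    have h1' := (mem_T10_mul_exp hr1 hψ1 h0).1 h1
    refine ⟨h1', fun Y hY => ?_⟩
    have := h2 Y ((mem_T10_mul_exp hr1 hψ1 h0).2 hY)
    rw [levi_mul_exp hr hψ h0 h1' hY] at this
    exact (mul_eq_zero.1 this).resolve_left he
  · rintro ⟨h1, h2⟩
    refine ⟨(mem_T10_mul_exp hr1 hψ1 h0).2 h1, fun Y hY => ?_⟩
    have hY' := (mem_T10_mul_exp hr1 hψ1 h0).1 hY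
    rw [levi_mul_exp hr hψ h0 h1 hY', h2 Y hY', mul_zero]

lemma wv_mul_exp (hr : ContDiffAt ℝ 2 r p) (hψ : ContDiffAt ℝ 2 ψ p) (h0 : r p = 0)
    (hg : gradSq n r p ≠ 0) (hL : L ∈ T10 n r p) :
    wv (fun y => r y * Real.exp (ψ y)) p L = wv r p L + pW (cR n ψ) L p := by
  have hr1 := hr.differentiableAt (by norm_num)
  have hψ1 := hψ.differentiableAt (by norm_num)
  have hu := contDiffAt_exp_comp hψ
  have he : (Real.exp (ψ p) : ℂ) ≠ 0 := by exact_mod_cast Real.exp_ne_zero _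
  rw [mem_T10_iff] at hL
  rw [wv, ← levi_eq (hr.mul hu), nrm_mul_exp hr1 hψ1 h0, levi_smul_right, levi_eq (hr.mul hu),
    pW_pB_mul hr hu, hL, pW_cR_exp hψ1, ← conj_pW_cR r, pW_nrm hg, conj_ofReal, Real.exp_neg, wv]
  have h1 : cR n r p = 0 := by simp [cR, h0]
  have h2 : cR n (fun y => Real.exp (ψ y)) p = (Real.exp (ψ p) : ℂ) := rfl
  rw [h1, h2, map_one]
  push_cast at he ⊢
  field_simp
  ring

lemma sv_mul_exp (hr : ContDiffAt ℝ 2 r p) (hψ : ContDiffAt ℝ 2 ψ p) (h0 : r p = 0)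
    (hg : gradSq n r p ≠ 0) (hL : L ∈ T10 n r p) :
    sv (fun y => r y * Real.exp (ψ y)) p L = sv r p L + pW (cR n ψ) L p := by
  have hr1 := hr.differentiableAt (by norm_num)
  have hψ1 := hψ.differentiableAt (by norm_num)
  have hu := contDiffAt_exp_comp hψ
  have he : (Real.exp (ψ p) : ℂ) ≠ 0 := by exact_mod_cast Real.exp_ne_zero _
  rw [mem_T10_iff] at hL
  rw [sv, nrm_mul_exp hr1 hψ1 h0, pW_pW_comm (hr.mul hu).cR, pW_smul_left,
    pW_pW_comm (hr.mul hu).cR,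
    pW_pW_mul hr hu, hL, pW_cR_exp hψ1 (X := L), pW_nrm hg, Real.exp_neg, sv]
  have h1 : cR n r p = 0 := by simp [cR, h0]
  have h2 : cR n (fun y => Real.exp (ψ y)) p = (Real.exp (ψ p) : ℂ) := rfl
  rw [h1, h2]
  push_cast at he ⊢
  field_simp
  ring

lemma kc_mul_exp (hr : ContDiffAt ℝ 3 r p) (hψ : ContDiffAt ℝ 3 ψ p) (h0 : r p = 0)
    (hg : gradSq n r p ≠ 0) (hL : L ∈ nullSp n r p) :
    kc (fun y => r y * Real.exp (ψ y)) p L = kc r p L + hs ψ L p := by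
  have hr2 : ContDiffAt ℝ 2 r p := hr.of_le (by norm_num)
  have hψ2 : ContDiffAt ℝ 2 ψ p := hψ.of_le (by norm_num)
  have hr1 := hr.differentiableAt (by norm_num)
  have hψ1 := hψ.differentiableAt (by norm_num)
  have hu := contDiffAt_exp_comp hψ
  have hu2 : ContDiffAt ℝ 2 (fun y => Real.exp (ψ y)) p := hu.of_le (by norm_num)
  have he : (Real.exp (ψ p) : ℂ) ≠ 0 := by exact_mod_cast Real.exp_ne_zero _
  set u : Pt n → ℝ := fun y => Real.exp (ψ y) with hudef
  have hL1 := hL.1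
  rw [mem_T10_iff] at hL1
  have hLb : pB (cR n r) L p = 0 := by rw [← conj_pW_cR, hL1, map_zero]
  have hLL : pW (pB (cR n r) L) L p = 0 := by rw [← levi_eq hr2, hL.2 L hL.1]
  have h1 : cR n r p = 0 := by simp [cR, h0]
  have h2 : cR n u p = (Real.exp (ψ p) : ℂ) := rfl
  have hcw : pW (pB (cR n r) L) (nrm r p) p = (starRingEnd ℂ) (wv r p L) := by
    rw [wv, ← levi_eq hr2, ← levi_eq hr2, levi_conj hr2]
  have hs' : pW (pW (cR n r) L) (nrm r p) p = sv r p L := by rw [sv, pW_pW_comm hr2.cR]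
  have third : pW (pW (pB (cR n (fun y => r y * u y)) L) L) (nrm r p) p =
      pW (pB (cR n u) L) L p + pB (cR n u) L p * sv r p L +
      (Real.exp (ψ p) * pW (pW (pB (cR n r) L) L) (nrm r p) p +
        pW (cR n u) L p * (starRingEnd ℂ) (wv r p L)) := by
    have hev : pW (pB (cR n (fun y => r y * u y)) L) L =ᶠ[𝓝 p] fun y =>
      cR n r y * pW (pB (cR n u) L) L y + pB (cR n u) L y * pW (cR n r) L y +
      (cR n u y * pW (pB (cR n r) L) L y + pB (cR n r) L y * pW (cR n u) L y) := by
      filter_upwards [hr.eventually (by simp), hu.eventually (by simp)] with y hy hy'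
      exact pW_pB_mul (hy.of_le (by norm_num)) (hy'.of_le (by norm_num)) _ _
    have d1 := hr.cR.differentiableAt (by norm_num)
    have d2 := hu.cR.differentiableAt (by norm_num)
    have e1 := (hr.cR.pW_right (m := 2) (by norm_num) L).differentiableAt (by norm_num)
    have e2 := (hu.cR.pW_right (m := 2) (by norm_num) L).differentiableAt (by norm_num)
    have e3 := (hr.cR.pB_right (m := 2) (by norm_num) L).differentiableAt (by norm_num)
    have e4 := (hu.cR.pB_right (m := 2) (by norm_num) L).differentiableAt (by norm_num)
    have g1 := ((hr.cR.pB_right (m := 2) (by norm_num) L).pW_right (m := 1) (by norm_num)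
      L).differentiableAt (by norm_num)
    have g2 := ((hu.cR.pB_right (m := 2) (by norm_num) L).pW_right (m := 1) (by norm_num)
      L).differentiableAt (by norm_num)
    rw [pW_congr hev, pW_add ((d1.fun_mul g2).fun_add (e4.fun_mul e1))
      ((d2.fun_mul g1).fun_add (e3.fun_mul e2)), pW_add (d1.fun_mul g2) (e4.fun_mul e1),
      pW_add (d2.fun_mul g1) (e3.fun_mul e2), pW_mul d1 g2, pW_mul e4 e1, pW_mul d2 g1,
      pW_mul e3 e2, h1, h2, hLL, hL1, hLb, pW_nrm hg, hcw, hs']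
    ring
  rw [kc, wv_mul_exp hr2 hψ2 h0 hg hL.1, sv_mul_exp hr2 hψ2 h0 hg hL.1,
    nrm_mul_exp hr1 hψ1 h0, pW_smul_left, third, pW_pB_cR_self hu2, hs_exp hψ2, pB_cR_exp hψ1,
    pW_cR_exp hψ1, kc, Real.exp_neg, map_add, conj_pW_cR]
  have hn : (normSq (pW (cR n ψ) L p) : ℂ) = pW (cR n ψ) L p * pB (cR n ψ) L p := by
    rw [← conj_pW_cR, mul_conj]
  push_cast at he ⊢
  rw [hn]
  field_simp
  ring

end transformation

section defining

variable {n : ℕ} {r : Pt n → ℝ} {Ω V : Set (Pt n)} {s : ℕ∞} {z p L X Y : Pt n}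

namespace IsDefining

lemma frontier_subset (h : IsDefining n s Ω r V) : frontier Ω ⊆ V :=
  frontier_subset_closure.trans h.2.1

lemma contDiffAt (h : IsDefining n s Ω r V) (hz : z ∈ V) : ContDiffAt ℝ s r z :=
  h.2.2.1.contDiffAt (h.1.mem_nhds hz)

lemma mem_iff (h : IsDefining n s Ω r V) : z ∈ Ω ↔ z ∈ V ∧ r z < 0 := by
  conv_lhs => rw [h.2.2.2.1]
  rfl

lemma neg_of_mem (h : IsDefining n s Ω r V) (hz : z ∈ Ω) : r z < 0 := (h.mem_iff.1 hz).2

lemma isOpen (h : IsDefining n s Ω r V) : IsOpen Ω := by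
  have : Ω = V ∩ r ⁻¹' Set.Iio 0 := by
    ext z; exact h.mem_iff
  rw [this]
  exact h.2.2.1.continuousOn.isOpen_inter_preimage h.1 isOpen_Iio

lemma nonpos_of_mem_closure (h : IsDefining n s Ω r V) (hz : z ∈ closure Ω) : r z ≤ 0 := by
  have hc : ContinuousWithinAt r Ω z := (h.contDiffAt (h.2.1 hz)).continuousAt.continuousWithinAt
  have hm := hc.mem_closure_image hz
  have : r '' Ω ⊆ Set.Iic 0 := by
    rintro _ ⟨y, hy, rfl⟩
    exact (h.neg_of_mem hy).le
  have h2 := closure_mono this hm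
  rwa [isClosed_Iic.closure_eq] at h2

lemma eq_zero (h : IsDefining n s Ω r V) (hz : z ∈ frontier Ω) : r z = 0 := by
  refine le_antisymm (h.nonpos_of_mem_closure (frontier_subset_closure hz)) ?_
  by_contra hlt
  push Not at hlt
  have : z ∈ Ω := h.mem_iff.2 ⟨h.frontier_subset hz, hlt⟩
  rw [h.isOpen.frontier_eq] at hz
  exact hz.2 this

lemma gradSq_ne_zero (h : IsDefining n s Ω r V) (hz : z ∈ frontier Ω) : gradSq n r z ≠ 0 :=
  fun h0 => h.2.2.2.2 z hz (gradSq_eq_zero_iff.1 h0)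

lemma mem_frontier_of_zero (h : IsDefining n s Ω r V) (hz : z ∈ V) (h0 : r z = 0)
    (hd : DifferentiableAt ℝ r z) (hr : fderiv ℝ r z ≠ 0) : z ∈ frontier Ω := by
  rw [h.isOpen.frontier_eq]
  refine ⟨?_, fun hm => (h.neg_of_mem hm).ne h0⟩
  obtain ⟨Y, hY⟩ : ∃ Y, fderiv ℝ r z Y < 0 := by
    by_contra hcon
    push Not at hcon
    apply hr
    ext Y
    refine le_antisymm ?_ (hcon Y)
    have := hcon (-Y)
    rw [map_neg] at this
    simpa using this
  have hder : HasDerivAt (fun t : ℝ => r (z + t • Y)) (fderiv ℝ r z Y) 0 := by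
    have h1 : HasDerivAt (fun t : ℝ => z + t • Y) Y 0 := by
      simpa using ((hasDerivAt_id (0 : ℝ)).smul_const Y).const_add z
    have h2 : HasFDerivAt r (fderiv ℝ r z) (z + (0 : ℝ) • Y) := by simpa using hd.hasFDerivAt
    exact h2.comp_hasDerivAt 0 h1
  have hneg : ∀ᶠ t in 𝓝[>] (0 : ℝ), r (z + t • Y) < 0 := by
    have h1 := (hasDerivAt_iff_tendsto_slope.1 hder).mono_left
      (nhdsWithin_mono 0 (fun x (hx : (0 : ℝ) < x) => (ne_of_gt hx : x ≠ 0)))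
    filter_upwards [h1.eventually (gt_mem_nhds hY), self_mem_nhdsWithin] with t ht ht0
    rw [slope_def_field] at ht
    simp only [zero_smul, add_zero, h0, sub_zero] at ht
    have ht0' : (0 : ℝ) < t := ht0
    rcases div_neg_iff.1 ht with h | h
    · linarith [h.2]
    · exact h.1
  have htend : Filter.Tendsto (fun t : ℝ => z + t • Y) (𝓝[>] 0) (𝓝 z) := by
    have : Filter.Tendsto (fun t : ℝ => z + t • Y) (𝓝 0) (𝓝 (z + (0 : ℝ) • Y)) :=
      (continuous_const.add (continuous_id.smul continuous_const)).tendsto 0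
    rw [zero_smul, add_zero] at this
    exact this.mono_left nhdsWithin_le_nhds
  refine mem_closure_of_tendsto htend ?_
  filter_upwards [hneg, htend.eventually (h.1.mem_nhds hz)] with t ht htV
  exact h.mem_iff.2 ⟨htV, ht⟩

lemma eventually_mem_frontier (h : IsDefining n s Ω r V) (hs1 : 1 ≤ s) (hp : p ∈ frontier Ω) :
    ∀ᶠ z in 𝓝 p, r z = 0 → z ∈ frontier Ω := by
  have h1 : ∀ᶠ z in 𝓝 p, fderiv ℝ r z ≠ 0 := by
    have hc : ContinuousAt (fderiv ℝ r) p :=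
      (((h.contDiffAt (h.frontier_subset hp)).of_le (show (1 : WithTop ℕ∞) ≤ s from WithTop.coe_le_coe.2 hs1)).fderiv_right
        (m := 0) (by norm_num)).continuousAt
    exact hc.eventually_ne (h.2.2.2.2 p hp)
  filter_upwards [h1, h.1.mem_nhds (h.frontier_subset hp)] with z hz hzV h0
  exact h.mem_frontier_of_zero hzV h0
    (((h.contDiffAt hzV).of_le (show (1 : WithTop ℕ∞) ≤ s from WithTop.coe_le_coe.2 hs1)).differentiableAt
      (by norm_num)) hz

end IsDefining

end defining

section leviphi

variable {n : ℕ} {r : Pt n → ℝ} {z p L X Y N : Pt n}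

/-- A quarter of the Laplacian along a line, from the second Fréchet derivative. -/
lemma hs_eq (h : ContDiffAt ℝ 2 r z) (X : Pt n) : hs r X z = (1 / 4 : ℝ) *
    (fderiv ℝ (fderiv ℝ r) z X X + fderiv ℝ (fderiv ℝ r) z (I • X) (I • X)) := by
  rw [hs, fderiv_fderiv_apply h.differentiableAt_fderiv,
    fderiv_fderiv_apply h.differentiableAt_fderiv]

lemma contDiffAt_hs_joint {m k : WithTop ℕ∞} (h : ContDiffAt ℝ k r p) (hm : m + 2 ≤ k)
    (X : Pt n) :
    ContDiffAt ℝ m (fun q : Pt n × Pt n => (1 / 4 : ℝ) *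
      (fderiv ℝ (fderiv ℝ r) q.1 q.2 q.2 + fderiv ℝ (fderiv ℝ r) q.1 (I • q.2) (I • q.2)))
      (p, X) := by
  have h1 : ContDiffAt ℝ (m + 1) (fderiv ℝ r) p := h.fderiv_right (by rwa [add_assoc, one_add_one_eq_two])
  have h2 : ContDiffAt ℝ m (fderiv ℝ (fderiv ℝ r)) p := h1.fderiv_right le_rfl
  have h3 : ContDiffAt ℝ m (fun q : Pt n × Pt n => fderiv ℝ (fderiv ℝ r) q.1) (p, X) :=
    ContDiffAt.comp (p, X) (g := fderiv ℝ (fderiv ℝ r)) h2 contDiffAt_fst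
  have h4 : ContDiffAt ℝ m (fun q : Pt n × Pt n => I • q.2) (p, X) :=
    contDiffAt_snd.const_smul I
  exact contDiffAt_const.mul (((h3.clm_apply contDiffAt_snd).clm_apply contDiffAt_snd).add
    ((h3.clm_apply h4).clm_apply h4))

lemma contDiffAt_pW_joint {m k : WithTop ℕ∞} (h : ContDiffAt ℝ k r p) (hm : m + 1 ≤ k) (X : Pt n) :
    ContDiffAt ℝ m (fun q : Pt n × Pt n => pW (cR n r) q.2 q.1) (p, X) := by
  have h2 : ContDiffAt ℝ m (fderiv ℝ (cR n r)) p := h.cR.fderiv_right hm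
  have h3 : ContDiffAt ℝ m (fun q : Pt n × Pt n => fderiv ℝ (cR n r) q.1) (p, X) :=
    ContDiffAt.comp (p, X) (g := fderiv ℝ (cR n r)) h2 contDiffAt_fst
  have h4 : ContDiffAt ℝ m (fun q : Pt n × Pt n => I • q.2) (p, X) :=
    contDiffAt_snd.const_smul I
  exact (contDiffAt_const (c := (1 / 2 : ℂ))).mul ((h3.clm_apply contDiffAt_snd).sub
    ((contDiffAt_const (c := I)).mul (h3.clm_apply h4)))

/-- The coefficient of `X` along `N` modulo the holomorphic tangent space. -/
noncomputable def kap (r : Pt n → ℝ) (N z X : Pt n) : ℂ := pW (cR n r) X z / pW (cR n r) N z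

/-- The Levi form of the tangential part of `X`. -/
noncomputable def lphi (r : Pt n → ℝ) (N z X : Pt n) : ℝ := hs r (X - kap r N z X • N) z

lemma contDiffAt_kap_joint {m k : WithTop ℕ∞} (h : ContDiffAt ℝ k r p) (hm : m + 1 ≤ k)
    (hN : pW (cR n r) N p ≠ 0) (X : Pt n) :
    ContDiffAt ℝ m (fun q : Pt n × Pt n => kap r N q.1 q.2) (p, X) := by
  simp only [kap, div_eq_mul_inv]
  refine (contDiffAt_pW_joint h hm X).mul (ContDiffAt.inv ?_ hN)
  exact ContDiffAt.comp (p, X) (g := pW (cR n r) N) (h.cR.pW_right hm N) contDiffAt_fst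

lemma contDiffAt_lphi_joint (h : ContDiffAt ℝ 3 r p) (hN : pW (cR n r) N p ≠ 0) (X : Pt n) :
    ContDiffAt ℝ 1 (fun q : Pt n × Pt n => lphi r N q.1 q.2) (p, X) := by
  have h1 : ContDiffAt ℝ 1 (fun q : Pt n × Pt n => (q.1, q.2 - kap r N q.1 q.2 • N)) (p, X) :=
    contDiffAt_fst.prodMk (contDiffAt_snd.sub
      ((contDiffAt_kap_joint (m := 1) h (by norm_num) hN X).smul contDiffAt_const))
  have h2 := ContDiffAt.comp (p, X) (contDiffAt_hs_joint (m := 1) h (by norm_num)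
    (X - kap r N p X • N)) h1
  refine h2.congr_of_eventuallyEq ?_
  have hev : ∀ᶠ q : Pt n × Pt n in 𝓝 (p, X), ContDiffAt ℝ 3 r q.1 :=
    continuousAt_fst.eventually (h.eventually (by simp))
  filter_upwards [hev] with q hq
  exact hs_eq (hq.of_le (by norm_num)) _

lemma sub_kap_mem_T10 (hN : pW (cR n r) N z ≠ 0) : X - kap r N z X • N ∈ T10 n r z := by
  rw [mem_T10_iff, pW_sub_left, pW_smul_left, kap, div_mul_cancel₀ _ hN, sub_self]

/-- Expansion of the Levi form of the tangential part. -/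
lemma lphi_eq (h : ContDiffAt ℝ 2 r z) (N X : Pt n) : (lphi r N z X : ℂ) =
    pW (pB (cR n r) X) X z - (starRingEnd ℂ) (kap r N z X) * pW (pB (cR n r) N) X z -
      (kap r N z X * pW (pB (cR n r) X) N z -
        kap r N z X * ((starRingEnd ℂ) (kap r N z X) * pW (pB (cR n r) N) N z)) := by
  rw [lphi, ← levi_self_eq_hs h, sub_eq_add_neg, ← neg_smul]
  simp only [levi_add_left, levi_add_right, levi_smul_left, levi_smul_right, map_neg]
  simp only [levi_eq h]
  ring

/-- The normal derivative of the Levi form of the tangential part of a null vector. -/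
lemma pW_lphi (h : ContDiffAt ℝ 3 r p) (hg : gradSq n r p ≠ 0) (hL : L ∈ nullSp n r p) :
    pW (cR n (fun z => lphi r (nrm r p) z L)) (nrm r p) p =
      kc r p L - (normSq (wv r p L) : ℂ) := by
  have h2 : ContDiffAt ℝ 2 r p := h.of_le (by norm_num)
  set N := nrm r p with hNdef
  have hN1 : pW (cR n r) N p = 1 := pW_nrm hg
  have hL1 := mem_T10_iff.1 hL.1
  have hk0 : kap r N p L = 0 := by rw [kap, hL1, zero_div]
  have hev : cR n (fun z => lphi r N z L) =ᶠ[𝓝 p] fun z =>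
    pW (pB (cR n r) L) L z - (starRingEnd ℂ) (kap r N z L) * pW (pB (cR n r) N) L z -
      (kap r N z L * pW (pB (cR n r) L) N z -
        kap r N z L * ((starRingEnd ℂ) (kap r N z L) * pW (pB (cR n r) N) N z)) := by
    filter_upwards [h.eventually (by simp)] with z hz
    exact lphi_eq (hz.of_le (by norm_num)) N L
  have dd : ∀ X Y : Pt n, DifferentiableAt ℝ (pW (pB (cR n r) X) Y) p := fun X Y =>
    ((h.cR.pB_right (m := 2) (by norm_num) _).pW_right (m := 1) (by norm_num) _).differentiableAt
      (by norm_num)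
  have dL := (h.cR.pW_right (m := 2) (by norm_num) L).differentiableAt (by norm_num)
  have dN := (h.cR.pW_right (m := 2) (by norm_num) N).differentiableAt (by norm_num)
  have dk : DifferentiableAt ℝ (fun z => kap r N z L) p := by
    have := (contDiffAt_kap_joint (m := 2) h (by norm_num) (by rw [hN1]; exact one_ne_zero) L)
    exact (ContDiffAt.comp p (f := fun z => (z, L)) this
      (contDiffAt_id.prodMk contDiffAt_const)).differentiableAt (by norm_num)
  have dkc : DifferentiableAt ℝ (fun z => (starRingEnd ℂ) (kap r N z L)) p :=
    (conjCLE : ℂ →L[ℝ] ℂ).differentiableAt.comp p dk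
  have hmulk : (fun z => kap r N z L * pW (cR n r) N z) =ᶠ[𝓝 p] pW (cR n r) L := by
    have : ∀ᶠ z in 𝓝 p, pW (cR n r) N z ≠ 0 :=
      dN.continuousAt.eventually_ne (by rw [hN1]; exact one_ne_zero)
    filter_upwards [this] with z hz
    rw [kap, div_mul_cancel₀ _ hz]
  have k1 : pW (fun z => kap r N z L) N p = sv r p L := by
    have := pW_congr (X := N) hmulk
    rw [pW_mul dk dN, hk0, hN1] at this
    rw [sv, ← pW_pW_comm h2.cR, ← this]; ring
  have k2 : pB (fun z => kap r N z L) N p = wv r p L := by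
    have := pB_congr (X := N) hmulk
    rw [pB_mul dk dN, hk0, hN1] at this
    rw [wv, pW_pB_comm h2.cR, ← this]; ring
  have hcw : pW (pB (cR n r) L) N p = (starRingEnd ℂ) (wv r p L) := by
    rw [wv, ← levi_eq h2, ← levi_eq h2, levi_conj h2]
  have hn : (normSq (wv r p L) : ℂ) = wv r p L * (starRingEnd ℂ) (wv r p L) := (mul_conj _).symm
  rw [pW_congr hev, pW_sub ((dd L L).fun_sub (dkc.fun_mul (dd N L)))
    ((dk.fun_mul (dd L N)).fun_sub (dk.fun_mul (dkc.fun_mul (dd N N)))),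
    pW_sub (dd L L) (dkc.fun_mul (dd N L)),
    pW_sub (dk.fun_mul (dd L N)) (dk.fun_mul (dkc.fun_mul (dd N N))),
    pW_mul dkc (dd N L), pW_mul dk (dd L N), pW_mul dk (dkc.fun_mul (dd N N)), pW_conj dk, k1, k2,
    hcw, hk0, kc, hn, map_zero]
  have hw' : pW (pB (cR n r) N) L p = wv r p L := rfl
  rw [hw']
  ring

end leviphi

section pseudoconvex

variable {n : ℕ} {r : Pt n → ℝ} {Ω V : Set (Pt n)} {s : ℕ∞} {z p L X Y : Pt n}

lemma IsDefining.contDiffAt_three (h : IsDefining n s Ω r V) (hs3 : 3 ≤ s) (hz : z ∈ V) :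
    ContDiffAt ℝ 3 r z := (h.contDiffAt hz).of_le (show (3 : WithTop ℕ∞) ≤ s from WithTop.coe_le_coe.2 hs3)

lemma lphi_nonneg_eventually (h : IsDefining n s Ω r V) (hs3 : 3 ≤ s) (hpsc : LeviPseudoconvex n r Ω)
    (hp : p ∈ frontier Ω) :
    ∀ᶠ z in 𝓝 p, r z = 0 → ∀ X, 0 ≤ lphi r (nrm r p) z X := by
  have h3 := h.contDiffAt_three hs3 (h.frontier_subset hp)
  have hN : ∀ᶠ z in 𝓝 p, pW (cR n r) (nrm r p) z ≠ 0 :=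
    (h3.cR.pW_right (m := 2) (by norm_num) _).continuousAt.eventually_ne
      (by rw [pW_nrm (h.gradSq_ne_zero hp)]; exact one_ne_zero)
  filter_upwards [hN, h.eventually_mem_frontier (le_trans (by norm_num) hs3) hp] with z hz hzf h0 X
  have hzf' := hzf h0
  have h2 : ContDiffAt ℝ 2 r z :=
    (h.contDiffAt_three hs3 (h.frontier_subset hzf')).of_le (by norm_num)
  have := hpsc z hzf' _ (sub_kap_mem_T10 (X := X) hz)
  rwa [levi_self_eq_hs h2, ofReal_re] at this

lemma kc_im_eq_zero (h : IsDefining n s Ω r V) (hs3 : 3 ≤ s) (hpsc : LeviPseudoconvex n r Ω)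
    (hp : p ∈ frontier Ω) (hL : L ∈ nullSp n r p) : (kc r p L).im = 0 := by
  have h3 := h.contDiffAt_three hs3 (h.frontier_subset hp)
  have h2 : ContDiffAt ℝ 2 r p := h3.of_le (by norm_num)
  have hg := h.gradSq_ne_zero hp
  have hN1 := pW_nrm hg
  have hL1 := mem_T10_iff.1 hL.1
  have hφC : ContDiffAt ℝ 1 (fun z => lphi r (nrm r p) z L) p := by
    have := contDiffAt_lphi_joint h3 (N := nrm r p) (by rw [hN1]; exact one_ne_zero) L
    exact ContDiffAt.comp p (f := fun z => (z, L)) this (contDiffAt_id.prodMk contDiffAt_const)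
  have hφ0 : lphi r (nrm r p) p L = 0 := by
    rw [lphi, kap, hL1, zero_div, zero_smul, sub_zero]
    have := levi_self_eq_hs h2 L
    rw [hL.2 L hL.1] at this
    exact_mod_cast this.symm
  have hmin : IsLocalExtrOn (fun z => lphi r (nrm r p) z L) {x | r x = r p} p := by
    left
    have : ∀ᶠ z in 𝓝[{x | r x = r p}] p, lphi r (nrm r p) p L ≤ lphi r (nrm r p) z L := by
      filter_upwards [nhdsWithin_le_nhds (lphi_nonneg_eventually h hs3 hpsc hp),
        self_mem_nhdsWithin] with z hz hz'
      rw [hφ0]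
      exact hz (by rw [← h.eq_zero hp]; exact hz') L
    exact this
  obtain ⟨a, b, hab, heq⟩ := hmin.exists_multipliers_of_hasStrictFDerivAt_1d
    (h2.hasStrictFDerivAt (by norm_num)) (hφC.hasStrictFDerivAt (by norm_num))
  have e1 := pW_lphi h3 hg hL
  rw [pW_cR] at e1
  have hrI : fderiv ℝ r p (I • nrm r p) = 0 := by
    rw [← two_mul_re_pW_cR, pW_smul_left, hN1]; simp
  have hrN : fderiv ℝ r p (nrm r p) = 2 := by
    rw [← two_mul_re_pW_cR, hN1]; simp
  have hI := congrArg (fun l => l (I • nrm r p)) heq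
  have hN' := congrArg (fun l => l (nrm r p)) heq
  simp only [add_apply, smul_apply, smul_eq_mul, hrI, hrN,
    zero_apply, mul_zero, zero_add] at hI hN'
  have hb : b ≠ 0 := by
    rintro rfl
    apply hab
    have : a = 0 := by simpa using hN'
    rw [this]; rfl
  have h0 := (mul_eq_zero.1 hI).resolve_left hb
  rw [h0] at e1
  have := congrArg Complex.im e1
  simpa using this.symm

/-- A null direction of a positive semidefinite Levi form is in its kernel. -/
lemma mem_nullSp_of_levi_self (h : ContDiffAt ℝ 2 r p)
    (hpos : ∀ X ∈ T10 n r p, 0 ≤ (levi n r p X X).re) (hL : L ∈ T10 n r p)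
    (h0 : (levi n r p L L).re ≤ 0) : L ∈ nullSp n r p := by
  refine ⟨hL, fun Y hY => ?_⟩
  by_contra hne
  set b := levi n r p L Y with hb
  set A := (levi n r p Y Y).re with hA
  have hA0 : 0 ≤ A := hpos Y hY
  have key : ∀ t : ℝ, 0 ≤ -2 * t * normSq b + t ^ 2 * normSq b * A := by
    intro t
    have hm : L + (-(t : ℂ) * b) • Y ∈ T10 n r p := by
      rw [mem_T10_iff] at hL hY ⊢
      rw [pW_add_left, pW_smul_left, hL, hY]; simp
    have h1 := hpos _ hm
    have hYL : levi n r p Y L = (starRingEnd ℂ) b := (levi_conj h L Y).symm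
    have hYY : levi n r p Y Y = (A : ℂ) := by rw [hA, levi_self_eq_hs h, ofReal_re]
    have h2 : levi n r p (L + (-(t : ℂ) * b) • Y) (L + (-(t : ℂ) * b) • Y) =
        levi n r p L L + ((-2 * t * normSq b + t ^ 2 * normSq b * A : ℝ) : ℂ) := by
      simp only [levi_add_left, levi_add_right, levi_smul_left, levi_smul_right, hYL, hYY,
        map_mul, map_neg, conj_ofReal, ← hb]
      push_cast
      rw [← mul_conj]
      ring
    rw [h2, add_re, ofReal_re] at h1
    linarith
  have hpos' : 0 < normSq b := normSq_pos.2 hne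
  have := key (1 / (A + 1))
  have hA1 : 0 < A + 1 := by linarith
  have e : -2 * (1 / (A + 1)) * normSq b + (1 / (A + 1)) ^ 2 * normSq b * A =
    -(normSq b * (A + 2)) / (A + 1) ^ 2 := by field_simp; ring
  rw [e] at this
  have hlt : -(normSq b * (A + 2)) / (A + 1) ^ 2 < 0 :=
    div_neg_of_neg_of_pos (neg_neg_of_pos (by positivity)) (by positivity)
  linarith

end pseudoconvex

section interior

variable {n : ℕ} {r : Pt n → ℝ} {Ω V : Set (Pt n)} {s : ℕ∞} {z p L X Y N : Pt n}

/-- The quantity whose positivity characterises strict plurisubharmonicity of `-(-r)^η`. -/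
noncomputable def dfq (r : Pt n → ℝ) (η : ℝ) (z X : Pt n) : ℝ :=
  -r z * hs r X z + (1 - η) * normSq (pW (cR n r) X z)

lemma continuousAt_hs_joint (h : ContDiffAt ℝ 2 r p) (X : Pt n) :
    ContinuousAt (fun q : Pt n × Pt n => hs r q.2 q.1) (p, X) := by
  refine (contDiffAt_hs_joint (m := 0) h (by norm_num) X).continuousAt.congr ?_
  have hev : ∀ᶠ q : Pt n × Pt n in 𝓝 (p, X), ContDiffAt ℝ 2 r q.1 :=
    continuousAt_fst.eventually (h.eventually (by simp))
  filter_upwards [hev] with q hq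
  exact (hs_eq hq _).symm

lemma continuousAt_pW_joint (h : ContDiffAt ℝ 1 r p) (X : Pt n) :
    ContinuousAt (fun q : Pt n × Pt n => pW (cR n r) q.2 q.1) (p, X) :=
  (contDiffAt_pW_joint (m := 0) h (by norm_num) X).continuousAt

lemma continuousAt_dfq_joint (h : ContDiffAt ℝ 2 r p) (η : ℝ) (X : Pt n) :
    ContinuousAt (fun q : Pt n × Pt n => dfq r η q.1 q.2) (p, X) := by
  have h1 : ContinuousAt (fun q : Pt n × Pt n => r q.1) (p, X) :=
    ContinuousAt.comp (f := Prod.fst) (g := r) h.continuousAt continuousAt_fst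
  exact (h1.neg.mul (continuousAt_hs_joint h X)).add (continuousAt_const.mul
    (Complex.continuous_normSq.continuousAt.comp (continuousAt_pW_joint (h.of_le (by norm_num)) X)))

lemma dfq_pos_of_not_mem_T10 (h : ContDiffAt ℝ 2 r p) (h0 : r p = 0) {η : ℝ} (hη : η < 1)
    (hX : X ∉ T10 n r p) : ∀ᶠ q : Pt n × Pt n in 𝓝 (p, X), 0 < dfq r η q.1 q.2 := by
  refine (continuousAt_dfq_joint h η X).eventually (lt_mem_nhds ?_)
  rw [mem_T10_iff] at hX
  simp only [dfq, h0, neg_zero, zero_mul, zero_add]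
  exact mul_pos (by linarith) (normSq_pos.2 hX)

lemma dfq_pos_of_hs_pos (h : ContDiffAt ℝ 2 r p) {η : ℝ} (hη : η < 1) (hX : 0 < hs r X p) :
    ∀ᶠ q : Pt n × Pt n in 𝓝 (p, X), r q.1 < 0 → 0 < dfq r η q.1 q.2 := by
  filter_upwards [(continuousAt_hs_joint h X).eventually (lt_mem_nhds hX)] with q hq hr
  exact add_pos_of_pos_of_nonneg (mul_pos (by linarith) hq)
    (mul_nonneg (by linarith) (normSq_nonneg _))

/-- The real quadratic form with these coefficients is positive definite. -/
lemma quadratic_pos {a b c t x : ℝ} (hc : 0 < c) (hd : b ^ 2 < a * c) (ht : 0 < t) :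
    0 < a * t ^ 2 - 2 * b * t * x + c * x ^ 2 := by
  have h1 : c * (a * t ^ 2 - 2 * b * t * x + c * x ^ 2) =
      (c * x - b * t) ^ 2 + (a * c - b ^ 2) * t ^ 2 := by ring
  have h2 : 0 < c * (a * t ^ 2 - 2 * b * t * x + c * x ^ 2) := by
    rw [h1]
    have := mul_pos (sub_pos.2 hd) (pow_pos ht 2)
    positivity
  exact (mul_pos_iff_of_pos_left hc).1 h2

/-- Existence of a nearby boundary point in a transversal direction. -/
lemma exists_zero_of_strict {ε : ℝ} (hε0 : 0 < ε) (hε : ε < 1) (h : ContDiffAt ℝ 1 r p)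
    (h0 : r p = 0) (hN : fderiv ℝ r p N = 2) {U : Set (Pt n)} (hU : U ∈ 𝓝 p) :
    ∀ᶠ z in 𝓝 p, r z < 0 → ∃ t, 0 < t ∧ t < ε ∧ r (z + t • N) = 0 ∧ z + t • N ∈ U ∧
      (2 - ε) * t ≤ -r z ∧ -r z ≤ (2 + ε) * t := by
  have hs := h.hasStrictFDerivAt (n := 1) (by norm_num)
  have hNp : 0 < ‖N‖ + 1 := by positivity
  have h1 := hs.isLittleO.def (div_pos hε0 hNp)
  have hcont : ∀ᶠ x in 𝓝 p, ContinuousAt r x :=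
    (h.eventually (by simp)).mono fun x hx => hx.continuousAt
  rw [nhds_prod_eq] at h1
  obtain ⟨W, hW, hW1⟩ := (Filter.eventually_prod_self_iff (r := fun a b =>
    ‖r a - r b - (fderiv ℝ r p) (a - b)‖ ≤ ε / (‖N‖ + 1) * ‖a - b‖)).1 h1
  obtain ⟨δ, hδ, hball⟩ := Metric.mem_nhds_iff.1
    (Filter.inter_mem (Filter.inter_mem hW hU) hcont)
  have hr : ∀ᶠ z in 𝓝 p, -r z < min ε (δ / (2 * (‖N‖ + 1))) := by
    have : ContinuousAt (fun z => -r z) p := h.continuousAt.neg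
    refine this.eventually (gt_mem_nhds ?_)
    simp only [h0, neg_zero]
    positivity
  filter_upwards [hr, Metric.ball_mem_nhds p (half_pos hδ)] with z hz hzb hneg
  set u := -r z with hu
  have hu0 : 0 < u := by linarith
  have hin : ∀ t ∈ Set.Icc (0 : ℝ) u, z + t • N ∈ Metric.ball p δ := by
    intro t ht
    rw [Metric.mem_ball, dist_eq_norm] at hzb ⊢
    have h2 : ‖t • N‖ ≤ u * (‖N‖ + 1) := by
      rw [norm_smul, Real.norm_of_nonneg ht.1]
      exact mul_le_mul ht.2 (by linarith) (norm_nonneg _) hu0.le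
    have h3 : u * (‖N‖ + 1) < δ / 2 := by
      have := (lt_min_iff.1 hz).2
      rw [lt_div_iff₀ (by positivity)] at this
      linarith
    calc ‖z + t • N - p‖ = ‖(z - p) + t • N‖ := by congr 1; abel
      _ ≤ ‖z - p‖ + ‖t • N‖ := norm_add_le _ _
      _ < δ := by linarith
  have hest : ∀ t ∈ Set.Icc (0 : ℝ) u, |r (z + t • N) - r z - 2 * t| ≤ ε * t := by
    intro t ht
    have h2 := hW1 _ (hball (hin t ht)).1.1 _ (hball (hin 0 ⟨le_rfl, hu0.le⟩)).1.1
    simp only [zero_smul, add_zero] at h2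
    rw [add_sub_cancel_left, map_smul, hN, norm_smul, Real.norm_of_nonneg ht.1, smul_eq_mul] at h2
    rw [show 2 * t = t * 2 by ring]
    refine h2.trans ?_
    have : ‖N‖ / (‖N‖ + 1) ≤ 1 := (div_le_one hNp).2 (by linarith)
    calc ε / (‖N‖ + 1) * (t * ‖N‖) = ε * t * (‖N‖ / (‖N‖ + 1)) := by ring
      _ ≤ ε * t * 1 := mul_le_mul_of_nonneg_left this (mul_nonneg hε0.le ht.1)
      _ = ε * t := mul_one _
  have hend : 0 ≤ r (z + u • N) := by
    have := (abs_le.1 (hest u ⟨hu0.le, le_rfl⟩)).1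
    nlinarith
  have hc : ContinuousOn (fun t : ℝ => r (z + t • N)) (Set.Icc 0 u) := by
    intro t ht
    refine ContinuousAt.continuousWithinAt ?_
    exact ContinuousAt.comp (f := fun t : ℝ => z + t • N) (g := r) (hball (hin t ht)).2
      (by fun_prop)
  obtain ⟨t, ht, ht0⟩ := intermediate_value_Icc hu0.le hc
    (show (0 : ℝ) ∈ Set.Icc _ _ from ⟨by simpa using hneg.le, hend⟩)
  have ht0' : r (z + t • N) = 0 := ht0
  have htpos : 0 < t := by
    rcases ht.1.eq_or_lt with h | h
    · rw [← h] at ht0'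
      simp at ht0'
      linarith
    · exact h
  have he := abs_le.1 (hest t ht)
  rw [ht0'] at he
  exact ⟨t, htpos, by linarith [ht.2, (lt_min_iff.1 hz).1], ht0', (hball (hin t ht)).1.2,
    by linarith [he.2], by linarith [he.1]⟩

lemma hs_eq_lphi (h : ContDiffAt ℝ 2 r z) (N X : Pt n) : hs r X z = lphi r N z X +
    2 * ((starRingEnd ℂ) (kap r N z X) * pW (pB (cR n r) N) X z).re -
      normSq (kap r N z X) * hs r N z := by
  have h1 := congrArg Complex.re (lphi_eq h N X)
  have hconj : pW (pB (cR n r) X) N z = (starRingEnd ℂ) (pW (pB (cR n r) N) X z) := by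
    rw [pW_pB_comm h.cR, pB_pW_cR_eq_conj h]
  rw [hconj, pW_pB_cR_self h, pW_pB_cR_self h] at h1
  have h2 : kap r N z X * ((starRingEnd ℂ) (kap r N z X) * (hs r N z : ℂ)) =
      ((normSq (kap r N z X) * hs r N z : ℝ) : ℂ) := by
    rw [← mul_assoc, Complex.mul_conj]; push_cast; ring
  rw [h2] at h1
  simp only [sub_re, ofReal_re, mul_re, conj_re, conj_im] at h1 ⊢
  linarith

set_option maxHeartbeats 800000 in
lemma dfq_pos_of_null (h : IsDefining n s Ω r V) (hs3 : 3 ≤ s) (hpsc : LeviPseudoconvex n r Ω)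
    (hp : p ∈ frontier Ω) (hL : L ∈ nullSp n r p) {η : ℝ} (hη1 : η < 1)
    (hQ : (kc r p L).re + η / (1 - η) * normSq (wv r p L) < 0) :
    ∀ᶠ q : Pt n × Pt n in 𝓝 (p, L), r q.1 < 0 → 0 < dfq r η q.1 q.2 := by
  have h3 := h.contDiffAt_three hs3 (h.frontier_subset hp)
  have h2 : ContDiffAt ℝ 2 r p := h3.of_le (by norm_num)
  have hg := h.gradSq_ne_zero hp
  have hη' : 0 < 1 - η := by linarith
  set N := nrm r p with hNdef
  have hN1 : pW (cR n r) N p = 1 := pW_nrm hg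
  have hNr : fderiv ℝ r p N = 2 := by rw [← two_mul_re_pW_cR, hN1]; norm_num
  set lam := (kc r p L).re - normSq (wv r p L) with hlam
  set W := ‖wv r p L‖ with hW
  have hWsq : normSq (wv r p L) = W ^ 2 := Complex.normSq_eq_norm_sq _
  have hQ' : lam * (1 - η) + W ^ 2 < 0 := by
    rw [hlam, ← hWsq]
    have : ((kc r p L).re + η / (1 - η) * normSq (wv r p L)) * (1 - η) < 0 :=
      mul_neg_of_neg_of_pos hQ hη'
    have e : ((kc r p L).re + η / (1 - η) * normSq (wv r p L)) * (1 - η) =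
      (kc r p L).re * (1 - η) + η * normSq (wv r p L) := by field_simp
    rw [e] at this
    linarith
  obtain ⟨ε, hε0, hε1, hεc, hεd⟩ : ∃ ε : ℝ, 0 < ε ∧ ε < 1 ∧ 0 < (1 - η) * (1 - ε) - ε ∧
      ((2 + ε) * (W + ε)) ^ 2 < (2 - ε) * (-2 * lam - ε) * ((1 - η) * (1 - ε) - ε) := by
    have c1 : ∀ᶠ ε : ℝ in 𝓝 0, 0 < (1 - η) * (1 - ε) - ε := by
      refine (by fun_prop : ContinuousAt (fun ε : ℝ => (1 - η) * (1 - ε) - ε) 0).eventually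
        (lt_mem_nhds ?_)
      simpa using hη1
    have c2 : ∀ᶠ ε : ℝ in 𝓝 0, 0 < (2 - ε) * (-2 * lam - ε) * ((1 - η) * (1 - ε) - ε) -
        ((2 + ε) * (W + ε)) ^ 2 := by
      refine (by fun_prop : ContinuousAt (fun ε : ℝ => (2 - ε) * (-2 * lam - ε) *
        ((1 - η) * (1 - ε) - ε) - ((2 + ε) * (W + ε)) ^ 2) 0).eventually (lt_mem_nhds ?_)
      simp only [sub_zero, add_zero]
      nlinarith
    have c3 : ∀ᶠ ε : ℝ in 𝓝 0, ε < 1 := gt_mem_nhds one_pos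
    have := ((c1.and c2).and c3).filter_mono (nhdsWithin_le_nhds (s := Set.Ioi 0))
    obtain ⟨ε, ⟨⟨h1, h2⟩, h3⟩, h4⟩ := (this.and self_mem_nhdsWithin).exists
    exact ⟨ε, h4, h3, h1, by linarith⟩
  -- the tangential Levi form decreases at a definite rate
  have hNne : pW (cR n r) N p ≠ 0 := by rw [hN1]; exact one_ne_zero
  have hφ := contDiffAt_lphi_joint h3 hNne L
  have hφs := hφ.hasStrictFDerivAt (by norm_num)
  have hφN : fderiv ℝ (fun q : Pt n × Pt n => lphi r N q.1 q.2) (p, L) (N, 0) = 2 * lam := by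
    have e1 : fderiv ℝ (fun z => lphi r N z L) p N = 2 * lam := by
      rw [← two_mul_re_pW_cR, pW_lphi h3 hg hL, sub_re, ofReal_re]
    rw [← e1]
    have hd : HasFDerivAt (fun z : Pt n => (z, L)) (ContinuousLinearMap.inl ℝ (Pt n) (Pt n)) p :=
      hasFDerivAt_prodMk_left p L
    have := (HasFDerivAt.comp (f := fun z : Pt n => (z, L)) p hφs.hasFDerivAt hd).fderiv
    have e2 : ((fun q : Pt n × Pt n => lphi r N q.1 q.2) ∘ fun z => (z, L)) =
      fun z => lphi r N z L := rfl
    rw [e2] at this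
    rw [this]
    rfl
  have hNp : 0 < ‖N‖ + 1 := by positivity
  have hφ1 := hφs.isLittleO.def (div_pos hε0 hNp)
  rw [nhds_prod_eq] at hφ1
  obtain ⟨A, hA, hA1⟩ := (Filter.eventually_prod_self_iff (r := fun a b : Pt n × Pt n =>
    ‖lphi r N a.1 a.2 - lphi r N b.1 b.2 -
      (fderiv ℝ (fun q : Pt n × Pt n => lphi r N q.1 q.2) (p, L)) (a - b)‖ ≤
        ε / (‖N‖ + 1) * ‖a - b‖)).1 hφ1
  rw [nhds_prod_eq] at hA
  obtain ⟨U1, hU1, U2, hU2, hUA⟩ := Filter.mem_prod_iff.1 hA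
  have hnn := lphi_nonneg_eventually h hs3 hpsc hp
  have hz1 := exists_zero_of_strict hε0 hε1 (h3.of_le (by norm_num)) (h.eq_zero hp) hNr
    (Filter.inter_mem hU1 hnn)
  -- the remaining quantities are controlled by continuity
  have hB : ContinuousAt (fun q : Pt n × Pt n => pW (pB (cR n r) N) q.2 q.1) (p, L) := by
    have hc : ContDiffAt ℝ 1 (pB (cR n r) N) p := h2.cR.pB_right (by norm_num) N
    have h4 : ContinuousAt (fun q : Pt n × Pt n => fderiv ℝ (pB (cR n r) N) q.1) (p, L) :=
      ContinuousAt.comp (f := Prod.fst) (g := fderiv ℝ (pB (cR n r) N))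
        (hc.fderiv_right (m := 0) (by norm_num)).continuousAt continuousAt_fst
    have h5 : ContinuousAt (fun q : Pt n × Pt n => I • q.2) (p, L) :=
      continuousAt_snd.const_smul I
    exact continuousAt_const.mul ((h4.clm_apply continuousAt_snd).sub
      (continuousAt_const.mul (h4.clm_apply h5)))
  have hBε : ∀ᶠ q : Pt n × Pt n in 𝓝 (p, L), ‖pW (pB (cR n r) N) q.2 q.1‖ < W + ε :=
    hB.norm.eventually (gt_mem_nhds (by
      show ‖wv r p L‖ < W + ε
      linarith))
  have hrc : ContinuousAt (fun q : Pt n × Pt n => r q.1) (p, L) :=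
    ContinuousAt.comp (f := Prod.fst) (g := r) h2.continuousAt continuousAt_fst
  have hNN : ∀ᶠ q : Pt n × Pt n in 𝓝 (p, L), -r q.1 * hs r N q.1 < ε := by
    have h4 : ContinuousAt (fun q : Pt n × Pt n => hs r N q.1) (p, L) :=
      ContinuousAt.comp (f := fun q : Pt n × Pt n => (q.1, N))
        (g := fun q : Pt n × Pt n => hs r q.2 q.1) (continuousAt_hs_joint h2 N) (by fun_prop)
    refine (hrc.neg.mul h4).eventually (gt_mem_nhds ?_)
    show -r p * hs r N p < ε
    rw [h.eq_zero hp, neg_zero, zero_mul]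
    exact hε0
  have hMN : ∀ᶠ q : Pt n × Pt n in 𝓝 (p, L), 1 - ε < normSq (pW (cR n r) N q.1) := by
    have h4 : ContinuousAt (fun q : Pt n × Pt n => pW (cR n r) N q.1) (p, L) :=
      ContinuousAt.comp (f := fun q : Pt n × Pt n => (q.1, N))
        (g := fun q : Pt n × Pt n => pW (cR n r) q.2 q.1)
        (continuousAt_pW_joint (h2.of_le (by norm_num)) N) (by fun_prop)
    refine (Complex.continuous_normSq.continuousAt.comp h4).eventually (lt_mem_nhds ?_)
    simp only [Function.comp, hN1, normSq_one]
    linarith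
  have hC2 : ∀ᶠ q : Pt n × Pt n in 𝓝 (p, L), ContDiffAt ℝ 2 r q.1 :=
    continuousAt_fst.eventually (h2.eventually (by simp))
  filter_upwards [continuousAt_fst.eventually hz1, continuousAt_fst.eventually hU1,
    continuousAt_snd.eventually hU2, hBε, hNN, hMN, hC2] with q hq1 hqU1 hqU2 hqB hqN hqM hqC hneg
  obtain ⟨z, Y⟩ := q
  simp only at hq1 hqU1 hqU2 hqB hqN hqM hqC hneg ⊢
  obtain ⟨t, ht0, htε, hzt, ⟨hzU, hzn⟩, hlo, hhi⟩ := hq1 hneg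
  have hφ0 := hzn hzt Y
  have hφd := hA1 (z + t • N, Y) (hUA ⟨hzU, hqU2⟩) (z, Y) (hUA ⟨hqU1, hqU2⟩)
  have e3 : ((z + t • N, Y) : Pt n × Pt n) - (z, Y) = t • ((N, 0) : Pt n × Pt n) := by
    simp
  rw [e3, map_smul, hφN, smul_eq_mul, norm_smul, Real.norm_of_nonneg ht0.le] at hφd
  have e4 : ‖((N, 0) : Pt n × Pt n)‖ = ‖N‖ := by simp [Prod.norm_def]
  rw [e4] at hφd
  have e5 : ε / (‖N‖ + 1) * (t * ‖N‖) ≤ ε * t := by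
    have : ‖N‖ / (‖N‖ + 1) ≤ 1 := (div_le_one hNp).2 (by linarith)
    calc ε / (‖N‖ + 1) * (t * ‖N‖) = ε * t * (‖N‖ / (‖N‖ + 1)) := by ring
      _ ≤ ε * t * 1 := mul_le_mul_of_nonneg_left this (mul_nonneg hε0.le ht0.le)
      _ = ε * t := mul_one _
  have hφz : (-2 * lam - ε) * t ≤ lphi r N z Y := by
    have := (abs_le.1 (hφd.trans e5)).2
    simp only at this hφ0
    linarith
  have hM0 : pW (cR n r) N z ≠ 0 := by
    intro h0
    rw [h0] at hqM
    simp only [normSq_zero] at hqM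
    linarith
  have hκ : pW (cR n r) Y z = kap r N z Y * pW (cR n r) N z := by
    rw [kap, div_mul_cancel₀ _ hM0]
  set κ := kap r N z Y with hκdef
  have hcross : -(‖κ‖ * (W + ε)) ≤ ((starRingEnd ℂ) κ * pW (pB (cR n r) N) Y z).re := by
    have := (abs_le.1 (Complex.abs_re_le_norm ((starRingEnd ℂ) κ * pW (pB (cR n r) N) Y z))).1
    rw [norm_mul, RCLike.norm_conj] at this
    have h4 : ‖κ‖ * ‖pW (pB (cR n r) N) Y z‖ ≤ ‖κ‖ * (W + ε) :=
      mul_le_mul_of_nonneg_left hqB.le (norm_nonneg _)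
    linarith
  have hu0 : 0 < -r z := by linarith
  have ha0 : 0 < -2 * lam - ε := by
    by_contra hcon
    have h6 : (2 - ε) * (-2 * lam - ε) * ((1 - η) * (1 - ε) - ε) ≤ 0 :=
      mul_nonpos_of_nonpos_of_nonneg (mul_nonpos_of_nonneg_of_nonpos (by linarith) (by linarith))
        hεc.le
    nlinarith [sq_nonneg ((2 + ε) * (W + ε))]
  rw [dfq, hs_eq_lphi hqC N Y, hκ, normSq_mul, Complex.normSq_eq_norm_sq κ]
  have hW0 : 0 ≤ W := norm_nonneg _
  have hfin := quadratic_pos (x := ‖κ‖) hεc hεd ht0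
  have i1 : (2 - ε) * (-2 * lam - ε) * t ^ 2 ≤ -r z * lphi r N z Y := by
    calc (2 - ε) * (-2 * lam - ε) * t ^ 2 = ((2 - ε) * t) * ((-2 * lam - ε) * t) := by ring
      _ ≤ -r z * lphi r N z Y := mul_le_mul hlo hφz (by positivity) hu0.le
  have i2 : -(2 * ((2 + ε) * (W + ε)) * t * ‖κ‖) ≤
      -r z * (2 * ((starRingEnd ℂ) κ * pW (pB (cR n r) N) Y z).re) := by
    have h5 : -r z * (‖κ‖ * (W + ε)) ≤ ((2 + ε) * t) * (‖κ‖ * (W + ε)) :=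
      mul_le_mul_of_nonneg_right hhi (by positivity)
    have h6 := mul_le_mul_of_nonneg_left hcross hu0.le
    linarith
  have i3 : -r z * (‖κ‖ ^ 2 * hs r N z) ≤ ε * ‖κ‖ ^ 2 := by
    have := mul_le_mul_of_nonneg_right hqN.le (sq_nonneg ‖κ‖)
    linarith
  have i4 : (1 - η) * (1 - ε) * ‖κ‖ ^ 2 ≤ (1 - η) * (‖κ‖ ^ 2 * normSq (pW (cR n r) N z)) := by
    have := mul_le_mul_of_nonneg_left hqM.le (mul_nonneg hη'.le (sq_nonneg ‖κ‖))
    linarith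
  linarith

end interior

section hsalg

variable {n : ℕ} {f g r : Pt n → ℝ} {z p L X Y : Pt n}

lemma hs_congr (h : f =ᶠ[𝓝 z] g) : hs f X z = hs g X z := by
  have h1 : ∀ Y : Pt n, (fun y => fderiv ℝ f y Y) =ᶠ[𝓝 z] fun y => fderiv ℝ g y Y := fun Y =>
    (h.fderiv (𝕜 := ℝ)).fun_comp (fun A => A Y)
  simp only [hs, (h1 X).fderiv_eq, (h1 (I • X)).fderiv_eq]

lemma hs_add (hf : ContDiffAt ℝ 2 f z) (hg : ContDiffAt ℝ 2 g z) (X : Pt n) :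
    hs (fun y => f y + g y) X z = hs f X z + hs g X z := by
  have h1 : fderiv ℝ (fun y => f y + g y) =ᶠ[𝓝 z] fun y => fderiv ℝ f y + fderiv ℝ g y := by
    filter_upwards [hf.eventually (by simp), hg.eventually (by simp)] with y hy hy'
    exact fderiv_fun_add (hy.differentiableAt (by norm_num)) (hy'.differentiableAt (by norm_num))
  rw [hs_eq (hf.add hg), hs_eq hf, hs_eq hg, h1.fderiv_eq,
    fderiv_fun_add hf.differentiableAt_fderiv hg.differentiableAt_fderiv]
  simp only [add_apply]
  ring

lemma hs_const_mul (a : ℝ) (hf : ContDiffAt ℝ 2 f z) (X : Pt n) :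
    hs (fun y => a * f y) X z = a * hs f X z := by
  have h1 : fderiv ℝ (fun y => a * f y) =ᶠ[𝓝 z] fun y => a • fderiv ℝ f y := by
    filter_upwards [hf.eventually (by simp)] with y hy
    exact fderiv_const_mul (hy.differentiableAt (by norm_num)) a
  rw [hs_eq (contDiffAt_const.mul hf), hs_eq hf, h1.fderiv_eq,
    fderiv_fun_const_smul hf.differentiableAt_fderiv a]
  simp only [smul_apply, smul_eq_mul]
  ring

lemma hs_smul_real (hf : ContDiffAt ℝ 2 f z) (t : ℝ) (X : Pt n) :
    hs f (t • X) z = t ^ 2 * hs f X z := by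
  rw [hs_eq hf, hs_eq hf, smul_comm I t X]
  simp only [map_smul, smul_apply, smul_eq_mul]
  ring

lemma pW_smul_real (f : Pt n → ℂ) (t : ℝ) (X z : Pt n) : pW f (t • X) z = t * pW f X z := by
  rw [← pW_smul_left]
  congr 1

lemma dfq_smul_real (hf : ContDiffAt ℝ 2 f z) (η t : ℝ) (X : Pt n) :
    dfq f η z (t • X) = t ^ 2 * dfq f η z X := by
  rw [dfq, dfq, hs_smul_real hf, pW_smul_real, normSq_mul, normSq_ofReal]
  ring

/-- The square of the Euclidean norm. -/
noncomputable def esq (z : Pt n) : ℝ := ∑ j, normSq (z j)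

lemma esq_pos (hX : X ≠ 0) : 0 < esq X := by
  obtain ⟨j, hj⟩ := Function.ne_iff.1 hX
  exact Finset.sum_pos' (fun i _ => normSq_nonneg _) ⟨j, Finset.mem_univ _, normSq_pos.2 hj⟩

lemma esq_nonneg (X : Pt n) : 0 ≤ esq X := Finset.sum_nonneg fun _ _ => normSq_nonneg _

/-- The real part of the Hermitian product. -/
noncomputable def rip (z X : Pt n) : ℝ := ∑ j, ((z j).re * (X j).re + (z j).im * (X j).im)

lemma hasFDerivAt_esq (z : Pt n) : HasFDerivAt esq
    (∑ j, (((2 * (z j).re) • (reCLM.comp (ContinuousLinearMap.proj (R := ℝ) j))) +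
      ((2 * (z j).im) • (imCLM.comp (ContinuousLinearMap.proj (R := ℝ) j)))) : Pt n →L[ℝ] ℝ) z := by
  have h1 : (esq : Pt n → ℝ) = fun z => ∑ j, ((z j).re ^ 2 + (z j).im ^ 2) := by
    funext z
    exact Finset.sum_congr rfl fun j _ => by rw [normSq_apply]; ring
  rw [h1]
  refine HasFDerivAt.fun_sum fun j _ => ?_
  have hr : HasFDerivAt (fun z : Pt n => (z j).re)
      (reCLM.comp (ContinuousLinearMap.proj (R := ℝ) j)) z :=
    (reCLM.comp (ContinuousLinearMap.proj (R := ℝ) j : Pt n →L[ℝ] ℂ)).hasFDerivAt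
  have hi : HasFDerivAt (fun z : Pt n => (z j).im)
      (imCLM.comp (ContinuousLinearMap.proj (R := ℝ) j)) z :=
    (imCLM.comp (ContinuousLinearMap.proj (R := ℝ) j : Pt n →L[ℝ] ℂ)).hasFDerivAt
  simpa using (hr.pow 2).fun_add (hi.pow 2)

lemma contDiff_esq {k : WithTop ℕ∞} : ContDiff ℝ k (esq : Pt n → ℝ) := by
  have h1 : (esq : Pt n → ℝ) = fun z => ∑ j, ((z j).re ^ 2 + (z j).im ^ 2) := by
    funext z
    exact Finset.sum_congr rfl fun j _ => by rw [normSq_apply]; ring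
  rw [h1]
  refine ContDiff.sum fun j _ => ?_
  exact ((reCLM.comp (ContinuousLinearMap.proj (R := ℝ) j : Pt n →L[ℝ] ℂ)).contDiff.pow 2).add
    ((imCLM.comp (ContinuousLinearMap.proj (R := ℝ) j : Pt n →L[ℝ] ℂ)).contDiff.pow 2)

lemma fderiv_esq (z X : Pt n) : fderiv ℝ esq z X = 2 * rip z X := by
  rw [(hasFDerivAt_esq z).fderiv, rip, Finset.mul_sum]
  simp only [sum_apply, add_apply, smul_apply, ContinuousLinearMap.comp_apply,
    ContinuousLinearMap.proj_apply, reCLM_apply, imCLM_apply, smul_eq_mul]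
  exact Finset.sum_congr rfl fun j _ => by ring

lemma rip_comm (z X : Pt n) : rip z X = rip X z :=
  Finset.sum_congr rfl fun j _ => by ring

lemma rip_self (X : Pt n) : rip X X = esq X :=
  Finset.sum_congr rfl fun j _ => by rw [normSq_apply]

lemma esq_I_smul (X : Pt n) : esq (I • X) = esq X :=
  Finset.sum_congr rfl fun j _ => by simp

lemma rip_sq_le (z X : Pt n) : rip z X ^ 2 ≤ esq z * esq X := by
  have key : ∀ t : ℝ, 0 ≤ esq X * (t * t) + (2 * rip z X) * t + esq z := by
    intro t
    have : esq X * (t * t) + (2 * rip z X) * t + esq z =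
        ∑ j, (((z j).re + t * (X j).re) ^ 2 + ((z j).im + t * (X j).im) ^ 2) := by
      simp only [esq, rip, Finset.mul_sum, Finset.sum_mul, ← Finset.sum_add_distrib, normSq_apply]
      exact Finset.sum_congr rfl fun j _ => by ring
    rw [this]
    positivity
  have := discrim_le_zero key
  rw [discrim] at this
  linarith

lemma hs_esq (X z : Pt n) : hs esq X z = esq X := by
  have hc : ∀ Y : Pt n, fderiv ℝ (fun y => fderiv ℝ esq y Y) z Y = 2 * esq Y := by
    intro Y
    have h1 : (fun y => fderiv ℝ esq y Y) = fun y : Pt n =>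
        2 * (fderiv ℝ esq Y y / 2) := by
      funext y
      rw [fderiv_esq, fderiv_esq, rip_comm]
      ring
    have h2 : (fun y : Pt n => 2 * (fderiv ℝ esq Y y / 2)) = fun y => fderiv ℝ esq Y y := by
      funext y; ring
    rw [h1, h2, ContinuousLinearMap.fderiv, fderiv_esq, rip_self]
  rw [hs, hc, hc, esq_I_smul]
  ring

lemma normSq_pW_esq_le (X z : Pt n) : normSq (pW (cR n esq) X z) ≤ 2 * esq z * esq X := by
  rw [normSq_pW_cR, fderiv_esq, fderiv_esq]
  have h1 := rip_sq_le z X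
  have h2 := rip_sq_le z (I • X)
  rw [esq_I_smul] at h2
  nlinarith

lemma normSq_add_le {c c1 : ℝ} (hc : 0 < c) (hc1 : c < c1) (x y : ℂ) :
    c * normSq (x + y) ≤ c1 * normSq x + c * c1 / (c1 - c) * normSq y := by
  have hd : 0 < c1 - c := by linarith
  have e : (c1 - c) * (c1 * normSq x + c * c1 / (c1 - c) * normSq y - c * normSq (x + y)) =
      normSq (((c1 - c : ℝ) : ℂ) * x - (c : ℂ) * y) := by
    have e2 : c * c1 / (c1 - c) * (c1 - c) = c * c1 := by field_simp
    have : (c1 - c) * (c1 * normSq x + c * c1 / (c1 - c) * normSq y - c * normSq (x + y)) =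
      (c1 - c) * (c1 * normSq x - c * normSq (x + y)) +
        (c * c1 / (c1 - c) * (c1 - c)) * normSq y := by ring
    rw [this, e2]
    simp only [normSq_apply, add_re, add_im, sub_re, sub_im, mul_re, mul_im, ofReal_re, ofReal_im]
    ring
  have := normSq_nonneg (((c1 - c : ℝ) : ℂ) * x - (c : ℂ) * y)
  rw [← e] at this
  linarith [nonneg_of_mul_nonneg_right this hd]

/-- Adding `-ε|z|²` to the weight makes the Riccati inequality strict. -/
lemma riccati_tilt {c c1 R : ℝ} (hc : 0 < c) (hc1 : c < c1) (hR : 0 ≤ R) :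
    ∃ ε > 0, ∀ (K : ℝ) (x : ℂ) (L z : Pt n), L ≠ 0 → esq z ≤ R →
      K + c1 * normSq x ≤ ε / 4 * esq L →
      K + hs (fun y => -ε * esq y) L z +
        c * normSq (x + pW (cR n (fun y => -ε * esq y)) L z) < 0 := by
  have hd : 0 < c1 - c := by linarith
  set M := c * c1 / (c1 - c) with hM
  have hM0 : 0 < M := by rw [hM]; exact div_pos (mul_pos hc (hc.trans hc1)) hd
  refine ⟨1 / (4 * M * (R + 1)), by positivity, ?_⟩
  set ε := 1 / (4 * M * (R + 1)) with hε
  have hε0 : 0 < ε := by positivity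
  intro K x L z hL hz hK
  have h1 : hs (fun y => -ε * esq y) L z = -ε * esq L := by
    rw [hs_const_mul _ contDiff_esq.contDiffAt, hs_esq]
  have h2 : pW (cR n (fun y => -ε * esq y)) L z = -ε * pW (cR n esq) L z := by
    have : cR n (fun y => -ε * esq y) = fun y => (-ε : ℂ) * cR n esq y := by
      funext y; simp [cR]
    rw [this, pW_const_mul]
    exact differentiableAt_cR.2 (contDiff_esq (k := 1)).contDiffAt.differentiableAt_one
  have h3 := normSq_add_le hc hc1 x (pW (cR n (fun y => -ε * esq y)) L z)
  have h4 : normSq (pW (cR n (fun y => -ε * esq y)) L z) ≤ ε ^ 2 * (2 * R * esq L) := by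
    rw [h2, normSq_mul, normSq_neg, normSq_ofReal, ← sq]
    refine mul_le_mul_of_nonneg_left ((normSq_pW_esq_le L z).trans ?_) (sq_nonneg _)
    nlinarith [esq_nonneg L]
  have h5 : M * (ε ^ 2 * (2 * R * esq L)) ≤ ε / 2 * esq L := by
    have : M * ε * (4 * (R + 1)) = 1 := by rw [hε]; field_simp
    have h6 : M * ε * (4 * R) ≤ 1 := by
      have := mul_pos hM0 hε0
      linarith
    have h7 := mul_le_mul_of_nonneg_right h6 (mul_nonneg hε0.le (esq_nonneg L))
    linarith
  have h6 := mul_le_mul_of_nonneg_left h4 hM0.le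
  have h7 : 0 < ε * esq L := mul_pos hε0 (esq_pos hL)
  rw [h1]
  linarith

end hsalg

section cutoff

/-- A smooth monotone step from `0` (at `a`) to `1` (at `b`). -/
noncomputable def rstep (a b t : ℝ) : ℝ := Real.smoothTransition ((t - a) / (b - a))

lemma contDiff_rstep (a b : ℝ) {k : ℕ∞} : ContDiff ℝ k (rstep a b) :=
  Real.smoothTransition.contDiff.comp (by fun_prop)

lemma rstep_of_le {a b t : ℝ} (hab : a < b) (h : t ≤ a) : rstep a b t = 0 :=
  Real.smoothTransition.zero_of_nonpos (div_nonpos_of_nonpos_of_nonneg (by linarith) (by linarith))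

lemma rstep_of_ge {a b t : ℝ} (hab : a < b) (h : b ≤ t) : rstep a b t = 1 :=
  Real.smoothTransition.one_of_one_le ((one_le_div (by linarith)).2 (by linarith))

lemma rstep_nonneg (a b t : ℝ) : 0 ≤ rstep a b t := Real.smoothTransition.nonneg _

lemma rstep_mono {a b : ℝ} (hab : a < b) : Monotone (rstep a b) := fun x y h =>
  Real.smoothTransition.monotone (div_le_div_of_nonneg_right (by linarith) (by linarith))

/-- A smooth convex nondecreasing function, equal to the identity on `[-a, ∞)` and constant on
`(-∞, -b]`. -/
noncomputable def chiTrunc (a b t : ℝ) : ℝ := ∫ s in (0 : ℝ)..t, rstep (-b) (-a) s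

lemma hasDerivAt_chiTrunc (a b t : ℝ) : HasDerivAt (chiTrunc a b) (rstep (-b) (-a) t) t :=
  intervalIntegral.integral_hasDerivAt_right
    (((contDiff_rstep (-b) (-a) (k := 0)).continuous).intervalIntegrable _ _)
    ((contDiff_rstep (-b) (-a) (k := 0)).continuous.stronglyMeasurableAtFilter _ _)
    (contDiff_rstep (-b) (-a) (k := 0)).continuous.continuousAt

lemma deriv_chiTrunc (a b : ℝ) : deriv (chiTrunc a b) = rstep (-b) (-a) :=
  funext fun t => (hasDerivAt_chiTrunc a b t).deriv

lemma contDiff_chiTrunc (a b : ℝ) : ContDiff ℝ 2 (chiTrunc a b) := by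
  rw [show (2 : WithTop ℕ∞) = 1 + 1 by norm_num, contDiff_succ_iff_deriv]
  refine ⟨fun t => (hasDerivAt_chiTrunc a b t).differentiableAt, by simp, ?_⟩
  rw [deriv_chiTrunc]
  exact contDiff_rstep _ _

lemma chiTrunc_of_ge {a b t : ℝ} (ha : 0 ≤ a) (hab : a < b) (h : -a ≤ t) : chiTrunc a b t = t := by
  have : Set.EqOn (rstep (-b) (-a)) (fun _ => (1 : ℝ)) (Set.uIcc 0 t) := by
    intro s hs
    refine rstep_of_ge (by linarith) ?_
    have := hs.1
    rcases min_cases (0 : ℝ) t with h' | h' <;> linarith [h'.1]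
  rw [chiTrunc, intervalIntegral.integral_congr this]
  simp

lemma chiTrunc_mono {a b : ℝ} : Monotone (chiTrunc a b) :=
  monotone_of_deriv_nonneg (fun t => (hasDerivAt_chiTrunc a b t).differentiableAt)
    fun t => by rw [deriv_chiTrunc]; exact rstep_nonneg _ _ _

lemma chiTrunc_neg {a b t : ℝ} (ha : 0 < a) (hab : a < b) (h : t < 0) : chiTrunc a b t < 0 := by
  rcases le_or_gt (-a) t with h' | h'
  · rwa [chiTrunc_of_ge ha.le hab h']
  · have := chiTrunc_mono (a := a) (b := b) h'.le
    rw [chiTrunc_of_ge ha.le hab le_rfl] at this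
    linarith

lemma deriv_deriv_chiTrunc_nonneg {a b : ℝ} (hab : a < b) (t : ℝ) :
    0 ≤ deriv (deriv (chiTrunc a b)) t := by
  rw [deriv_chiTrunc]
  exact (rstep_mono (by linarith)).deriv_nonneg

lemma deriv_deriv_chiTrunc_of_lt {a b t : ℝ} (hab : a < b) (h : t < -b) :
    deriv (deriv (chiTrunc a b)) t = 0 := by
  rw [deriv_chiTrunc]
  have : rstep (-b) (-a) =ᶠ[𝓝 t] fun _ => (0 : ℝ) := by
    filter_upwards [gt_mem_nhds h] with s hs
    exact rstep_of_le (by linarith) hs.le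
  rw [this.deriv_eq, deriv_const]

end cutoff

section negpow

variable {n : ℕ} {r : Pt n → ℝ} {z X : Pt n}

lemma hasDerivAt_neg_rpow (η : ℝ) {t : ℝ} (ht : t < 0) :
    HasDerivAt (fun t : ℝ => -(-t) ^ η) (η * (-t) ^ (η - 1)) t := by
  have h1 := ((hasDerivAt_id t).neg.rpow_const (p := η) (Or.inl (by simp; linarith))).neg
  exact h1.congr_deriv (by simp)

lemma contDiffAt_neg_rpow (η : ℝ) {k : WithTop ℕ∞} {t : ℝ} (ht : t < 0) :
    ContDiffAt ℝ k (fun t : ℝ => -(-t) ^ η) t :=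
  (contDiffAt_id.neg.rpow_const_of_ne (by simp; linarith)).neg

lemma hs_neg_rpow (h : ContDiffAt ℝ 2 r z) (hz : r z < 0) (η : ℝ) (X : Pt n) :
    hs (fun y => -(-r y) ^ η) X z = η * (-r z) ^ (η - 2) * dfq r η z X := by
  have h1 := hs_comp (X := X) h (contDiffAt_neg_rpow η hz)
  have hd : deriv (fun t : ℝ => -(-t) ^ η) =ᶠ[𝓝 (r z)] fun t => η * (-t) ^ (η - 1) := by
    filter_upwards [gt_mem_nhds hz] with t ht
    exact (hasDerivAt_neg_rpow η ht).deriv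
  have hd2 : deriv (deriv (fun t : ℝ => -(-t) ^ η)) (r z) = η * (1 - η) * (-r z) ^ (η - 2) := by
    rw [hd.deriv_eq]
    have := ((hasDerivAt_neg_rpow (η - 1) hz).neg.const_mul η).deriv
    have e : (fun y : ℝ => η * (-fun t : ℝ => -(-t) ^ (η - 1)) y) =
        fun t => η * (-t) ^ (η - 1) := by
      funext t; simp
    rw [e] at this
    rw [this, show η - 1 - 1 = η - 2 by ring]
    ring
  rw [h1, hd2, (hasDerivAt_neg_rpow η hz).deriv, dfq,
    show η - 1 = (η - 2) + 1 by ring, Real.rpow_add_one (by linarith)]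
  ring

lemma hs_nonneg_of_dfq (h : ContDiffAt ℝ 2 r z) (hz : r z < 0) {η : ℝ} (hη : 0 < η)
    (hd : 0 < dfq r η z X) : 0 < hs (fun y => -(-r y) ^ η) X z := by
  rw [hs_neg_rpow h hz]
  have : 0 < (-r z) ^ (η - 2) := Real.rpow_pos_of_pos (by linarith) _
  positivity

end negpow

section globalize

variable {n : ℕ} {r : Pt n → ℝ} {Ω V : Set (Pt n)} {s : ℕ∞} {z p L X Y : Pt n}

lemma strictPSHOn_of_hs {f : Pt n → ℝ} {U : Set (Pt n)} (hf : ∀ z ∈ U, ContDiffAt ℝ 2 f z)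
    (h : ∀ z ∈ U, ∀ X : Pt n, X ≠ 0 → 0 < hs f X z) : StrictPSHOn n f U := by
  intro z hz X hX
  rw [levi_self_eq_hs (hf z hz), ofReal_re]
  exact h z hz X hX

/-- A defining function satisfying the plurisubharmonicity condition near the boundary can be
modified in the interior so as to satisfy it everywhere. -/
lemma exists_global_of_collar (h : IsDefining n s Ω r V) (hs2 : 2 ≤ s)
    (hbdd : Bornology.IsBounded Ω) {η δ : ℝ} (hη0 : 0 < η) (hδ : 0 < δ)
    (hcol : ∀ z ∈ Ω, -δ < r z → ∀ X : Pt n, X ≠ 0 → 0 < dfq r η z X) :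
    ∃ ρ, IsDefining n 1 Ω ρ V ∧ StrictPSHOn n (fun z => -((-ρ z) ^ η)) Ω := by
  have hr2 : ∀ z ∈ V, ContDiffAt ℝ 2 r z := fun z hz =>
    (h.contDiffAt hz).of_le (show (2 : WithTop ℕ∞) ≤ s from WithTop.coe_le_coe.2 hs2)
  have hΩV : Ω ⊆ V := subset_closure.trans h.2.1
  have hneg : ∀ z ∈ Ω, r z < 0 := fun z hz => h.neg_of_mem hz
  set f : Pt n → ℝ := fun z => -(-r z) ^ η with hf
  have hf2 : ∀ z ∈ Ω, ContDiffAt ℝ 2 f z := fun z hz =>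
    (contDiffAt_neg_rpow η (hneg z hz)).comp z (hr2 z (hΩV hz))
  have hfneg : ∀ z ∈ Ω, f z < 0 := fun z hz =>
    neg_neg_of_pos (Real.rpow_pos_of_pos (by linarith [hneg z hz]) _)
  have hfpos : ∀ z ∈ Ω, -δ < r z → ∀ X : Pt n, X ≠ 0 → 0 < hs f X z := fun z hz hd X hX =>
    hs_nonneg_of_dfq (hr2 z (hΩV hz)) (hneg z hz) hη0 (hcol z hz hd X hX)
  obtain ⟨C, hC⟩ : ∃ C, ∀ z ∈ Ω, esq z ≤ C := by
    obtain ⟨C, hC⟩ := (hbdd.isCompact_closure.image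
      (contDiff_esq (n := n) (k := 0)).continuous).bddAbove
    exact ⟨C, fun z hz => hC ⟨z, subset_closure hz, rfl⟩⟩
  -- cutoffs
  set g : Pt n → ℝ := fun z => rstep (δ / 4) (δ / 2) (-r z) * (esq z - C) with hg
  have hg2 : ∀ z ∈ V, ContDiffAt ℝ 2 g z := fun z hz =>
    ((contDiff_rstep _ _ (k := 2)).contDiffAt.comp z (hr2 z hz).neg).mul
      (contDiff_esq.contDiffAt.sub contDiffAt_const)
  set a := (δ / 2) ^ η with ha
  set b := (3 * δ / 4) ^ η with hb
  have ha0 : 0 < a := by positivity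
  have hab : a < b := Real.rpow_lt_rpow (by positivity) (by linarith) hη0
  set F : Pt n → ℝ := fun z => chiTrunc a b (f z) with hF
  have hF2 : ∀ z ∈ Ω, ContDiffAt ℝ 2 F z := fun z hz =>
    (contDiff_chiTrunc a b).contDiffAt.comp z (hf2 z hz)
  have hFeq : ∀ z ∈ Ω, -(δ / 2) ≤ r z → F z = f z := by
    intro z hz hrz
    refine chiTrunc_of_ge ha0.le hab ?_
    exact neg_le_neg (Real.rpow_le_rpow (by linarith [hneg z hz]) (by linarith) hη0.le)
  have hFnn : ∀ z ∈ Ω, ∀ X, 0 ≤ hs F X z := by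
    intro z hz X
    by_cases hX : X = 0
    · have := hs_smul_real (hF2 z hz) 0 X
      rw [hX, smul_zero] at this
      rw [hX, this]; simp
    have e : hs F X z = _ := hs_comp (hf2 z hz) (contDiff_chiTrunc a b).contDiffAt
    rw [e]
    rcases lt_or_ge (-δ) (r z) with hd | hd
    · refine add_nonneg (mul_nonneg ?_ (hfpos z hz hd X hX).le)
        (mul_nonneg (deriv_deriv_chiTrunc_nonneg hab _) (normSq_nonneg _))
      rw [deriv_chiTrunc]
      exact rstep_nonneg _ _ _
    · have hlt : f z < -b :=
        neg_lt_neg (Real.rpow_lt_rpow (by positivity) (by linarith) hη0)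
      rw [deriv_deriv_chiTrunc_of_lt hab hlt, deriv_chiTrunc,
        rstep_of_le (by linarith) hlt.le]
      simp
  -- smallness of the perturbation on the transition layer
  have hK : IsCompact ({z | z ∈ closure Ω ∧ -r z ∈ Set.Icc (δ / 4) (δ / 2)} ×ˢ
      Metric.sphere (0 : Pt n) 1) := by
    refine IsCompact.prod ?_ (isCompact_sphere 0 1)
    refine hbdd.isCompact_closure.of_isClosed_subset ?_ fun z hz => hz.1
    have hc : ContinuousOn (fun z => -r z) (closure Ω) := fun z hz =>
      (hr2 z (h.2.1 hz)).continuousAt.neg.continuousWithinAt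
    exact hc.preimage_isClosed_of_isClosed isClosed_closure isClosed_Icc
  have hmemΩ : ∀ z ∈ closure Ω, r z < 0 → z ∈ Ω := fun z hz hr => h.mem_iff.2 ⟨h.2.1 hz, hr⟩
  obtain ⟨ε, hε0, hε⟩ : ∃ ε : ℝ, 0 < ε ∧ ∀ q ∈ ({z | z ∈ closure Ω ∧ -r z ∈
      Set.Icc (δ / 4) (δ / 2)} ×ˢ Metric.sphere (0 : Pt n) 1),
        0 < hs f q.2 q.1 + ε * hs g q.2 q.1 := by
    have key : ∀ q ∈ ({z | z ∈ closure Ω ∧ -r z ∈ Set.Icc (δ / 4) (δ / 2)} ×ˢ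
        Metric.sphere (0 : Pt n) 1), ∀ᶠ x : ℝ × (Pt n × Pt n) in 𝓝 (0 : ℝ) ×ˢ 𝓝 q,
          0 < hs f x.2.2 x.2.1 + x.1 * hs g x.2.2 x.2.1 := by
      rintro ⟨z, X⟩ ⟨⟨hzc, hzr⟩, hX⟩
      simp only at hzc hzr hX
      have hzΩ : z ∈ Ω := hmemΩ z hzc (by linarith [hzr.1])
      have hX0 : X ≠ 0 := ne_zero_of_mem_unit_sphere ⟨X, hX⟩
      rw [← nhds_prod_eq]
      have c1 : ContinuousAt (fun x : ℝ × (Pt n × Pt n) => hs f x.2.2 x.2.1) (0, (z, X)) :=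
        ContinuousAt.comp (f := Prod.snd) (g := fun q : Pt n × Pt n => hs f q.2 q.1)
          (continuousAt_hs_joint (hf2 z hzΩ) X) continuousAt_snd
      have c2 : ContinuousAt (fun x : ℝ × (Pt n × Pt n) => hs g x.2.2 x.2.1) (0, (z, X)) :=
        ContinuousAt.comp (f := Prod.snd) (g := fun q : Pt n × Pt n => hs g q.2 q.1)
          (continuousAt_hs_joint (hg2 z (hΩV hzΩ)) X) continuousAt_snd
      refine (c1.add (continuousAt_fst.mul c2)).eventually (lt_mem_nhds ?_)
      show 0 < hs f X z + 0 * hs g X z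
      rw [zero_mul, add_zero]
      exact hfpos z hzΩ (by linarith [hzr.2]) X hX0
    have h0 : ∀ᶠ ε : ℝ in 𝓝 0, ∀ q ∈ ({z | z ∈ closure Ω ∧ -r z ∈ Set.Icc (δ / 4) (δ / 2)} ×ˢ
        Metric.sphere (0 : Pt n) 1), 0 < hs f q.2 q.1 + ε * hs g q.2 q.1 :=
      hK.eventually_forall_of_forall_eventually
        (P := fun (ε : ℝ) (q : Pt n × Pt n) => 0 < hs f q.2 q.1 + ε * hs g q.2 q.1)
        fun q hq => by
          rw [nhds_prod_eq]
          exact key q hq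
    have h1 := h0.filter_mono (nhdsWithin_le_nhds (s := Set.Ioi (0 : ℝ)))
    obtain ⟨ε, h2, h3⟩ := (h1.and self_mem_nhdsWithin).exists
    exact ⟨ε, h3, h2⟩
  set w : Pt n → ℝ := fun z => F z + ε * g z with hw
  have hw2 : ∀ z ∈ Ω, ContDiffAt ℝ 2 w z := fun z hz =>
    (hF2 z hz).add (contDiffAt_const.mul (hg2 z (hΩV hz)))
  have hwneg : ∀ z ∈ Ω, w z < 0 := by
    intro z hz
    have h1 : F z < 0 := chiTrunc_neg ha0 hab (hfneg z hz)
    have h2 : g z ≤ 0 := mul_nonpos_of_nonneg_of_nonpos (rstep_nonneg _ _ _)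
      (by linarith [hC z hz])
    have := mul_nonpos_of_nonneg_of_nonpos hε0.le h2
    show F z + ε * g z < 0
    linarith
  have hweq : ∀ z ∈ Ω, -(δ / 4) ≤ r z → w z = f z := by
    intro z hz hrz
    have h1 : g z = 0 := by
      show rstep _ _ _ * _ = 0
      rw [rstep_of_le (by linarith) (by linarith), zero_mul]
    show F z + ε * g z = f z
    rw [hFeq z hz (by linarith), h1, mul_zero, add_zero]
  have hwhs : ∀ z ∈ Ω, ∀ X, hs w X z = hs F X z + ε * hs g X z := by
    intro z hz X
    rw [← hs_const_mul ε (hg2 z (hΩV hz))]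
    exact hs_add (hF2 z hz) (contDiffAt_const.mul (hg2 z (hΩV hz))) X
  have hrev : ∀ z ∈ V, ∀ t, t < r z → ∀ᶠ y in 𝓝 z, t < r y := fun z hz t ht =>
    (hr2 z hz).continuousAt.eventually (lt_mem_nhds ht)
  have hΩo : IsOpen Ω := h.isOpen
  have hwpos1 : ∀ z ∈ Ω, ∀ X : Pt n, ‖X‖ = 1 → 0 < hs w X z := by
    intro z hz X hX1
    have hX0 : X ≠ 0 := by
      rintro rfl
      simp at hX1
    rcases lt_or_ge (-(δ / 4)) (r z) with h1 | h1
    · have : w =ᶠ[𝓝 z] f := by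
        filter_upwards [hrev z (hΩV hz) _ h1, hΩo.mem_nhds hz] with y hy hyΩ
        exact hweq y hyΩ hy.le
      rw [hs_congr this]
      exact hfpos z hz (by linarith) X hX0
    rcases le_or_gt (-(δ / 2)) (r z) with h2 | h2
    · have h3 := hε (z, X) ⟨⟨subset_closure hz, by linarith, by linarith⟩, by simpa using hX1⟩
      rw [hwhs z hz]
      rcases h2.eq_or_lt with h4 | h4
      · have e : hs F X z = _ := hs_comp (hf2 z hz) (contDiff_chiTrunc a b).contDiffAt
        have hfa : f z = -a := by
          show -(-r z) ^ η = -a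
          rw [← h4, neg_neg]
        rw [e, deriv_chiTrunc, hfa, rstep_of_ge (by linarith) le_rfl, one_mul, ← deriv_chiTrunc]
        have := mul_nonneg (deriv_deriv_chiTrunc_nonneg hab (-a)) (normSq_nonneg (pW (cR n f) X z))
        simp only at h3
        linarith
      · have : F =ᶠ[𝓝 z] f := by
          filter_upwards [hrev z (hΩV hz) _ h4, hΩo.mem_nhds hz] with y hy hyΩ
          exact hFeq y hyΩ hy.le
        rw [hs_congr this]
        exact h3
    · have : g =ᶠ[𝓝 z] fun y => esq y + -C := by
        filter_upwards [(hr2 z (hΩV hz)).continuousAt.eventually (gt_mem_nhds h2)] with y hy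
        show rstep _ _ _ * _ = _
        rw [rstep_of_ge (by linarith) (by linarith), one_mul, sub_eq_add_neg]
      have h3 : hs g X z = esq X := by
        rw [hs_congr this, hs_add contDiff_esq.contDiffAt contDiffAt_const, hs_esq]
        simp [hs]
      rw [hwhs z hz, h3]
      have := mul_pos hε0 (esq_pos hX0)
      linarith [hFnn z hz X]
  have hwpos : ∀ z ∈ Ω, ∀ X : Pt n, X ≠ 0 → 0 < hs w X z := by
    intro z hz X hX
    have h1 := hwpos1 z hz (‖X‖⁻¹ • X) (by
      rw [norm_smul, norm_inv, norm_norm, inv_mul_cancel₀ (norm_ne_zero_iff.2 hX)])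
    rw [hs_smul_real (hw2 z hz)] at h1
    exact pos_of_mul_pos_right h1 (sq_nonneg _)
  -- the modified defining function
  classical
  set ρ : Pt n → ℝ := fun z => if z ∈ Ω then -(-w z) ^ (1 / η) else r z with hρ
  have hρeq : ∀ z, (z ∈ Ω → -(δ / 4) ≤ r z) → ρ z = r z := by
    intro z hz
    by_cases hzΩ : z ∈ Ω
    · have h1 : ρ z = -(-w z) ^ (1 / η) := if_pos hzΩ
      rw [h1, hweq z hzΩ (hz hzΩ)]
      show -(- -(-r z) ^ η) ^ (1 / η) = r z
      rw [neg_neg, ← Real.rpow_mul (by linarith [hneg z hzΩ]), mul_one_div_cancel hη0.ne',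
        Real.rpow_one, neg_neg]
    · exact if_neg hzΩ
  have hρnear : ∀ z ∈ V, -(δ / 4) < r z → ρ =ᶠ[𝓝 z] r := by
    intro z hz hrz
    filter_upwards [hrev z hz _ hrz] with y hy
    exact hρeq y fun _ => hy.le
  have hρin : ∀ z ∈ Ω, ρ =ᶠ[𝓝 z] fun y => -(-w y) ^ (1 / η) := by
    intro z hz
    filter_upwards [hΩo.mem_nhds hz] with y hy
    exact if_pos hy
  refine ⟨ρ, ⟨h.1, h.2.1, ?_, ?_, ?_⟩, ?_⟩
  · intro z hz
    refine ContDiffAt.contDiffWithinAt ?_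
    rcases lt_or_ge (-(δ / 4)) (r z) with h1 | h1
    · exact ((hr2 z hz).of_le (by norm_num)).congr_of_eventuallyEq (hρnear z hz h1)
    · have hzΩ : z ∈ Ω := h.mem_iff.2 ⟨hz, by linarith⟩
      have h2 : ContDiffAt ℝ 2 (fun y => -(-w y) ^ (1 / η)) z :=
        (contDiffAt_neg_rpow (1 / η) (hwneg z hzΩ)).comp z (hw2 z hzΩ)
      exact (h2.of_le (by norm_num)).congr_of_eventuallyEq (hρin z hzΩ)
  · ext z
    constructor
    · intro hz
      refine ⟨hΩV hz, ?_⟩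
      have h1 : ρ z = -(-w z) ^ (1 / η) := if_pos hz
      rw [h1]
      exact neg_neg_of_pos (Real.rpow_pos_of_pos (by linarith [hwneg z hz]) _)
    · rintro ⟨hz, hlt⟩
      by_contra hzΩ
      rw [show ρ z = r z from if_neg hzΩ] at hlt
      exact hzΩ (h.mem_iff.2 ⟨hz, hlt⟩)
  · intro z hz
    rw [(hρnear z (h.frontier_subset hz) (by rw [h.eq_zero hz]; linarith)).fderiv_eq]
    exact h.2.2.2.2 z hz
  · have heq : ∀ z ∈ Ω, (fun y => -((-ρ y) ^ η)) =ᶠ[𝓝 z] w := by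
      intro z hz
      filter_upwards [hΩo.mem_nhds hz] with y hy
      have h1 : ρ y = -(-w y) ^ (1 / η) := if_pos hy
      rw [h1, neg_neg, ← Real.rpow_mul (by linarith [hwneg y hy]), one_div_mul_cancel hη0.ne',
        Real.rpow_one, neg_neg]
    refine strictPSHOn_of_hs (fun z hz => (hw2 z hz).congr_of_eventuallyEq (heq z hz)) ?_
    intro z hz X hX
    rw [hs_congr (heq z hz)]
    exact hwpos z hz X hX

end globalize

section directionA

variable {n : ℕ} {r : Pt n → ℝ} {Ω V : Set (Pt n)} {s : ℕ∞} {z p L X Y : Pt n}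

/-- The pointwise curvature condition at a null vector in terms of `kc` and `wv`. -/
lemma condition_iff (h : ContDiffAt ℝ 3 r p) (hg : gradSq n r p ≠ 0) (hL : L ∈ nullSp n r p)
    (c : ℝ) :
    (c : ℂ) * omegaWedge (dAngelo n r) (L, 0) (0, conjVec L) p -
          delbOmega (dAngelo n r) (L, 0) (0, conjVec L) p ≤ 0 ↔
      (kc r p L).re + c * normSq (wv r p L) ≤ 0 ∧ (kc r p L).im = 0 := by
  rw [omegaWedge_dAngelo (h.of_le (by norm_num)) hg, kc_dAngelo h hg hL, Complex.le_def]
  simp only [sub_re, sub_im, mul_re, mul_im, ofReal_re, ofReal_im, neg_re, neg_im, conj_re,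
    conj_im, zero_re, zero_im, mul_zero, zero_mul, sub_zero, add_zero, zero_sub, neg_neg]
  constructor
  · rintro ⟨h1, h2⟩
    exact ⟨by linarith, by linarith⟩
  · rintro ⟨h1, h2⟩
    exact ⟨by linarith, by linarith⟩

lemma IsDefining.mul_exp (h : IsDefining n s Ω r V) (hs3 : 3 ≤ s) {ψ : Pt n → ℝ}
    (hψ : ContDiff ℝ s ψ) : IsDefining n s Ω (fun y => r y * Real.exp (ψ y)) V := by
  refine ⟨h.1, h.2.1, h.2.2.1.mul (Real.contDiff_exp.comp hψ).contDiffOn, ?_, ?_⟩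
  · ext z
    rw [h.mem_iff]
    refine and_congr_right fun _ => ⟨fun hz => mul_neg_of_neg_of_pos hz (Real.exp_pos _),
      fun hz => ?_⟩
    exact neg_of_mul_neg_left hz (Real.exp_pos _).le
  · intro z hz
    have hrd := ((h.contDiffAt_three hs3 (h.frontier_subset hz)).of_le (m := 1)
      (by norm_num)).differentiableAt (by norm_num)
    have hψd : DifferentiableAt ℝ ψ z := (hψ.of_le (m := 1) (show (1 : WithTop ℕ∞) ≤ s from
      WithTop.coe_le_coe.2 (le_trans (by norm_num) hs3))).contDiffAt.differentiableAt (by norm_num)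
    rw [Ne, ← gradSq_eq_zero_iff, gradSq_mul_exp hrd hψd (h.eq_zero hz)]
    exact mul_ne_zero (by positivity) (h.gradSq_ne_zero hz)

lemma mem_weakPts_of_null (hp : p ∈ frontier Ω) (hL : L ∈ nullSp n r p) (hL0 : L ≠ 0) :
    p ∈ weakPts n r Ω := ⟨hp, L, hL.1, hL0, hL.2 L hL.1⟩

/-- A strict curvature condition gives a strictly plurisubharmonic power near the boundary. -/
lemma exists_collar (h : IsDefining n s Ω r V) (hs3 : 3 ≤ s) (hpsc : LeviPseudoconvex n r Ω)
    (hbdd : Bornology.IsBounded Ω) {η : ℝ} (hη1 : η < 1)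
    (hQ : ∀ p ∈ frontier Ω, ∀ L ∈ nullSp n r p, L ≠ 0 →
      (kc r p L).re + η / (1 - η) * normSq (wv r p L) < 0) :
    ∃ δ > 0, ∀ z ∈ Ω, -δ < r z → ∀ X : Pt n, X ≠ 0 → 0 < dfq r η z X := by
  have hr2 : ∀ z ∈ V, ContDiffAt ℝ 2 r z := fun z hz =>
    (h.contDiffAt_three hs3 hz).of_le (by norm_num)
  have hΩV : Ω ⊆ V := subset_closure.trans h.2.1
  have hfr : IsCompact (frontier Ω) :=
    hbdd.isCompact_closure.of_isClosed_subset isClosed_frontier frontier_subset_closure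
  have hpt : ∀ q ∈ frontier Ω ×ˢ Metric.sphere (0 : Pt n) 1, ∀ᶠ x : Pt n × Pt n in 𝓝 q,
      r x.1 < 0 → 0 < dfq r η x.1 x.2 := by
    rintro ⟨p, X⟩ ⟨hp, hX⟩
    simp only at hp hX
    have hX0 : X ≠ 0 := ne_zero_of_mem_unit_sphere ⟨X, hX⟩
    have h2 := hr2 p (h.frontier_subset hp)
    by_cases hT : X ∈ T10 n r p
    · rcases lt_or_ge 0 (hs r X p) with hpos | hnp
      · exact dfq_pos_of_hs_pos h2 hη1 hpos
      · have hnull : X ∈ nullSp n r p := mem_nullSp_of_levi_self h2 (hpsc p hp) hT (by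
          rw [levi_self_eq_hs h2, ofReal_re]; exact hnp)
        exact dfq_pos_of_null h hs3 hpsc hp hnull hη1 (hQ p hp X hnull hX0)
    · exact (dfq_pos_of_not_mem_T10 h2 (h.eq_zero hp) hη1 hT).mono fun _ hx _ => hx
  obtain ⟨u, v, hu, -, hfu, hsv, huv⟩ := generalized_tube_lemma hfr
    (isCompact_sphere (0 : Pt n) 1) (isOpen_setOfPred_eventually_nhds (p := fun x : Pt n × Pt n =>
      r x.1 < 0 → 0 < dfq r η x.1 x.2)) hpt
  have hK : IsCompact (closure Ω \ u) := hbdd.isCompact_closure.diff hu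
  have hKpos : ∀ z ∈ closure Ω \ u, 0 < -r z := by
    rintro z ⟨hz, hzu⟩
    have hzΩ : z ∈ Ω := by
      by_contra hcon
      refine hzu (hfu ?_)
      rw [frontier, h.isOpen.interior_eq]
      exact ⟨hz, hcon⟩
    linarith [h.neg_of_mem hzΩ]
  have hKc : ContinuousOn (fun z => -r z) (closure Ω \ u) := fun z hz =>
    (hr2 z (h.2.1 hz.1)).continuousAt.neg.continuousWithinAt
  obtain ⟨δ, hδ, hδK⟩ := hK.exists_forall_le' hKc hKpos
  refine ⟨δ, hδ, fun z hz hrz X hX => ?_⟩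
  have hzu : z ∈ u := by
    by_contra hcon
    have := hδK z ⟨subset_closure hz, hcon⟩
    linarith
  have h1 : 0 < dfq r η z (‖X‖⁻¹ • X) := by
    have hX1 : ‖X‖⁻¹ • X ∈ Metric.sphere (0 : Pt n) 1 := by
      rw [mem_sphere_zero_iff_norm, norm_smul, norm_inv, norm_norm,
        inv_mul_cancel₀ (norm_ne_zero_iff.2 hX)]
    have h2 : ∀ᶠ x : Pt n × Pt n in 𝓝 (z, ‖X‖⁻¹ • X), r x.1 < 0 → 0 < dfq r η x.1 x.2 :=
      huv (Set.mk_mem_prod hzu (hsv hX1))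
    exact h2.self_of_nhds (h.neg_of_mem hz)
  rw [dfq_smul_real (hr2 z (hΩV hz))] at h1
  exact pos_of_mul_pos_right h1 (sq_nonneg _)

lemma div_one_sub_lt {η η₁ : ℝ} (h : η < η₁) (h1 : η₁ < 1) : η / (1 - η) < η₁ / (1 - η₁) := by
  rw [div_lt_div_iff₀ (by linarith) (by linarith)]
  nlinarith

lemma exists_strictPSH_of_condition (h : IsDefining n s Ω r V) (hs3 : 3 ≤ s)
    (hpsc : ∀ ρ V, IsDefining n s Ω ρ V → LeviPseudoconvex n ρ Ω)
    (hbdd : Bornology.IsBounded Ω) {η η₁ : ℝ} (hη0 : 0 < η) (hη : η < η₁) (hη1 : η₁ < 1)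
    (hQ : ∀ p ∈ weakPts n r Ω, ∀ L ∈ nullSp n r p,
      ((η₁ / (1 - η₁) : ℝ) : ℂ) * omegaWedge (dAngelo n r) (L, 0) (0, conjVec L) p -
          delbOmega (dAngelo n r) (L, 0) (0, conjVec L) p ≤ 0) :
    ∃ ρ, IsDefining n 1 Ω ρ V ∧ StrictPSHOn n (fun z => -((-ρ z) ^ η)) Ω := by
  obtain ⟨R, hR⟩ := ((hbdd.isCompact_closure.of_isClosed_subset isClosed_frontier
    frontier_subset_closure).image (contDiff_esq (n := n) (k := 0)).continuous).bddAbove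
  have hR' : ∀ z ∈ frontier Ω, esq z ≤ max R 0 := fun z hz => le_max_of_le_left (hR ⟨z, hz, rfl⟩)
  obtain ⟨ε, hε, htilt⟩ := riccati_tilt (n := n) (c := η / (1 - η)) (c1 := η₁ / (1 - η₁))
    (div_pos hη0 (by linarith)) (div_one_sub_lt hη hη1) (le_max_right R 0)
  set ψ : Pt n → ℝ := fun y => -ε * esq y with hψ
  have hψc : ∀ k : WithTop ℕ∞, ContDiff ℝ k ψ := fun k => contDiff_const.mul contDiff_esq
  have hr' := h.mul_exp hs3 (hψc s)
  obtain ⟨δ, hδ, hcol⟩ := exists_collar hr' hs3 (hpsc _ _ hr') hbdd (hη.trans hη1) (by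
    intro p hp L hL hL0
    have h3 := h.contDiffAt_three hs3 (h.frontier_subset hp)
    have h2 : ContDiffAt ℝ 2 r p := h3.of_le (by norm_num)
    have h0 := h.eq_zero hp
    have hg := h.gradSq_ne_zero hp
    have hL' : L ∈ nullSp n r p := (nullSp_mul_exp h2 (hψc 2).contDiffAt h0).1 hL
    have hc := ((condition_iff h3 hg hL' _).1
      (hQ p (mem_weakPts_of_null hp hL' hL0) L hL')).1
    rw [kc_mul_exp h3 (hψc 3).contDiffAt h0 hg hL', wv_mul_exp h2 (hψc 2).contDiffAt h0 hg hL'.1,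
      add_re, ofReal_re]
    have h4 : 0 ≤ ε / 4 * esq L := mul_nonneg (by positivity) (esq_nonneg L)
    exact htilt _ _ L p hL0 (hR' p hp) (hc.trans h4))
  exact exists_global_of_collar hr' (le_trans (by norm_num) hs3) hbdd hη0 hδ hcol

end directionA

section pointwisePSH

variable {n : ℕ} {f : Pt n → ℝ} {Ω : Set (Pt n)} {z X : Pt n}

lemma two_mul_re_pB_cR (f : Pt n → ℝ) (X z : Pt n) :
    2 * (pB (cR n f) X z).re = fderiv ℝ f z X := by
  rw [pB, fderiv_cR_apply, fderiv_cR_apply]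
  simp

lemma differentiableAt_fderiv_apply_of_dZb
    (h : ∀ k, DifferentiableAt ℝ (dZb n (cR n f) k) z) (X : Pt n) :
    DifferentiableAt ℝ (fun y => fderiv ℝ f y X) z := by
  have h1 : (fun y => fderiv ℝ f y X) =
      fun y => 2 * (∑ k, (starRingEnd ℂ) (X k) * dZb n (cR n f) k y).re := by
    funext y; rw [← two_mul_re_pB_cR, pB_eq_sum]
  rw [h1]
  have h2 : DifferentiableAt ℝ (fun y => ∑ k, (starRingEnd ℂ) (X k) * dZb n (cR n f) k y) z :=
    .fun_sum fun k _ => (h k).const_mul _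
  exact (reCLM.differentiableAt.comp z h2).const_mul 2

lemma StrictPSHOn.differentiableAt_dZb (h : StrictPSHOn n f Ω) (hz : z ∈ Ω) (k : Fin n) :
    DifferentiableAt ℝ (dZb n (cR n f) k) z := by
  by_contra hn
  have h1 := h z hz (Pi.single k 1) (by
    intro h0; have := congrFun h0 k; simp at this)
  rw [levi, Finset.sum_eq_single k, Finset.sum_eq_single k] at h1
  · change 0 < ((1 / 2 : ℂ) * (fderiv ℝ (dZb n (cR n f) k) z _ - I *
      fderiv ℝ (dZb n (cR n f) k) z _) * _ * _).re at h1
    rw [fderiv_zero_of_not_differentiableAt hn] at h1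
    simp at h1
  · intro b _ hb; simp [hb]
  · simp
  · intro b _ hb; simp [hb]
  · simp

lemma StrictPSHOn.differentiableAt_fderiv_apply (h : StrictPSHOn n f Ω) (hz : z ∈ Ω) (X : Pt n) :
    DifferentiableAt ℝ (fun y => fderiv ℝ f y X) z :=
  differentiableAt_fderiv_apply_of_dZb (h.differentiableAt_dZb hz) X

lemma StrictPSHOn.re_levi_self (h : StrictPSHOn n f Ω) (hz : z ∈ Ω) (X : Pt n) :
    (levi n f z X X).re = hs f X z := by
  have hd := h.differentiableAt_dZb hz
  have h1 : pB (cR n f) X = fun y => ∑ k, (starRingEnd ℂ) (X k) * dZb n (cR n f) k y := by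
    funext y; exact pB_eq_sum _ _ _
  have h2 : levi n f z X X = pW (pB (cR n f) X) X z := by
    rw [h1, pW_sum _ (fun k _ => (hd k).const_mul _), levi, Finset.sum_comm]
    refine Finset.sum_congr rfl fun k _ => ?_
    rw [pW_const_mul _ (hd k), pW_eq_sum, Finset.mul_sum]
    refine Finset.sum_congr rfl fun j _ => ?_
    ring
  have h3 : ∀ Y, fderiv ℝ (pB (cR n f) X) z Y = (1 / 2 : ℂ) *
      ((fderiv ℝ (fun y => fderiv ℝ f y X) z Y : ℂ) + I *
        (fderiv ℝ (fun y => fderiv ℝ f y (I • X)) z Y : ℂ)) := by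
    intro Y
    have e1 : pB (cR n f) X = fun y => (1 / 2 : ℂ) * (cR n (fun y => fderiv ℝ f y X) y + I *
        cR n (fun y => fderiv ℝ f y (I • X)) y) := by
      funext y; rw [pB, fderiv_cR_apply, fderiv_cR_apply]; rfl
    have d1 := differentiableAt_cR.2 (h.differentiableAt_fderiv_apply hz X)
    have d2 := differentiableAt_cR.2 (h.differentiableAt_fderiv_apply hz (I • X))
    rw [e1, fderiv_const_mul (d1.fun_add (d2.const_mul _)), fderiv_fun_add d1 (d2.const_mul _),
      fderiv_const_mul d2]
    simp only [smul_apply, add_apply, smul_eq_mul, fderiv_cR_apply]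
  rw [h2, pW, h3, h3, hs]
  simp
  ring

lemma StrictPSHOn.hs_nonneg (h : StrictPSHOn n f Ω) (hz : z ∈ Ω) (X : Pt n) : 0 ≤ hs f X z := by
  by_cases hX : X = 0
  · simp [hX, hs]
  · rw [← h.re_levi_self hz]; exact (h z hz X hX).le

end pointwisePSH

section divergence

open MeasureTheory

lemma setIntegral_box_nonneg_of_divergence {m : ℕ} (I : BoxIntegral.Box (Fin (m + 1)))
    (F : (Fin (m + 1) → ℝ) → Fin (m + 1) → ℝ)
    (F' : (Fin (m + 1) → ℝ) → (Fin (m + 1) → ℝ) →L[ℝ] (Fin (m + 1) → ℝ))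
    (hF : ∀ x, HasFDerivAt F (F' x) x)
    (h0 : ∀ x, (∃ i, x i = I.lower i ∨ x i = I.upper i) → F x = 0)
    (g₁ g₂ : (Fin (m + 1) → ℝ) → ℝ) (hg₁ : ∀ x, 0 ≤ g₁ x) (hg₂ : Continuous g₂)
    (hdiv : ∀ x, ∑ i, F' x (Pi.single i 1) i = g₁ x - g₂ x) : 0 ≤ ∫ x in (I : Set _), g₂ x := by
  have h1 := BoxIntegral.hasIntegral_GP_divergence_of_forall_hasDerivWithinAt I F F' ∅
    Set.countable_empty (by simp) (fun x _ => (hF x).hasFDerivWithinAt)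
  have h2 : ∀ i, ∀ x, F (i.insertNth (I.upper i) x) i = 0 := fun i x => by
    rw [h0 _ ⟨i, Or.inr (by simp)⟩]; rfl
  have h3 : ∀ i, ∀ x, F (i.insertNth (I.lower i) x) i = 0 := fun i x => by
    rw [h0 _ ⟨i, Or.inl (by simp)⟩]; rfl
  simp only [h2, h3, sub_self, Finset.sum_const_zero, hdiv] at h1
  have h4 := (hg₂.continuousOn (s := BoxIntegral.Box.Icc I)).hasBoxIntegral volume
    BoxIntegral.IntegrationParams.GP
  have h5 := h1.add h4
  have h6 : (fun x => g₁ x - g₂ x) + g₂ = g₁ := by funext x; simp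
  rw [h6, zero_add] at h5
  rw [← h5.integral_eq]
  exact BoxIntegral.integral_nonneg (fun x _ => hg₁ x) volume

lemma integral_nonneg_of_divergence {E : Type*} [NormedAddCommGroup E] [NormedSpace ℝ E]
    [FiniteDimensional ℝ E] [MeasurableSpace E] [BorelSpace E] (μ : Measure E)
    [μ.IsAddHaarMeasure] {m : ℕ} (hE : Module.finrank ℝ E = m + 1) {A B g₁ g₂ : E → ℝ} (v w : E)
    (hA : Differentiable ℝ A) (hB : Differentiable ℝ B) (hAc : HasCompactSupport A)
    (hBc : HasCompactSupport B) (hg₁ : ∀ x, 0 ≤ g₁ x) (hg₂ : Continuous g₂)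
    (hgc : HasCompactSupport g₂)
    (hdiv : ∀ x, fderiv ℝ A x v + fderiv ℝ B x w = g₁ x - g₂ x) : 0 ≤ ∫ x, g₂ x ∂μ := by
  have T : (Fin (m + 1) → ℝ) ≃L[ℝ] E := ContinuousLinearEquiv.ofFinrankEq (by simp [hE])
  obtain ⟨R, hR0, hR⟩ : ∃ R : ℝ, 0 < R ∧ ∀ x : Fin (m + 1) → ℝ,
      R ≤ ‖x‖ → A (T x) = 0 ∧ B (T x) = 0 ∧ g₂ (T x) = 0 := by
    have hc : IsCompact (T.symm '' (tsupport A ∪ tsupport B ∪ tsupport g₂)) :=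
      ((hAc.isCompact.union hBc.isCompact).union hgc.isCompact).image T.symm.continuous
    obtain ⟨R, hR0, hR⟩ := hc.isBounded.exists_pos_norm_lt
    refine ⟨R, hR0, fun x hx => ?_⟩
    have : T x ∉ tsupport A ∪ tsupport B ∪ tsupport g₂ := fun h =>
      absurd (hR x ⟨T x, h, by simp⟩) (not_lt.2 hx)
    simp only [Set.mem_union, not_or] at this
    exact ⟨image_eq_zero_of_notMem_tsupport this.1.1, image_eq_zero_of_notMem_tsupport this.1.2,
      image_eq_zero_of_notMem_tsupport this.2⟩
  let I : BoxIntegral.Box (Fin (m + 1)) := ⟨fun _ => -R, fun _ => R, fun _ => by linarith⟩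
  have hT : ∀ x, HasFDerivAt T (T : (Fin (m + 1) → ℝ) →L[ℝ] E) x := fun x => T.hasFDerivAt
  have key := setIntegral_box_nonneg_of_divergence I
    (fun x => A (T x) • T.symm v + B (T x) • T.symm w)
    (fun x => ((fderiv ℝ A (T x)).comp (T : (Fin (m + 1) → ℝ) →L[ℝ] E)).smulRight (T.symm v) +
      ((fderiv ℝ B (T x)).comp (T : (Fin (m + 1) → ℝ) →L[ℝ] E)).smulRight (T.symm w))
    (fun x => (((hA _).hasFDerivAt.comp x (hT x)).smul_const _).add
      (((hB _).hasFDerivAt.comp x (hT x)).smul_const _))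
    (fun x hx => by
      obtain ⟨i, hi⟩ := hx
      have hxi : R ≤ ‖x‖ := by
        refine le_trans ?_ (norm_le_pi_norm x i)
        rcases hi with hi | hi <;> · rw [hi]; simp [I, abs_of_pos hR0]
      obtain ⟨a, b, -⟩ := hR x hxi
      simp [a, b])
    (fun x => g₁ (T x)) (fun x => g₂ (T x)) (fun x => hg₁ _) (hg₂.comp T.continuous)
    (fun x => by
      rw [← hdiv]
      have aux : ∀ (l : E →L[ℝ] ℝ) (u : E), ∑ i, l (T (Pi.single i 1)) * T.symm u i = l u := by
        intro l u
        have := LinearMap.pi_apply_eq_sum_univ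
          ((l.comp (T : (Fin (m + 1) → ℝ) →L[ℝ] E)).toLinearMap) (T.symm u)
        simp only [ContinuousLinearMap.coe_coe, ContinuousLinearMap.comp_apply,
          ContinuousLinearEquiv.coe_coe, T.apply_symm_apply] at this
        rw [this]
        refine Finset.sum_congr rfl fun i _ => ?_
        rw [smul_eq_mul, mul_comm]
        congr 3
        funext j
        simp [Pi.single_apply, eq_comm]
      simp only [add_apply, ContinuousLinearMap.smulRight_apply, ContinuousLinearMap.comp_apply,
        Pi.add_apply, Pi.smul_apply, smul_eq_mul, Finset.sum_add_distrib]
      exact congrArg₂ _ (aux _ _) (aux _ _))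
  have h1 : ∫ x in (I : Set _), g₂ (T x) = ∫ x, g₂ (T x) := by
    refine setIntegral_eq_integral_of_forall_compl_eq_zero fun x hx => (hR x ?_).2.2
    by_contra hlt
    push Not at hlt
    refine hx ?_
    rw [BoxIntegral.Box.mem_coe, BoxIntegral.Box.mem_def]
    intro i
    have := (norm_le_pi_norm x i).trans_lt hlt
    rw [Real.norm_eq_abs, abs_lt] at this
    exact ⟨this.1, this.2.le⟩
  have h2 : ∫ x, g₂ (T x) = ∫ y, g₂ y ∂(Measure.map T volume) := by
    exact (T.toHomeomorph.measurableEmbedding.integral_map g₂).symm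
  have : (Measure.map T (volume : Measure (Fin (m+1) → ℝ))).IsAddHaarMeasure :=
    T.isAddHaarMeasure_map _
  have h3 := Measure.isAddLeftInvariant_eq_smul μ (Measure.map T volume)
  rw [h1, h2] at key
  rw [h3, integral_smul_nnreal_measure]
  exact smul_nonneg (by positivity) key

end divergence

section mollify

open MeasureTheory Convolution

variable {n : ℕ} {f p G χ : Pt n → ℝ} {Ω : Set (Pt n)} {z X : Pt n}

lemma wronskian_fderiv (hf : ∀ z ∈ Ω, DifferentiableAt ℝ f z)
    (hd : ∀ z ∈ Ω, ∀ X, DifferentiableAt ℝ (fun y => fderiv ℝ f y X) z) (hp : ContDiff ℝ 2 p)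
    (hs : tsupport p ⊆ Ω) (v z : Pt n) :
    DifferentiableAt ℝ (fun y => p y * fderiv ℝ f y v - f y * fderiv ℝ p y v) z ∧
      fderiv ℝ (fun y => p y * fderiv ℝ f y v - f y * fderiv ℝ p y v) z v =
        p z * fderiv ℝ (fun y => fderiv ℝ f y v) z v -
          f z * fderiv ℝ (fun y => fderiv ℝ p y v) z v := by
  by_cases hz : z ∈ Ω
  · have d1 : DifferentiableAt ℝ p z := hp.contDiffAt.differentiableAt (by norm_num)
    have d2 : DifferentiableAt ℝ (fun y => fderiv ℝ p y v) z :=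
      (hp.contDiffAt.fderiv_apply_const (m := 1) (by norm_num) v).differentiableAt (by norm_num)
    have h := (d1.hasFDerivAt.mul (hd z hz v).hasFDerivAt).sub
      ((hf z hz).hasFDerivAt.mul d2.hasFDerivAt)
    refine ⟨h.differentiableAt, ?_⟩
    erw [h.fderiv]
    simp only [sub_apply, add_apply, smul_apply, smul_eq_mul]
    ring
  · have h0 : p =ᶠ[𝓝 z] fun _ => 0 := notMem_tsupport_iff_eventuallyEq.1 fun h => hz (hs h)
    have h1 : (fun y => fderiv ℝ p y v) =ᶠ[𝓝 z] fun _ => 0 := by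
      filter_upwards [h0.fderiv (𝕜 := ℝ)] with y hy
      rw [hy]; simp
    have h2 : (fun y => p y * fderiv ℝ f y v - f y * fderiv ℝ p y v) =ᶠ[𝓝 z] fun _ => 0 := by
      filter_upwards [h0, h1] with y hy hy'
      rw [hy, hy']; ring
    refine ⟨(differentiableAt_const 0).congr_of_eventuallyEq h2, ?_⟩
    rw [h2.fderiv_eq, h1.fderiv_eq, h0.eq_of_nhds]
    simp

lemma hs_eq_zero_of_notMem (h : z ∉ tsupport p) (X : Pt n) : hs p X z = 0 := by
  have h0 : p =ᶠ[𝓝 z] fun _ => 0 := notMem_tsupport_iff_eventuallyEq.1 h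
  rw [hs_congr h0]
  simp [hs]

lemma continuous_hs (hp : ContDiff ℝ 2 p) (X : Pt n) : Continuous (hs p X) := by
  have h : ∀ v, Continuous fun z => fderiv ℝ (fun y => fderiv ℝ p y v) z v := fun v => by
    have h1 : ContDiff ℝ 1 fun y => fderiv ℝ p y v :=
      contDiff_iff_contDiffAt.2 fun y => hp.contDiffAt.fderiv_apply_const (by norm_num) v
    exact (h1.continuous_fderiv (by norm_num)).clm_apply continuous_const
  unfold hs
  exact ((h _).add (h _)).const_mul _

lemma integral_mul_hs_nonneg (hn : n ≠ 0) (hf : ∀ z ∈ Ω, DifferentiableAt ℝ f z)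
    (hd : ∀ z ∈ Ω, ∀ X, DifferentiableAt ℝ (fun y => fderiv ℝ f y X) z) (hp : ContDiff ℝ 2 p)
    (hpc : HasCompactSupport p) (hps : tsupport p ⊆ Ω) (hp0 : ∀ z, 0 ≤ p z) (X : Pt n)
    (hnn : ∀ z ∈ Ω, 0 ≤ hs f X z) : 0 ≤ ∫ z, f z * hs p X z := by
  obtain ⟨m, hm⟩ : ∃ m, Module.finrank ℝ (Pt n) = m + 1 := by
    refine Nat.exists_eq_succ_of_ne_zero ?_
    rw [Module.finrank_pi_fintype]
    simp [hn]
  have hcs : ∀ v, HasCompactSupport fun y => p y * fderiv ℝ f y v - f y * fderiv ℝ p y v := by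
    intro v
    refine hpc.of_isClosed_subset (isClosed_tsupport _) (closure_minimal ?_ (isClosed_tsupport _))
    intro y hy
    by_contra h
    have h0 : p =ᶠ[𝓝 y] fun _ => 0 := notMem_tsupport_iff_eventuallyEq.1 h
    have h1 : fderiv ℝ p y = 0 := by rw [h0.fderiv_eq]; simp
    exact hy (by simp [h1, h0.eq_of_nhds])
  have h0 : ∀ z, z ∉ tsupport p → f z * hs p X z = 0 := fun z hz => by
    rw [hs_eq_zero_of_notMem hz, mul_zero]
  have hcont : Continuous fun z => f z * hs p X z := by
    rw [continuous_iff_continuousAt]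
    intro z
    by_cases hz : z ∈ Ω
    · exact (hf z hz).continuousAt.mul (continuous_hs hp X).continuousAt
    · have : (fun z => f z * hs p X z) =ᶠ[𝓝 z] fun _ => 0 := by
        filter_upwards [(isClosed_tsupport p).isOpen_compl.mem_nhds fun h => hz (hps h)] with y hy
        exact h0 y hy
      exact continuousAt_const.congr this.symm
  have hcs2 : HasCompactSupport fun z => f z * hs p X z :=
    HasCompactSupport.intro hpc.isCompact h0
  have key := integral_nonneg_of_divergence (volume : Measure (Pt n)) hm (g₁ := fun z => 4 * (p z * hs f X z))
    (g₂ := fun z => 4 * (f z * hs p X z)) X (I • X)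
    (fun z => (wronskian_fderiv hf hd hp hps X z).1)
    (fun z => (wronskian_fderiv hf hd hp hps (I • X) z).1) (hcs _) (hcs _)
    (fun z => by
      by_cases hz : z ∈ Ω
      · have := hnn z hz; have := hp0 z; positivity
      · simp [image_eq_zero_of_notMem_tsupport fun h => hz (hps h)])
    (hcont.const_mul 4) (hcs2.mul_left)
    (fun z => by
      rw [(wronskian_fderiv hf hd hp hps X z).2, (wronskian_fderiv hf hd hp hps (I • X) z).2,
        hs, hs]
      ring)
  rw [integral_const_mul] at key
  linarith

open ContinuousLinearMap in
lemma fderiv_convolution_apply (hχ : ContDiff ℝ 1 χ) (hc : HasCompactSupport χ)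
    (hG : LocallyIntegrable G) (z X : Pt n) :
    fderiv ℝ (χ ⋆[lsmul ℝ ℝ, volume] G) z X =
      ((fun y => fderiv ℝ χ y X) ⋆[lsmul ℝ ℝ, volume] G) z := by
  have h := hc.hasFDerivAt_convolution_left (lsmul ℝ ℝ) hχ hG z
  rw [h.fderiv, convolution, convolution]
  have hi : ConvolutionExistsAt (fderiv ℝ χ) G z ((lsmul ℝ ℝ : ℝ →L[ℝ] ℝ →L[ℝ] ℝ).precompL (Pt n)) volume :=
    (hc.fderiv (𝕜 := ℝ)).convolutionExists_left _ (hχ.continuous_fderiv (by norm_num)) hG z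
  rw [ContinuousLinearMap.integral_apply hi]
  rfl

lemma hs_convolution (hχ : ContDiff ℝ 2 χ) (hc : HasCompactSupport χ)
    (hG : LocallyIntegrable G) (z X : Pt n) :
    hs (χ ⋆[ContinuousLinearMap.lsmul ℝ ℝ, volume] G) X z = ∫ y, G y * hs χ X (z - y) := by
  have h1 : ContDiff ℝ 1 χ := hχ.of_le (by norm_num)
  have h2 : ∀ v, ContDiff ℝ 1 fun y => fderiv ℝ χ y v := fun v =>
    contDiff_iff_contDiffAt.2 fun y => hχ.contDiffAt.fderiv_apply_const (by norm_num) v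
  have hcv : ∀ v, HasCompactSupport fun y => fderiv ℝ χ y v := fun v => hc.fderiv_apply (𝕜 := ℝ) v
  have hcv2 : ∀ v, HasCompactSupport fun x => fderiv ℝ (fun y => fderiv ℝ χ y v) x v :=
    fun v => (hcv v).fderiv_apply (𝕜 := ℝ) v
  have h3 : ∀ v, fderiv ℝ (fun y => fderiv ℝ (χ ⋆[ContinuousLinearMap.lsmul ℝ ℝ, volume] G) y v) z v =
      ((fun x => fderiv ℝ (fun y => fderiv ℝ χ y v) x v)
        ⋆[ContinuousLinearMap.lsmul ℝ ℝ, volume] G) z := by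
    intro v
    have : (fun y => fderiv ℝ (χ ⋆[ContinuousLinearMap.lsmul ℝ ℝ, volume] G) y v) =
        (fun y => fderiv ℝ χ y v) ⋆[ContinuousLinearMap.lsmul ℝ ℝ, volume] G := by
      funext y; exact fderiv_convolution_apply h1 hc hG y v
    rw [this, fderiv_convolution_apply (h2 v) (hcv v) hG]
  have hi : ∀ v, Integrable fun y => (fun x => fderiv ℝ (fun y => fderiv ℝ χ y v) x v) (z - y) * G y := by
    intro v
    have := (hcv2 v).convolutionExists_left (ContinuousLinearMap.lsmul ℝ ℝ)
      (((h2 v).continuous_fderiv (by norm_num)).clm_apply continuous_const) hG z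
    exact this.integrable_swap
  rw [hs, h3, h3, convolution_lsmul_swap, convolution_lsmul_swap]
  simp only [smul_eq_mul]
  rw [← integral_add (hi _) (hi _), ← integral_const_mul]
  congr 1
  funext y
  simp only [hs]
  ring

lemma fderiv_comp_const_sub_apply {g : Pt n → ℝ} (hg : Differentiable ℝ g) (z y v : Pt n) :
    fderiv ℝ (fun y => g (z - y)) y v = -fderiv ℝ g (z - y) v := by
  have h := (hg (z - y)).hasFDerivAt.comp y ((hasFDerivAt_id y).const_sub z)
  have e : (fun y => g (z - y)) = g ∘ HSub.hSub z := rfl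
  rw [e, h.fderiv]
  simp

lemma hs_comp_sub (hχ : ContDiff ℝ 2 χ) (z y X : Pt n) :
    hs (fun y => χ (z - y)) X y = hs χ X (z - y) := by
  have h1 : ∀ v, (fun y => fderiv ℝ (fun y => χ (z - y)) y v) = fun y => -fderiv ℝ χ (z - y) v := by
    intro v; funext y
    exact fderiv_comp_const_sub_apply (hχ.differentiable (by norm_num)) z y v
  have h2 : ∀ v, fderiv ℝ (fun y => fderiv ℝ (fun y => χ (z - y)) y v) y v =
      fderiv ℝ (fun y => fderiv ℝ χ y v) (z - y) v := by
    intro v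
    have hd : Differentiable ℝ fun y => fderiv ℝ χ y v := fun y =>
      (hχ.contDiffAt.fderiv_apply_const (m := 1) (by norm_num) v).differentiableAt (by norm_num)
    rw [h1 v, fderiv_fun_neg, neg_apply, fderiv_comp_const_sub_apply hd, neg_neg]
  rw [hs, hs, h2, h2]

/-- Mollifications of a function that is superharmonic along complex lines in `Ω`. -/
lemma hs_convolution_nonpos (hn : n ≠ 0) (hf : ∀ z ∈ Ω, DifferentiableAt ℝ f z)
    (hd : ∀ z ∈ Ω, ∀ X, DifferentiableAt ℝ (fun y => fderiv ℝ f y X) z)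
    (hnn : ∀ z ∈ Ω, ∀ X, 0 ≤ hs f X z) (hG : LocallyIntegrable G) (hGf : ∀ z ∈ Ω, f z = -G z)
    (φ : ContDiffBump (0 : Pt n)) (hz : Metric.closedBall z φ.rOut ⊆ Ω) (X : Pt n) :
    hs (φ.normed volume ⋆[ContinuousLinearMap.lsmul ℝ ℝ, volume] G) X z ≤ 0 := by
  have hχ : ContDiff ℝ 2 (φ.normed (volume : Measure (Pt n))) := φ.contDiff_normed
  rw [hs_convolution hχ φ.hasCompactSupport_normed hG]
  have hts : tsupport (fun y => φ.normed (volume : Measure (Pt n)) (z - y)) ⊆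
      Metric.closedBall z φ.rOut := by
    refine closure_minimal (fun y hy => ?_) Metric.isClosed_closedBall
    have : z - y ∈ Function.support (φ.normed (volume : Measure (Pt n))) := hy
    rw [φ.support_normed_eq] at this
    rw [Metric.mem_closedBall, dist_comm, dist_eq_norm]
    exact (mem_ball_zero_iff.1 this).le
  have key := integral_mul_hs_nonneg hn hf hd (p := fun y => φ.normed (volume : Measure (Pt n)) (z - y))
    (hχ.comp (contDiff_const.sub contDiff_id))
    ((isCompact_closedBall z φ.rOut).of_isClosed_subset (isClosed_tsupport _) hts)
    (hts.trans hz) (fun y => φ.nonneg_normed _) X (fun z hz => hnn z hz X)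
  have e : (fun y => f y * hs (fun y => φ.normed (volume : Measure (Pt n)) (z - y)) X y) =
      fun y => -(G y * hs (φ.normed (volume : Measure (Pt n))) X (z - y)) := by
    funext y
    by_cases hy : y ∈ Ω
    · rw [hs_comp_sub hχ, hGf y hy]; ring
    · have h0 : y ∉ tsupport (fun y => φ.normed (volume : Measure (Pt n)) (z - y)) := fun h =>
        hy (hz (hts h))
      have h1 := hs_eq_zero_of_notMem h0 X
      rw [h1, ← hs_comp_sub hχ, h1]; ring
  rw [e, integral_neg] at key
  linarith

end mollify

section smoothApprox

open MeasureTheory Convolution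

variable {n : ℕ} {ρ f G : Pt n → ℝ} {Ω V : Set (Pt n)} {z X : Pt n} {s : ℕ∞}

open scoped Classical in
lemma IsDefining.continuous_extension (h : IsDefining n s Ω ρ V) {η : ℝ} (hη : 0 < η) :
    Continuous fun z => if ρ z < 0 ∧ z ∈ V then (-ρ z) ^ η else 0 := by
  rw [continuous_iff_continuousAt]
  intro z
  by_cases hz : z ∈ V
  · have h1 : (fun z => if ρ z < 0 ∧ z ∈ V then (-ρ z) ^ η else 0) =ᶠ[𝓝 z]
        fun z => (max (-ρ z) 0) ^ η := by
      filter_upwards [h.1.mem_nhds hz] with y hy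
      by_cases hr : ρ y < 0
      · rw [if_pos ⟨hr, hy⟩, max_eq_left (by linarith)]
      · rw [if_neg (fun h => hr h.1), max_eq_right (by linarith), Real.zero_rpow hη.ne']
    refine ContinuousAt.congr ?_ h1.symm
    exact (((h.contDiffAt hz).continuousAt.neg.max continuousAt_const)).rpow_const (Or.inr hη.le)
  · have h2 : z ∉ closure Ω := fun hc => hz (h.2.1 hc)
    have h1 : (fun z => if ρ z < 0 ∧ z ∈ V then (-ρ z) ^ η else 0) =ᶠ[𝓝 z] fun _ => 0 := by
      filter_upwards [isClosed_closure.isOpen_compl.mem_nhds h2] with y hy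
      refine if_neg fun hc => hy (subset_closure ?_)
      rw [h.2.2.2.1]; exact ⟨hc.2, hc.1⟩
    exact continuousAt_const.congr h1.symm

lemma abs_log_sub_log_le {m t u δ : ℝ} (hm : 0 < m) (hu : m ≤ u) (hδ : 0 ≤ δ)
    (h1 : |t - u| ≤ m / 2) (h2 : |t - u| ≤ m / 2 * δ) : 0 < t ∧ |Real.log t - Real.log u| ≤ δ := by
  have hu0 : 0 < u := hm.trans_le hu
  have ht : m / 2 ≤ t := by have := (abs_le.1 h1).1; linarith
  have ht0 : 0 < t := by linarith
  refine ⟨ht0, ?_⟩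
  have a1 : Real.log t - Real.log u ≤ (t - u) / u := by
    rw [← Real.log_div ht0.ne' hu0.ne', sub_div, div_self hu0.ne']
    exact Real.log_le_sub_one_of_pos (by positivity)
  have a2 : Real.log u - Real.log t ≤ (u - t) / t := by
    rw [← Real.log_div hu0.ne' ht0.ne', sub_div, div_self ht0.ne']
    exact Real.log_le_sub_one_of_pos (by positivity)
  have b1 : (t - u) / u ≤ δ := by
    rw [div_le_iff₀ hu0]
    have := (abs_le.1 h2).2
    nlinarith
  have b2 : (u - t) / t ≤ δ := by
    rw [div_le_iff₀ ht0]
    have := (abs_le.1 h2).1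
    nlinarith
  rw [abs_le]; constructor <;> linarith

lemma hs_rpow_mul_le (hG : ContDiffAt ℝ 2 G z) (h0 : 0 < G z) (hn : hs G X z ≤ 0) {a : ℝ}
    (ha : 0 < a) :
    hs (fun y => G y ^ a) X z * G z ^ a ≤
      -((1 - a) / a) * normSq (pW (cR n fun y => G y ^ a) X z) := by
  have hφ : ∀ b : ℝ, ∀ t : ℝ, 0 < t → HasDerivAt (fun t : ℝ => t ^ b) (b * t ^ (b - 1)) t :=
    fun b t ht => Real.hasDerivAt_rpow_const (Or.inl ht.ne')
  have hd : deriv (fun t : ℝ => t ^ a) =ᶠ[𝓝 (G z)] fun t => a * t ^ (a - 1) := by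
    filter_upwards [lt_mem_nhds h0] with t ht
    exact (hφ a t ht).deriv
  have hdd : deriv (deriv fun t : ℝ => t ^ a) (G z) = a * ((a - 1) * G z ^ (a - 2)) := by
    rw [hd.deriv_eq, ((hφ (a - 1) _ h0).const_mul a).deriv]
    ring_nf
  have hc : ContDiffAt ℝ 2 (fun t : ℝ => t ^ a) (G z) :=
    contDiffAt_id.rpow_const_of_ne h0.ne'
  rw [hs_comp hG hc, pW_comp_real (hG.differentiableAt (by norm_num))
    (hφ a _ h0).differentiableAt, hdd, (hφ a _ h0).deriv, map_mul, normSq_ofReal]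
  set N := normSq (pW (cR n G) X z)
  have hN : 0 ≤ N := normSq_nonneg _
  have e1 : G z ^ (a - 2) * G z ^ a = G z ^ (a - 1) * G z ^ (a - 1) := by
    rw [← Real.rpow_add h0, ← Real.rpow_add h0]; ring_nf
  have h1 : a * G z ^ (a - 1) * hs G X z * G z ^ a ≤ 0 := by
    have p1 : 0 < G z ^ (a - 1) := Real.rpow_pos_of_pos h0 _
    have p2 : 0 < G z ^ a := Real.rpow_pos_of_pos h0 _
    have : a * G z ^ (a - 1) * hs G X z * G z ^ a = (a * G z ^ (a - 1) * G z ^ a) * hs G X z := by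
      ring
    rw [this]
    exact mul_nonpos_of_nonneg_of_nonpos (by positivity) hn
  have h2 : -((1 - a) / a) * (a * G z ^ (a - 1) * (a * G z ^ (a - 1)) * N) =
      a * ((a - 1) * (G z ^ (a - 2) * G z ^ a)) * N := by
    rw [e1]; field_simp; ring
  rw [h2]
  linarith

open scoped Classical in
/-- Smooth positive approximations, uniform on compact sets, of `(-ρ) ^ β` that keep the
quantitative plurisubharmonicity of `-(-ρ) ^ η`. -/
lemma IsDefining.exists_smooth_approx (hn : n ≠ 0) (h : IsDefining n 1 Ω ρ V) (hO : IsOpen Ω)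
    {η β δ : ℝ} (hη : StrictPSHOn n (fun z => -((-ρ z) ^ η)) Ω) (hβ : 0 < β) (hβη : β < η)
    {K : Set (Pt n)} (hK : IsCompact K) (hKΩ : K ⊆ Ω) (hδ : 0 < δ) :
    ∃ F : Pt n → ℝ, ∃ O : Set (Pt n), IsOpen O ∧ K ⊆ O ∧
      (∀ z ∈ O, ContDiffAt ℝ ∞ F z ∧ 0 < F z ∧
        (∀ X, hs F X z * F z ≤ -((η - β) / β) * normSq (pW (cR n F) X z)) ∧
        |Real.log (F z) - β * Real.log (-ρ z)| ≤ δ) := by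
  have hη0 : 0 < η := hβ.trans hβη
  set G : Pt n → ℝ := fun z => if ρ z < 0 ∧ z ∈ V then (-ρ z) ^ η else 0 with hGdef
  have hGc : Continuous G := h.continuous_extension hη0
  have hmem : ∀ z ∈ Ω, ρ z < 0 ∧ z ∈ V := fun z hz => by
    rw [h.2.2.2.1] at hz; exact ⟨hz.2, hz.1⟩
  have hGΩ : ∀ z ∈ Ω, G z = (-ρ z) ^ η := fun z hz => if_pos (hmem z hz)
  have hGpos : ∀ z ∈ Ω, 0 < G z := fun z hz => by
    rw [hGΩ z hz]; exact Real.rpow_pos_of_pos (by linarith [(hmem z hz).1]) _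
  obtain ⟨ε₀, hε₀, hK0⟩ := hK.exists_cthickening_subset_open hO hKΩ
  set K1 := Metric.cthickening (ε₀ / 2) K
  have hK1 : IsCompact K1 := hK.cthickening
  have hK1Ω : K1 ⊆ Ω := (Metric.cthickening_mono (by linarith) K).trans hK0
  obtain ⟨m, hm, hmG⟩ : ∃ m, 0 < m ∧ ∀ z ∈ K1, m ≤ G z := by
    rcases K1.eq_empty_or_nonempty with he | hne
    · exact ⟨1, one_pos, by simp [he]⟩
    · obtain ⟨x, hx, hmin⟩ := hK1.exists_isMinOn hne hGc.continuousOn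
      exact ⟨G x, hGpos x (hK1Ω hx), fun z hz => hmin hz⟩
  set δ' := min (m / 2) (m / 2 * δ)
  have hδ' : 0 < δ' := lt_min (by positivity) (by positivity)
  have hu := hK1.uniformContinuousAt_of_continuousAt G (fun z _ => hGc.continuousAt)
    (Metric.dist_mem_uniformity hδ')
  obtain ⟨ε₁, hε₁, hu⟩ := Metric.mem_uniformity_dist.1 hu
  set ε := min ε₁ (ε₀ / 2)
  have hε : 0 < ε := lt_min hε₁ (by linarith)
  let φ : ContDiffBump (0 : Pt n) := ⟨ε / 2, ε, by linarith, by linarith⟩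
  set Gε := φ.normed (volume : Measure (Pt n)) ⋆[ContinuousLinearMap.lsmul ℝ ℝ, volume] G
  have hsm : ContDiff ℝ ∞ Gε := φ.hasCompactSupport_normed.contDiff_convolution_left _
    φ.contDiff_normed hGc.locallyIntegrable
  have hclose : ∀ z ∈ K1, |Gε z - G z| ≤ δ' := by
    intro z hz
    rw [← Real.dist_eq]
    refine φ.dist_normed_convolution_le hGc.aestronglyMeasurable fun x hx => ?_
    rw [dist_comm]
    refine le_of_lt (hu (a := z) (b := x) ?_ hz)
    rw [dist_comm]
    exact (Metric.mem_ball.1 hx).trans_le (min_le_left _ _)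
  have hlog : ∀ z ∈ K1, 0 < Gε z ∧ |Real.log (Gε z) - Real.log (G z)| ≤ δ := fun z hz =>
    abs_log_sub_log_le hm (hmG z hz) hδ.le ((hclose z hz).trans (min_le_left _ _))
      ((hclose z hz).trans (min_le_right _ _))
  have hdf : ∀ z ∈ Ω, DifferentiableAt ℝ (fun z => -((-ρ z) ^ η)) z := fun z hz =>
    (((h.contDiffAt (hmem z hz).2).neg.rpow_const_of_ne
      (by linarith [(hmem z hz).1])).neg).differentiableAt (by norm_num)
  have hhs : ∀ z ∈ K1, ∀ X, hs Gε X z ≤ 0 := fun z hz X => by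
    refine hs_convolution_nonpos hn hdf (fun z hz X => hη.differentiableAt_fderiv_apply hz X)
      (fun z hz X => hη.hs_nonneg hz X) hGc.locallyIntegrable (fun z hz => ?_) φ ?_ X
    · rw [hGΩ z hz]
    · refine ((Metric.closedBall_subset_cthickening hz ε).trans
        (Metric.cthickening_cthickening_subset hε.le (by linarith) K)).trans
        ((Metric.cthickening_mono ?_ K).trans hK0)
      have : ε ≤ ε₀ / 2 := min_le_right _ _
      linarith
  refine ⟨fun z => Gε z ^ (β / η), Metric.thickening (ε₀ / 2) K, Metric.isOpen_thickening,
    Metric.self_subset_thickening (by linarith) K, fun z hz => ?_⟩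
  have hz1 : z ∈ K1 := Metric.thickening_subset_cthickening _ _ hz
  obtain ⟨hp, hl⟩ := hlog z hz1
  have ha0 : 0 < β / η := by positivity
  refine ⟨hsm.contDiffAt.rpow_const_of_ne hp.ne', Real.rpow_pos_of_pos hp _, fun X => ?_, ?_⟩
  · have := hs_rpow_mul_le (X := X) (hsm.contDiffAt.of_le (show (2 : WithTop ℕ∞) ≤ ∞ from WithTop.coe_le_coe.2 le_top)) hp
      (hhs z hz1 X) ha0
    have e : (1 - β / η) / (β / η) = (η - β) / β := by field_simp
    rwa [e] at this
  · rw [Real.log_rpow hp]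
    rw [hGΩ z (hK1Ω hz1), Real.log_rpow (by linarith [(hmem z (hK1Ω hz1)).1])] at hl
    have : β / η * Real.log (Gε z) - β * Real.log (-ρ z) =
        β / η * (Real.log (Gε z) - η * Real.log (-ρ z)) := by field_simp
    rw [this, abs_mul, abs_of_pos ha0]
    have ha1 : β / η < 1 := (div_lt_one hη0).2 hβη
    have := abs_nonneg (Real.log (Gε z) - η * Real.log (-ρ z))
    nlinarith

end smoothApprox

section paramIntegral

variable {P : Type} [NormedAddCommGroup P] [NormedSpace ℝ P] {H : P → ℂ → ℝ} {O : Set P}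
  {k : Set ℂ} {N : ℕ∞}

open MeasureTheory Convolution

theorem integral_eq_convolution_zero (g : ℂ → ℝ) :
    ((fun _ : ℂ => (1 : ℝ)) ⋆[ContinuousLinearMap.mul ℝ ℝ, volume] g) 0 = ∫ s, g s := by
  rw [convolution_def]
  simp only [ContinuousLinearMap.mul_apply', one_mul, zero_sub]
  exact integral_neg_eq_self g volume

theorem contDiffOn_integral_param (hO : IsOpen O) (hk : IsCompact k)
    (h0 : ∀ z s, z ∈ O → s ∉ k → H z s = 0) (hH : ContDiffOn ℝ N (↿H) (O ×ˢ Set.univ)) :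
    ContDiffOn ℝ N (fun z => ∫ s, H z s) O := by
  have h := contDiffOn_convolution_right_with_param (μ := volume) (ContinuousLinearMap.mul ℝ ℝ) hO hk h0
    (locallyIntegrable_const (1 : ℝ)) hH
  have h2 : ContDiffOn ℝ N (fun z : P => (z, (0 : ℂ))) O := by fun_prop
  refine (h.comp h2 fun z hz => ⟨hz, Set.mem_univ _⟩).congr fun z _ => ?_
  exact (integral_eq_convolution_zero (H z)).symm

theorem fderiv_integral_param (hO : IsOpen O) (hk : IsCompact k)
    (h0 : ∀ z s, z ∈ O → s ∉ k → H z s = 0) (hH : ContDiffOn ℝ 1 (↿H) (O ×ˢ Set.univ))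
    {z : P} (hz : z ∈ O) (v : P) :
    fderiv ℝ (fun y => ∫ s, H y s) z v = ∫ s, fderiv ℝ (fun y => H y s) z v := by
  have h := hasFDerivAt_convolution_right_with_param (μ := volume) (ContinuousLinearMap.mul ℝ ℝ)
    hO hk h0 (locallyIntegrable_const (1 : ℝ)) hH (z, (0 : ℂ)) hz
  have h2 : HasFDerivAt (fun y : P => (y, (0 : ℂ))) (ContinuousLinearMap.inl ℝ P ℂ) z :=
    (hasFDerivAt_id z).prodMk (hasFDerivAt_const _ _)
  have h3 := h.comp z h2
  have e : (fun y => ∫ s, H y s) =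
      (fun q : P × ℂ => ((fun _ : ℂ => (1 : ℝ)) ⋆[ContinuousLinearMap.mul ℝ ℝ, volume] H q.1) q.2) ∘
        fun y : P => (y, (0 : ℂ)) := by
    funext y
    exact (integral_eq_convolution_zero (H y)).symm
  rw [e, h3.fderiv, ContinuousLinearMap.comp_apply, convolution_def]
  have hopen : IsOpen (O ×ˢ (Set.univ : Set ℂ)) := hO.prod isOpen_univ
  have hcont : Continuous fun s : ℂ => fderiv ℝ (↿H) (z, s) := by
    have := hH.continuousOn_fderiv_of_isOpen hopen le_rfl
    refine continuous_iff_continuousAt.2 fun s => ?_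
    exact ((this.continuousAt (hopen.mem_nhds ⟨hz, trivial⟩)).comp
      (f := fun s : ℂ => (z, s)) (by fun_prop))
  have hzero : ∀ s, s ∉ k → fderiv ℝ (↿H) (z, s) = 0 := fun s hs => by
    have : ↿H =ᶠ[𝓝 (z, s)] fun _ => 0 := by
      filter_upwards [(hO.prod hk.isClosed.isOpen_compl).mem_nhds ⟨hz, hs⟩] with q hq
      exact h0 q.1 q.2 hq.1 hq.2
    rw [this.fderiv_eq, fderiv_fun_const]; rfl
  have h_integ : Integrable (fun s => fderiv ℝ (↿H) (z, s)) :=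
    hcont.integrable_of_hasCompactSupport (HasCompactSupport.intro hk hzero)
  rw [show (∫ t : ℂ, ((ContinuousLinearMap.mul ℝ ℝ).precompR (P × ℂ)) 1
      (fderiv ℝ (↿H) (z, 0 - t))) = ∫ t : ℂ, fderiv ℝ (↿H) (z, t) from ?_]
  · rw [ContinuousLinearMap.integral_apply h_integ]
    refine integral_congr_ae (Filter.Eventually.of_forall fun s => ?_)
    have hd : DifferentiableAt ℝ (↿H) (z, s) :=
      (hH.contDiffAt (hopen.mem_nhds ⟨hz, trivial⟩)).differentiableAt (by norm_num)
    have h4 : HasFDerivAt (fun y : P => (y, s)) (ContinuousLinearMap.inl ℝ P ℂ) z :=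
      (hasFDerivAt_id z).prodMk (hasFDerivAt_const _ _)
    have h5 := hd.hasFDerivAt.comp z h4
    have : fderiv ℝ (fun y => H y s) z = _ := h5.fderiv
    simp only [this]; rfl
  · rw [← integral_neg_eq_self (fun t => fderiv ℝ (↿H) (z, t)) volume]
    refine integral_congr_ae (Filter.Eventually.of_forall fun s => ?_)
    refine ContinuousLinearMap.ext fun v => ?_
    simp [ContinuousLinearMap.precompR_apply]

theorem fderiv_slice (hO : IsOpen O) (hH : ContDiffOn ℝ 1 (↿H) (O ×ˢ Set.univ)) {z : P}
    (hz : z ∈ O) (s : ℂ) (v : P) :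
    fderiv ℝ (fun y => H y s) z v = fderiv ℝ (↿H) (z, s) (v, 0) := by
  have hd : DifferentiableAt ℝ (↿H) (z, s) :=
    (hH.contDiffAt ((hO.prod isOpen_univ).mem_nhds ⟨hz, trivial⟩)).differentiableAt (by norm_num)
  have h4 : HasFDerivAt (fun y : P => (y, s)) (ContinuousLinearMap.inl ℝ P ℂ) z :=
    (hasFDerivAt_id z).prodMk (hasFDerivAt_const _ _)
  have h5 := hd.hasFDerivAt.comp z h4
  have : fderiv ℝ (fun y => H y s) z = _ := h5.fderiv
  rw [this]; rfl

theorem contDiffOn_fderiv_slice (hO : IsOpen O) (hH : ContDiffOn ℝ 2 (↿H) (O ×ˢ Set.univ)) (v : P) :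
    ContDiffOn ℝ 1 (↿fun (y : P) (s : ℂ) => fderiv ℝ (fun y => H y s) y v) (O ×ˢ Set.univ) := by
  have h1 : ContDiffOn ℝ 1 (fun q => fderiv ℝ (↿H) q) (O ×ˢ Set.univ) :=
    hH.fderiv_of_isOpen (hO.prod isOpen_univ) (by norm_num)
  refine (h1.clm_apply (contDiffOn_const (c := ((v, 0) : P × ℂ)))).congr fun q hq => ?_
  exact fderiv_slice hO (hH.of_le (by norm_num)) hq.1 q.2 v

theorem fderiv_slice_eq_zero (hO : IsOpen O) (h0 : ∀ z s, z ∈ O → s ∉ k → H z s = 0) {z : P}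
    {s : ℂ} (hz : z ∈ O) (hs : s ∉ k) (v : P) : fderiv ℝ (fun y => H y s) z v = 0 := by
  have : (fun y => H y s) =ᶠ[𝓝 z] fun _ => 0 := by
    filter_upwards [hO.mem_nhds hz] with y hy using h0 y s hy hs
  rw [this.fderiv_eq, fderiv_fun_const]; rfl

theorem fderiv_fderiv_integral_param (hO : IsOpen O) (hk : IsCompact k)
    (h0 : ∀ z s, z ∈ O → s ∉ k → H z s = 0) (hH : ContDiffOn ℝ 2 (↿H) (O ×ˢ Set.univ))
    {z : P} (hz : z ∈ O) (v w : P) :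
    fderiv ℝ (fun y => fderiv ℝ (fun y => ∫ s, H y s) y v) z w =
      ∫ s, fderiv ℝ (fun y => fderiv ℝ (fun y => H y s) y v) z w := by
  have e : (fun y => fderiv ℝ (fun y => ∫ s, H y s) y v) =ᶠ[𝓝 z]
      fun y => ∫ s, fderiv ℝ (fun y => H y s) y v := by
    filter_upwards [hO.mem_nhds hz] with y hy
    exact fderiv_integral_param hO hk h0 (hH.of_le (by norm_num)) hy v
  rw [e.fderiv_eq]
  exact fderiv_integral_param (H := fun y s => fderiv ℝ (fun y => H y s) y v) hO hk
    (fun z s hz hs => fderiv_slice_eq_zero hO h0 hz hs v) (contDiffOn_fderiv_slice hO hH v) hz w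

theorem integrable_slice {P : Type} [NormedAddCommGroup P] {H : P → ℂ → ℝ} {O : Set P} (hO : IsOpen O) (hk : IsCompact k)
    (h0 : ∀ z s, z ∈ O → s ∉ k → H z s = 0) (hH : ContinuousOn (↿H) (O ×ˢ Set.univ))
    {z : P} (hz : z ∈ O) : Integrable (fun s => H z s) := by
  refine Continuous.integrable_of_hasCompactSupport ?_
    (HasCompactSupport.intro hk fun s hs => h0 z s hz hs)
  refine continuous_iff_continuousAt.2 fun s => ?_
  exact ((hH.continuousAt ((hO.prod isOpen_univ).mem_nhds ⟨hz, trivial⟩)).comp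
      (f := fun s : ℂ => (z, s)) (by fun_prop))

end paramIntegral

section shear

open MeasureTheory

/-- The real linear map `s ↦ s + (Re s) ζ` of the complex plane. -/
noncomputable def shearMap (ζ : ℂ) : ℂ →ₗ[ℝ] ℂ := LinearMap.id + Complex.reLm.smulRight ζ

theorem shearMap_apply (ζ s : ℂ) : shearMap ζ s = s + s.re * ζ := by
  simp [shearMap]

theorem det_shearMap (ζ : ℂ) : LinearMap.det (shearMap ζ) = 1 + ζ.re := by
  rw [← LinearMap.det_toMatrix Complex.basisOneI, Matrix.det_fin_two]
  simp [LinearMap.toMatrix_apply, shearMap_apply]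

theorem integral_shear (f : ℂ → ℝ) {ζ : ℂ} (hζ : 0 < 1 + ζ.re) :
    ∫ s, f s = ∫ s, f (s + s.re * ζ) * (1 + ζ.re) := by
  have hd : LinearMap.det (shearMap ζ) ≠ 0 := by rw [det_shearMap]; exact hζ.ne'
  have h := MeasureTheory.Measure.map_linearMap_addHaar_eq_smul_addHaar volume hd
  have hemb : MeasurableEmbedding (shearMap ζ) :=
    (LinearMap.equivOfDetNeZero _ hd).toContinuousLinearEquiv.toHomeomorph.measurableEmbedding
  have h2 := hemb.integral_map (μ := volume) f
  rw [h, integral_smul_measure, det_shearMap, abs_of_pos (by positivity),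
    ENNReal.toReal_ofReal (by positivity), smul_eq_mul] at h2
  rw [integral_mul_const, ← funext (fun s => congrArg f (shearMap_apply ζ s)), ← h2]
  field_simp

end shear

section secondDerivative

variable {E : Type} [NormedAddCommGroup E] [NormedSpace ℝ E] {f g : E → ℝ} {z κ : E}

/-- The second derivative of `f` at `z` in the direction `κ`. -/
noncomputable def dd (f : E → ℝ) (κ z : E) : ℝ := fderiv ℝ (fun y => fderiv ℝ f y κ) z κ

theorem dd_congr (h : f =ᶠ[𝓝 z] g) : dd f κ z = dd g κ z := by
  have : (fun y => fderiv ℝ f y κ) =ᶠ[𝓝 z] fun y => fderiv ℝ g y κ :=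
    (h.fderiv (𝕜 := ℝ)).mono fun y hy => by simp only [hy]
  rw [dd, this.fderiv_eq, dd]

theorem dd_mul (hf : ContDiffAt ℝ 2 f z) (hg : ContDiffAt ℝ 2 g z) :
    dd (fun y => f y * g y) κ z =
      dd f κ z * g z + 2 * (fderiv ℝ f z κ * fderiv ℝ g z κ) + f z * dd g κ z := by
  have e : (fun y => fderiv ℝ (fun y => f y * g y) y κ) =ᶠ[𝓝 z]
      fun y => f y * fderiv ℝ g y κ + g y * fderiv ℝ f y κ := by
    filter_upwards [hf.eventually (by simp), hg.eventually (by simp)] with y h1 h2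
    rw [fderiv_fun_mul (h1.differentiableAt (by norm_num)) (h2.differentiableAt (by norm_num))]
    simp
  have h1 := hf.differentiableAt (by norm_num)
  have h2 := hg.differentiableAt (by norm_num)
  have h3 : DifferentiableAt ℝ (fun y => fderiv ℝ f y κ) z :=
    ((hf.fderiv_right (m := 1) (by norm_num)).clm_apply contDiffAt_const).differentiableAt (by norm_num)
  have h4 : DifferentiableAt ℝ (fun y => fderiv ℝ g y κ) z :=
    ((hg.fderiv_right (m := 1) (by norm_num)).clm_apply contDiffAt_const).differentiableAt (by norm_num)
  rw [dd, e.fderiv_eq, fderiv_fun_add (h1.fun_mul h4) (h2.fun_mul h3), fderiv_fun_mul h1 h4,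
    fderiv_fun_mul h2 h3]
  simp only [dd, add_apply, smul_apply, smul_eq_mul]
  ring

theorem fderiv_comp_quadratic {n : ℕ} {F : Pt n → ℝ} {a0 a1 a2 : Pt n} {y : ℂ}
    (hF : DifferentiableAt ℝ F (a0 + y • a1 + y ^ 2 • a2)) (κ : ℂ) :
    fderiv ℝ (fun ζ : ℂ => F (a0 + ζ • a1 + ζ ^ 2 • a2)) y κ =
      fderiv ℝ F (a0 + y • a1 + y ^ 2 • a2) (κ • a1 + (2 * y * κ) • a2) := by
  have h1 : HasDerivAt (fun ζ : ℂ => a0 + ζ • a1 + ζ ^ 2 • a2) (a1 + (2 * y) • a2) y := by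
    have := (((hasDerivAt_id y).smul_const a1).const_add a0).add
      (((hasDerivAt_id y).pow 2).smul_const a2)
    refine this.congr_deriv ?_
    simp
  have h2 := hF.hasFDerivAt.comp y (h1.hasFDerivAt.restrictScalars ℝ)
  have h3 : fderiv ℝ (fun ζ : ℂ => F (a0 + ζ • a1 + ζ ^ 2 • a2)) y = _ := h2.fderiv
  rw [h3]
  simp only [ContinuousLinearMap.comp_apply]
  congr 1
  simp [smul_add, smul_smul]
  ring_nf

theorem dd_comp_quadratic {n : ℕ} {F : Pt n → ℝ} {a0 a1 a2 : Pt n}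
    (hF : ContDiffAt ℝ 2 F a0) (κ : ℂ) :
    dd (fun ζ : ℂ => F (a0 + ζ • a1 + ζ ^ 2 • a2)) κ 0 =
      dd F (κ • a1) a0 + fderiv ℝ F a0 ((2 * κ ^ 2) • a2) := by
  have hc : Continuous fun ζ : ℂ => a0 + ζ • a1 + ζ ^ 2 • a2 := by fun_prop
  have e0 : a0 + (0 : ℂ) • a1 + (0 : ℂ) ^ 2 • a2 = a0 := by simp
  have ht : Filter.Tendsto (fun ζ : ℂ => a0 + ζ • a1 + ζ ^ 2 • a2) (𝓝 0) (𝓝 a0) := by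
    have := hc.tendsto 0
    rwa [e0] at this
  have e : (fun y => fderiv ℝ (fun ζ : ℂ => F (a0 + ζ • a1 + ζ ^ 2 • a2)) y κ) =ᶠ[𝓝 0]
      fun y => fderiv ℝ F (a0 + y • a1 + y ^ 2 • a2) (κ • a1 + (2 * y * κ) • a2) := by
    filter_upwards [ht.eventually (hF.eventually (by simp))] with y hy
    exact fderiv_comp_quadratic (hy.differentiableAt (by norm_num)) κ
  rw [dd, e.fderiv_eq]
  have hd : DifferentiableAt ℝ (fderiv ℝ F) (a0 + (0 : ℂ) • a1 + (0 : ℂ) ^ 2 • a2) := by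
    rw [e0]; exact hF.differentiableAt_fderiv
  have h1 : HasDerivAt (fun ζ : ℂ => a0 + ζ • a1 + ζ ^ 2 • a2) a1 0 := by
    have := (((hasDerivAt_id (0 : ℂ)).smul_const a1).const_add a0).add
      (((hasDerivAt_id (0 : ℂ)).pow 2).smul_const a2)
    refine this.congr_deriv ?_
    simp
  have h2 := hd.hasFDerivAt.comp (0 : ℂ) (h1.hasFDerivAt.restrictScalars ℝ)
  have h3 : HasDerivAt (fun y : ℂ => κ • a1 + (2 * y * κ) • a2) ((2 * κ) • a2) 0 := by
    have := ((((hasDerivAt_id (0 : ℂ)).const_mul 2).mul_const κ).smul_const a2).const_add (κ • a1)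
    refine this.congr_deriv ?_
    simp
  have h4 := h2.clm_apply (h3.hasFDerivAt.restrictScalars ℝ)
  have h5 : fderiv ℝ (fun y : ℂ => fderiv ℝ F (a0 + y • a1 + y ^ 2 • a2)
      (κ • a1 + (2 * y * κ) • a2)) 0 = _ := h4.fderiv
  rw [h5, dd, fderiv_fderiv_apply hF.differentiableAt_fderiv]
  simp [smul_smul]
  ring_nf

theorem hs_eq_dd {n : ℕ} (F : Pt n → ℝ) (X z : Pt n) :
    hs F X z = (1 / 4) * (dd F X z + dd F (I • X) z) := rfl

end secondDerivative

section shearWeight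

variable {B : ℂ → ℝ} {β : ℝ}

theorem fderiv_comp_affine_complex {y s : ℂ} {σ : ℝ} (hB : DifferentiableAt ℝ B (s + σ * y)) (κ : ℂ) :
    fderiv ℝ (fun ζ : ℂ => B (s + σ * ζ)) y κ = σ * fderiv ℝ B (s + σ * y) κ := by
  have h1 : HasDerivAt (fun ζ : ℂ => s + σ * ζ) (σ : ℂ) y := by
    have := ((hasDerivAt_id y).const_mul (σ : ℂ)).const_add s
    refine this.congr_deriv ?_
    simp
  have h2 := hB.hasFDerivAt.comp y (h1.hasFDerivAt.restrictScalars ℝ)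
  have h3 : fderiv ℝ (fun ζ : ℂ => B (s + σ * ζ)) y = _ := h2.fderiv
  rw [h3, ContinuousLinearMap.comp_apply, ← smul_eq_mul σ, ← map_smul]
  congr 1
  simp [mul_comm]

theorem dd_comp_affine_complex (hB : ContDiff ℝ 2 B) (s : ℂ) (σ : ℝ) (κ : ℂ) :
    dd (fun ζ : ℂ => B (s + σ * ζ)) κ 0 = σ ^ 2 * dd B κ s := by
  have e : (fun y => fderiv ℝ (fun ζ : ℂ => B (s + σ * ζ)) y κ) =
      fun y => σ * fderiv ℝ B (s + σ * y) κ := by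
    funext y
    exact fderiv_comp_affine_complex (hB.differentiable (by norm_num) _) κ
  have hd : Differentiable ℝ (fun y => fderiv ℝ B y κ) :=
    ((hB.fderiv_right (m := 1) (by norm_num)).clm_apply contDiff_const).differentiable (by norm_num)
  have hd2 : DifferentiableAt ℝ (fun ζ : ℂ => fderiv ℝ B (s + σ * ζ) κ) 0 :=
    (hd _).fun_comp' (0 : ℂ) (by fun_prop)
  rw [dd, e, fderiv_const_mul hd2, smul_apply, fderiv_comp_affine_complex (hd _) κ, dd]
  simp
  ring

theorem fderiv_one_add_re_rpow (β : ℝ) {y : ℂ} (hy : 0 < 1 + y.re) (κ : ℂ) :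
    fderiv ℝ (fun ζ : ℂ => (1 + ζ.re) ^ β) y κ = β * (1 + y.re) ^ (β - 1) * κ.re := by
  have h1 : HasFDerivAt (fun ζ : ℂ => 1 + ζ.re) Complex.reCLM y :=
    Complex.reCLM.hasFDerivAt.const_add 1
  rw [(h1.rpow_const (Or.inl hy.ne')).fderiv]
  simp

theorem contDiffAt_one_add_re_rpow (β : ℝ) {y : ℂ} (hy : 0 < 1 + y.re) {N : WithTop ℕ∞} :
    ContDiffAt ℝ N (fun ζ : ℂ => (1 + ζ.re) ^ β) y :=
  ContDiffAt.rpow_const_of_ne (contDiffAt_const.add Complex.reCLM.contDiff.contDiffAt) hy.ne'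

theorem dd_one_add_re_rpow (β : ℝ) (κ : ℂ) :
    dd (fun ζ : ℂ => (1 + ζ.re) ^ β) κ 0 = β * (β - 1) * κ.re ^ 2 := by
  have e : (fun y => fderiv ℝ (fun ζ : ℂ => (1 + ζ.re) ^ β) y κ) =ᶠ[𝓝 0]
      fun y => β * κ.re * (1 + y.re) ^ (β - 1) := by
    have : ∀ᶠ y : ℂ in 𝓝 0, 0 < 1 + y.re :=
      (by fun_prop : Continuous fun y : ℂ => 1 + y.re).continuousAt.eventually
        (lt_mem_nhds (by simp))
    filter_upwards [this] with y hy
    rw [fderiv_one_add_re_rpow β hy]; ring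
  have h0 : 0 < 1 + (0 : ℂ).re := by simp
  rw [dd, e.fderiv_eq, fderiv_const_mul ((contDiffAt_one_add_re_rpow (N := 1) _ h0).differentiableAt
    (by norm_num)), smul_apply, fderiv_one_add_re_rpow _ h0]
  simp
  ring

/-- The pointwise estimate for the integrand after the substitution `s ↦ s + (Re s) ζ`. -/
theorem lap_integrand_le {u b : ℂ → ℝ} {s : ℂ} {σ g w : ℝ} (hu : ContDiffAt ℝ 2 u 0) (hu0 : 0 < u 0)
    (hg : 0 < g) (hw : 0 ≤ w) (hb : ContDiff ℝ 2 b)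
    (hlap : (dd u 1 0 + dd u I 0) * u 0 ≤ -g * (fderiv ℝ u 0 1 ^ 2 + fderiv ℝ u 0 I ^ 2)) :
    dd (fun ζ => u ζ * (w * ((1 + ζ.re) ^ (-β) * b (s + σ * ζ) ^ 2))) 1 0 +
      dd (fun ζ => u ζ * (w * ((1 + ζ.re) ^ (-β) * b (s + σ * ζ) ^ 2))) I 0 +
      2 * β * fderiv ℝ (fun ζ => u ζ * (w * ((1 + ζ.re) ^ (-β) * b (s + σ * ζ) ^ 2))) 0 1 ≤
    u 0 * (w * (β * (1 - β) * b s ^ 2 + σ ^ 2 * (4 / g * (fderiv ℝ b s 1 ^ 2 + fderiv ℝ b s I ^ 2) +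
      (dd (fun y => b y ^ 2) 1 s + dd (fun y => b y ^ 2) I s)))) := by
  set B : ℂ → ℝ := fun y => b y ^ 2 with hBdef
  have hB : ContDiff ℝ 2 B := hb.pow 2
  have hBκ : ∀ κ, fderiv ℝ B s κ = 2 * b s * fderiv ℝ b s κ := fun κ => by
    rw [hBdef, fderiv_fun_pow 2 (hb.differentiable (by norm_num) s)]
    simp
  have h0 : 0 < 1 + (0 : ℂ).re := by simp
  have hχ := contDiffAt_one_add_re_rpow (-β) h0 (N := 2)
  have hBa : ContDiffAt ℝ 2 (fun ζ : ℂ => B (s + σ * ζ)) 0 := by fun_prop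
  have hM : ContDiffAt ℝ 2 (fun ζ : ℂ => (1 + ζ.re) ^ (-β) * B (s + σ * ζ)) 0 := hχ.mul hBa
  have hwM : ContDiffAt ℝ 2 (fun ζ : ℂ => w * ((1 + ζ.re) ^ (-β) * B (s + σ * ζ))) 0 :=
    contDiffAt_const.mul hM
  have dM : ∀ κ, fderiv ℝ (fun ζ : ℂ => w * ((1 + ζ.re) ^ (-β) * B (s + σ * ζ))) 0 κ =
      w * (-β * κ.re * B s + σ * fderiv ℝ B s κ) := fun κ => by
    rw [fderiv_const_mul (hM.differentiableAt (by norm_num)), smul_apply,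
      fderiv_fun_mul (hχ.differentiableAt (by norm_num)) (hBa.differentiableAt (by norm_num)),
      add_apply, smul_apply, smul_apply, fderiv_one_add_re_rpow _ h0,
      fderiv_comp_affine_complex (hB.differentiable (by norm_num) _)]
    simp only [mul_zero, add_zero, Complex.zero_re, Real.one_rpow, smul_eq_mul]
    ring
  have ddM : ∀ κ, dd (fun ζ : ℂ => w * ((1 + ζ.re) ^ (-β) * B (s + σ * ζ))) κ 0 =
      w * (β * (β + 1) * κ.re ^ 2 * B s - 2 * β * κ.re * σ * fderiv ℝ B s κ + σ ^ 2 * dd B κ s) :=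
    fun κ => by
    rw [dd_mul contDiffAt_const hM, dd_mul hχ hBa, dd_one_add_re_rpow, fderiv_one_add_re_rpow _ h0,
      fderiv_comp_affine_complex (hB.differentiable (by norm_num) _), dd_comp_affine_complex hB]
    simp only [dd, fderiv_fun_const, Pi.zero_apply, zero_apply, mul_zero, add_zero,
      Complex.zero_re, Real.one_rpow, zero_mul, zero_add]
    ring
  rw [dd_mul hu hwM, dd_mul hu hwM, fderiv_fun_mul (hu.differentiableAt (by norm_num))
    (hwM.differentiableAt (by norm_num)), add_apply, smul_apply, smul_apply, ddM, ddM, dM, dM,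
    hBκ, hBκ]
  simp only [Complex.one_re, Complex.I_re, Complex.zero_re, smul_eq_mul, mul_zero, add_zero,
    Real.one_rpow, one_mul, hBdef]
  set D1 := fderiv ℝ u 0 1
  set D2 := fderiv ℝ u 0 I
  set Δ := dd u 1 0 + dd u I 0
  set K := u 0
  set b1 := fderiv ℝ b s 1
  set b2 := fderiv ℝ b s I
  have key : Δ * b s ^ 2 + 4 * σ * b s * (D1 * b1 + D2 * b2) ≤ K * (σ ^ 2 * (4 / g * (b1 ^ 2 + b2 ^ 2))) := by
    have h1 : 0 ≤ (g * D1 * b s - 2 * K * σ * b1) ^ 2 + (g * D2 * b s - 2 * K * σ * b2) ^ 2 := by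
      positivity
    have h2 : (Δ * K) * b s ^ 2 ≤ (-g * (D1 ^ 2 + D2 ^ 2)) * b s ^ 2 :=
      mul_le_mul_of_nonneg_right hlap (sq_nonneg _)
    have h3 : (Δ * b s ^ 2 + 4 * σ * b s * (D1 * b1 + D2 * b2)) * (g * K) ≤
        K * (σ ^ 2 * (4 / g * (b1 ^ 2 + b2 ^ 2))) * (g * K) := by
      have : K * (σ ^ 2 * (4 / g * (b1 ^ 2 + b2 ^ 2))) * (g * K) =
          4 * K ^ 2 * σ ^ 2 * (b1 ^ 2 + b2 ^ 2) := by field_simp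
      rw [this]
      have h4 := mul_le_mul_of_nonneg_left h2 hg.le
      nlinarith
    exact le_of_mul_le_mul_right h3 (by positivity)
  have key2 := mul_le_mul_of_nonneg_left key hw
  have e : dd u 1 0 = Δ - dd u I 0 := by ring
  rw [e]
  linarith

end shearWeight

section average

open MeasureTheory

variable {n : ℕ} {F : Pt n → ℝ} {O : Set (Pt n)} {E : Pt n →L[ℂ] Pt n} {E0 z0 : Pt n}
  {b : ℂ → ℝ} {β g : ℝ}

/-- The weighted average of `F` over the analytic discs `s ↦ z - s (E0 + E z)`. -/
noncomputable def discAvg (F : Pt n → ℝ) (E : Pt n →L[ℂ] Pt n) (E0 : Pt n) (β : ℝ) (b : ℂ → ℝ)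
    (z : Pt n) : ℝ :=
  ∫ s : ℂ, F (z - s • (E0 + E z)) * (s.re ^ (-1 - β) * b s ^ 2)

/-- The set of centres whose discs stay inside `O`. -/
def discDomain (O : Set (Pt n)) (E : Pt n →L[ℂ] Pt n) (E0 : Pt n) (b : ℂ → ℝ) : Set (Pt n) :=
  {z | ∀ s ∈ tsupport b, z - s • (E0 + E z) ∈ O}

theorem isOpen_discDomain (hO : IsOpen O) (hbc : HasCompactSupport b) :
    IsOpen (discDomain O E E0 b) := by
  rw [isOpen_iff_mem_nhds]
  intro z hz
  refine IsCompact.eventually_forall_of_forall_eventually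
    (P := fun z s => z - s • (E0 + E z) ∈ O) hbc fun s hs => ?_
  have hc : Continuous fun q : Pt n × ℂ => q.1 - q.2 • (E0 + E q.1) := by fun_prop
  exact hc.continuousAt.eventually (hO.mem_nhds (hz s hs))

theorem contDiffOn_of_tsupport {X : Type} [NormedAddCommGroup X] [NormedSpace ℝ X] {A : X → ℂ}
    (hA : Continuous A) {f : X → ℝ} {U : Set X} {N : WithTop ℕ∞}
    (h1 : ∀ q ∈ U, A q ∈ tsupport b → ContDiffAt ℝ N f q) (h2 : ∀ q, A q ∉ tsupport b → f q = 0) :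
    ContDiffOn ℝ N f U := fun q hq => by
  by_cases h : A q ∈ tsupport b
  · exact (h1 q hq h).contDiffWithinAt
  · have : f =ᶠ[𝓝 q] fun _ => 0 := by
      filter_upwards [hA.continuousAt.eventually ((isClosed_tsupport b).isOpen_compl.mem_nhds h)]
        with y hy using h2 y hy
    exact (contDiffAt_const.congr_of_eventuallyEq this).contDiffWithinAt

theorem contDiffAt_discAvg (hO : IsOpen O) (hF : ∀ z ∈ O, ContDiffAt ℝ 2 F z) (hb : ContDiff ℝ 2 b)
    (hbc : HasCompactSupport b) (hbs : tsupport b ⊆ {s | 0 < s.re})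
    (hz : z0 ∈ discDomain O E E0 b) : ContDiffAt ℝ 2 (discAvg F E E0 β b) z0 := by
  have hD := isOpen_discDomain (E := E) (E0 := E0) hO hbc
  refine ContDiffOn.contDiffAt (contDiffOn_integral_param (N := 2)
    (H := fun z s => F (z - s • (E0 + E z)) * (s.re ^ (-1 - β) * b s ^ 2)) hD hbc
    (fun z s _ hs => by simp [image_eq_zero_of_notMem_tsupport hs]) ?_) (hD.mem_nhds hz)
  refine contDiffOn_of_tsupport (b := b) (A := Prod.snd) continuous_snd (fun q hq hs => ?_)
    fun q hs => ?_
  · have hE : ContDiff ℝ 2 E := (E.restrictScalars ℝ).contDiff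
    have h1 : ContDiffAt ℝ 2 (fun q : Pt n × ℂ => F (q.1 - q.2 • (E0 + E q.1))) q :=
      (hF _ (hq.1 q.2 hs)).comp (f := fun q : Pt n × ℂ => q.1 - q.2 • (E0 + E q.1)) q (by fun_prop)
    have h2 : ContDiffAt ℝ 2 (fun q : Pt n × ℂ => q.2.re ^ (-1 - β)) q :=
      ContDiffAt.rpow_const_of_ne (Complex.reCLM.contDiff.comp contDiff_snd).contDiffAt (hbs hs).ne'
    exact h1.mul (h2.mul ((hb.comp contDiff_snd).contDiffAt.pow 2))
  · simp [Function.HasUncurry.uncurry, image_eq_zero_of_notMem_tsupport hs]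

theorem integrable_disc_weight (hF : ∀ z ∈ O, ContDiffAt ℝ 2 F z)
    (hbc : HasCompactSupport b) (hbs : tsupport b ⊆ {s | 0 < s.re})
    (hz : z0 ∈ discDomain O E E0 b) {r : ℂ → ℝ} (hr : Continuous r)
    (hr0 : ∀ s, s ∉ tsupport b → r s = 0) :
    Integrable fun s : ℂ => F (z0 - s • (E0 + E z0)) * (s.re ^ (-1 - β) * r s) := by
  refine Continuous.integrable_of_hasCompactSupport ?_
    (HasCompactSupport.intro hbc fun s hs => by simp [hr0 s hs])
  refine continuous_iff_continuousAt.2 fun s => ?_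
  by_cases h : s ∈ tsupport b
  · have h1 : ContinuousAt (fun s : ℂ => F (z0 - s • (E0 + E z0))) s :=
      (hF _ (hz s h)).continuousAt.comp (f := fun s : ℂ => z0 - s • (E0 + E z0)) (by fun_prop)
    exact h1.mul ((Complex.continuous_re.continuousAt.rpow_const (Or.inl (hbs h).ne')).mul
      hr.continuousAt)
  · have : (fun s : ℂ => F (z0 - s • (E0 + E z0)) * (s.re ^ (-1 - β) * r s)) =ᶠ[𝓝 s] fun _ => 0 := by
      filter_upwards [(isClosed_tsupport b).isOpen_compl.mem_nhds h] with y hy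
      simp [hr0 y hy]
    exact continuousAt_const.congr this.symm

theorem fderiv_eq_zero_of_notMem_tsupport {s : ℂ} (hs : s ∉ tsupport b) : fderiv ℝ b s = 0 := by
  have : b =ᶠ[𝓝 s] fun _ => 0 := by
    filter_upwards [(isClosed_tsupport b).isOpen_compl.mem_nhds hs] with y hy using
      image_eq_zero_of_notMem_tsupport hy
  rw [this.fderiv_eq, fderiv_fun_const]; rfl

theorem dd_sq_eq_zero_of_notMem_tsupport {s : ℂ} (hs : s ∉ tsupport b) (κ : ℂ) :
    dd (fun y => b y ^ 2) κ s = 0 := by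
  have : (fun y => b y ^ 2) =ᶠ[𝓝 s] fun _ => 0 := by
    filter_upwards [(isClosed_tsupport b).isOpen_compl.mem_nhds hs] with y hy
    simp [image_eq_zero_of_notMem_tsupport hy]
  rw [dd_congr this]
  simp [dd]

/-- The quadratic differential expression in the cutoff which controls the averaging error. -/
noncomputable def bumpErr (g : ℝ) (b : ℂ → ℝ) (s : ℂ) : ℝ :=
  4 / g * (fderiv ℝ b s 1 ^ 2 + fderiv ℝ b s I ^ 2) +
    (dd (fun y => b y ^ 2) 1 s + dd (fun y => b y ^ 2) I s)

theorem continuous_bumpErr (hb : ContDiff ℝ 2 b) : Continuous (bumpErr g b) := by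
  have h1 : ∀ κ, Continuous fun s => fderiv ℝ b s κ := fun κ =>
    (hb.continuous_fderiv (by norm_num)).clm_apply continuous_const
  have h2 : ∀ κ, Continuous fun s => dd (fun y => b y ^ 2) κ s := fun κ => by
    have h3 : ContDiff ℝ 1 (fun s => fderiv ℝ (fun y => b y ^ 2) s κ) :=
      ((hb.pow 2).fderiv_right (m := 1) (by norm_num)).clm_apply contDiff_const
    exact (h3.continuous_fderiv (by norm_num)).clm_apply continuous_const
  have := h1 1; have := h1 I; have := h2 1; have := h2 I
  unfold bumpErr
  fun_prop

theorem lap_discAvg_le (hO : IsOpen O) (hF : ∀ z ∈ O, ContDiffAt ℝ 2 F z)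
    (hFpos : ∀ z ∈ O, 0 < F z) (hg : 0 < g)
    (hFr : ∀ z ∈ O, ∀ X, hs F X z * F z ≤ -g * normSq (pW (cR n F) X z))
    (hb : ContDiff ℝ 2 b) (hbc : HasCompactSupport b) (hbs : tsupport b ⊆ {s | 0 < s.re})
    (hz : z0 ∈ discDomain O E E0 b) (L : Pt n) :
    4 * hs (discAvg F E E0 β b) L z0 + 2 * β * fderiv ℝ (discAvg F E E0 β b) z0 L ≤
      β * (1 - β) * discAvg F E E0 β b z0 +
        ∫ s : ℂ, F (z0 - s • (E0 + E z0)) * (s.re ^ (-1 - β) * (s.re ^ 2 * bumpErr g b s)) := by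
  set V := discAvg F E E0 β b with hV
  have hV2 : ContDiffAt ℝ 2 V z0 := contDiffAt_discAvg hO hF hb hbc hbs hz
  have hD := isOpen_discDomain (E := E) (E0 := E0) hO hbc
  set H : ℂ → ℂ → ℝ := fun ζ s => F (z0 + ζ • L - (s + s.re * ζ) • (E0 + E (z0 + ζ • L))) *
    (s.re ^ (-1 - β) * ((1 + ζ.re) ^ (-β) * b (s + s.re * ζ) ^ 2)) with hH
  set U : Set ℂ := Metric.ball 0 (1 / 2) ∩ {ζ | z0 + ζ • L ∈ discDomain O E E0 b} with hU
  have hUo : IsOpen U := Metric.isOpen_ball.inter (hD.preimage (by fun_prop))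
  have h0U : (0 : ℂ) ∈ U := ⟨by simp, by simpa using hz⟩
  obtain ⟨R, hR⟩ := hbc.isBounded.exists_norm_le
  have hUre : ∀ ζ ∈ U, |ζ.re| < 1 / 2 := fun ζ hζ =>
    (Complex.abs_re_le_norm ζ).trans_lt (by simpa using hζ.1)
  have hk0 : ∀ ζ s, ζ ∈ U → s ∉ Metric.closedBall (0 : ℂ) (2 * R) → H ζ s = 0 := by
    intro ζ s hζ hs
    have : s + s.re * ζ ∉ tsupport b := fun hmem => hs (by
      have h1 := hR _ hmem
      have h2 : ‖(s.re : ℂ) * ζ‖ ≤ ‖s‖ * (1 / 2) := by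
        rw [norm_mul, Complex.norm_real]
        exact mul_le_mul (Complex.abs_re_le_norm s) (by simpa using (mem_ball_zero_iff.1 hζ.1).le)
          (norm_nonneg _) (norm_nonneg _)
      have h3 := norm_sub_le (s + s.re * ζ) (s.re * ζ)
      rw [add_sub_cancel_right] at h3
      rw [mem_closedBall_zero_iff]
      linarith)
    simp [hH, image_eq_zero_of_notMem_tsupport this]
  have hHs : ContDiffOn ℝ 2 (↿H) (U ×ˢ Set.univ) := by
    have hre : ContDiff ℝ 2 Complex.re := Complex.reCLM.contDiff
    have hof : ContDiff ℝ 2 (fun x : ℝ => (x : ℂ)) := Complex.ofRealCLM.contDiff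
    have hA : ContDiff ℝ 2 (fun q : ℂ × ℂ => q.2 + q.2.re * q.1) :=
      contDiff_snd.add ((hof.comp (hre.comp contDiff_snd)).mul contDiff_fst)
    refine contDiffOn_of_tsupport (b := b) hA.continuous (fun q hq hs => ?_) fun q hs => ?_
    · have hq1 : 0 < 1 + q.1.re := by have := abs_lt.1 (hUre _ hq.1); linarith
      have hq2 : 0 < q.2.re := by
        have h1 : 0 < (q.2 + q.2.re * q.1).re := hbs hs
        have h2 : (q.2 + q.2.re * q.1).re = q.2.re * (1 + q.1.re) := by simp; ring
        rw [h2] at h1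
        exact (pos_iff_pos_of_mul_pos h1).2 hq1
      have hE : ContDiff ℝ 2 E := (E.restrictScalars ℝ).contDiff
      have h1 : ContDiffAt ℝ 2 (fun q : ℂ × ℂ =>
          F (z0 + q.1 • L - (q.2 + q.2.re * q.1) • (E0 + E (z0 + q.1 • L)))) q :=
        (hF _ (hq.1.2 _ hs)).comp (f := fun q : ℂ × ℂ =>
          z0 + q.1 • L - (q.2 + q.2.re * q.1) • (E0 + E (z0 + q.1 • L))) q (by fun_prop)
      have h2 : ContDiffAt ℝ 2 (fun q : ℂ × ℂ => q.2.re ^ (-1 - β)) q :=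
        ContDiffAt.rpow_const_of_ne (hre.comp contDiff_snd).contDiffAt hq2.ne'
      have h3 : ContDiffAt ℝ 2 (fun q : ℂ × ℂ => (1 + q.1.re) ^ (-β)) q :=
        ContDiffAt.rpow_const_of_ne (contDiffAt_const.add (hre.comp contDiff_fst).contDiffAt) hq1.ne'
      exact h1.mul (h2.mul (h3.mul ((hb.comp hA).contDiffAt.pow 2)))
    · simp [Function.HasUncurry.uncurry, hH, image_eq_zero_of_notMem_tsupport hs]
  have hVW : ∀ ζ ∈ U, V (z0 + ζ • L) = ∫ s, H ζ s := fun ζ hζ => by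
    have hζ1 : 0 < 1 + ζ.re := by have := abs_lt.1 (hUre _ hζ); linarith
    rw [hV, discAvg, integral_shear _ hζ1]
    refine integral_congr_ae (Filter.Eventually.of_forall fun s => ?_)
    simp only [hH]
    have hre : (s + s.re * ζ).re = s.re * (1 + ζ.re) := by simp; ring
    by_cases hs : s + s.re * ζ ∈ tsupport b
    · have h1 : 0 < (s + s.re * ζ).re := hbs hs
      rw [hre] at h1 ⊢
      have hs0 : 0 < s.re := (pos_iff_pos_of_mul_pos h1).2 hζ1
      have h2 : (s.re * (1 + ζ.re)) ^ (-1 - β) * (1 + ζ.re) = s.re ^ (-1 - β) * (1 + ζ.re) ^ (-β) := by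
        rw [Real.mul_rpow hs0.le hζ1.le, mul_assoc]
        congr 1
        rw [← Real.rpow_add_one hζ1.ne']
        congr 1; ring
      linear_combination (F (z0 + ζ • L - (s + s.re * ζ) • (E0 + E (z0 + ζ • L))) *
        b (s + s.re * ζ) ^ 2) * h2
    · simp [image_eq_zero_of_notMem_tsupport hs]
  have hVW' : (fun ζ : ℂ => V (z0 + ζ • L + ζ ^ 2 • 0)) =ᶠ[𝓝 0] fun ζ => ∫ s, H ζ s := by
    filter_upwards [hUo.mem_nhds h0U] with ζ hζ
    rw [smul_zero, add_zero, hVW ζ hζ]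
  have hdd : ∀ κ : ℂ, dd V (κ • L) z0 = ∫ s, dd (fun ζ => H ζ s) κ 0 := fun κ => by
    have h1 := dd_comp_quadratic (a1 := L) (a2 := 0) hV2 κ
    rw [smul_zero, map_zero, add_zero, dd_congr hVW'] at h1
    rw [← h1]
    exact fderiv_fderiv_integral_param hUo (isCompact_closedBall _ _) hk0 hHs h0U κ κ
  have hd1 : fderiv ℝ V z0 L = ∫ s, fderiv ℝ (fun ζ => H ζ s) 0 1 := by
    have h1 := fderiv_comp_quadratic (F := V) (a0 := z0) (a1 := L) (a2 := 0) (y := 0)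
      (by simpa using hV2.differentiableAt (by norm_num)) 1
    rw [hVW'.fderiv_eq] at h1
    simp only [zero_smul, smul_zero, add_zero, one_smul] at h1
    rw [← h1]
    exact fderiv_integral_param hUo (isCompact_closedBall _ _) hk0 (hHs.of_le (by norm_num)) h0U 1
  have hk1 : ∀ κ ζ s, ζ ∈ U → s ∉ Metric.closedBall (0 : ℂ) (2 * R) →
      fderiv ℝ (fun ζ => H ζ s) ζ κ = 0 := fun κ ζ s hζ hs => fderiv_slice_eq_zero hUo hk0 hζ hs κ
  have hi1 : Integrable fun s => fderiv ℝ (fun ζ => H ζ s) 0 1 :=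
    integrable_slice (H := fun ζ s => fderiv ℝ (fun ζ => H ζ s) ζ 1) hUo (isCompact_closedBall _ _)
      (hk1 1) (contDiffOn_fderiv_slice hUo hHs 1).continuousOn h0U
  have hi2 : ∀ κ, Integrable fun s => dd (fun ζ => H ζ s) κ 0 := fun κ => by
    refine integrable_slice (H := fun ζ s => dd (fun ζ => H ζ s) κ ζ) hUo (isCompact_closedBall _ _)
      (fun ζ s hζ hs => fderiv_slice_eq_zero hUo (hk1 κ) hζ hs κ) ?_ h0U
    have h1 := contDiffOn_fderiv_slice hUo hHs κ
    have h2 : ContinuousOn (fun q : ℂ × ℂ =>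
        fderiv ℝ (↿fun (y : ℂ) (s : ℂ) => fderiv ℝ (fun y => H y s) y κ) q (κ, 0)) (U ×ˢ Set.univ) :=
      (h1.continuousOn_fderiv_of_isOpen (hUo.prod isOpen_univ) le_rfl).clm_apply continuousOn_const
    refine h2.congr fun q hq => ?_
    exact fderiv_slice (H := fun y s => fderiv ℝ (fun y => H y s) y κ) hUo h1 hq.1 q.2 κ
  have e1 : 4 * hs V L z0 + 2 * β * fderiv ℝ V z0 L = ∫ s, (dd (fun ζ => H ζ s) 1 0 +
      dd (fun ζ => H ζ s) I 0 + 2 * β * fderiv ℝ (fun ζ => H ζ s) 0 1) := by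
    rw [integral_add (Integrable.fun_add (hi2 1) (hi2 I)) (hi1.const_mul _), integral_add (hi2 1) (hi2 I),
      integral_const_mul, ← hdd, ← hdd, ← hd1, hs_eq_dd, one_smul]
    ring
  have hj1 := integrable_disc_weight (β := β) hF hbc hbs hz (r := fun s => b s ^ 2)
    (hb.continuous.pow 2) (fun s hs => by simp [image_eq_zero_of_notMem_tsupport hs])
  have hj2 := integrable_disc_weight (β := β) hF hbc hbs hz (r := fun s => s.re ^ 2 * bumpErr g b s)
    ((Complex.continuous_re.pow 2).mul (continuous_bumpErr hb)) (fun s hs => by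
      simp [bumpErr, fderiv_eq_zero_of_notMem_tsupport hs, dd_sq_eq_zero_of_notMem_tsupport hs])
  have e2 : β * (1 - β) * V z0 +
      ∫ s : ℂ, F (z0 - s • (E0 + E z0)) * (s.re ^ (-1 - β) * (s.re ^ 2 * bumpErr g b s)) =
      ∫ s : ℂ, (β * (1 - β) * (F (z0 - s • (E0 + E z0)) * (s.re ^ (-1 - β) * b s ^ 2)) +
        F (z0 - s • (E0 + E z0)) * (s.re ^ (-1 - β) * (s.re ^ 2 * bumpErr g b s))) := by
    rw [integral_add (hj1.const_mul _) hj2, integral_const_mul]; rfl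
  rw [e1, e2]
  refine integral_mono (((hi2 1).add (hi2 I)).add (hi1.const_mul _)) ((hj1.const_mul _).add hj2)
    fun s => ?_
  by_cases hs : s ∈ tsupport b
  · set a0 := z0 - s • (E0 + E z0) with ha0
    set a1 := L - (s.re : ℂ) • (E0 + E z0) - s • E L with ha1
    set a2 := -((s.re : ℂ) • E L) with ha2
    have ha : a0 ∈ O := hz s hs
    have hu2 := hF a0 ha
    have hfun : ∀ ζ : ℂ, z0 + ζ • L - (s + s.re * ζ) • (E0 + E (z0 + ζ • L)) =
        a0 + ζ • a1 + ζ ^ 2 • a2 := fun ζ => by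
      rw [ha0, ha1, ha2, map_add, map_smul]
      module
    have hdu : ∀ κ : ℂ, fderiv ℝ (fun ζ : ℂ => F (a0 + ζ • a1 + ζ ^ 2 • a2)) 0 κ =
        fderiv ℝ F a0 (κ • a1) := fun κ => by
      have := fderiv_comp_quadratic (F := F) (a0 := a0) (a1 := a1) (a2 := a2) (y := 0)
        (by simpa using hu2.differentiableAt (by norm_num)) κ
      simpa using this
    have hu : ContDiffAt ℝ 2 (fun ζ : ℂ => F (a0 + ζ • a1 + ζ ^ 2 • a2)) 0 := by
      have : ContDiffAt ℝ 2 F (a0 + (0 : ℂ) • a1 + (0 : ℂ) ^ 2 • a2) := by simpa using hu2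
      exact this.comp (f := fun ζ : ℂ => a0 + ζ • a1 + ζ ^ 2 • a2) 0 (by fun_prop)
    have hmain := lap_integrand_le (β := β) (s := s) (σ := s.re) (w := s.re ^ (-1 - β)) hu
      (by simpa using hFpos a0 ha) hg (Real.rpow_nonneg (hbs hs).le _) hb ?_
    · have hHeq : (fun ζ => H ζ s) = fun ζ => F (a0 + ζ • a1 + ζ ^ 2 • a2) *
          (s.re ^ (-1 - β) * ((1 + ζ.re) ^ (-β) * b (s + s.re * ζ) ^ 2)) := by
        funext ζ
        rw [← hfun]
      beta_reduce
      rw [hHeq]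
      refine hmain.trans (le_of_eq ?_)
      simp only [zero_smul, add_zero, bumpErr, ne_eq, OfNat.ofNat_ne_zero, not_false_eq_true,
        zero_pow]
      ring
    · rw [dd_comp_quadratic hu2, dd_comp_quadratic hu2, hdu, hdu]
      have h1 := hFr a0 ha a1
      rw [hs_eq_dd, normSq_pW_cR] at h1
      have h2 : (2 * I ^ 2 : ℂ) • a2 = -((2 * 1 ^ 2 : ℂ) • a2) := by
        rw [I_sq, ← neg_smul]; congr 1; ring
      rw [h2, map_neg]
      simp only [one_smul, zero_smul, add_zero, ne_eq, OfNat.ofNat_ne_zero, not_false_eq_true,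
        zero_pow]
      linarith
  · have h1 : (fun ζ => H ζ s) =ᶠ[𝓝 0] fun _ => 0 := by
      have hc : Continuous fun ζ : ℂ => s + s.re * ζ := by fun_prop
      filter_upwards [hc.continuousAt.eventually ((isClosed_tsupport b).isOpen_compl.mem_nhds
        (show s + s.re * 0 ∉ tsupport b by simpa using hs))] with ζ hζ
      simp [hH, image_eq_zero_of_notMem_tsupport hζ]
    have h2 : fderiv ℝ (fun ζ => H ζ s) 0 = 0 := by rw [h1.fderiv_eq, fderiv_fun_const]; rfl
    have h3 : ∀ κ, dd (fun ζ => H ζ s) κ 0 = 0 := fun κ => by rw [dd_congr h1]; simp [dd]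
    simp [h2, h3, bumpErr, fderiv_eq_zero_of_notMem_tsupport hs, dd_sq_eq_zero_of_notMem_tsupport hs,
      image_eq_zero_of_notMem_tsupport hs]

theorem discAvg_riccati (hO : IsOpen O) (hF : ∀ z ∈ O, ContDiffAt ℝ 2 F z)
    (hFpos : ∀ z ∈ O, 0 < F z) (hg : 0 < g)
    (hFr : ∀ z ∈ O, ∀ X, hs F X z * F z ≤ -g * normSq (pW (cR n F) X z))
    (hb : ContDiff ℝ 2 b) (hbc : HasCompactSupport b) (hbs : tsupport b ⊆ {s | 0 < s.re})
    (hz : z0 ∈ discDomain O E E0 b) {A : ℝ} (hA : 0 < A)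
    (herr : ∫ s : ℂ, F (z0 - s • (E0 + E z0)) * (s.re ^ (-1 - β) * (s.re ^ 2 * bumpErr g b s)) ≤
      (A - β * (1 - β)) * discAvg F E E0 β b z0) (L : Pt n) :
    hs (discAvg F E E0 β b) L z0 * discAvg F E E0 β b z0 ≤
      -(β ^ 2 / A) * normSq (pW (cR n (discAvg F E E0 β b)) L z0) := by
  set V := discAvg F E E0 β b with hVdef
  have hV2 : ContDiffAt ℝ 2 V z0 := contDiffAt_discAvg hO hF hb hbc hbs hz
  have hlin : ∀ L : Pt n, β ^ 2 * fderiv ℝ V z0 L ^ 2 + 4 * hs V L z0 * (A * V z0) ≤ 0 := fun L => by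
    have h1 : ∀ x : ℝ, 0 ≤ (-(4 * hs V L z0)) * (x * x) + (-(2 * β * fderiv ℝ V z0 L)) * x +
        A * V z0 := fun x => by
      have := lap_discAvg_le hO hF hFpos hg hFr hb hbc hbs hz (β := β) (x • L)
      rw [← hVdef, hs_smul_real hV2, map_smul, smul_eq_mul] at this
      nlinarith
    have h2 := discrim_le_zero h1
    rw [discrim] at h2
    nlinarith
  set w := pW (cR n V) L z0 with hw
  by_cases hw0 : w = 0
  · have := hlin L
    rw [hw0, map_zero, mul_zero]
    have h4 : A * (hs V L z0 * V z0) ≤ 0 := by nlinarith [sq_nonneg (β * fderiv ℝ V z0 L)]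
    exact nonpos_of_mul_nonpos_right h4 hA
  · set μ : ℂ := (starRingEnd ℂ) w / ‖w‖ with hμ
    have hwn : (‖w‖ : ℂ) ≠ 0 := by simpa using hw0
    have hμn : ‖μ‖ = 1 := by
      rw [hμ, norm_div, RCLike.norm_conj, Complex.norm_real, norm_norm]
      exact div_self (norm_ne_zero_iff.2 hw0)
    have h1 : fderiv ℝ V z0 (μ • L) = 2 * ‖w‖ := by
      rw [← two_mul_re_pW_cR, pW_smul_left, ← hw, hμ, div_mul_eq_mul_div,
        mul_comm ((starRingEnd ℂ) w), Complex.mul_conj, Complex.normSq_eq_norm_sq]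
      have : ((‖w‖ ^ 2 : ℝ) : ℂ) / (‖w‖ : ℂ) = ((‖w‖ : ℝ) : ℂ) := by
        push_cast; field_simp
      rw [this, Complex.ofReal_re]
    have h2 : hs V (μ • L) z0 = hs V L z0 := by
      have h5 : ((hs V (μ • L) z0 : ℝ) : ℂ) = (hs V L z0 : ℝ) := by
        rw [← levi_self_eq_hs hV2, ← levi_self_eq_hs hV2, levi_smul_left, levi_smul_right,
          ← mul_assoc, Complex.mul_conj, Complex.normSq_eq_norm_sq, hμn]
        simp
      exact_mod_cast h5
    have h3 := hlin (μ • L)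
    rw [h1, h2] at h3
    rw [Complex.normSq_eq_norm_sq]
    have h4 : A * (hs V L z0 * V z0) ≤ A * (-(β ^ 2 / A) * ‖w‖ ^ 2) := by
      have : A * (-(β ^ 2 / A) * ‖w‖ ^ 2) = -(β ^ 2 * ‖w‖ ^ 2) := by field_simp
      rw [this]; nlinarith
    exact le_of_mul_le_mul_left h4 hA

theorem hs_log_add_le {V : Pt n → ℝ} {a β : ℝ} {z L : Pt n} (hV : ContDiffAt ℝ 2 V z) (hV0 : 0 < V z)
    (hβ : 0 < β) (h : hs V L z * V z ≤ -a * normSq (pW (cR n V) L z)) :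
    hs (fun y => β⁻¹ * Real.log (V y)) L z +
      β * (a + 1) * normSq (pW (cR n fun y => β⁻¹ * Real.log (V y)) L z) ≤ 0 := by
  have hφ : ContDiffAt ℝ 2 (fun x => β⁻¹ * Real.log x) (V z) :=
    contDiffAt_const.mul (Real.contDiffAt_log.2 hV0.ne')
  have e1 : deriv (fun x => β⁻¹ * Real.log x) = fun x => β⁻¹ * x⁻¹ := by
    funext x; rw [deriv_const_mul_field, Real.deriv_log]
  have e2 : deriv (fun x : ℝ => β⁻¹ * x⁻¹) (V z) = -(β⁻¹ * (V z ^ 2)⁻¹) := by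
    rw [deriv_const_mul_field, deriv_inv]; ring
  rw [hs_comp hV hφ, e1, e2, pW_comp_real (φ := fun x => β⁻¹ * Real.log x) (hV.differentiableAt (by norm_num))
    (hφ.differentiableAt (by norm_num)), e1, map_mul, Complex.normSq_ofReal]
  set N := normSq (pW (cR n V) L z)
  have h5 : β⁻¹ * (V z)⁻¹ * hs V L z ≤ β⁻¹ * (V z ^ 2)⁻¹ * (-a * N) := by
    have : β⁻¹ * (V z)⁻¹ * hs V L z = β⁻¹ * (V z ^ 2)⁻¹ * (hs V L z * V z) := by field_simp
    rw [this]
    exact mul_le_mul_of_nonneg_left h (by positivity)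
  have h6 : β * (a + 1) * (β⁻¹ * (V z)⁻¹ * (β⁻¹ * (V z)⁻¹) * N) = β⁻¹ * (V z ^ 2)⁻¹ * ((a + 1) * N) := by
    field_simp
  rw [h6]
  linarith

end average

section bump

open MeasureTheory

theorem fderiv_re_mul_im {P Q : ℝ → ℝ} (hP : Differentiable ℝ P) (hQ : Differentiable ℝ Q)
    (s v : ℂ) : fderiv ℝ (fun s : ℂ => P s.re * Q s.im) s v =
      deriv P s.re * v.re * Q s.im + P s.re * (deriv Q s.im * v.im) := by
  have h1 : HasFDerivAt (fun s : ℂ => P s.re) (deriv P s.re • Complex.reCLM) s :=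
    (hP s.re).hasDerivAt.comp_hasFDerivAt s Complex.reCLM.hasFDerivAt
  have h2 : HasFDerivAt (fun s : ℂ => Q s.im) (deriv Q s.im • Complex.imCLM) s :=
    (hQ s.im).hasDerivAt.comp_hasFDerivAt s Complex.imCLM.hasFDerivAt
  rw [(h1.fun_mul h2).fderiv]
  simp
  ring

theorem dd_re_mul_im {P Q : ℝ → ℝ} (hP : ContDiff ℝ 2 P) (hQ : ContDiff ℝ 2 Q) (s : ℂ) :
    dd (fun s : ℂ => P s.re * Q s.im) 1 s = deriv (deriv P) s.re * Q s.im ∧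
      dd (fun s : ℂ => P s.re * Q s.im) I s = P s.re * deriv (deriv Q) s.im := by
  have hP1 : Differentiable ℝ P := hP.differentiable (by norm_num)
  have hQ1 : Differentiable ℝ Q := hQ.differentiable (by norm_num)
  have hP2 : Differentiable ℝ (deriv P) :=
    ((contDiff_succ_iff_deriv (n := 1)).1 hP).2.2.differentiable (by norm_num)
  have hQ2 : Differentiable ℝ (deriv Q) :=
    ((contDiff_succ_iff_deriv (n := 1)).1 hQ).2.2.differentiable (by norm_num)
  constructor
  · have : (fun y => fderiv ℝ (fun s : ℂ => P s.re * Q s.im) y 1) =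
        fun y : ℂ => deriv P y.re * Q y.im := by
      funext y; rw [fderiv_re_mul_im hP1 hQ1]; simp
    unfold dd
    rw [this, fderiv_re_mul_im hP2 hQ1]; simp
  · have : (fun y => fderiv ℝ (fun s : ℂ => P s.re * Q s.im) y I) =
        fun y : ℂ => P y.re * deriv Q y.im := by
      funext y; rw [fderiv_re_mul_im hP1 hQ1]; simp
    unfold dd
    rw [this, fderiv_re_mul_im hP1 hQ2]; simp

/-- The bump function `f` in the variable `log x / R`, extended by zero to `x ≤ 0`. -/
noncomputable def logBump (f : ℝ → ℝ) (R x : ℝ) : ℝ := if 0 < x then f (Real.log x / R) else 0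

theorem logBump_eventuallyEq (f : ℝ → ℝ) (R : ℝ) {x : ℝ} (hx : 0 < x) :
    logBump f R =ᶠ[𝓝 x] fun y => f (Real.log y / R) := by
  filter_upwards [eventually_gt_nhds hx] with y hy
  simp [logBump, hy]

theorem logBump_eq_zero {f : ℝ → ℝ} {R x : ℝ} (hR : 0 < R) (hf : ∀ t, 2 ≤ |t| → f t = 0)
    (hx : x ∉ Set.Icc (Real.exp (-(2 * R))) (Real.exp (2 * R))) : logBump f R x = 0 := by
  unfold logBump
  split_ifs with h
  · apply hf
    rw [abs_div, abs_of_pos hR, le_div_iff₀ hR]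
    rw [Set.mem_Icc, not_and_or, not_le, not_le, ← Real.log_lt_iff_lt_exp h,
      ← Real.lt_log_iff_exp_lt h] at hx
    rcases hx with hx | hx
    · have := neg_le_abs (Real.log x); linarith
    · have := le_abs_self (Real.log x); linarith
  · rfl

theorem contDiff_logBump {f : ℝ → ℝ} {R : ℝ} (hR : 0 < R) (hf : ContDiff ℝ ∞ f)
    (hf0 : ∀ t, 2 ≤ |t| → f t = 0) : ContDiff ℝ ∞ (logBump f R) := by
  rw [contDiff_iff_contDiffAt]
  intro x
  by_cases hx : 0 < x
  · refine ContDiffAt.congr_of_eventuallyEq ?_ (logBump_eventuallyEq f R hx)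
    exact hf.contDiffAt.comp x ((Real.contDiffAt_log.2 hx.ne').div_const R)
  · have hc : ContDiffAt ℝ ∞ (fun _ : ℝ => (0 : ℝ)) x := contDiffAt_const
    refine hc.congr_of_eventuallyEq ?_
    have := Real.exp_pos (-(2 * R))
    filter_upwards [eventually_lt_nhds (lt_of_le_of_lt (not_lt.1 hx) this)] with y hy
    exact logBump_eq_zero hR hf0 fun h => absurd h.1 (not_le.2 hy)

theorem deriv_logBump {f : ℝ → ℝ} {R x : ℝ} (hf : Differentiable ℝ f) (hx : 0 < x) :
    deriv (logBump f R) x = deriv f (Real.log x / R) / (R * x) := by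
  rw [(logBump_eventuallyEq f R hx).deriv_eq]
  have h := (hf (Real.log x / R)).hasDerivAt.comp x ((Real.hasDerivAt_log hx.ne').div_const R)
  rw [show (fun y => f (Real.log y / R)) = f ∘ fun y => Real.log y / R from rfl, h.deriv]
  field_simp

theorem deriv_deriv_logBump {f : ℝ → ℝ} {R x : ℝ} (hf : ContDiff ℝ 2 f) (hR : 0 < R)
    (hx : 0 < x) : deriv (deriv (logBump f R)) x =
      (deriv (deriv f) (Real.log x / R) / R - deriv f (Real.log x / R)) / (R * x ^ 2) := by
  have hf1 : Differentiable ℝ f := hf.differentiable (by norm_num)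
  have hf2 : Differentiable ℝ (deriv f) :=
    ((contDiff_succ_iff_deriv (n := 1)).1 hf).2.2.differentiable (by norm_num)
  have h1 : deriv (logBump f R) =ᶠ[𝓝 x] fun y => deriv f (Real.log y / R) / (R * y) := by
    filter_upwards [eventually_gt_nhds hx] with y hy using deriv_logBump hf1 hy
  rw [h1.deriv_eq]
  have h := (hf2 (Real.log x / R)).hasDerivAt.comp x ((Real.hasDerivAt_log hx.ne').div_const R)
  have h2 := h.div ((hasDerivAt_id x).const_mul R) (by simp; exact ⟨hR.ne', hx.ne'⟩)
  refine (h2.congr_deriv ?_).deriv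
  simp only [Function.comp, id]
  field_simp

theorem deriv_comp_div_const (f : ℝ → ℝ) (S : ℝ) :
    deriv (fun y => f (y / S)) = fun y => deriv f (y / S) / S := by
  funext y
  have := deriv_comp_mul_left S⁻¹ f y
  simp only [smul_eq_mul] at this
  rw [show (fun y => f (y / S)) = fun y => f (S⁻¹ * y) by funext y; ring_nf, this]
  ring_nf

theorem exists_bound_of_eq_zero {f : ℝ → ℝ} (hf : Continuous f) (h0 : ∀ t, 2 < |t| → f t = 0) :
    ∃ C, 0 < C ∧ ∀ t, |f t| ≤ C := by
  obtain ⟨C, hC⟩ := (isCompact_Icc (a := (-2 : ℝ)) (b := 2)).exists_bound_of_continuousOn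
    hf.continuousOn
  refine ⟨max C 1, by positivity, fun t => ?_⟩
  by_cases ht : 2 < |t|
  · rw [h0 t ht]; simp
  · exact (hC t (abs_le.1 (not_lt.1 ht))).trans (le_max_left _ _)

theorem exists_even_bump : ∃ f : ℝ → ℝ, ContDiff ℝ ∞ f ∧ (∀ t, f (-t) = f t) ∧
    (∀ t, |t| ≤ 1 → f t = 1) ∧ (∀ t, 2 ≤ |t| → f t = 0) ∧ (∀ t, 0 ≤ f t) ∧ ∀ t, f t ≤ 1 := by
  let F : ContDiffBump (0 : ℝ) := ⟨1, 2, one_pos, one_lt_two⟩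
  refine ⟨F, F.contDiff, fun t => F.neg t, fun t ht => F.one_of_mem_closedBall (by simpa using ht),
    fun t ht => F.zero_of_le_dist (by simpa using ht), fun t => F.nonneg, fun t => F.le_one⟩

theorem deriv_eq_zero_of_two_lt_abs {f : ℝ → ℝ} (h0 : ∀ t, 2 < |t| → f t = 0) {t : ℝ}
    (ht : 2 < |t|) : deriv f t = 0 := by
  have : f =ᶠ[𝓝 t] fun _ => 0 := by
    filter_upwards [continuous_abs.continuousAt.eventually (lt_mem_nhds ht)] with y hy using h0 y hy
  rw [this.deriv_eq]; simp

theorem setIntegral_inv_re {a b c : ℝ} (ha : 0 < a) (hab : a ≤ b) (hc : 0 ≤ c) :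
    ∫ s in Set.Icc a b ×ℂ Set.Icc (-c) c, s.re⁻¹ = Real.log (b / a) * (2 * c) := by
  have h1 : Set.Icc a b ×ℂ Set.Icc (-c) c =
      Complex.measurableEquivRealProd ⁻¹' (Set.Icc a b ×ˢ Set.Icc (-c) c) := by
    ext s; simp [Complex.mem_reProdIm, Complex.measurableEquivRealProd_apply]; tauto
  rw [h1]
  have h2 := Complex.volume_preserving_equiv_real_prod.setIntegral_preimage_emb
    Complex.measurableEquivRealProd.measurableEmbedding (fun x : ℝ × ℝ => x.1⁻¹)
    (Set.Icc a b ×ˢ Set.Icc (-c) c)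
  simp only [Complex.measurableEquivRealProd_apply] at h2
  rw [h2]
  have h3 := setIntegral_prod_mul (μ := (volume : Measure ℝ)) (ν := (volume : Measure ℝ))
    (fun x : ℝ => x⁻¹) (fun _ : ℝ => (1 : ℝ)) (Set.Icc a b) (Set.Icc (-c) c)
  simp only [mul_one] at h3
  rw [Measure.volume_eq_prod, h3, integral_Icc_eq_integral_Ioc,
    ← intervalIntegral.integral_of_le hab, integral_inv_of_pos ha (ha.trans_le hab)]
  simp
  left
  rw [max_eq_left (by linarith)]; ring

theorem integrableOn_inv_re {a b c : ℝ} (ha : 0 < a) :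
    IntegrableOn (fun s : ℂ => s.re⁻¹) (Set.Icc a b ×ℂ Set.Icc (-c) c) := by
  refine ContinuousOn.integrableOn_compact (isCompact_Icc.reProdIm isCompact_Icc) ?_
  refine Complex.continuous_re.continuousOn.inv₀ fun s hs => ?_
  exact (ha.trans_le (Complex.mem_reProdIm.1 hs).1.1).ne'

/-- Logarithmically wide bumps make the error in the discrete Riccati inequality relatively
small. -/
theorem exists_bump_bumpErr {g κ : ℝ} (hg : 0 < g) (hκ : 0 < κ) :
    ∃ b : ℂ → ℝ, ContDiff ℝ ∞ b ∧ HasCompactSupport b ∧ tsupport b ⊆ {s | 0 < s.re} ∧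
      (∀ s, b ((starRingEnd ℂ) s) = b s) ∧ b 1 = 1 ∧
      ∫ s : ℂ, s.re * |bumpErr g b s| ≤ κ * ∫ s : ℂ, s.re⁻¹ * b s ^ 2 := by
  obtain ⟨f, hf, heven, hf1, hf0, hfn, hfl⟩ := exists_even_bump
  set u : ℝ → ℝ := fun t => f t ^ 2 with hu
  have huc : ContDiff ℝ ∞ u := hf.pow 2
  have hu0 : ∀ t, 2 ≤ |t| → u t = 0 := fun t ht => by simp [hu, hf0 t ht]
  have hle : (2 : WithTop ℕ∞) ≤ ∞ := WithTop.coe_le_coe.2 le_top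
  have hd : ∀ {v : ℝ → ℝ}, ContDiff ℝ ∞ v → ContDiff ℝ ∞ (deriv v) := fun h =>
    (contDiff_infty_iff_deriv.1 h).2
  have hlt : ∀ {v : ℝ → ℝ}, (∀ t, 2 ≤ |t| → v t = 0) → ∀ t, 2 < |t| → v t = 0 :=
    fun h t ht => h t ht.le
  obtain ⟨C1, hC1, hf'⟩ := exists_bound_of_eq_zero (hd hf).continuous
    fun t ht => deriv_eq_zero_of_two_lt_abs (hlt hf0) ht
  obtain ⟨C2, hC2, hu'⟩ := exists_bound_of_eq_zero (hd huc).continuous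
    fun t ht => deriv_eq_zero_of_two_lt_abs (hlt hu0) ht
  obtain ⟨C3, hC3, hu''⟩ := exists_bound_of_eq_zero (hd (hd huc)).continuous
    fun t ht => deriv_eq_zero_of_two_lt_abs (fun t ht => deriv_eq_zero_of_two_lt_abs (hlt hu0) ht) ht
  set M := 8 * C1 ^ 2 / g + (2 * C3 + C2) with hM
  have hMpos : 0 < M := by positivity
  set R := max 1 (4 * M / κ) with hR
  have hR1 : 1 ≤ R := le_max_left _ _
  have hR0 : 0 < R := by linarith
  have hRM : M ≤ κ * R / 4 := by
    have : 4 * M / κ ≤ R := le_max_right _ _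
    rw [div_le_iff₀ hκ] at this; linarith
  set S := R * Real.exp (2 * R) with hS
  have hS0 : 0 < S := by positivity
  set P := logBump f R with hP
  set Q : ℝ → ℝ := fun y => f (y / S) with hQ
  have hPc : ContDiff ℝ ∞ P := contDiff_logBump hR0 hf hf0
  have hQc : ContDiff ℝ ∞ Q := hf.comp (contDiff_id.div_const S)
  set a := Real.exp (-(2 * R)) with ha
  set A := Real.exp (2 * R) with hA
  have ha0 : 0 < a := Real.exp_pos _
  have haA : a ≤ A := Real.exp_le_exp.2 (by linarith)
  set K := Set.Icc a A ×ℂ Set.Icc (-(2 * S)) (2 * S) with hK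
  have hKc : IsCompact K := isCompact_Icc.reProdIm isCompact_Icc
  set b : ℂ → ℝ := fun s => P s.re * Q s.im with hb
  have hbc : ContDiff ℝ ∞ b :=
    (hPc.comp Complex.reCLM.contDiff).mul (hQc.comp Complex.imCLM.contDiff)
  have hb0 : ∀ s, s ∉ K → b s = 0 := by
    intro s hsK
    rw [hK, Complex.mem_reProdIm, not_and_or] at hsK
    rcases hsK with h | h
    · simp only [hb, hP, logBump_eq_zero hR0 hf0 h, zero_mul]
    · have : Q s.im = 0 := by
        apply hf0
        rw [abs_div, abs_of_pos hS0, le_div_iff₀ hS0]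
        by_contra hlt'
        exact h (abs_le.1 (not_le.1 hlt').le)
      simp only [hb, this, mul_zero]
  have hbt : tsupport b ⊆ K := closure_minimal (fun s hsb => by
    by_contra h; exact hsb (hb0 s h)) hKc.isClosed
  have hbs : HasCompactSupport b := HasCompactSupport.of_support_subset_isCompact hKc
    fun s hsb => by by_contra h; exact hsb (hb0 s h)
  refine ⟨b, hbc, hbs, fun s hsb => ha0.trans_le (Complex.mem_reProdIm.1 (hbt hsb)).1.1, ?_, ?_, ?_⟩
  · intro s
    simp only [hb, hQ, Complex.conj_re, Complex.conj_im, neg_div, heven]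
  · simp [hb, hP, hQ, logBump, hf1]
  have herr0 : ∀ s, s ∉ K → bumpErr g b s = 0 := fun s hsK => by
    have h1 : s ∉ tsupport b := fun h => hsK (hbt h)
    simp [bumpErr, fderiv_eq_zero_of_notMem_tsupport h1, dd_sq_eq_zero_of_notMem_tsupport h1]
  have hsq : (fun y : ℂ => b y ^ 2) = fun s : ℂ => logBump u R s.re * (fun y => u (y / S)) s.im := by
    funext s
    simp only [hb, hP, hQ, hu, logBump]
    split_ifs <;> ring
  have hPu : ContDiff ℝ ∞ (logBump u R) := contDiff_logBump hR0 huc hu0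
  have hQu : ContDiff ℝ ∞ (fun y => u (y / S)) := huc.comp (contDiff_id.div_const S)
  have hul : ∀ t, |u t| ≤ 1 := fun t => by
    rw [hu, abs_of_nonneg (by positivity)]; exact pow_le_one₀ (hfn t) (hfl t)
  have hPl : ∀ x, |logBump u R x| ≤ 1 := fun x => by
    unfold logBump; split_ifs
    · exact hul _
    · simp
  have hPl' : ∀ x, |P x| ≤ 1 := fun x => by
    rw [hP]; unfold logBump; split_ifs
    · rw [abs_of_nonneg (hfn _)]; exact hfl _
    · simp
  have hQl : ∀ x, |Q x| ≤ 1 := fun x => by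
    simp only [hQ]; rw [abs_of_nonneg (hfn _)]; exact hfl _
  have hbound : ∀ s ∈ K, s.re * |bumpErr g b s| ≤ M / R * s.re⁻¹ := by
    intro s hsK
    obtain ⟨⟨h1, h2⟩, -⟩ := Complex.mem_reProdIm.1 hsK
    have hx : 0 < s.re := ha0.trans_le h1
    have e1 : fderiv ℝ b s 1 = deriv f (Real.log s.re / R) / (R * s.re) * Q s.im := by
      rw [hb, fderiv_re_mul_im (hPc.differentiable (by simp)) (hQc.differentiable (by simp)), hP,
        deriv_logBump (hf.differentiable (by simp)) hx]
      simp
    have e2 : fderiv ℝ b s I = P s.re * (deriv f (s.im / S) / S) := by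
      rw [hb, fderiv_re_mul_im (hPc.differentiable (by simp)) (hQc.differentiable (by simp)), hQ,
        deriv_comp_div_const]
      simp
    obtain ⟨e3, e4⟩ := dd_re_mul_im (hPu.of_le hle) (hQu.of_le hle) s
    rw [← hsq] at e3 e4
    rw [deriv_deriv_logBump (huc.of_le hle) hR0 hx] at e3
    rw [deriv_comp_div_const] at e4
    have e5 : deriv (fun y => deriv u (y / S) / S) s.im = deriv (deriv u) (s.im / S) / S / S := by
      have := congrFun (deriv_comp_div_const (deriv u) S) s.im
      rw [deriv_div_const, this]
    rw [e5] at e4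
    have hxS : s.re / S ≤ 1 / R := by
      rw [div_le_div_iff₀ hS0 hR0, hS]; nlinarith
    have hxS2 : (s.re / S) ^ 2 ≤ 1 / R := by
      calc (s.re / S) ^ 2 ≤ (1 / R) ^ 2 := by gcongr
        _ ≤ 1 / R := by
          rw [sq]; exact mul_le_of_le_one_left (by positivity) (by rw [div_le_one hR0]; exact hR1)
    have hR2 : (1 / R) ^ 2 ≤ 1 / R := by
      rw [sq]; exact mul_le_of_le_one_left (by positivity) (by rw [div_le_one hR0]; exact hR1)
    have b1 : s.re ^ 2 * fderiv ℝ b s 1 ^ 2 ≤ C1 ^ 2 * (1 / R) := by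
      have : s.re ^ 2 * fderiv ℝ b s 1 ^ 2 =
          deriv f (Real.log s.re / R) ^ 2 * (1 / R) ^ 2 * Q s.im ^ 2 := by
        rw [e1]; field_simp
      rw [this]
      have q1 : deriv f (Real.log s.re / R) ^ 2 ≤ C1 ^ 2 := sq_le_sq' (abs_le.1 (hf' _)).1 (abs_le.1 (hf' _)).2
      have q2 : Q s.im ^ 2 ≤ 1 := (sq_le_one_iff_abs_le_one _).2 (hQl _)
      calc _ ≤ C1 ^ 2 * (1 / R) * 1 := by gcongr
        _ = _ := by ring
    have b2 : s.re ^ 2 * fderiv ℝ b s I ^ 2 ≤ C1 ^ 2 * (1 / R) := by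
      have : s.re ^ 2 * fderiv ℝ b s I ^ 2 =
          deriv f (s.im / S) ^ 2 * (s.re / S) ^ 2 * P s.re ^ 2 := by
        rw [e2]; field_simp
      rw [this]
      have q1 : deriv f (s.im / S) ^ 2 ≤ C1 ^ 2 := sq_le_sq' (abs_le.1 (hf' _)).1 (abs_le.1 (hf' _)).2
      have q2 : P s.re ^ 2 ≤ 1 := (sq_le_one_iff_abs_le_one _).2 (hPl' _)
      calc _ ≤ C1 ^ 2 * (1 / R) * 1 := by gcongr
        _ = _ := by ring
    have b3 : s.re ^ 2 * |dd (fun y => b y ^ 2) 1 s| ≤ (C3 + C2) * (1 / R) := by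
      rw [e3]
      have : s.re ^ 2 * |(deriv (deriv u) (Real.log s.re / R) / R - deriv u (Real.log s.re / R)) /
          (R * s.re ^ 2) * u (s.im / S)| = |deriv (deriv u) (Real.log s.re / R) / R -
            deriv u (Real.log s.re / R)| * |u (s.im / S)| * (1 / R) := by
        rw [abs_mul, abs_div, abs_mul R, abs_of_pos hR0, abs_of_pos (by positivity : 0 < s.re ^ 2)]
        field_simp
      rw [this]
      have q1 : |deriv (deriv u) (Real.log s.re / R) / R - deriv u (Real.log s.re / R)| ≤ C3 + C2 := by
        refine (abs_sub _ _).trans (add_le_add ?_ (hu' _))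
        rw [abs_div, abs_of_pos hR0]
        exact (div_le_self (abs_nonneg _) hR1).trans (hu'' _)
      calc _ ≤ (C3 + C2) * 1 * (1 / R) := by gcongr; exact hul _
        _ = _ := by ring
    have b4 : s.re ^ 2 * |dd (fun y => b y ^ 2) I s| ≤ C3 * (1 / R) := by
      rw [e4]
      have : s.re ^ 2 * |logBump u R s.re * (deriv (deriv u) (s.im / S) / S / S)| =
          |logBump u R s.re| * |deriv (deriv u) (s.im / S)| * (s.re / S) ^ 2 := by
        rw [abs_mul, abs_div, abs_div, abs_of_pos hS0]
        field_simp
      rw [this]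
      calc _ ≤ 1 * C3 * (1 / R) := by gcongr; exacts [hPl _, hu'' _]
        _ = _ := by ring
    have hfin : s.re ^ 2 * |bumpErr g b s| ≤ M / R := by
      have t : |bumpErr g b s| ≤ 4 / g * (fderiv ℝ b s 1 ^ 2 + fderiv ℝ b s I ^ 2) +
          (|dd (fun y => b y ^ 2) 1 s| + |dd (fun y => b y ^ 2) I s|) := by
        unfold bumpErr
        refine (abs_add_le _ _).trans (add_le_add ?_ (abs_add_le _ _))
        rw [abs_of_nonneg (by positivity)]
      calc s.re ^ 2 * |bumpErr g b s|
          ≤ s.re ^ 2 * (4 / g * (fderiv ℝ b s 1 ^ 2 + fderiv ℝ b s I ^ 2) +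
            (|dd (fun y => b y ^ 2) 1 s| + |dd (fun y => b y ^ 2) I s|)) := by gcongr
        _ = 4 / g * (s.re ^ 2 * fderiv ℝ b s 1 ^ 2 + s.re ^ 2 * fderiv ℝ b s I ^ 2) +
            (s.re ^ 2 * |dd (fun y => b y ^ 2) 1 s| + s.re ^ 2 * |dd (fun y => b y ^ 2) I s|) := by
          ring
        _ ≤ 4 / g * (C1 ^ 2 * (1 / R) + C1 ^ 2 * (1 / R)) + ((C3 + C2) * (1 / R) + C3 * (1 / R)) := by
          gcongr
        _ = M / R := by rw [hM]; ring
    have : s.re * |bumpErr g b s| = s.re ^ 2 * |bumpErr g b s| * s.re⁻¹ := by field_simp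
    rw [this]
    gcongr
  have hup : ∫ s : ℂ, s.re * |bumpErr g b s| ≤ M / R * (Real.log (A / a) * (2 * (2 * S))) := by
    rw [← setIntegral_eq_integral_of_forall_compl_eq_zero (s := K)
      (fun s hsK => by rw [herr0 s hsK]; simp), ← setIntegral_inv_re ha0 haA (by positivity),
      ← integral_const_mul]
    refine setIntegral_mono_on ?_ ((integrableOn_inv_re ha0).const_mul _)
      hKc.measurableSet hbound
    exact (Complex.continuous_re.mul
      (continuous_bumpErr (hbc.of_le hle)).abs).continuousOn.integrableOn_compact hKc
  have hlow : Real.log (Real.exp R / Real.exp (-R)) * (2 * S) ≤ ∫ s : ℂ, s.re⁻¹ * b s ^ 2 := by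
    set K' := Set.Icc (Real.exp (-R)) (Real.exp R) ×ℂ Set.Icc (-S) S with hK'
    have hK'c : IsCompact K' := isCompact_Icc.reProdIm isCompact_Icc
    have hKK : K' ⊆ K := by
      intro s hsK
      obtain ⟨⟨h1, h2⟩, h3, h4⟩ := Complex.mem_reProdIm.1 hsK
      refine Complex.mem_reProdIm.2 ⟨⟨le_trans ?_ h1, h2.trans ?_⟩, ?_, ?_⟩
      · exact Real.exp_le_exp.2 (by linarith)
      · exact Real.exp_le_exp.2 (by linarith)
      · linarith
      · linarith
    have h_integ : IntegrableOn (fun s : ℂ => s.re⁻¹ * b s ^ 2) K :=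
      ContinuousOn.integrableOn_compact hKc ((Complex.continuous_re.continuousOn.inv₀
        fun s hsK => (ha0.trans_le (Complex.mem_reProdIm.1 hsK).1.1).ne').mul
          (hbc.continuous.pow 2).continuousOn)
    rw [← setIntegral_inv_re (Real.exp_pos _) (Real.exp_le_exp.2 (by linarith)) hS0.le,
      ← setIntegral_eq_integral_of_forall_compl_eq_zero (s := K)
      (f := fun s : ℂ => s.re⁻¹ * b s ^ 2) (fun s hsK => by rw [hb0 s hsK]; simp)]
    refine le_trans ?_ (setIntegral_mono_set h_integ ?_ (Filter.Eventually.of_forall hKK))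
    · refine setIntegral_mono_on (integrableOn_inv_re (Real.exp_pos _)) (h_integ.mono_set hKK)
        hK'c.measurableSet fun s hsK => ?_
      obtain ⟨⟨h1, h2⟩, h3, h4⟩ := Complex.mem_reProdIm.1 hsK
      have hx : 0 < s.re := (Real.exp_pos _).trans_le h1
      have hb1 : b s = 1 := by
        have l1 : |Real.log s.re / R| ≤ 1 := by
          rw [abs_div, abs_of_pos hR0, div_le_one hR0, abs_le]
          exact ⟨(Real.le_log_iff_exp_le hx).2 h1, (Real.log_le_iff_le_exp hx).2 h2⟩
        have l2 : |s.im / S| ≤ 1 := by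
          rw [abs_div, abs_of_pos hS0, div_le_one hS0, abs_le]
          exact ⟨h3, h4⟩
        simp only [hb, hP, hQ, logBump, if_pos hx, hf1 _ l1, hf1 _ l2, mul_one]
      rw [hb1]; simp
    · refine ae_restrict_of_forall_mem hKc.measurableSet fun s hsK => ?_
      have hx := ha0.trans_le (Complex.mem_reProdIm.1 hsK).1.1
      simp only [Pi.zero_apply]
      positivity
  have l1 : Real.log (A / a) = 4 * R := by
    rw [hA, ha, ← Real.exp_sub, Real.log_exp]; ring
  have l2 : Real.log (Real.exp R / Real.exp (-R)) = 2 * R := by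
    rw [← Real.exp_sub, Real.log_exp]; ring
  rw [l1] at hup
  rw [l2] at hlow
  calc _ ≤ _ := hup
    _ = 16 * S * M := by field_simp; ring
    _ ≤ 16 * S * (κ * R / 4) := by gcongr
    _ = κ * (2 * R * (2 * S)) := by ring
    _ ≤ _ := by gcongr

end bump

section asymptotics

variable {n : ℕ} {r ρ : Pt n → ℝ} {Ω V V' : Set (Pt n)} {s : ℕ∞} {z p L X Y : Pt n}

theorem eventually_neg_of_hasDerivAt {f : ℝ → ℝ} {d : ℝ} (h : HasDerivAt f d 0) (h0 : f 0 = 0)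
    (hd : d < 0) : ∀ᶠ t in 𝓝[>] (0 : ℝ), f t < 0 := by
  have h1 := (hasDerivAt_iff_tendsto_slope.1 h).eventually (gt_mem_nhds hd)
  have h2 : ∀ᶠ t in 𝓝[>] (0 : ℝ), slope f 0 t < 0 :=
    h1.filter_mono (nhdsWithin_mono _ fun t ht => ne_of_gt ht)
  filter_upwards [h2, self_mem_nhdsWithin] with t ht htp
  rw [slope_def_field, h0, sub_zero, sub_zero] at ht
  have htp' : (0 : ℝ) < t := htp
  by_contra hc
  exact absurd ht (not_lt.2 (div_nonneg (not_lt.1 hc) htp'.le))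

theorem hasDerivAt_line {f : Pt n → ℝ} (hf : DifferentiableAt ℝ f p) (X : Pt n) :
    HasDerivAt (fun t : ℝ => f (p + t • X)) (fderiv ℝ f p X) 0 := by
  have h1 : HasDerivAt (fun t : ℝ => p + t • X) X 0 := by
    simpa using ((hasDerivAt_id (0 : ℝ)).smul_const X).const_add p
  have h2 : HasFDerivAt f (fderiv ℝ f p) (p + (0 : ℝ) • X) := by simpa using hf.hasFDerivAt
  exact h2.comp_hasDerivAt (0 : ℝ) h1

/-- The ratio of the differentials of two defining functions. -/
noncomputable def ratio (r ρ : Pt n → ℝ) (p : Pt n) : ℝ := fderiv ℝ ρ p (nrm r p) / 2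

theorem fderiv_nonpos_of_neg (h : IsDefining n s Ω r V) (hs1 : 1 ≤ s)
    (h' : IsDefining n 1 Ω ρ V') (hp : p ∈ frontier Ω) (hX : fderiv ℝ r p X < 0) :
    fderiv ℝ ρ p X ≤ 0 := by
  have hs1' : (1 : WithTop ℕ∞) ≤ s := by exact_mod_cast hs1
  have d1 : DifferentiableAt ℝ r p :=
    (h.contDiffAt (h.frontier_subset hp)).differentiableAt (by
      intro hc; rw [hc] at hs1'; simp at hs1')
  have d2 : DifferentiableAt ℝ ρ p :=
    (h'.contDiffAt (h'.frontier_subset hp)).differentiableAt (by simp)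
  by_contra hc
  push Not at hc
  have e1 := eventually_neg_of_hasDerivAt (hasDerivAt_line d1 X) (by simpa using h.eq_zero hp) hX
  have e2 := eventually_neg_of_hasDerivAt (f := fun t => -ρ (p + t • X)) (hasDerivAt_line d2 X).neg
    (by simpa using h'.eq_zero hp) (by linarith)
  have hcont : Filter.Tendsto (fun t : ℝ => p + t • X) (𝓝[>] 0) (𝓝 p) := by
    have : Continuous fun t : ℝ => p + t • X := by fun_prop
    simpa using this.continuousAt.tendsto.mono_left (nhdsWithin_le_nhds (a := (0 : ℝ)) (s := Set.Ioi 0))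
  have e3 := hcont.eventually (h.1.mem_nhds (h.frontier_subset hp))
  obtain ⟨t, t1, t2, t3⟩ := (e1.and (e2.and e3)).exists
  have : p + t • X ∈ Ω := h.mem_iff.2 ⟨t3, t1⟩
  have := h'.neg_of_mem this
  linarith

theorem fderiv_nrm (hg : gradSq n r p ≠ 0) : fderiv ℝ r p (nrm r p) = 2 := by
  rw [← two_mul_re_pW_cR, pW_nrm hg]; simp

theorem fderiv_eq_ratio_mul (h : IsDefining n s Ω r V) (hs1 : 1 ≤ s)
    (h' : IsDefining n 1 Ω ρ V') (hp : p ∈ frontier Ω) :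
    0 < ratio r ρ p ∧ ∀ X, fderiv ℝ ρ p X = ratio r ρ p * fderiv ℝ r p X := by
  have hN := fderiv_nrm (h.gradSq_ne_zero hp)
  set N := nrm r p
  have key : ∀ X, fderiv ℝ r p X = 0 → fderiv ℝ ρ p X ≤ 0 := by
    intro X hX
    have hle : ∀ ε : ℝ, 0 < ε → fderiv ℝ ρ p X ≤ ε * fderiv ℝ ρ p N := by
      intro ε hε
      have := fderiv_nonpos_of_neg h hs1 h' hp (X := X - ε • N) (by
        rw [map_sub, map_smul, hX, hN, smul_eq_mul]; linarith)
      rw [map_sub, map_smul, smul_eq_mul] at this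
      linarith
    have hlim : Filter.Tendsto (fun ε : ℝ => ε * fderiv ℝ ρ p N) (𝓝[>] 0) (𝓝 0) := by
      have : Continuous fun ε : ℝ => ε * fderiv ℝ ρ p N := by fun_prop
      simpa using this.continuousAt.tendsto.mono_left
        (nhdsWithin_le_nhds (a := (0 : ℝ)) (s := Set.Ioi 0))
    exact ge_of_tendsto hlim (by filter_upwards [self_mem_nhdsWithin] with ε hε using hle ε hε)
  have key2 : ∀ X, fderiv ℝ ρ p X = ratio r ρ p * fderiv ℝ r p X := by
    intro X
    set Y := X - (fderiv ℝ r p X / 2) • N with hY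
    have hY0 : fderiv ℝ r p Y = 0 := by
      rw [hY, map_sub, map_smul, hN, smul_eq_mul]; ring
    have h1 := key Y hY0
    have h2 := key (-Y) (by rw [map_neg, hY0, neg_zero])
    rw [map_neg] at h2
    have h3 : fderiv ℝ ρ p Y = 0 := by linarith
    rw [hY, map_sub, map_smul, smul_eq_mul] at h3
    unfold ratio
    linarith
  have hnn : 0 ≤ ratio r ρ p := by
    have := fderiv_nonpos_of_neg h hs1 h' hp (X := -N) (by rw [map_neg, hN]; norm_num)
    rw [map_neg] at this
    unfold ratio; linarith
  refine ⟨lt_of_le_of_ne hnn fun hz => h'.2.2.2.2 p hp ?_, key2⟩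
  ext X
  rw [key2, ← hz]; simp

theorem eventually_log_neg_line (hρ : ContDiffAt ℝ 1 ρ p) {v : Pt n} (hv : fderiv ℝ ρ p v < 0)
    {δ : ℝ} (hδ : 0 < δ) :
    ∀ᶠ x : ℝ × Pt n × Pt n in 𝓝 (0, p, v), 0 < x.1 → ρ x.2.1 = 0 →
      0 < -ρ (x.2.1 + x.1 • x.2.2) ∧ 0 < -fderiv ℝ ρ x.2.1 x.2.2 ∧
      |Real.log (-ρ (x.2.1 + x.1 • x.2.2)) - Real.log x.1 -
        Real.log (-fderiv ℝ ρ x.2.1 x.2.2)| ≤ δ := by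
  set A := -fderiv ℝ ρ p v with hA
  have hA0 : 0 < A := by linarith
  have hst : HasStrictFDerivAt ρ (fderiv ℝ ρ p) p := hρ.hasStrictFDerivAt (by simp)
  have hlog := (Real.continuousAt_log hA0.ne')
  obtain ⟨ε, hε, hεA⟩ := Metric.continuousAt_iff.1 hlog (δ / 2) (by linarith)
  set ε' := min (ε / 2) (A / 2) with hε'
  have hε'0 : 0 < ε' := lt_min (by linarith) (by linarith)
  set c := ε' / (2 * (‖v‖ + 1)) with hc
  have hc0 : 0 < c := by positivity
  have t1 : Filter.Tendsto (fun x : ℝ × Pt n × Pt n => (x.2.1 + x.1 • x.2.2, x.2.1))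
      (𝓝 (0, p, v)) (𝓝 (p, p)) := by
    have : Continuous fun x : ℝ × Pt n × Pt n => (x.2.1 + x.1 • x.2.2, x.2.1) := by fun_prop
    simpa using this.tendsto (0, p, v)
  have e1 := t1.eventually ((hst.isLittleO).def hc0)
  have t2 : ContinuousAt (fun x : ℝ × Pt n × Pt n => fderiv ℝ ρ p x.2.2) (0, p, v) := by fun_prop
  have e2 := t2.eventually (Metric.ball_mem_nhds (x := fderiv ℝ ρ p v) (ε := ε' / 2) (by linarith))
  have hfc : ContinuousAt (fderiv ℝ ρ) p := (hρ.fderiv_right (m := 0) (by simp)).continuousAt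
  have t3 : ContinuousAt (fun x : ℝ × Pt n × Pt n => fderiv ℝ ρ x.2.1 x.2.2) (0, p, v) := by
    refine ContinuousAt.clm_apply (f := fun x : ℝ × Pt n × Pt n => fderiv ℝ ρ x.2.1) ?_ (by fun_prop)
    exact ContinuousAt.comp (f := fun x : ℝ × Pt n × Pt n => x.2.1) (g := fderiv ℝ ρ) hfc (by fun_prop)
  have e3 := t3.eventually (Metric.ball_mem_nhds (x := fderiv ℝ ρ p v) (ε := ε') hε'0)
  have t4 : ContinuousAt (fun x : ℝ × Pt n × Pt n => ‖x.2.2‖) (0, p, v) := by fun_prop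
  have e4 := t4.eventually (gt_mem_nhds (show ‖v‖ < ‖v‖ + 1 by linarith))
  filter_upwards [e1, e2, e3, e4] with ⟨τ, z, w⟩ h1 h2 h3 h4 hτ hz
  simp only at h1 h2 h3 h4 hτ hz ⊢
  simp only [add_sub_cancel_left, hz, sub_zero, map_smul, norm_smul, smul_eq_mul, Real.norm_eq_abs,
    abs_of_pos hτ] at h1
  rw [Real.dist_eq] at h2 h3
  have hQ : |ρ (z + τ • w) / τ - fderiv ℝ ρ p w| ≤ ε' / 2 := by
    rw [div_sub' hτ.ne', abs_div, abs_of_pos hτ, div_le_iff₀ hτ]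
    refine h1.trans ?_
    calc c * (τ * ‖w‖) ≤ c * (τ * (‖v‖ + 1)) := by gcongr
      _ = ε' / 2 * τ := by rw [hc]; field_simp
  have hQ2 : |-ρ (z + τ • w) / τ - A| < ε' := by
    have : -ρ (z + τ • w) / τ - A = -((ρ (z + τ • w) / τ - fderiv ℝ ρ p w) +
        (fderiv ℝ ρ p w - fderiv ℝ ρ p v)) := by rw [hA]; ring
    rw [this, abs_neg]
    calc _ ≤ _ := abs_add_le _ _
      _ < ε' / 2 + ε' / 2 := by linarith
      _ = ε' := by ring
  have hR2 : |-fderiv ℝ ρ z w - A| < ε' := by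
    have : -fderiv ℝ ρ z w - A = -(fderiv ℝ ρ z w - fderiv ℝ ρ p v) := by rw [hA]; ring
    rw [this, abs_neg]; exact h3
  have hε1 : ε' ≤ ε / 2 := min_le_left _ _
  have hε2 : ε' ≤ A / 2 := min_le_right _ _
  have l1 := hεA (x := -ρ (z + τ • w) / τ) (by rw [Real.dist_eq]; linarith)
  have l2 := hεA (x := -fderiv ℝ ρ z w) (by rw [Real.dist_eq]; linarith)
  have p1 : 0 < -ρ (z + τ • w) / τ := by have := (abs_lt.1 hQ2).1; linarith
  have p2 : 0 < -fderiv ℝ ρ z w := by have := (abs_lt.1 hR2).1; linarith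
  have p3 : 0 < -ρ (z + τ • w) := by
    have := mul_pos p1 hτ; rwa [div_mul_cancel₀ _ hτ.ne'] at this
  refine ⟨p3, p2, ?_⟩
  rw [← Real.log_div p3.ne' hτ.ne']
  rw [Real.dist_eq] at l1 l2
  rw [abs_lt] at l1 l2
  rw [abs_le]
  constructor <;> linarith [l1.1, l1.2, l2.1, l2.2]

end asymptotics

section jets

variable {n : ℕ} {r : Pt n → ℝ} {z p L X Y : Pt n}

theorem pW_pW_eq (h : ContDiffAt ℝ 2 r z) : pW (pW (cR n r) Y) X z = (1 / 4 : ℂ) *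
    (fderiv ℝ (fderiv ℝ (cR n r)) z X Y - I * fderiv ℝ (fderiv ℝ (cR n r)) z X (I • Y) -
      I * (fderiv ℝ (fderiv ℝ (cR n r)) z (I • X) Y -
        I * fderiv ℝ (fderiv ℝ (cR n r)) z (I • X) (I • Y))) := by
  have hd := h.cR.differentiableAt_fderiv
  rw [pW, fderiv_pW_apply h.cR, fderiv_pW_apply h.cR]
  simp only [fderiv_fderiv_apply hd]
  ring

theorem pW_pB_eq (h : ContDiffAt ℝ 2 r z) : pW (pB (cR n r) Y) X z = (1 / 4 : ℂ) *
    (fderiv ℝ (fderiv ℝ (cR n r)) z X Y + I * fderiv ℝ (fderiv ℝ (cR n r)) z X (I • Y) -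
      I * (fderiv ℝ (fderiv ℝ (cR n r)) z (I • X) Y +
        I * fderiv ℝ (fderiv ℝ (cR n r)) z (I • X) (I • Y))) := by
  have hd := h.cR.differentiableAt_fderiv
  rw [pW, fderiv_pB_apply h.cR, fderiv_pB_apply h.cR]
  simp only [fderiv_fderiv_apply hd]
  ring

theorem fderiv_hs_apply (h : ContDiffAt ℝ 3 r z) : fderiv ℝ (hs r L) z X = (1 / 4 : ℝ) *
    (fderiv ℝ (fderiv ℝ (fderiv ℝ r)) z X L L +
      fderiv ℝ (fderiv ℝ (fderiv ℝ r)) z X (I • L) (I • L)) := by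
  have h2 : ∀ᶠ y in 𝓝 z, ContDiffAt ℝ 2 r y :=
    (h.of_le (show (2 : WithTop ℕ∞) ≤ 3 by norm_num)).eventually (by simp)
  have he : hs r L =ᶠ[𝓝 z] fun y => (1 / 4 : ℝ) *
      (fderiv ℝ (fderiv ℝ r) y L L + fderiv ℝ (fderiv ℝ r) y (I • L) (I • L)) := by
    filter_upwards [h2] with y hy using hs_eq hy L
  have hd : DifferentiableAt ℝ (fderiv ℝ (fderiv ℝ r)) z :=
    ((h.fderiv_right (m := 2) (by norm_num)).fderiv_right (m := 1) (by norm_num)).differentiableAt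
      (by simp)
  have h3 : ∀ Y : Pt n, HasFDerivAt (fun y => fderiv ℝ (fderiv ℝ r) y Y Y)
      ((fderiv ℝ (fderiv ℝ (fderiv ℝ r)) z).flip Y |>.flip Y) z := by
    intro Y
    have := (hd.hasFDerivAt.clm_apply (hasFDerivAt_const Y z)).clm_apply (hasFDerivAt_const Y z)
    refine this.congr_fderiv ?_
    ext X
    simp
  rw [he.fderiv_eq (𝕜 := ℝ), ((h3 L).fun_add (h3 (I • L)) |>.const_mul (1 / 4)).fderiv]
  simp
  ring

theorem kc_eq (h : ContDiffAt ℝ 3 r z) : kc r z L =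
    pW (cR n (hs r L)) (nrm r z) z - (starRingEnd ℂ) (wv r z L) * sv r z L := by
  have h2 : ∀ᶠ y in 𝓝 z, ContDiffAt ℝ 2 r y :=
    (h.of_le (show (2 : WithTop ℕ∞) ≤ 3 by norm_num)).eventually (by simp)
  have he : pW (pB (cR n r) L) L =ᶠ[𝓝 z] cR n (hs r L) := by
    filter_upwards [h2] with y hy using pW_pB_cR_self hy L
  rw [kc, pW_congr he]

theorem continuousAt_fderiv_fderiv_cR (h : ContDiffAt ℝ 2 r z) :
    ContinuousAt (fderiv ℝ (fderiv ℝ (cR n r))) z :=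
  ((h.cR.fderiv_right (m := 1) (by norm_num)).fderiv_right (m := 0) (by norm_num)).continuousAt

theorem ContinuousAt.clm_apply_two {T E F : Type*} [TopologicalSpace T] [NormedAddCommGroup E]
    [NormedSpace ℝ E] [NormedAddCommGroup F] [NormedSpace ℝ F] {B : T → E →L[ℝ] E →L[ℝ] F}
    {a b : T → E} {x : T} (hB : ContinuousAt B x) (ha : ContinuousAt a x) (hb : ContinuousAt b x) :
    ContinuousAt (fun t => B t (a t) (b t)) x :=
  (hB.clm_apply ha).clm_apply hb

theorem continuousAt_wv_sv (h : ContDiffAt ℝ 2 r z) (hg : gradSq n r z ≠ 0) (L : Pt n) :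
    ContinuousAt (fun x : Pt n × Pt n => wv r x.1 x.2) (z, L) ∧
      ContinuousAt (fun x : Pt n × Pt n => sv r x.1 x.2) (z, L) := by
  have h2 : ∀ᶠ x : Pt n × Pt n in 𝓝 (z, L), ContDiffAt ℝ 2 r x.1 :=
    continuousAt_fst.eventually (h.eventually (by simp))
  have hB : ContinuousAt (fun x : Pt n × Pt n => fderiv ℝ (fderiv ℝ (cR n r)) x.1) (z, L) :=
    ContinuousAt.comp (g := fderiv ℝ (fderiv ℝ (cR n r))) (continuousAt_fderiv_fderiv_cR h)
      continuousAt_fst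
  have hN : ContinuousAt (fun x : Pt n × Pt n => nrm r x.1) (z, L) :=
    ContinuousAt.comp (g := nrm r) (contDiffAt_nrm (m := 1) h (by norm_num) hg).continuousAt
      continuousAt_fst
  have hX : ContinuousAt (fun x : Pt n × Pt n => x.2) (z, L) := continuousAt_snd
  have hIN := hN.const_smul I
  have hIX := hX.const_smul I
  constructor
  · refine ContinuousAt.congr ?_ (h2.mono fun x hx => (pW_pB_eq hx).symm)
    exact continuousAt_const.mul (((hB.clm_apply_two hX hN).add
      (continuousAt_const.mul (hB.clm_apply_two hX hIN))).sub
      (continuousAt_const.mul ((hB.clm_apply_two hIX hN).add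
        (continuousAt_const.mul (hB.clm_apply_two hIX hIN)))))
  · refine ContinuousAt.congr ?_ (h2.mono fun x hx => (pW_pW_eq hx).symm)
    exact continuousAt_const.mul (((hB.clm_apply_two hX hN).sub
      (continuousAt_const.mul (hB.clm_apply_two hX hIN))).sub
      (continuousAt_const.mul ((hB.clm_apply_two hIX hN).sub
        (continuousAt_const.mul (hB.clm_apply_two hIX hIN)))))

theorem ContDiffAt.continuousAt_fderiv_two {T E W : Type*} [TopologicalSpace T]
    [NormedAddCommGroup E] [NormedSpace ℝ E] [NormedAddCommGroup W] [NormedSpace ℝ W] {f : E → W}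
    {w a b : T → E} {x : T} (h : ContDiffAt ℝ 2 f (w x)) (hw : ContinuousAt w x)
    (ha : ContinuousAt a x) (hb : ContinuousAt b x) :
    ContinuousAt (fun t => fderiv ℝ (fderiv ℝ f) (w t) (a t) (b t)) x := by
  have h1 : ContDiffAt ℝ 1 (fderiv ℝ f) (w x) := h.fderiv_right (by norm_num)
  have h2 : ContDiffAt ℝ 0 (fderiv ℝ (fderiv ℝ f)) (w x) := h1.fderiv_right (by norm_num)
  exact ((h2.continuousAt.comp hw).clm_apply ha).clm_apply hb

theorem ContDiffAt.continuousAt_fderiv_three {T E : Type*} [TopologicalSpace T]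
    [NormedAddCommGroup E] [NormedSpace ℝ E] {f : E → ℝ} {w a b c : T → E} {x : T}
    (h : ContDiffAt ℝ 3 f (w x)) (hw : ContinuousAt w x) (ha : ContinuousAt a x)
    (hb : ContinuousAt b x) (hc : ContinuousAt c x) :
    ContinuousAt (fun t => fderiv ℝ (fderiv ℝ (fderiv ℝ f)) (w t) (a t) (b t) (c t)) x :=
  ((h.fderiv_right (m := 2) (by norm_num)).continuousAt_fderiv_two hw ha hb).clm_apply hc

theorem continuousAt_kc (h : ContDiffAt ℝ 3 r z) (hg : gradSq n r z ≠ 0) (L : Pt n) :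
    ContinuousAt (fun x : Pt n × Pt n => kc r x.1 x.2) (z, L) := by
  have h3 : ∀ᶠ x : Pt n × Pt n in 𝓝 (z, L), ContDiffAt ℝ 3 r x.1 :=
    continuousAt_fst.eventually (h.eventually (by simp))
  obtain ⟨hw, hsv⟩ := continuousAt_wv_sv (h.of_le (by norm_num)) hg L
  have hN : ContinuousAt (fun x : Pt n × Pt n => nrm r x.1) (z, L) :=
    ContinuousAt.comp (g := nrm r) (contDiffAt_nrm (m := 1) h (by norm_num) hg).continuousAt
      continuousAt_fst
  have hX : ContinuousAt (fun x : Pt n × Pt n => x.2) (z, L) := continuousAt_snd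
  have hIN := hN.const_smul I
  have hIX := hX.const_smul I
  have hreal : ∀ {a : Pt n × Pt n → Pt n}, ContinuousAt a (z, L) → ContinuousAt
      (fun x : Pt n × Pt n => (((1 / 4 : ℝ) * (fderiv ℝ (fderiv ℝ (fderiv ℝ r)) x.1 (a x) x.2 x.2 +
      fderiv ℝ (fderiv ℝ (fderiv ℝ r)) x.1 (a x) (I • x.2) (I • x.2)) : ℝ) : ℂ)) (z, L) := by
    intro a ha
    exact Complex.continuous_ofReal.continuousAt.comp (continuousAt_const.mul
      ((ContDiffAt.continuousAt_fderiv_three (w := Prod.fst) h continuousAt_fst ha hX hX).add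
        (ContDiffAt.continuousAt_fderiv_three (w := Prod.fst) h continuousAt_fst ha hIX hIX)))
  refine ContinuousAt.congr (f := fun x : Pt n × Pt n => (1 / 2 : ℂ) *
    ((((1 / 4 : ℝ) * (fderiv ℝ (fderiv ℝ (fderiv ℝ r)) x.1 (nrm r x.1) x.2 x.2 +
      fderiv ℝ (fderiv ℝ (fderiv ℝ r)) x.1 (nrm r x.1) (I • x.2) (I • x.2)) : ℝ) : ℂ) -
    I * (((1 / 4 : ℝ) * (fderiv ℝ (fderiv ℝ (fderiv ℝ r)) x.1 (I • nrm r x.1) x.2 x.2 +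
      fderiv ℝ (fderiv ℝ (fderiv ℝ r)) x.1 (I • nrm r x.1) (I • x.2) (I • x.2)) : ℝ) : ℂ)) -
    (starRingEnd ℂ) (wv r x.1 x.2) * sv r x.1 x.2) ?_ (h3.mono fun x hx => ?_)
  · exact (continuousAt_const.mul ((hreal hN).sub (continuousAt_const.mul (hreal hIN)))).sub
      ((Complex.continuous_conj.continuousAt.comp hw).mul hsv)
  · simp only
    rw [kc_eq hx, pW_cR, fderiv_hs_apply hx, fderiv_hs_apply hx]

end jets

section phase

open MeasureTheory

variable {b : ℂ → ℝ} {β : ℝ}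

/-- The phase average of the model function `(2 Re (s(1+iy)))^β`. -/
noncomputable def phaseInt (b : ℂ → ℝ) (β y : ℝ) : ℝ :=
  ∫ s : ℂ, (2 * (s.re - s.im * y)) ^ β * (s.re ^ (-1 - β) * b s ^ 2)

/-- The parameters at which the phase average has a positive integrand. -/
def phaseDomain (b : ℂ → ℝ) : Set ℝ := {y | ∀ s ∈ tsupport b, 0 < s.re - s.im * y}

theorem isOpen_phaseDomain (hbc : HasCompactSupport b) : IsOpen (phaseDomain b) := by
  rw [isOpen_iff_mem_nhds]
  intro y hy
  refine IsCompact.eventually_forall_of_forall_eventually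
    (P := fun (y : ℝ) (s : ℂ) => 0 < s.re - s.im * y) hbc fun s hs => ?_
  have hc : Continuous fun q : ℝ × ℂ => q.2.re - q.2.im * q.1 := by fun_prop
  exact hc.continuousAt.eventually (lt_mem_nhds (hy s hs))

theorem zero_mem_phaseDomain (hbs : tsupport b ⊆ {s | 0 < s.re}) : (0 : ℝ) ∈ phaseDomain b :=
  fun s hs => by simpa using hbs hs

theorem contDiffOn_phase_integrand (hb : ContDiff ℝ 2 b) (hbs : tsupport b ⊆ {s | 0 < s.re}) :
    ContDiffOn ℝ 2 (fun q : ℝ × ℂ => (2 * (q.2.re - q.2.im * q.1)) ^ β *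
      (q.2.re ^ (-1 - β) * b q.2 ^ 2)) (phaseDomain b ×ˢ Set.univ) := by
  refine contDiffOn_of_tsupport (b := b) continuous_snd (fun q hq hs => ?_) fun q hs => ?_
  · have hre : ContDiff ℝ 2 fun q : ℝ × ℂ => q.2.re := Complex.reCLM.contDiff.comp contDiff_snd
    have him : ContDiff ℝ 2 fun q : ℝ × ℂ => q.2.im := Complex.imCLM.contDiff.comp contDiff_snd
    have h1 : (2 * (q.2.re - q.2.im * q.1)) ≠ 0 := (mul_pos two_pos (hq.1 q.2 hs)).ne'
    have h2 : q.2.re ≠ 0 := ne_of_gt (hbs hs)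
    exact ((contDiff_const.mul (hre.sub (him.mul contDiff_fst))).contDiffAt.rpow_const_of_ne h1).mul
      ((hre.contDiffAt.rpow_const_of_ne h2).mul ((hb.comp contDiff_snd).pow 2).contDiffAt)
  · simp [image_eq_zero_of_notMem_tsupport hs]

theorem contDiffAt_phaseInt (hb : ContDiff ℝ 2 b) (hbc : HasCompactSupport b)
    (hbs : tsupport b ⊆ {s | 0 < s.re}) {y : ℝ} (hy : y ∈ phaseDomain b) :
    ContDiffAt ℝ 2 (phaseInt b β) y := by
  have h := contDiffOn_integral_param (isOpen_phaseDomain hbc) hbc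
    (H := fun (y : ℝ) (s : ℂ) => (2 * (s.re - s.im * y)) ^ β * (s.re ^ (-1 - β) * b s ^ 2))
    (fun y s _ hs => by simp [image_eq_zero_of_notMem_tsupport hs])
    (contDiffOn_phase_integrand hb hbs)
  exact h.contDiffAt ((isOpen_phaseDomain hbc).mem_nhds hy)

theorem phaseInt_neg (hsym : ∀ s, b ((starRingEnd ℂ) s) = b s) (y : ℝ) :
    phaseInt b β (-y) = phaseInt b β y := by
  have := Complex.conjLIE.measurePreserving.integral_comp
    Complex.conjLIE.toHomeomorph.measurableEmbedding
    (fun s : ℂ => (2 * (s.re - s.im * y)) ^ β * (s.re ^ (-1 - β) * b s ^ 2))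
  unfold phaseInt
  rw [← this]
  congr 1
  funext s
  simp [hsym]

theorem phaseInt_pos (hb : ContDiff ℝ 2 b) (hbc : HasCompactSupport b)
    (hbs : tsupport b ⊆ {s | 0 < s.re}) (hb1 : b 1 = 1) {y : ℝ} (hy : y ∈ phaseDomain b) :
    0 < phaseInt b β y := by
  have hcont : Continuous fun s : ℂ => (2 * (s.re - s.im * y)) ^ β * (s.re ^ (-1 - β) * b s ^ 2) := by
    have h := (contDiffOn_phase_integrand (β := β) hb hbs).continuousOn
    have h2 : Continuous fun s : ℂ => (y, s) := by fun_prop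
    have := h.comp h2.continuousOn (s := Set.univ) fun s _ => ⟨hy, Set.mem_univ s⟩
    simpa [continuousOn_univ, Function.comp_def] using this
  have hcs : HasCompactSupport fun s : ℂ =>
      (2 * (s.re - s.im * y)) ^ β * (s.re ^ (-1 - β) * b s ^ 2) :=
    hbc.mono fun s hs hb0 => hs (by simp [hb0])
  have hnn : ∀ s : ℂ, 0 ≤ (2 * (s.re - s.im * y)) ^ β * (s.re ^ (-1 - β) * b s ^ 2) := by
    intro s
    by_cases hs : s ∈ tsupport b
    · have := hy s hs
      have := hbs hs
      simp only [Set.mem_ofPred_eq] at this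
      positivity
    · simp [image_eq_zero_of_notMem_tsupport hs]
  refine hcont.integral_pos_of_hasCompactSupport_nonneg_nonzero hcs hnn (x := 1) ?_
  have h1 : (1 : ℂ) ∈ tsupport b := subset_tsupport b (by simp [hb1])
  have := hy 1 h1
  simp at this
  simp [hb1, (Real.rpow_pos_of_pos two_pos β).ne']

theorem integral_re_mul_rpow {q : ℂ} (hq : 0 < q.re)
    (hy : q.im / q.re ∈ phaseDomain b) :
    ∫ s : ℂ, (2 * (s * q).re) ^ β * (s.re ^ (-1 - β) * b s ^ 2) =
      q.re ^ β * phaseInt b β (q.im / q.re) := by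
  rw [phaseInt, ← integral_const_mul]
  congr 1
  funext s
  by_cases hs : s ∈ tsupport b
  · have h1 := hy s hs
    have h2 : 2 * (s * q).re = q.re * (2 * (s.re - s.im * (q.im / q.re))) := by
      rw [Complex.mul_re]; field_simp
    rw [h2, Real.mul_rpow hq.le (by linarith)]
    ring
  · simp [image_eq_zero_of_notMem_tsupport hs]

/-- The logarithmic phase correction. -/
noncomputable def phaseLog (b : ℂ → ℝ) (β y : ℝ) : ℝ := β⁻¹ * Real.log (phaseInt b β y)

theorem contDiffAt_phaseLog (hb : ContDiff ℝ 2 b) (hbc : HasCompactSupport b)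
    (hbs : tsupport b ⊆ {s | 0 < s.re}) (hb1 : b 1 = 1) {y : ℝ} (hy : y ∈ phaseDomain b) :
    ContDiffAt ℝ 2 (phaseLog b β) y :=
  contDiffAt_const.mul ((contDiffAt_phaseInt hb hbc hbs hy).log (phaseInt_pos hb hbc hbs hb1 hy).ne')

theorem deriv_phaseLog_zero (hsym : ∀ s, b ((starRingEnd ℂ) s) = b s) :
    deriv (phaseLog b β) 0 = 0 := by
  have h : (fun y => phaseLog b β (-y)) = phaseLog b β := by
    funext y; rw [phaseLog, phaseInt_neg hsym]; rfl
  have h2 := deriv_comp_neg (phaseLog b β) (0 : ℝ)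
  rw [h, neg_zero] at h2
  linarith

end phase

section model

variable {n : ℕ} {r : Pt n → ℝ} {q : Pt n → ℂ} {z p L X Y : Pt n} {b : ℂ → ℝ} {β : ℝ}

theorem pW_pB_self (h : ContDiffAt ℝ 2 q z) (X : Pt n) : pW (pB q X) X z =
    (1 / 4 : ℂ) * (fderiv ℝ (fun y => fderiv ℝ q y X) z X +
      fderiv ℝ (fun y => fderiv ℝ q y (I • X)) z (I • X)) := by
  rw [pW, fderiv_pB_apply h, fderiv_pB_apply h, h.fderiv_comm X (I • X)]
  linear_combination (1 / 4 : ℂ) * fderiv ℝ (fun y => fderiv ℝ q y (I • X)) z (I • X) * (-I_mul_I)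

theorem fderiv_eq_pW_add_pB (q : Pt n → ℂ) (X z : Pt n) : fderiv ℝ q z X = pW q X z + pB q X z := by
  rw [pW, pB]; ring

theorem fderiv_re_apply (h : DifferentiableAt ℝ q z) (X : Pt n) :
    fderiv ℝ (fun y => (q y).re) z X = (fderiv ℝ q z X).re := by
  have := (Complex.reCLM.hasFDerivAt.comp z h.hasFDerivAt).fderiv
  rw [show (fun y => (q y).re) = Complex.reCLM ∘ q from rfl, this]; rfl

theorem fderiv_im_apply (h : DifferentiableAt ℝ q z) (X : Pt n) :
    fderiv ℝ (fun y => (q y).im) z X = (fderiv ℝ q z X).im := by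
  have := (Complex.imCLM.hasFDerivAt.comp z h.hasFDerivAt).fderiv
  rw [show (fun y => (q y).im) = Complex.imCLM ∘ q from rfl, this]; rfl

theorem hs_re (h : ContDiffAt ℝ 2 q z) (X : Pt n) :
    hs (fun y => (q y).re) X z = (pW (pB q X) X z).re := by
  have key : ∀ Y : Pt n, fderiv ℝ (fun y => fderiv ℝ (fun y => (q y).re) y Y) z Y =
      (fderiv ℝ (fun y => fderiv ℝ q y Y) z Y).re := by
    intro Y
    have h1 : (fun y => fderiv ℝ (fun y => (q y).re) y Y) =ᶠ[𝓝 z] fun y => (fderiv ℝ q y Y).re := by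
      filter_upwards [h.eventually (by simp)] with y hy
      exact fderiv_re_apply (hy.differentiableAt (by simp)) Y
    rw [h1.fderiv_eq, fderiv_re_apply ((h.fderiv_apply_const (m := 1) (by norm_num) Y).differentiableAt
      (by simp))]
  rw [hs, key, key, pW_pB_self h]
  simp [Complex.mul_re]

/-- The logarithm of the model function `(∫ (2 Re(sq))^β dm)^{1/β}`. -/
noncomputable def modelLog (b : ℂ → ℝ) (β : ℝ) (q : Pt n → ℂ) (z : Pt n) : ℝ :=
  Real.log (q z).re + phaseLog b β ((q z).im / (q z).re)

theorem contDiffAt_modelLog (hb : ContDiff ℝ 2 b) (hbc : HasCompactSupport b)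
    (hbs : tsupport b ⊆ {s | 0 < s.re}) (hb1 : b 1 = 1) (hq : ContDiffAt ℝ 2 q z)
    (hre : 0 < (q z).re) (hy : (q z).im / (q z).re ∈ phaseDomain b) :
    ContDiffAt ℝ 2 (modelLog b β q) z := by
  have h1 : ContDiffAt ℝ 2 (fun z => (q z).re) z := Complex.reCLM.contDiff.contDiffAt.comp z hq
  have h2 : ContDiffAt ℝ 2 (fun z => (q z).im) z := Complex.imCLM.contDiff.contDiffAt.comp z hq
  have h3 : ContDiffAt ℝ 2 (fun z => (q z).im / (q z).re) z := h2.div h1 hre.ne'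
  exact (h1.log hre.ne').add (ContDiffAt.comp (g := phaseLog b β)
    (f := fun z => (q z).im / (q z).re) z (contDiffAt_phaseLog hb hbc hbs hb1 hy) h3)

theorem modelLog_jet (hb : ContDiff ℝ 2 b) (hbc : HasCompactSupport b)
    (hbs : tsupport b ⊆ {s | 0 < s.re}) (hb1 : b 1 = 1)
    (hsym : ∀ s, b ((starRingEnd ℂ) s) = b s) (hq : ContDiffAt ℝ 2 q p) (hq1 : q p = 1)
    (hqL : pB q L p = (starRingEnd ℂ) (pW q L p)) :
    pW (cR n (modelLog b β q)) L p = pW q L p ∧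
      hs (modelLog b β q) L p = (pW (pB q L) L p).re - normSq (pW q L p) := by
  have hqd : DifferentiableAt ℝ q p := hq.differentiableAt (by simp)
  set w := pW q L p with hw
  have h1 : ContDiffAt ℝ 2 (fun z => (q z).re) p := Complex.reCLM.contDiff.contDiffAt.comp p hq
  have h2 : ContDiffAt ℝ 2 (fun z => (q z).im) p := Complex.imCLM.contDiff.contDiffAt.comp p hq
  have hre1 : (q p).re = 1 := by rw [hq1]; simp
  have him0 : (q p).im = 0 := by rw [hq1]; simp
  have hy0 : (q p).im / (q p).re = 0 := by rw [him0]; simp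
  have h3 : ContDiffAt ℝ 2 (fun z => (q z).im / (q z).re) p := h2.div h1 (by rw [hre1]; simp)
  have hDL : fderiv ℝ q p L = ((2 * w.re : ℝ) : ℂ) := by
    rw [fderiv_eq_pW_add_pB, hqL, ← hw, Complex.add_conj]
  have hDIL : fderiv ℝ q p (I • L) = ((-2 * w.im : ℝ) : ℂ) := by
    have e : pW q L p - pB q L p = -I * fderiv ℝ q p (I • L) := by rw [pW, pB]; ring
    rw [hqL, ← hw, Complex.sub_conj] at e
    have : fderiv ℝ q p (I • L) = I * (-I * fderiv ℝ q p (I • L)) := by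
      linear_combination fderiv ℝ q p (I • L) * (I_mul_I)
    rw [this, ← e]
    push_cast
    linear_combination (2 * w.im : ℂ) * I_mul_I
  have hpre : pW (cR n fun z => (q z).re) L p = w := by
    rw [pW_cR, fderiv_re_apply hqd, fderiv_re_apply hqd, hDL, hDIL]
    apply Complex.ext <;> simp
  have hdy : ∀ X, (fderiv ℝ q p X).im = 0 → fderiv ℝ (fun z => (q z).im / (q z).re) p X = 0 := by
    intro X hX
    have := ((h2.differentiableAt (by simp)).hasFDerivAt.mul
      ((h1.inv (by rw [hre1]; simp)).differentiableAt (by simp)).hasFDerivAt).fderiv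
    have e : (fun z => (q z).im / (q z).re) = (fun z => (q z).im) * (fun z => (q z).re)⁻¹ := by
      funext z; simp [div_eq_mul_inv]
    rw [e, this]
    simp [him0, fderiv_im_apply hqd, hX]
  have hpy : pW (cR n fun z => (q z).im / (q z).re) L p = 0 := by
    rw [pW_cR, hdy L (by rw [hDL]; simp), hdy (I • L) (by rw [hDIL]; simp)]; simp
  have hφ : ContDiffAt ℝ 2 (phaseLog b β) ((q p).im / (q p).re) := by
    rw [hy0]; exact contDiffAt_phaseLog hb hbc hbs hb1 (zero_mem_phaseDomain hbs)
  have hlog : ContDiffAt ℝ 2 Real.log (q p).re := Real.contDiffAt_log.2 (by rw [hre1]; simp)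
  have c1 : ContDiffAt ℝ 2 (fun z => Real.log (q z).re) p :=
    h1.log (by rw [hre1]; simp)
  have c2 : ContDiffAt ℝ 2 (fun z => phaseLog b β ((q z).im / (q z).re)) p :=
    ContDiffAt.comp (g := phaseLog b β) (f := fun z => (q z).im / (q z).re) p hφ h3
  have a1 : pW (cR n fun z => phaseLog b β ((q z).im / (q z).re)) L p = 0 := by
    rw [pW_comp_real (φ := phaseLog b β) (h3.differentiableAt (by simp)) (hφ.differentiableAt (by simp)),
      hpy, mul_zero]
  have a2 : hs (fun z => phaseLog b β ((q z).im / (q z).re)) L p = 0 := by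
    rw [hs_comp (φ := phaseLog b β) h3 hφ, hpy, hy0, deriv_phaseLog_zero hsym]; simp
  have a3 : pW (cR n fun z => Real.log (q z).re) L p = w := by
    rw [pW_comp_real (φ := Real.log) (h1.differentiableAt (by simp)) (hlog.differentiableAt (by simp)),
      hpre, Real.deriv_log, hre1]; simp
  have a4 : hs (fun z => Real.log (q z).re) L p = (pW (pB q L) L p).re - normSq w := by
    rw [hs_comp (φ := Real.log) h1 hlog, hpre, hs_re hq]
    simp only [Real.deriv_log', deriv_inv', hre1]
    norm_num
    ring
  constructor
  · have e : cR n (modelLog b β q) = fun z => cR n (fun z => Real.log (q z).re) z +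
        cR n (fun z => phaseLog b β ((q z).im / (q z).re)) z := by
      funext z; simp [cR, modelLog]
    rw [e, pW_add (differentiableAt_cR.2 (c1.differentiableAt (by simp)))
      (differentiableAt_cR.2 (c2.differentiableAt (by simp))), a1, a3, add_zero]
  · rw [show modelLog b β q = fun z => Real.log (q z).re + phaseLog b β ((q z).im / (q z).re) from rfl,
      hs_add c1 c2, a2, a4, add_zero]

/-- The correction making the normal direction holomorphic to first order. -/
noncomputable def tiltForm (r : Pt n → ℝ) (p : Pt n) : Pt n →L[ℂ] ℂ :=
  LinearMap.toContinuousLinearMap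
    { toFun := fun X => wv r p X - sv r p X
      map_add' := fun X Y => by simp only [wv, sv, pW_add_left]; ring
      map_smul' := fun a X => by
        simp only [wv, sv, pW_smul_left, smul_eq_mul, RingHom.id_apply]; ring }

theorem tiltForm_apply (X : Pt n) : tiltForm r p X = wv r p X - sv r p X := rfl

/-- The tilted normal derivative of `r` near `p`. -/
noncomputable def tiltNormal (r : Pt n → ℝ) (p z : Pt n) : ℂ :=
  (1 + tiltForm r p (z - p)) * pW (cR n r) (nrm r p) z

theorem contDiff_tiltFactor (k : WithTop ℕ∞) :
    ContDiff ℝ k fun z : Pt n => 1 + tiltForm r p (z - p) :=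
  contDiff_const.add (((tiltForm r p).restrictScalars ℝ).contDiff.comp (contDiff_id.sub contDiff_const))

theorem fderiv_tiltFactor (X : Pt n) :
    fderiv ℝ (fun z : Pt n => 1 + tiltForm r p (z - p)) z X = tiltForm r p X := by
  have h := ((((tiltForm r p).restrictScalars ℝ).hasFDerivAt.comp z
    ((hasFDerivAt_id z).sub_const p)).const_add 1).fderiv
  have e : (fun z : Pt n => 1 + tiltForm r p (z - p)) =
      fun z => 1 + (⇑((tiltForm r p).restrictScalars ℝ) ∘ fun x => id x - p) z := rfl
  rw [e, h]; rfl

theorem pW_tiltFactor : pW (fun z : Pt n => 1 + tiltForm r p (z - p)) X z = tiltForm r p X := by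
  rw [pW, fderiv_tiltFactor, fderiv_tiltFactor, map_smul, smul_eq_mul]
  linear_combination -(1 / 2 : ℂ) * tiltForm r p X * I_mul_I

theorem pB_tiltFactor : pB (fun z : Pt n => 1 + tiltForm r p (z - p)) X z = 0 := by
  rw [pB, fderiv_tiltFactor, fderiv_tiltFactor, map_smul, smul_eq_mul]
  linear_combination (1 / 2 : ℂ) * tiltForm r p X * I_mul_I

theorem contDiffAt_tiltNormal (h : ContDiffAt ℝ 3 r z) : ContDiffAt ℝ 2 (tiltNormal r p) z :=
  (contDiff_tiltFactor 2).contDiffAt.mul (h.cR.pW_right (by norm_num) _)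

theorem tiltNormal_jet (h : ContDiffAt ℝ 3 r p) (hg : gradSq n r p ≠ 0) (L : Pt n) :
    tiltNormal r p p = 1 ∧ pW (tiltNormal r p) L p = wv r p L ∧
      pB (tiltNormal r p) L p = (starRingEnd ℂ) (wv r p L) ∧
      (pW (pB (tiltNormal r p) L) L p).re = (kc r p L).re + normSq (wv r p L) := by
  have h2 : ContDiffAt ℝ 2 r p := h.of_le (by norm_num)
  set N := nrm r p with hN
  have hq1 : ContDiffAt ℝ 2 (pW (cR n r) N) p := h.cR.pW_right (by norm_num) N
  have hed : ∀ z, DifferentiableAt ℝ (fun z : Pt n => 1 + tiltForm r p (z - p)) z := fun z =>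
    (contDiff_tiltFactor 1).contDiffAt.differentiableAt (by simp)
  have hv : pW (cR n r) N p = 1 := pW_nrm hg
  have hpB : pB (pW (cR n r) N) L p = (starRingEnd ℂ) (wv r p L) := pB_pW_cR_eq_conj h2 N L
  have hpBe : pB (tiltNormal r p) L =ᶠ[𝓝 p] fun z =>
      (1 + tiltForm r p (z - p)) * pB (pW (cR n r) N) L z := by
    filter_upwards [hq1.eventually (by simp)] with z hz
    rw [show tiltNormal r p = fun z => (1 + tiltForm r p (z - p)) * pW (cR n r) N z from rfl,
      pB_mul (hed z) (hz.differentiableAt (by simp)), pB_tiltFactor, mul_zero, add_zero]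
  refine ⟨by simp [tiltNormal, ← hN, hv], ?_, ?_, ?_⟩
  · rw [show tiltNormal r p = fun z => (1 + tiltForm r p (z - p)) * pW (cR n r) N z from rfl,
      pW_mul (hed p) (hq1.differentiableAt (by simp)), pW_tiltFactor, hv,
      show pW (pW (cR n r) N) L p = sv r p L from rfl]
    simp only [sub_self, map_zero]
    rw [tiltForm_apply]
    ring
  · rw [hpBe.self_of_nhds]
    simp only [sub_self, map_zero, hpB, add_zero, one_mul]
  · rw [pW_congr hpBe, pW_mul (hed p) ((hq1.pB_right (m := 1) (by norm_num) L).differentiableAt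
      (by simp)), pW_tiltFactor, hpB]
    simp only [sub_self, map_zero]
    rw [tiltForm_apply]
    have e1 : pB (pW (cR n r) N) L =ᶠ[𝓝 p] pW (pB (cR n r) L) N := by
      filter_upwards [h2.eventually (by simp)] with z hz using (pW_pB_comm hz.cR L N).symm
    rw [pW_congr e1, pW_pW_comm (h.cR.pB_right (by norm_num) L) N L, kc, ← hN]
    simp only [Complex.add_re, Complex.sub_re, Complex.mul_re, Complex.conj_re, Complex.conj_im,
      Complex.sub_im, Complex.add_im, Complex.one_re, Complex.one_im, Complex.zero_re,
      Complex.zero_im, normSq_apply]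
    ring

end model

section weights

open MeasureTheory

variable {b : ℂ → ℝ} {β g κ B δ : ℝ} {q : ℂ} {G : ℂ → ℝ}

theorem integrable_re_mul_rpow (hb : ContDiff ℝ 2 b) (hbc : HasCompactSupport b)
    (hbs : tsupport b ⊆ {s | 0 < s.re}) (hq : 0 < q.re) (hy : q.im / q.re ∈ phaseDomain b) :
    Integrable fun s : ℂ => (2 * (s * q).re) ^ β * (s.re ^ (-1 - β) * b s ^ 2) := by
  have hcont : Continuous fun s : ℂ => (2 * (s.re - s.im * (q.im / q.re))) ^ β *
      (s.re ^ (-1 - β) * b s ^ 2) := by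
    have h := (contDiffOn_phase_integrand (β := β) hb hbs).continuousOn
    have h2 : Continuous fun s : ℂ => (q.im / q.re, s) := by fun_prop
    have := h.comp h2.continuousOn (s := Set.univ) fun s _ => ⟨hy, Set.mem_univ s⟩
    simpa [continuousOn_univ, Function.comp_def] using this
  have hcs : HasCompactSupport fun s : ℂ =>
      (2 * (s.re - s.im * (q.im / q.re))) ^ β * (s.re ^ (-1 - β) * b s ^ 2) :=
    hbc.mono fun s hs hb0 => hs (by simp [hb0])
  refine ((hcont.integrable_of_hasCompactSupport hcs).const_mul (q.re ^ β)).congr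
    (Filter.Eventually.of_forall fun s => ?_)
  by_cases hs : s ∈ tsupport b
  · have h1 := hy s hs
    have h2 : 2 * (s * q).re = q.re * (2 * (s.re - s.im * (q.im / q.re))) := by
      rw [Complex.mul_re]; field_simp
    simp only
    rw [h2, Real.mul_rpow hq.le (by linarith)]
    ring
  · simp [image_eq_zero_of_notMem_tsupport hs]

theorem exp_mul_rpow_bounds {x y : ℝ} (hx : 0 < x) (hy : 0 < y)
    (h : |Real.log x - (B + β * Real.log y)| ≤ δ) :
    Real.exp (B - δ) * y ^ β ≤ x ∧ x ≤ Real.exp (B + δ) * y ^ β := by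
  rw [abs_le] at h
  rw [Real.rpow_def_of_pos hy, ← Real.exp_add, ← Real.exp_add, ← Real.le_log_iff_exp_le hx,
    ← Real.log_le_iff_le_exp hx]
  constructor <;> linarith

/-- Averages of functions close to the model function. -/
theorem log_integral_approx (hb : ContDiff ℝ 2 b) (hbc : HasCompactSupport b)
    (hbs : tsupport b ⊆ {s | 0 < s.re}) (hb1 : b 1 = 1) (hβ : β ≠ 0)
    (hq : 0 < q.re) (hy : q.im / q.re ∈ phaseDomain b)
    (hG : Integrable fun s : ℂ => G s * (s.re ^ (-1 - β) * b s ^ 2))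
    (hlog : ∀ s ∈ tsupport b, 0 < G s ∧ 0 < (s * q).re ∧
      |Real.log (G s) - (B + β * Real.log (2 * (s * q).re))| ≤ δ) :
    0 < ∫ s : ℂ, G s * (s.re ^ (-1 - β) * b s ^ 2) ∧
    |Real.log (∫ s : ℂ, G s * (s.re ^ (-1 - β) * b s ^ 2)) - B - β * (Real.log q.re +
      phaseLog b β (q.im / q.re))| ≤ δ := by
  have hI := integrable_re_mul_rpow (β := β) hb hbc hbs hq hy
  have hP := phaseInt_pos (β := β) hb hbc hbs hb1 hy
  have hval := integral_re_mul_rpow (b := b) (β := β) hq hy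
  have hJ : 0 < q.re ^ β * phaseInt b β (q.im / q.re) := mul_pos (Real.rpow_pos_of_pos hq _) hP
  have hlogJ : β * (Real.log q.re + phaseLog b β (q.im / q.re)) =
      Real.log (q.re ^ β * phaseInt b β (q.im / q.re)) := by
    rw [Real.log_mul (Real.rpow_pos_of_pos hq _).ne' hP.ne', Real.log_rpow hq, phaseLog]
    field_simp
  have lower : Real.exp (B - δ) * (q.re ^ β * phaseInt b β (q.im / q.re)) ≤
      ∫ s : ℂ, G s * (s.re ^ (-1 - β) * b s ^ 2) := by
    rw [← hval, ← integral_const_mul]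
    refine integral_mono (hI.const_mul _) hG fun s => ?_
    by_cases hs : s ∈ tsupport b
    · obtain ⟨h1, h2, h3⟩ := hlog s hs
      have hre : 0 < s.re := hbs hs
      exact (mul_assoc _ _ _).symm.trans_le (mul_le_mul_of_nonneg_right
        (exp_mul_rpow_bounds h1 (by linarith) h3).1 (by positivity))
    · simp [image_eq_zero_of_notMem_tsupport hs]
  have upper : ∫ s : ℂ, G s * (s.re ^ (-1 - β) * b s ^ 2) ≤
      Real.exp (B + δ) * (q.re ^ β * phaseInt b β (q.im / q.re)) := by
    rw [← hval, ← integral_const_mul]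
    refine integral_mono hG (hI.const_mul _) fun s => ?_
    by_cases hs : s ∈ tsupport b
    · obtain ⟨h1, h2, h3⟩ := hlog s hs
      have hre : 0 < s.re := hbs hs
      exact (mul_le_mul_of_nonneg_right (exp_mul_rpow_bounds h1 (by linarith) h3).2
        (by positivity)).trans_eq (mul_assoc _ _ _)
    · simp [image_eq_zero_of_notMem_tsupport hs]
  have hpos := lt_of_lt_of_le (mul_pos (Real.exp_pos _) hJ) lower
  refine ⟨hpos, ?_⟩
  have l1 := Real.log_le_log (mul_pos (Real.exp_pos _) hJ) lower
  have l2 := Real.log_le_log hpos upper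
  rw [Real.log_mul (Real.exp_pos _).ne' hJ.ne', Real.log_exp] at l1 l2
  rw [hlogJ, abs_le]
  constructor <;> linarith

theorem integrable_inv_re_mul_sq (hb : ContDiff ℝ 2 b) (hbc : HasCompactSupport b)
    (hbs : tsupport b ⊆ {s | 0 < s.re}) : Integrable fun s : ℂ => s.re⁻¹ * b s ^ 2 := by
  have h := integrable_disc_weight (n := 0) (F := fun _ => (1 : ℝ)) (O := Set.univ) (E := 0) (E0 := 0)
    (z0 := 0) (β := 0) (fun _ _ => contDiffAt_const) hbc hbs (fun _ _ => Set.mem_univ _)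
    (r := fun s => b s ^ 2) (hb.continuous.pow 2) fun s hs => by
      simp [image_eq_zero_of_notMem_tsupport hs]
  simpa [Real.rpow_neg_one] using h

theorem bumpErr_eq_zero {s : ℂ} (hs : s ∉ tsupport b) : bumpErr g b s = 0 := by
  simp [bumpErr, fderiv_eq_zero_of_notMem_tsupport hs, dd_sq_eq_zero_of_notMem_tsupport hs]

theorem integral_bumpErr_le (hb : ContDiff ℝ 2 b) (hbc : HasCompactSupport b)
    (hbs : tsupport b ⊆ {s | 0 < s.re}) (hκ0 : 0 ≤ κ) (hβ0 : 0 < β) (hβ1 : β ≤ 1)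
    (hκ : ∫ s : ℂ, s.re * |bumpErr g b s| ≤ κ * ∫ s : ℂ, s.re⁻¹ * b s ^ 2)
    (hG : Integrable fun s : ℂ => G s * (s.re ^ (-1 - β) * b s ^ 2))
    (hGe : Integrable fun s : ℂ => G s * (s.re ^ (-1 - β) * (s.re ^ 2 * bumpErr g b s)))
    (hδ : δ ≤ Real.log 2)
    (hlog : ∀ s ∈ tsupport b, 0 < G s ∧ s.re / 2 ≤ (s * q).re ∧ (s * q).re ≤ 2 * s.re ∧
      |Real.log (G s) - (B + β * Real.log (2 * (s * q).re))| ≤ δ) :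
    ∫ s : ℂ, G s * (s.re ^ (-1 - β) * (s.re ^ 2 * bumpErr g b s)) ≤
      16 * κ * ∫ s : ℂ, G s * (s.re ^ (-1 - β) * b s ^ 2) := by
  set C := Real.exp B / 2 with hC
  have hCpos : 0 < C := by positivity
  have hexp : Real.exp δ ≤ 2 := by
    rw [← Real.exp_log (show (0 : ℝ) < 2 by norm_num)]; exact Real.exp_le_exp.2 hδ
  have bounds : ∀ s ∈ tsupport b, C * s.re ^ β ≤ G s ∧ G s ≤ 16 * C * s.re ^ β := by
    intro s hs
    obtain ⟨h1, h2, h3, h4⟩ := hlog s hs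
    have hre : 0 < s.re := hbs hs
    have hy : 0 < 2 * (s * q).re := by linarith
    obtain ⟨l, u⟩ := exp_mul_rpow_bounds h1 hy h4
    have hsp : 0 < s.re ^ β := Real.rpow_pos_of_pos hre β
    have hlo : s.re ^ β ≤ (2 * (s * q).re) ^ β := Real.rpow_le_rpow hre.le (by linarith) hβ0.le
    have hup : (2 * (s * q).re) ^ β ≤ 4 * s.re ^ β := by
      calc (2 * (s * q).re) ^ β ≤ (4 * s.re) ^ β := Real.rpow_le_rpow hy.le (by linarith) hβ0.le
        _ = 4 ^ β * s.re ^ β := Real.mul_rpow (by norm_num) hre.le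
        _ ≤ 4 ^ (1 : ℝ) * s.re ^ β := by
          gcongr
          norm_num
        _ = 4 * s.re ^ β := by rw [Real.rpow_one]
    rw [Real.exp_add] at u
    rw [sub_eq_add_neg, Real.exp_add] at l
    have hneg : (1 / 2 : ℝ) ≤ Real.exp (-δ) := by
      rw [Real.exp_neg, one_div]
      exact inv_anti₀ (Real.exp_pos _) hexp
    constructor
    · refine le_trans ?_ l
      rw [hC, div_eq_mul_one_div]
      gcongr
    · refine u.trans ?_
      calc Real.exp B * Real.exp δ * (2 * (s * q).re) ^ β ≤ Real.exp B * 2 * (4 * s.re ^ β) := by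
            gcongr
        _ = 16 * C * s.re ^ β := by rw [hC]; ring
  have i1 : Integrable fun s : ℂ => 16 * C * (s.re * |bumpErr g b s|) := by
    refine Integrable.const_mul (Continuous.integrable_of_hasCompactSupport ?_ ?_) _
    · exact Complex.continuous_re.mul (continuous_bumpErr hb).abs
    · exact hbc.of_isClosed_subset (isClosed_tsupport _) (closure_minimal (fun s hs => by
        by_contra hsb
        exact hs (by simp [bumpErr_eq_zero hsb])) (isClosed_tsupport b))
  have hlower : ∫ s : ℂ, G s * (s.re ^ (-1 - β) * (s.re ^ 2 * bumpErr g b s)) ≤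
      16 * C * ∫ s : ℂ, s.re * |bumpErr g b s| := by
    rw [← integral_const_mul]
    refine integral_mono hGe i1 fun s => ?_
    by_cases hs : s ∈ tsupport b
    · have hre : 0 < s.re := hbs hs
      have hw : s.re ^ β * (s.re ^ (-1 - β) * s.re ^ 2) = s.re := by
        rw [← Real.rpow_natCast s.re 2, ← Real.rpow_add hre, ← Real.rpow_add hre,
          show β + (-1 - β + ((2 : ℕ) : ℝ)) = 1 by push_cast; ring, Real.rpow_one]
      have := (hlog s hs).1
      simp only
      calc G s * (s.re ^ (-1 - β) * (s.re ^ 2 * bumpErr g b s))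
          ≤ G s * (s.re ^ (-1 - β) * (s.re ^ 2 * |bumpErr g b s|)) := by
            gcongr; exact le_abs_self _
        _ ≤ (16 * C * s.re ^ β) * (s.re ^ (-1 - β) * (s.re ^ 2 * |bumpErr g b s|)) := by
            gcongr; exact (bounds s hs).2
        _ = 16 * C * ((s.re ^ β * (s.re ^ (-1 - β) * s.re ^ 2)) * |bumpErr g b s|) := by ring
        _ = _ := by rw [hw]
    · simp [bumpErr_eq_zero hs]
  have hupper : C * ∫ s : ℂ, s.re⁻¹ * b s ^ 2 ≤ ∫ s : ℂ, G s * (s.re ^ (-1 - β) * b s ^ 2) := by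
    rw [← integral_const_mul]
    refine integral_mono ((integrable_inv_re_mul_sq hb hbc hbs).const_mul _) hG fun s => ?_
    by_cases hs : s ∈ tsupport b
    · have hre : 0 < s.re := hbs hs
      have hw : s.re ^ β * s.re ^ (-1 - β) = s.re⁻¹ := by
        rw [← Real.rpow_add hre, show β + (-1 - β) = -1 by ring, Real.rpow_neg_one]
      simp only
      rw [← hw]
      calc C * (s.re ^ β * s.re ^ (-1 - β) * b s ^ 2)
          = (C * s.re ^ β) * (s.re ^ (-1 - β) * b s ^ 2) := by ring
        _ ≤ _ := by gcongr; exact (bounds s hs).1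
    · simp [image_eq_zero_of_notMem_tsupport hs]
  calc _ ≤ 16 * C * ∫ s : ℂ, s.re * |bumpErr g b s| := hlower
    _ ≤ 16 * C * (κ * ∫ s : ℂ, s.re⁻¹ * b s ^ 2) := by gcongr
    _ = 16 * κ * (C * ∫ s : ℂ, s.re⁻¹ * b s ^ 2) := by ring
    _ ≤ _ := by gcongr

end weights

section riccati

variable {n : ℕ} {r f g : Pt n → ℝ} {z p L X : Pt n} {c c1 : ℝ}

/-- The Riccati expression of a weight `f` with respect to `r`. -/
noncomputable def ricc (r f : Pt n → ℝ) (c : ℝ) (L z : Pt n) : ℝ :=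
  hs f L z + (kc r z L).re + c * normSq (wv r z L + pW (cR n f) L z)

theorem wv_smul_real (t : ℝ) (L : Pt n) : wv r p (t • L) = t * wv r p L := pW_smul_real _ _ _ _

theorem sv_smul_real (t : ℝ) (L : Pt n) : sv r p (t • L) = t * sv r p L := pW_smul_real _ _ _ _

theorem pB_smul_real (f : Pt n → ℂ) (t : ℝ) (X z : Pt n) : pB f (t • X) z = t * pB f X z := by
  have := pB_smul_left f (t : ℂ) X z
  rw [conj_ofReal] at this
  rw [← this]
  congr 1

theorem kc_smul_real (h : ContDiffAt ℝ 3 r p) (t : ℝ) (L : Pt n) :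
    kc r p (t • L) = t ^ 2 * kc r p L := by
  have e1 : pB (cR n r) (t • L) = fun z => (t : ℂ) * pB (cR n r) L z :=
    funext fun z => pB_smul_real _ _ _ _
  have e2 : pW (pB (cR n r) (t • L)) (t • L) =ᶠ[𝓝 p]
      fun z => (t : ℂ) ^ 2 * pW (pB (cR n r) L) L z := by
    filter_upwards [h.eventually (by simp)] with z hz
    have h2 : DifferentiableAt ℝ (pB (cR n r) L) z :=
      (hz.cR.pB_right (m := 2) (by norm_num) L).differentiableAt (by simp)
    rw [e1, pW_smul_real, pW_const_mul _ h2]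
    ring
  have h3 : DifferentiableAt ℝ (pW (pB (cR n r) L) L) p :=
    ((h.cR.pB_right (m := 2) (by norm_num) L).pW_right (m := 1) (by norm_num) L).differentiableAt
      (by simp)
  rw [kc, kc, pW_congr e2, pW_const_mul _ h3, wv_smul_real, sv_smul_real, map_mul, conj_ofReal]
  ring

theorem kc_re_smul_real (h : ContDiffAt ℝ 3 r p) (t : ℝ) (L : Pt n) :
    (kc r p (t • L)).re = t ^ 2 * (kc r p L).re := by
  rw [kc_smul_real h, ← ofReal_pow, re_ofReal_mul]

theorem esq_smul_real (t : ℝ) (L : Pt n) : esq (t • L) = t ^ 2 * esq L := by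
  simp only [esq, Pi.smul_apply, real_smul, normSq_mul, normSq_ofReal, Finset.mul_sum, sq]

theorem hs_const (a : ℝ) : hs (fun _ : Pt n => a) X z = 0 := by simp [hs]

theorem hs_sub_sub_const (hf : ContDiffAt ℝ 2 f z) (hg : ContDiffAt ℝ 2 g z) (a : ℝ) (X : Pt n) :
    hs (fun y => f y - g y - a) X z = hs f X z - hs g X z := by
  have e : (fun y => f y - g y - a) = fun y => f y + ((-1) * g y + -a) := by funext y; ring
  have hg' : ContDiffAt ℝ 2 (fun y => (-1 : ℝ) * g y) z := contDiffAt_const.mul hg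
  rw [e, hs_add hf (hg'.add contDiffAt_const), hs_add hg' contDiffAt_const, hs_const_mul _ hg, hs_const]
  ring

theorem pW_sub_sub_const (hf : DifferentiableAt ℝ f z) (hg : DifferentiableAt ℝ g z) (a : ℝ) (X : Pt n) :
    pW (cR n fun y => f y - g y - a) X z = pW (cR n f) X z - pW (cR n g) X z := by
  have e : ∀ Y, fderiv ℝ (fun y => f y - g y - a) z Y = fderiv ℝ f z Y - fderiv ℝ g z Y := fun Y => by
    rw [fderiv_sub_const, fderiv_fun_sub hf hg]; rfl
  rw [pW_cR, pW_cR, pW_cR, e, e]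
  push_cast
  ring

theorem ricc_sub_sub_const_le (hf : ContDiffAt ℝ 2 f z) (hg : ContDiffAt ℝ 2 g z) (hc : 0 < c)
    (hc1 : c < c1) (a : ℝ) (L : Pt n) (hfr : hs f L z + c1 * normSq (pW (cR n f) L z) ≤ 0) :
    ricc r (fun y => f y - g y - a) c L z ≤ (kc r z L).re - hs g L z +
      c * c1 / (c1 - c) * normSq (wv r z L - pW (cR n g) L z) := by
  have := normSq_add_le hc hc1 (pW (cR n f) L z) (wv r z L - pW (cR n g) L z)
  rw [ricc, hs_sub_sub_const hf hg, pW_sub_sub_const (hf.differentiableAt (by simp))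
    (hg.differentiableAt (by simp)),
    show wv r z L + (pW (cR n f) L z - pW (cR n g) L z) =
      pW (cR n f) L z + (wv r z L - pW (cR n g) L z) by ring]
  linarith

/-- A quadratic defect vanishing at a point is small nearby. -/
theorem eventually_defect_le (h : ContDiffAt ℝ 3 r p) (hg : gradSq n r p ≠ 0)
    (hf : ContDiffAt ℝ 2 f p) (C : ℝ) {ε : ℝ} (hε : 0 < ε)
    (hp : ∀ L, pW (cR n f) L p = wv r p L ∧ hs f L p = (kc r p L).re) :
    ∀ᶠ z in 𝓝 p, ∀ L, (kc r z L).re - hs f L z + C * normSq (wv r z L - pW (cR n f) L z) ≤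
      ε * esq L := by
  have hsph : ∀ᶠ z in 𝓝 p, ∀ L ∈ Metric.sphere (0 : Pt n) 1,
      (kc r z L).re - hs f L z + C * normSq (wv r z L - pW (cR n f) L z) < ε * esq L := by
    refine IsCompact.eventually_forall_of_forall_eventually (P := fun (z L : Pt n) =>
      (kc r z L).re - hs f L z + C * normSq (wv r z L - pW (cR n f) L z) < ε * esq L)
      (isCompact_sphere _ _) fun L hL => ?_
    have c1 := continuousAt_kc h hg L
    have c2 := (continuousAt_wv_sv (h.of_le (by norm_num)) hg L).1
    have c3 := continuousAt_hs_joint hf L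
    have c4 := continuousAt_pW_joint (hf.of_le (by norm_num)) L
    have c5 : ContinuousAt (fun x : Pt n × Pt n => ε * esq x.2) (p, L) :=
      (continuous_const.mul ((contDiff_esq (k := 1)).continuous.comp continuous_snd)).continuousAt
    have c6 : ContinuousAt (fun x : Pt n × Pt n => (kc r x.1 x.2).re - hs f x.2 x.1 +
        C * normSq (wv r x.1 x.2 - pW (cR n f) x.2 x.1)) (p, L) :=
      ((Complex.continuous_re.continuousAt.comp c1).sub c3).add
        (continuousAt_const.mul (Complex.continuous_normSq.continuousAt.comp (c2.sub c4)))
    refine c6.eventually_lt c5 ?_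
    have hL0 : L ≠ 0 := by rintro rfl; simp at hL
    simp only [(hp L).1, (hp L).2, sub_self, map_zero, mul_zero, add_zero]
    exact mul_pos hε (esq_pos hL0)
  filter_upwards [hsph, h.eventually (by simp), hf.eventually (by simp)] with z hz h3 hf2 L
  rcases eq_or_ne L 0 with rfl | hL
  · have e1 := hs_smul_real hf2 0 0
    have e2 := kc_re_smul_real h3 0 0
    have e3 := wv_smul_real (r := r) (p := z) 0 0
    have e4 := pW_smul_real (cR n f) 0 0 z
    have e5 := esq_smul_real (n := n) 0 0
    simp only [smul_zero, ofReal_zero, zero_mul, ne_eq, OfNat.ofNat_ne_zero, not_false_eq_true,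
      zero_pow] at e1 e2 e3 e4 e5
    rw [e1, e2, e3, e4, e5]; simp
  · have hn : ‖L‖ ≠ 0 := norm_ne_zero_iff.2 hL
    have hLe : L = ‖L‖ • (‖L‖⁻¹ • L) := by rw [smul_smul, mul_inv_cancel₀ hn, one_smul]
    have key := hz (‖L‖⁻¹ • L) (by simp [norm_smul, hn])
    set M := ‖L‖⁻¹ • L
    rw [hLe, hs_smul_real hf2, kc_re_smul_real h3, wv_smul_real, pW_smul_real, esq_smul_real,
      ← mul_sub, ← mul_sub, normSq_mul, normSq_ofReal]
    nlinarith [mul_le_mul_of_nonneg_left key.le (sq_nonneg ‖L‖)]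

end riccati

section patch

open MeasureTheory

variable {n : ℕ} {r ρ : Pt n → ℝ} {Ω V V' : Set (Pt n)} {s : ℕ∞} {p z : Pt n} {b : ℂ → ℝ}
  {β η c ε : ℝ}

theorem exists_pos_lt_riccati_const (hβ : 0 < β) (hβ1 : β < 1) (hc : c < β / (1 - β)) :
    ∃ κ > 0, c < β * (β ^ 2 / (β * (1 - β) + 16 * κ) + 1) := by
  have h1 : 0 < 1 - β := by linarith
  have hcont : ContinuousAt (fun κ : ℝ => β * (β ^ 2 / (β * (1 - β) + 16 * κ) + 1)) 0 := by
    refine continuousAt_const.mul ((continuousAt_const.div (by fun_prop) ?_).add continuousAt_const)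
    have := mul_pos hβ h1
    simpa using ⟨hβ.ne', h1.ne'⟩
  have hv : c < β * (β ^ 2 / (β * (1 - β) + 16 * (0 : ℝ)) + 1) := by
    have : β * (β ^ 2 / (β * (1 - β) + 16 * (0 : ℝ)) + 1) = β / (1 - β) := by
      field_simp; ring
    rwa [this]
  have h2 := (hcont.eventually (lt_mem_nhds hv)).filter_mono (nhdsWithin_le_nhds (s := Set.Ioi 0))
  obtain ⟨κ, hκ, hκ0⟩ := (h2.and self_mem_nhdsWithin).exists
  exact ⟨κ, hκ0, hκ⟩

theorem eventually_tiltNormal (h : ContDiffAt ℝ 3 r p) (hg : gradSq n r p ≠ 0)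
    (hbc : HasCompactSupport b) (hbs : tsupport b ⊆ {s | 0 < s.re}) :
    ∀ᶠ z in 𝓝 p, 0 < (tiltNormal r p z).re ∧
      (tiltNormal r p z).im / (tiltNormal r p z).re ∈ phaseDomain b ∧
      ∀ s ∈ tsupport b, s.re / 2 ≤ (s * tiltNormal r p z).re ∧ (s * tiltNormal r p z).re ≤ 2 * s.re := by
  have hq : ContinuousAt (tiltNormal r p) p := (contDiffAt_tiltNormal h).continuousAt
  have hq1 : tiltNormal r p p = 1 := (tiltNormal_jet h hg 0).1
  have hre : ContinuousAt (fun z => (tiltNormal r p z).re) p := Complex.continuous_re.continuousAt.comp hq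
  have him : ContinuousAt (fun z => (tiltNormal r p z).im) p := Complex.continuous_im.continuousAt.comp hq
  have e1 : ∀ᶠ z in 𝓝 p, 0 < (tiltNormal r p z).re :=
    hre.eventually (lt_mem_nhds (by simp [hq1]))
  have e2 : ∀ᶠ z in 𝓝 p, (tiltNormal r p z).im / (tiltNormal r p z).re ∈ phaseDomain b := by
    refine (him.div hre (by rw [hq1]; simp)).eventually_mem ((isOpen_phaseDomain hbc).mem_nhds ?_)
    simpa [hq1] using zero_mem_phaseDomain hbs
  have e3 : ∀ᶠ z in 𝓝 p, ∀ s ∈ tsupport b,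
      s.re / 2 < (s * tiltNormal r p z).re ∧ (s * tiltNormal r p z).re < 2 * s.re := by
    refine IsCompact.eventually_forall_of_forall_eventually (P := fun (z : Pt n) (s : ℂ) =>
      s.re / 2 < (s * tiltNormal r p z).re ∧ (s * tiltNormal r p z).re < 2 * s.re) hbc fun s hs => ?_
    have hre : 0 < s.re := hbs hs
    have hc1 : ContinuousAt (fun x : Pt n × ℂ => (x.2 * tiltNormal r p x.1).re) (p, s) :=
      Complex.continuous_re.continuousAt.comp (continuousAt_snd.mul hq.fst')
    have hc2 : ContinuousAt (fun x : Pt n × ℂ => x.2.re / 2) (p, s) := by fun_prop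
    have hc3 : ContinuousAt (fun x : Pt n × ℂ => 2 * x.2.re) (p, s) := by fun_prop
    refine (hc2.eventually_lt hc1 ?_).and (hc1.eventually_lt hc3 ?_)
    · simp only [hq1, mul_one]; linarith
    · simp only [hq1, mul_one]; linarith
  filter_upwards [e1, e2, e3] with z h1 h2 h3
  exact ⟨h1, h2, fun s hs => ⟨(h3 s hs).1.le, (h3 s hs).2.le⟩⟩

/-- A thin sheet of discs transversal to the boundary. -/
theorem exists_transversal_scale (h : IsDefining n s Ω r V) (hs3 : 3 ≤ s) (h' : IsDefining n 1 Ω ρ V')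
    (hbc : HasCompactSupport b) {K : Set (Pt n)} (hK : IsCompact K) (hKf : K ⊆ frontier Ω)
    (hq : ∀ z ∈ K, ∀ s ∈ tsupport b, 0 < (s * tiltNormal r p z).re) {δ : ℝ} (hδ : 0 < δ) :
    ∃ τ : ℝ, 0 < τ ∧ ∀ z ∈ K, ∀ s ∈ tsupport b,
      z - s • (((τ : ℂ) * (1 + tiltForm r p (z - p))) • nrm r p) ∈ Ω ∧
      |Real.log (-ρ (z - s • (((τ : ℂ) * (1 + tiltForm r p (z - p))) • nrm r p))) - Real.log τ -
        (Real.log (ratio r ρ z) + Real.log (2 * (s * tiltNormal r p z).re))| ≤ δ := by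
  set v : Pt n → ℂ → Pt n := fun z s => -((s * (1 + tiltForm r p (z - p))) • nrm r p) with hv
  have hvc : Continuous fun x : Pt n × ℂ => v x.1 x.2 := by
    have : Continuous fun x : Pt n × ℂ => 1 + tiltForm r p (x.1 - p) :=
      (contDiff_tiltFactor (r := r) (p := p) 1).continuous.comp continuous_fst
    exact ((continuous_snd.mul this).smul continuous_const).neg
  have hpt : ∀ (τ : ℝ) z s, z - s • (((τ : ℂ) * (1 + tiltForm r p (z - p))) • nrm r p) =
      z + τ • v z s := by
    intro τ z s
    ext j
    simp only [hv, Pi.sub_apply, Pi.add_apply, Pi.smul_apply, Pi.neg_apply, smul_eq_mul, real_smul]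
    ring
  have hdr : ∀ z ∈ K, ∀ s, fderiv ℝ ρ z (v z s) = -(ratio r ρ z * (2 * (s * tiltNormal r p z).re)) := by
    intro z hz s
    rw [(fderiv_eq_ratio_mul h (le_trans (by norm_num) hs3) h' (hKf hz)).2, ← two_mul_re_pW_cR, hv,
      pW_neg_left, pW_smul_left, tiltNormal, ← mul_assoc, neg_re]
    ring_nf
  have key : ∀ᶠ τ : ℝ in 𝓝 0, ∀ x ∈ K ×ˢ tsupport b, x.1 + τ • v x.1 x.2 ∈ V' ∧
      (0 < τ → 0 < -ρ (x.1 + τ • v x.1 x.2) ∧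
        |Real.log (-ρ (x.1 + τ • v x.1 x.2)) - Real.log τ - Real.log (-fderiv ℝ ρ x.1 (v x.1 x.2))| ≤ δ)
      ∨ x.1 ∉ frontier Ω := by
    refine IsCompact.eventually_forall_of_forall_eventually (P := fun (τ : ℝ) (x : Pt n × ℂ) =>
      x.1 + τ • v x.1 x.2 ∈ V' ∧ (0 < τ → 0 < -ρ (x.1 + τ • v x.1 x.2) ∧
        |Real.log (-ρ (x.1 + τ • v x.1 x.2)) - Real.log τ - Real.log (-fderiv ℝ ρ x.1 (v x.1 x.2))| ≤ δ)
      ∨ x.1 ∉ frontier Ω) (hK.prod hbc) fun x hx => ?_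
    obtain ⟨hx1, hx2⟩ := hx
    have hxV : x.1 ∈ V' := h'.frontier_subset (hKf hx1)
    have hneg : fderiv ℝ ρ x.1 (v x.1 x.2) < 0 := by
      rw [hdr _ hx1, neg_lt_zero]
      exact mul_pos (fderiv_eq_ratio_mul h (le_trans (by norm_num) hs3) h' (hKf hx1)).1
        (by have := hq _ hx1 _ hx2; linarith)
    have ev := eventually_log_neg_line (h'.contDiffAt hxV) hneg hδ
    have hm : Continuous fun y : ℝ × (Pt n × ℂ) => (y.1, y.2.1, v y.2.1 y.2.2) := by fun_prop
    have hm2 : Continuous fun y : ℝ × (Pt n × ℂ) => y.2.1 + y.1 • v y.2.1 y.2.2 := by fun_prop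
    have ev2 := (hm.tendsto' (0, x) (0, x.1, v x.1 x.2) rfl).eventually ev
    have ev3 : ∀ᶠ y in 𝓝 ((0 : ℝ), x), y.2.1 + y.1 • v y.2.1 y.2.2 ∈ V' :=
      (hm2.tendsto' (0, x) x.1 (by simp)).eventually (h'.1.mem_nhds hxV)
    filter_upwards [ev2, ev3] with y h2 h3
    by_cases hy : y.2.1 ∈ frontier Ω
    · refine Or.inl ⟨h3, fun h0 => ?_⟩
      have := h2 h0 (h'.eq_zero hy)
      exact ⟨this.1, this.2.2⟩
    · exact Or.inr hy
  obtain ⟨τ, hτ, hτ0⟩ := ((key.filter_mono (nhdsWithin_le_nhds (s := Set.Ioi 0))).and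
    self_mem_nhdsWithin).exists
  refine ⟨τ, hτ0, fun z hz s hs => ?_⟩
  rcases hτ (z, s) ⟨hz, hs⟩ with ⟨h1, h2⟩ | h2
  · obtain ⟨h3, h4⟩ := h2 hτ0
    have hpos := hq z hz s hs
    rw [hpt]
    refine ⟨h'.mem_iff.2 ⟨h1, by linarith⟩, ?_⟩
    rw [hdr z hz s, neg_neg, Real.log_mul
      (fderiv_eq_ratio_mul h (le_trans (by norm_num) hs3) h' (hKf hz)).1.ne' (by linarith)] at h4
    exact h4
  · exact absurd (hKf hz) h2

end patch

section patch

open MeasureTheory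

variable {n : ℕ} {r ρ : Pt n → ℝ} {Ω V V' : Set (Pt n)} {s : ℕ∞} {p z : Pt n} {b : ℂ → ℝ}
  {β η c ε : ℝ}

/-- Local solutions of the Riccati inequality close to the logarithm of the ratio of two
defining functions. -/
theorem exists_patch (hn : n ≠ 0) (h : IsDefining n s Ω r V) (hs3 : 3 ≤ s)
    (h' : IsDefining n 1 Ω ρ V') (hη1 : η < 1) (hη : StrictPSHOn n (fun z => -((-ρ z) ^ η)) Ω)
    (hβ : 0 < β) (hβη : β < η) (hc : 0 < c) (hcβ : c < β / (1 - β)) (hp : p ∈ frontier Ω)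
    (hε : 0 < ε) :
    ∃ σ > 0, ∀ δ > 0, ∃ ψ : Pt n → ℝ, ∀ z ∈ frontier Ω ∩ Metric.closedBall p σ,
      ContDiffAt ℝ 2 ψ z ∧ |ψ z - Real.log (ratio r ρ z)| ≤ δ ∧ ∀ L, ricc r ψ c L z ≤ ε * esq L := by
  have hβ1 : β < 1 := hβη.trans hη1
  have hg : 0 < (η - β) / β := div_pos (by linarith) hβ
  obtain ⟨κ, hκ, hcκ⟩ := exists_pos_lt_riccati_const hβ hβ1 hcβ
  set A := β * (1 - β) + 16 * κ with hA
  have hApos : 0 < A := by have := mul_pos hβ (sub_pos.2 hβ1); positivity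
  set c1 := β * (β ^ 2 / A + 1) with hc1
  obtain ⟨b, hb', hbc, hbs, hsym, hb1, herr⟩ := exists_bump_bumpErr hg hκ
  have hb : ContDiff ℝ 2 b := hb'.of_le (WithTop.coe_le_coe.2 le_top)
  have hpV : p ∈ V := h.frontier_subset hp
  have hr3 : ContDiffAt ℝ 3 r p := h.contDiffAt_three hs3 hpV
  have hgp := h.gradSq_ne_zero hp
  set q := tiltNormal r p with hq
  set M := modelLog b β q with hM
  have hq2 : ContDiffAt ℝ 2 q p := contDiffAt_tiltNormal hr3
  have hjet : ∀ L, pW (cR n M) L p = wv r p L ∧ hs M L p = (kc r p L).re := by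
    intro L
    obtain ⟨j1, j2, j3, j4⟩ := tiltNormal_jet hr3 hgp L
    obtain ⟨m1, m2⟩ := modelLog_jet (β := β) hb hbc hbs hb1 hsym hq2 j1 (by rw [j3, j2])
    rw [hM, m1, m2, hq, j2, j4]
    exact ⟨rfl, by ring⟩
  have hqev := eventually_tiltNormal hr3 hgp hbc hbs
  have hMp : ContDiffAt ℝ 2 M p :=
    contDiffAt_modelLog hb hbc hbs hb1 hq2 hqev.self_of_nhds.1 hqev.self_of_nhds.2.1
  have hdef := eventually_defect_le hr3 hgp hMp (c * c1 / (c1 - c)) hε hjet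
  obtain ⟨σ, hσ, hball⟩ := Metric.eventually_nhds_iff.1
    (hqev.and (hdef.and (hMp.eventually (by simp))))
  refine ⟨σ / 2, half_pos hσ, fun δ hδ => ?_⟩
  set K := frontier Ω ∩ Metric.closedBall p (σ / 2) with hKdef
  have hK : IsCompact K := (isCompact_closedBall p (σ / 2)).inter_left isClosed_frontier
  have hKball : ∀ z ∈ K, dist z p < σ := fun z hz =>
    lt_of_le_of_lt (Metric.mem_closedBall.1 hz.2) (half_lt_self hσ)
  set δ1 := min (β * δ) (Real.log 2) / 2 with hδ1
  have hlog2 : 0 < Real.log 2 := Real.log_pos (by norm_num)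
  have hδpos₁ : 0 < δ1 := half_pos (lt_min (mul_pos hβ hδ) hlog2)
  have hδa : 2 * δ1 ≤ β * δ := by rw [hδ1]; linarith [min_le_left (β * δ) (Real.log 2)]
  have hδb : 2 * δ1 ≤ Real.log 2 := by rw [hδ1]; linarith [min_le_right (β * δ) (Real.log 2)]
  have hqpos : ∀ z ∈ K, ∀ s ∈ tsupport b, 0 < (s * q z).re := fun z hz s hs => by
    have h1 : 0 < s.re := hbs hs
    have := ((hball (hKball z hz)).1.2.2 s hs).1
    linarith
  obtain ⟨τ, hτ, hline⟩ := exists_transversal_scale h hs3 h' hbc hK Set.inter_subset_left hqpos hδpos₁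
  set E : Pt n →L[ℂ] Pt n := (τ : ℂ) • (tiltForm r p).smulRight (nrm r p) with hE
  set E0 : Pt n := ((τ : ℂ) * (1 - tiltForm r p p)) • nrm r p with hE0
  have hEE : ∀ z, E0 + E z = ((τ : ℂ) * (1 + tiltForm r p (z - p))) • nrm r p := by
    intro z
    rw [hE, hE0, map_sub, smul_apply, ContinuousLinearMap.smulRight_apply, smul_smul, ← add_smul]
    congr 1
    ring
  have hptc : Continuous fun x : Pt n × ℂ => x.1 - x.2 • (E0 + E x.1) := by fun_prop
  have hK2 : IsCompact ((fun x : Pt n × ℂ => x.1 - x.2 • (E0 + E x.1)) '' (K ×ˢ tsupport b)) :=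
    (hK.prod hbc).image hptc
  have hK2Ω : ((fun x : Pt n × ℂ => x.1 - x.2 • (E0 + E x.1)) '' (K ×ˢ tsupport b)) ⊆ Ω := by
    rintro _ ⟨x, hx, rfl⟩
    simp only [hEE]
    exact (hline x.1 hx.1 x.2 hx.2).1
  obtain ⟨F, O, hO, hKO, hF⟩ := h'.exists_smooth_approx hn h'.isOpen hη hβ hβη hK2 hK2Ω hδpos₁
  have hF2 : ∀ z ∈ O, ContDiffAt ℝ 2 F z := fun z hz =>
    (hF z hz).1.of_le (WithTop.coe_le_coe.2 le_top)
  refine ⟨fun z => β⁻¹ * Real.log (discAvg F E E0 β b z) - M z - Real.log τ, fun z hz => ?_⟩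
  obtain ⟨⟨hqre, hqph, hqs⟩, hdz, hMz⟩ := hball (hKball z hz)
  have hzO : ∀ s ∈ tsupport b, z - s • (E0 + E z) ∈ O := fun s hs =>
    hKO (Set.mem_image_of_mem _ (Set.mk_mem_prod hz hs))
  have hdom : z ∈ discDomain O E E0 b := hzO
  have hi1 : Integrable fun s : ℂ => F (z - s • (E0 + E z)) * (s.re ^ (-1 - β) * b s ^ 2) :=
    integrable_disc_weight hF2 hbc hbs hdom (hb.continuous.pow 2) fun s hs => by
      simp [image_eq_zero_of_notMem_tsupport hs]
  have hi2 : Integrable fun s : ℂ => F (z - s • (E0 + E z)) *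
      (s.re ^ (-1 - β) * (s.re ^ 2 * bumpErr ((η - β) / β) b s)) :=
    integrable_disc_weight hF2 hbc hbs hdom ((Complex.continuous_re.pow 2).mul (continuous_bumpErr hb))
      fun s hs => by simp [bumpErr_eq_zero hs]
  have hlog : ∀ s ∈ tsupport b, 0 < F (z - s • (E0 + E z)) ∧
      |Real.log (F (z - s • (E0 + E z))) - (β * (Real.log τ + Real.log (ratio r ρ z)) +
        β * Real.log (2 * (s * q z).re))| ≤ 2 * δ1 := by
    intro s hs
    obtain ⟨_, f1, _, f2⟩ := hF _ (hzO s hs)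
    have f3 := (hline z hz s hs).2
    rw [← hEE] at f3
    refine ⟨f1, ?_⟩
    rw [abs_le] at f2 f3 ⊢
    constructor <;> nlinarith
  obtain ⟨hVpos, hVlog⟩ := log_integral_approx hb hbc hbs hb1 hβ.ne' hqre hqph hi1
    fun s hs => ⟨(hlog s hs).1, hqpos z hz s hs, (hlog s hs).2⟩
  have herr2 := integral_bumpErr_le hb hbc hbs hκ.le hβ hβ1.le herr hi1 hi2 hδb
    fun s hs => ⟨(hlog s hs).1, (hqs s hs).1, (hqs s hs).2, (hlog s hs).2⟩
  have hVC : ContDiffAt ℝ 2 (discAvg F E E0 β b) z := contDiffAt_discAvg hO hF2 hb hbc hbs hdom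
  have hVpos' : 0 < discAvg F E E0 β b z := hVpos
  have hΨ : ContDiffAt ℝ 2 (fun z => β⁻¹ * Real.log (discAvg F E E0 β b z)) z :=
    contDiffAt_const.mul (hVC.log hVpos'.ne')
  refine ⟨(hΨ.sub hMz).sub contDiffAt_const, ?_, fun L => ?_⟩
  · have e : β⁻¹ * Real.log (discAvg F E E0 β b z) - M z - Real.log τ - Real.log (ratio r ρ z) =
        β⁻¹ * (Real.log (discAvg F E E0 β b z) - β * (Real.log τ + Real.log (ratio r ρ z)) -
          β * M z) := by
      field_simp
      ring
    rw [e, abs_mul, abs_of_pos (inv_pos.2 hβ), inv_mul_le_iff₀ hβ]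
    exact le_trans hVlog hδa
  · have hric := discAvg_riccati hO hF2 (fun z hz => (hF z hz).2.1) hg (fun z hz => (hF z hz).2.2.1)
      hb hbc hbs hdom hApos (by
        rw [hA, add_sub_cancel_left]
        exact herr2) L
    have hlr := hs_log_add_le hVC hVpos' hβ hric
    exact (ricc_sub_sub_const_le hΨ hMz hc hcκ _ L hlr).trans (hdz L)

end patch

section gluing

variable {n : ℕ} {f g χ φ : Pt n → ℝ} {z X : Pt n} {w : ℂ} {c c1 m K ε : ℝ}

theorem pW_cR_mul (hf : DifferentiableAt ℝ f z) (hg : DifferentiableAt ℝ g z) :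
    pW (cR n fun y => f y * g y) X z = f z * pW (cR n g) X z + g z * pW (cR n f) X z := by
  have e : (cR n fun y => f y * g y) = fun y => cR n f y * cR n g y := by
    funext y; simp [cR]
  rw [e, pW_mul (differentiableAt_cR.2 hf) (differentiableAt_cR.2 hg)]
  simp only [cR]

theorem hs_sq (hf : ContDiffAt ℝ 2 f z) (X : Pt n) :
    hs (fun y => f y ^ 2) X z = 2 * f z * hs f X z + 2 * normSq (pW (cR n f) X z) := by
  have h1 : deriv (fun t : ℝ => t ^ 2) = fun t => 2 * t := by funext t; simp
  rw [hs_comp (φ := fun t => t ^ 2) hf (by fun_prop), h1]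
  simp

theorem pW_cR_add (hf : DifferentiableAt ℝ f z) (hg : DifferentiableAt ℝ g z) :
    pW (cR n fun y => f y + g y) X z = pW (cR n f) X z + pW (cR n g) X z := by
  have e : (cR n fun y => f y + g y) = fun y => cR n f y + cR n g y := by
    funext y; simp [cR]
  rw [e, pW_add (differentiableAt_cR.2 hf) (differentiableAt_cR.2 hg)]

theorem hs_mul (hf : ContDiffAt ℝ 2 f z) (hg : ContDiffAt ℝ 2 g z) (X : Pt n) :
    hs (fun y => f y * g y) X z = f z * hs g X z + g z * hs f X z +
      2 * (pW (cR n f) X z * (starRingEnd ℂ) (pW (cR n g) X z)).re := by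
  have e : (fun y => f y * g y) = fun y => (1 / 2) * ((f y + g y) ^ 2 + ((-1) * f y ^ 2 + (-1) * g y ^ 2)) := by
    funext y; ring
  have hd : DifferentiableAt ℝ f z := hf.differentiableAt (by norm_num)
  have hd' : DifferentiableAt ℝ g z := hg.differentiableAt (by norm_num)
  rw [e, hs_const_mul _ (by fun_prop), hs_add (by fun_prop) (by fun_prop),
    hs_add (by fun_prop) (by fun_prop), hs_const_mul _ (by fun_prop), hs_const_mul _ (by fun_prop),
    hs_sq (f := fun y => f y + g y) (hf.add hg), hs_sq hf, hs_sq hg, hs_add hf hg, pW_cR_add hd hd']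
  simp only [normSq_apply, add_re, add_im, mul_re, conj_re, conj_im]
  ring

theorem hs_sum {ι : Type*} (s : Finset ι) {F : ι → Pt n → ℝ}
    (hF : ∀ i ∈ s, ContDiffAt ℝ 2 (F i) z) (X : Pt n) :
    hs (fun y => ∑ i ∈ s, F i y) X z = ∑ i ∈ s, hs (F i) X z := by
  classical
  induction s using Finset.induction_on with
  | empty => simp [hs_const]
  | insert a s ha ih =>
    simp only [Finset.sum_insert ha]
    rw [hs_add (hF a (by simp)) (ContDiffAt.sum fun i hi => hF i (by simp [hi])),
      ih fun i hi => hF i (by simp [hi])]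

theorem pW_cR_sum {ι : Type*} (s : Finset ι) {F : ι → Pt n → ℝ}
    (hF : ∀ i ∈ s, DifferentiableAt ℝ (F i) z) (X : Pt n) :
    pW (cR n fun y => ∑ i ∈ s, F i y) X z = ∑ i ∈ s, pW (cR n (F i)) X z := by
  have e : (cR n fun y => ∑ i ∈ s, F i y) = fun y => ∑ i ∈ s, cR n (F i) y := by
    funext y; simp [cR]
  rw [e, pW_sum s fun i hi => differentiableAt_cR.2 (hF i hi)]

/-- A cut-off exponential of a Riccati subsolution. -/
theorem cutoff_exp_riccati (hχ : ContDiffAt ℝ 2 χ z) (hφ : ContDiffAt ℝ 2 φ z) (hc : 0 < c)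
    (hc1 : c < c1) (hm : 1 ≤ m)
    (hric : hs φ X z + K + c1 * normSq (w + pW (cR n φ) X z) ≤ ε) :
    ∃ R, 0 ≤ R ∧
      normSq (pW (cR n fun y => χ y ^ 2 * Real.exp (-m * φ y)) X z) =
        R * (χ z ^ 2 * Real.exp (-m * φ z)) ∧
      (1 + c / m) * R + χ z ^ 2 * Real.exp (-m * φ z) * (m * (K - ε + c * normSq w)) -
        2 * c * (w * (starRingEnd ℂ) (pW (cR n fun y => χ y ^ 2 * Real.exp (-m * φ y)) X z)).re -
        Real.exp (-m * φ z) * (2 * |χ z * hs χ X z| +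
          (2 + 4 * (c * c1 / (c1 - c))) * normSq (pW (cR n χ) X z)) ≤
      hs (fun y => χ y ^ 2 * Real.exp (-m * φ y)) X z := by
  have hm0 : 0 < m := by linarith
  have hdχ : DifferentiableAt ℝ χ z := hχ.differentiableAt (by norm_num)
  have hdφ : DifferentiableAt ℝ φ z := hφ.differentiableAt (by norm_num)
  have h1 : deriv (fun t : ℝ => t ^ 2) = fun t => 2 * t := by funext t; simp
  have h2 : deriv (fun t : ℝ => Real.exp (-m * t)) = fun t => -m * Real.exp (-m * t) := by
    funext t
    have := ((hasDerivAt_id t).const_mul (-m)).exp.deriv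
    simpa [mul_comm] using this
  have h3 : deriv (fun t : ℝ => -m * Real.exp (-m * t)) (φ z) = m ^ 2 * Real.exp (-m * φ z) := by
    have := congrFun h2 (φ z)
    rw [deriv_const_mul_field, this]; ring
  have a1 : pW (cR n fun y => χ y ^ 2) X z = (2 * χ z : ℝ) * pW (cR n χ) X z := by
    rw [pW_comp_real (φ := fun t => t ^ 2) hdχ (by fun_prop), h1]
  have a2 : pW (cR n fun y => Real.exp (-m * φ y)) X z =
      (-m * Real.exp (-m * φ z) : ℝ) * pW (cR n φ) X z := by
    rw [pW_comp_real (φ := fun t => Real.exp (-m * t)) hdφ (by fun_prop), h2]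
  have a3 : hs (fun y => Real.exp (-m * φ y)) X z = -m * Real.exp (-m * φ z) * hs φ X z +
      m ^ 2 * Real.exp (-m * φ z) * normSq (pW (cR n φ) X z) := by
    rw [hs_comp (φ := fun t => Real.exp (-m * t)) hφ (by fun_prop), h2, h3]
  have hC1 : ContDiffAt ℝ 2 (fun y => χ y ^ 2) z := hχ.pow 2
  have hC2 : ContDiffAt ℝ 2 (fun y => Real.exp (-m * φ y)) z := by fun_prop
  have b1 := hs_mul hC1 hC2 X
  have b2 := pW_cR_mul (X := X) (hC1.differentiableAt (by norm_num)) (hC2.differentiableAt (by norm_num))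
  rw [a1, a2, a3, hs_sq hχ] at b1
  rw [a1, a2] at b2
  rw [b1, b2]
  set t := Real.exp (-m * φ z)
  have ht : 0 < t := Real.exp_pos _
  set x := χ z
  set a := pW (cR n χ) X z
  set b := pW (cR n φ) X z
  set e := hs χ X z
  set h := hs φ X z
  have hN := normSq_add_le hc hc1 ((x : ℂ) * (w + b)) (-((2 / m : ℝ) : ℂ) * a)
  refine ⟨t * normSq (2 * a - (m * x : ℝ) * b), mul_nonneg ht.le (normSq_nonneg _), ?_, ?_⟩
  · simp only [normSq_apply, add_re, add_im, sub_re, sub_im, mul_re, mul_im, ofReal_re, ofReal_im, re_ofNat, im_ofNat]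
    ring
  · have key : x ^ 2 * (-m * t * h + m ^ 2 * t * normSq b) + t * (2 * x * e + 2 * normSq a) +
        2 * (((2 * x : ℝ) : ℂ) * a * (starRingEnd ℂ) (((-m * t : ℝ) : ℂ) * b)).re -
        ((1 + c / m) * (t * normSq (2 * a - (m * x : ℝ) * b)) +
          x ^ 2 * t * (m * (K - ε + c * normSq w)) - 2 * c * (w * (starRingEnd ℂ)
            (((x ^ 2 : ℝ) : ℂ) * (((-m * t : ℝ) : ℂ) * b) + (t : ℂ) * (((2 * x : ℝ) : ℂ) * a))).re -
          t * (2 * |x * e| + (2 + 4 * (c * c1 / (c1 - c))) * normSq a)) =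
        t * (2 * (x * e + |x * e|) + m * x ^ 2 * (ε - (h + K + c1 * normSq (w + b))) +
          m * (c1 * normSq ((x : ℂ) * (w + b)) + c * c1 / (c1 - c) * normSq (-((2 / m : ℝ) : ℂ) * a)
            - c * normSq ((x : ℂ) * (w + b) + -((2 / m : ℝ) : ℂ) * a)) +
          4 * (c * c1 / (c1 - c)) * normSq a * (1 - 1 / m)) := by
      simp only [normSq_apply, add_re, add_im, sub_re, sub_im, mul_re, mul_im, ofReal_re, ofReal_im, neg_re, neg_im,
        conj_re, conj_im, re_ofNat, im_ofNat]
      generalize c * c1 / (c1 - c) = A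
      field_simp
      ring
    have p1 : 0 ≤ x * e + |x * e| := by linarith [neg_abs_le (x * e)]
    have p2 : 0 ≤ m * x ^ 2 * (ε - (h + K + c1 * normSq (w + b))) :=
      mul_nonneg (by positivity) (by linarith)
    have p3 : 0 ≤ m * (c1 * normSq ((x : ℂ) * (w + b)) + c * c1 / (c1 - c) * normSq (-((2 / m : ℝ) : ℂ) * a)
            - c * normSq ((x : ℂ) * (w + b) + -((2 / m : ℝ) : ℂ) * a)) :=
      mul_nonneg hm0.le (by linarith)
    have p4 : 0 ≤ 4 * (c * c1 / (c1 - c)) * normSq a * (1 - 1 / m) := by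
      have : 0 ≤ 1 - 1 / m := by
        rw [sub_nonneg, div_le_one hm0]; exact hm
      have h4 : 0 ≤ c * c1 / (c1 - c) :=
        div_nonneg (mul_nonneg hc.le (hc.trans hc1).le) (sub_pos.2 hc1).le
      exact mul_nonneg (mul_nonneg (by linarith) (normSq_nonneg _)) this
    have := mul_nonneg ht.le (add_nonneg (add_nonneg (add_nonneg (mul_nonneg zero_le_two p1) p2) p3) p4)
    rw [← key] at this
    linarith

/-- Riccati subsolutions are preserved by exponential means. -/
theorem log_sum_riccati {ι : Type*} (s : Finset ι) {F : ι → Pt n → ℝ} {R err : ι → ℝ}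
    (hF : ∀ i ∈ s, ContDiffAt ℝ 2 (F i) z) (hF0 : ∀ i ∈ s, 0 ≤ F i z) (hpos : 0 < ∑ i ∈ s, F i z)
    (hm : 0 < m) (hc : 0 < c) (hR0 : ∀ i ∈ s, 0 ≤ R i)
    (hR : ∀ i ∈ s, normSq (pW (cR n (F i)) X z) = R i * F i z)
    (hle : ∀ i ∈ s, (1 + c / m) * R i + F i z * (m * (K - ε + c * normSq w)) -
      2 * c * (w * (starRingEnd ℂ) (pW (cR n (F i)) X z)).re - err i ≤ hs (F i) X z) :
    hs (fun y => -(1 / m) * Real.log (∑ i ∈ s, F i y)) X z + K +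
      c * normSq (w + pW (cR n fun y => -(1 / m) * Real.log (∑ i ∈ s, F i y)) X z) ≤
      ε + (∑ i ∈ s, err i) / (m * ∑ i ∈ s, F i z) := by
  have hPC : ContDiffAt ℝ 2 (fun y => ∑ i ∈ s, F i y) z := ContDiffAt.sum hF
  have hPd : DifferentiableAt ℝ (fun y => ∑ i ∈ s, F i y) z := hPC.differentiableAt (by norm_num)
  have hlogC : ContDiffAt ℝ 2 (fun t => -(1 / m) * Real.log t) (∑ i ∈ s, F i z) :=
    contDiffAt_const.mul (Real.contDiffAt_log.2 hpos.ne')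
  have hd1 : deriv (fun t => -(1 / m) * Real.log t) = fun t => -(1 / m) * t⁻¹ := by
    funext t; rw [deriv_const_mul_field]; simp
  have hd2 : deriv (fun t : ℝ => -(1 / m) * t⁻¹) (∑ i ∈ s, F i z) =
      (1 / m) * ((∑ i ∈ s, F i z) ^ 2)⁻¹ := by
    rw [deriv_const_mul_field]; simp
  rw [hs_comp (φ := fun t => -(1 / m) * Real.log t) hPC hlogC,
    pW_comp_real (φ := fun t => -(1 / m) * Real.log t) hPd (hlogC.differentiableAt (by norm_num)), hd1, hd2,
    hs_sum s hF, pW_cR_sum s fun i hi => (hF i hi).differentiableAt (by norm_num)]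
  have hcs : normSq (∑ i ∈ s, pW (cR n (F i)) X z) ≤ (∑ i ∈ s, R i) * ∑ i ∈ s, F i z := by
    rw [normSq_eq_norm_sq]
    refine le_trans (pow_le_pow_left₀ (norm_nonneg _) (norm_sum_le _ _) 2) ?_
    refine Finset.sum_sq_le_sum_mul_sum_of_sq_le_mul s hR0 hF0 fun i hi => ?_
    rw [← normSq_eq_norm_sq, hR i hi]
  have hsum := Finset.sum_le_sum hle
  simp only [Finset.sum_sub_distrib, Finset.sum_add_distrib, ← Finset.mul_sum, ← Finset.sum_mul] at hsum
  have hconj : ∑ i ∈ s, (w * (starRingEnd ℂ) (pW (cR n (F i)) X z)).re =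
      (w * (starRingEnd ℂ) (∑ i ∈ s, pW (cR n (F i)) X z)).re := by
    rw [map_sum, Finset.mul_sum, re_sum]
  rw [hconj] at hsum
  set P := ∑ i ∈ s, F i z
  set D := ∑ i ∈ s, pW (cR n (F i)) X z
  have h1 : (1 + c / m) * (normSq D / P) ≤ (1 + c / m) * ∑ i ∈ s, R i :=
    mul_le_mul_of_nonneg_left ((div_le_iff₀ hpos).2 hcs) (by positivity)
  have h2 : (1 + c / m) * (normSq D / P) + P * (m * (K - ε + c * normSq w)) -
      2 * c * (w * (starRingEnd ℂ) D).re - ∑ i ∈ s, err i ≤ ∑ i ∈ s, hs (F i) X z := by linarith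
  have h3 := mul_le_mul_of_nonneg_left h2 (inv_pos.2 (mul_pos hm hpos)).le
  rw [← sub_nonneg]
  refine (sub_nonneg.2 h3).trans_eq ?_
  simp only [normSq_apply, add_re, add_im, mul_re, mul_im, ofReal_re, ofReal_im, conj_re, conj_im]
  field_simp
  ring

end gluing

section globalWeight

variable {n : ℕ} {r f g : Pt n → ℝ} {z p X : Pt n} {c c1 ε : ℝ} {K : Set (Pt n)}

/-- Inequalities between real quadratic functions may be checked on the unit sphere. -/
theorem le_of_forall_sphere {Φ Ψ : Pt n → ℝ} (hΦ : ∀ (t : ℝ) L, Φ (t • L) = t ^ 2 * Φ L)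
    (hΨ : ∀ (t : ℝ) L, Ψ (t • L) = t ^ 2 * Ψ L)
    (h : ∀ L ∈ Metric.sphere (0 : Pt n) 1, Φ L ≤ Ψ L) (L : Pt n) : Φ L ≤ Ψ L := by
  rcases eq_or_ne L 0 with rfl | hL
  · have e1 := hΦ 0 0
    have e2 := hΨ 0 0
    simp only [smul_zero, ne_eq, OfNat.ofNat_ne_zero, not_false_eq_true, zero_pow, zero_mul] at e1 e2
    rw [e1, e2]
  · have hn : ‖L‖ ≠ 0 := norm_ne_zero_iff.2 hL
    have hLe : L = ‖L‖ • (‖L‖⁻¹ • L) := by rw [smul_smul, mul_inv_cancel₀ hn, one_smul]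
    rw [hLe, hΦ, hΨ]
    exact mul_le_mul_of_nonneg_left (h _ (by simp [norm_smul, hn])) (sq_nonneg _)

theorem normSq_pW_smul_real (f : Pt n → ℂ) (t : ℝ) (X z : Pt n) :
    normSq (pW f (t • X) z) = t ^ 2 * normSq (pW f X z) := by
  rw [pW_smul_real, normSq_mul, normSq_ofReal, sq]

theorem continuousAt_esq_snd (q : Pt n × Pt n) : ContinuousAt (fun x : Pt n × Pt n => esq x.2) q :=
  ((contDiff_esq (k := 1)).continuous.comp continuous_snd).continuousAt

theorem exists_derivative_bound (hK : IsCompact K) (hf : ContDiff ℝ 2 f) (a b : ℝ) :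
    ∃ C, 0 ≤ C ∧ ∀ z ∈ K, ∀ L, a * |f z * hs f L z| + b * normSq (pW (cR n f) L z) ≤ C * esq L := by
  have hc : ContinuousOn (fun x : Pt n × Pt n =>
      (a * |f x.1 * hs f x.2 x.1| + b * normSq (pW (cR n f) x.2 x.1)) / esq x.2)
      (K ×ˢ Metric.sphere 0 1) := by
    intro x hx
    refine ContinuousAt.continuousWithinAt ?_
    have hL0 : x.2 ≠ 0 := by
      intro h0
      have := hx.2
      simp [h0] at this
    have c3 := continuousAt_hs_joint hf.contDiffAt x.2 (p := x.1)
    have c4 := continuousAt_pW_joint ((hf.contDiffAt (x := x.1)).of_le (by norm_num)) x.2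
    have c5 : ContinuousAt (fun x : Pt n × Pt n => f x.1) x :=
      (hf.continuous.comp continuous_fst).continuousAt
    exact ((continuousAt_const.mul (c5.mul c3).abs).add
      (continuousAt_const.mul (Complex.continuous_normSq.continuousAt.comp c4))).div
      (continuousAt_esq_snd x) (esq_pos hL0).ne'
  obtain ⟨C, hC⟩ := (hK.prod (isCompact_sphere 0 1)).exists_bound_of_continuousOn hc
  refine ⟨max C 0, le_max_right _ _, fun z hz => ?_⟩
  refine le_of_forall_sphere (fun t L => ?_) (fun t L => ?_) fun L hL => ?_
  · rw [hs_smul_real hf.contDiffAt, normSq_pW_smul_real, mul_left_comm, abs_mul, abs_of_nonneg (sq_nonneg t)]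
    ring
  · rw [esq_smul_real]; ring
  · have hL0 : L ≠ 0 := by rintro rfl; simp at hL
    have := (le_abs_self _).trans ((hC (z, L) (Set.mk_mem_prod hz hL)).trans (le_max_left C 0))
    exact (div_le_iff₀ (esq_pos hL0)).1 this

/-- Gluing local solutions of the Riccati inequality along a compact set. -/
theorem exists_glued_weight (hK : IsCompact K) (hc : 0 < c) (hc1 : c < c1) (hε : 0 < ε)
    (hpatch : ∀ p ∈ K, ∃ σ > 0, ∀ δ > 0, ∃ ψ : Pt n → ℝ, ∀ z ∈ K ∩ Metric.closedBall p σ,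
      ContDiffAt ℝ 2 ψ z ∧ |ψ z - g z| ≤ δ ∧ ∀ L, ricc r ψ c1 L z ≤ ε * esq L) :
    ∃ ψ : Pt n → ℝ, ∀ z ∈ K, ContDiffAt ℝ 2 ψ z ∧ ∀ L, ricc r ψ c L z ≤ 2 * ε * esq L := by
  classical
  have H : ∀ p ∈ K, ∃ (χ : Pt n → ℝ) (C : ℝ), ContDiff ℝ 2 χ ∧ (∀ᶠ z in 𝓝 p, χ z = 1) ∧ 0 ≤ C ∧
      (∀ z ∈ K, ∀ L, 2 * |χ z * hs χ L z| + (2 + 4 * (c * c1 / (c1 - c))) * normSq (pW (cR n χ) L z) ≤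
        C * esq L) ∧ ∀ δ > 0, ∃ ψ : Pt n → ℝ, ∀ z ∈ K ∩ tsupport χ,
      ContDiffAt ℝ 2 ψ z ∧ |ψ z - g z| ≤ δ ∧ ∀ L, ricc r ψ c1 L z ≤ ε * esq L := by
    intro p hp
    obtain ⟨σ, hσ, h⟩ := hpatch p hp
    let χ : ContDiffBump p := ⟨σ / 2, σ, half_pos hσ, half_lt_self hσ⟩
    have hχ : ContDiff ℝ 2 χ := χ.contDiff
    obtain ⟨C, hC0, hC⟩ := exists_derivative_bound hK hχ 2 (2 + 4 * (c * c1 / (c1 - c)))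
    refine ⟨χ, C, hχ, χ.eventuallyEq_one, hC0, hC, ?_⟩
    rw [χ.tsupport_eq]
    exact h
  choose! χ C hχC hχ1 hC0 hC hψ using H
  obtain ⟨t, htK, htcov⟩ := hK.elim_nhds_subcover (fun p => {z | χ p z = 1}) hχ1
  have hS0 : 0 ≤ ∑ i ∈ t, C i := Finset.sum_nonneg fun i hi => hC0 i (htK i hi)
  set m : ℝ := 1 + Real.exp 2 * (∑ i ∈ t, C i) / ε with hm
  have hm1 : 1 ≤ m := by
    have : 0 ≤ Real.exp 2 * (∑ i ∈ t, C i) / ε := by positivity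
    linarith
  have hm0 : 0 < m := by linarith
  have hmS : Real.exp 2 * (∑ i ∈ t, C i) ≤ ε * m := by
    have : ε * m = ε + Real.exp 2 * (∑ i ∈ t, C i) := by rw [hm]; field_simp
    linarith
  choose! ψ hψC hψg hψr using fun p hp => hψ p hp (1 / m) (by positivity)
  let F : Pt n → Pt n → ℝ := fun i y => χ i y ^ 2 * Real.exp (-m * ψ i y)
  have hF0 : ∀ i y, 0 ≤ F i y := fun i y => mul_nonneg (sq_nonneg _) (Real.exp_pos _).le
  have hFz : ∀ i z, z ∉ tsupport (χ i) → F i =ᶠ[𝓝 z] fun _ => 0 := by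
    intro i z hz
    filter_upwards [notMem_tsupport_iff_eventuallyEq.1 hz] with y hy
    simp [F, hy]
  have hFC : ∀ i ∈ t, ∀ z ∈ K, ContDiffAt ℝ 2 (F i) z := by
    intro i hi z hz
    by_cases hzt : z ∈ tsupport (χ i)
    · have h1 : ContDiffAt ℝ 2 (ψ i) z := hψC i (htK i hi) z ⟨hz, hzt⟩
      have h2 : ContDiffAt ℝ 2 (χ i) z := (hχC i (htK i hi)).contDiffAt
      exact (h2.pow 2).mul (contDiffAt_const.mul h1).exp
    · exact contDiffAt_const.congr_of_eventuallyEq (hFz i z hzt)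
  have hexp : ∀ i ∈ t, ∀ z ∈ K, z ∈ tsupport (χ i) →
      Real.exp (-m * ψ i z) ≤ Real.exp 2 * ∑ j ∈ t, F j z := by
    intro i hi z hz hzt
    obtain ⟨j, hj, hj1⟩ := Set.mem_iUnion₂.1 (htcov hz)
    replace hj1 : χ j z = 1 := hj1
    have hzj : z ∈ tsupport (χ j) := subset_tsupport _ (by simp [hj1])
    have h1 := abs_le.1 (hψg i (htK i hi) z ⟨hz, hzt⟩)
    have h2 := abs_le.1 (hψg j (htK j hj) z ⟨hz, hzj⟩)
    calc Real.exp (-m * ψ i z) ≤ Real.exp (2 + -m * ψ j z) := by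
          refine Real.exp_le_exp.2 ?_
          have : m * (ψ j z - ψ i z) ≤ m * (2 * (1 / m)) :=
            mul_le_mul_of_nonneg_left (by linarith [h1.1, h2.2]) hm0.le
          have e : m * (2 * (1 / m)) = 2 := by field_simp
          nlinarith
      _ = Real.exp 2 * F j z := by simp [F, hj1, Real.exp_add]
      _ ≤ Real.exp 2 * ∑ j ∈ t, F j z :=
          mul_le_mul_of_nonneg_left (Finset.single_le_sum (f := fun j => F j z) (fun i _ => hF0 i z) hj)
            (Real.exp_pos _).le
  have hPpos : ∀ z ∈ K, 0 < ∑ j ∈ t, F j z := by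
    intro z hz
    obtain ⟨j, hj, hj1⟩ := Set.mem_iUnion₂.1 (htcov hz)
    replace hj1 : χ j z = 1 := hj1
    refine Finset.sum_pos' (fun i _ => hF0 i z) ⟨j, hj, ?_⟩
    simp only [F, hj1]
    positivity
  refine ⟨fun y => -(1 / m) * Real.log (∑ i ∈ t, F i y), fun z hz => ⟨?_, fun L => ?_⟩⟩
  · exact contDiffAt_const.mul ((ContDiffAt.sum fun i hi => hFC i hi z hz).log (hPpos z hz).ne')
  have hE := esq_nonneg L
  have hterm : ∀ i, ∃ R err, i ∈ t → 0 ≤ R ∧ normSq (pW (cR n (F i)) L z) = R * F i z ∧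
      (1 + c / m) * R + F i z * (m * ((kc r z L).re - ε * esq L + c * normSq (wv r z L))) -
        2 * c * (wv r z L * (starRingEnd ℂ) (pW (cR n (F i)) L z)).re - err ≤ hs (F i) L z ∧
      err ≤ Real.exp 2 * (∑ j ∈ t, F j z) * (C i * esq L) := by
    intro i
    by_cases hi : i ∈ t
    · by_cases hzt : z ∈ tsupport (χ i)
      · have hr := hψr i (htK i hi) z ⟨hz, hzt⟩ L
        obtain ⟨R, h1, h2, h3⟩ := cutoff_exp_riccati (hχC i (htK i hi)).contDiffAt
          (hψC i (htK i hi) z ⟨hz, hzt⟩) hc hc1 hm1 hr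
        refine ⟨R, Real.exp (-m * ψ i z) * (2 * |χ i z * hs (χ i) L z| +
          (2 + 4 * (c * c1 / (c1 - c))) * normSq (pW (cR n (χ i)) L z)), fun _ => ⟨h1, h2, h3, ?_⟩⟩
        refine (mul_le_mul_of_nonneg_left (hC i (htK i hi) z hz L) (Real.exp_pos _).le).trans ?_
        exact mul_le_mul_of_nonneg_right (hexp i hi z hz hzt) (mul_nonneg (hC0 i (htK i hi)) hE)
      · have e0 := hFz i z hzt
        have e1 : hs (F i) L z = 0 := by rw [hs_congr e0, hs_const]
        have e2 : pW (cR n (F i)) L z = 0 := by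
          have : cR n (F i) =ᶠ[𝓝 z] fun _ => 0 := by
            filter_upwards [e0] with y hy
            simp [cR, hy]
          rw [pW_congr this, pW_const]
        refine ⟨0, 0, fun _ => ⟨le_rfl, ?_, ?_, ?_⟩⟩
        · simp [e2]
        · simp [e1, e2, e0.eq_of_nhds]
        · have := hPpos z hz
          have := hC0 i (htK i hi)
          positivity
    · exact ⟨0, 0, fun h => absurd h hi⟩
  choose R err hRe using hterm
  have key := log_sum_riccati t (fun i hi => hFC i hi z hz) (fun i _ => hF0 i z) (hPpos z hz) hm0 hc
    (fun i hi => (hRe i hi).1) (fun i hi => (hRe i hi).2.1) (fun i hi => (hRe i hi).2.2.1)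
  refine key.trans ?_
  have herr : (∑ i ∈ t, err i) / (m * ∑ i ∈ t, F i z) ≤ ε * esq L := by
    rw [div_le_iff₀ (mul_pos hm0 (hPpos z hz))]
    refine (Finset.sum_le_sum fun i hi => (hRe i hi).2.2.2).trans ?_
    rw [← Finset.mul_sum, ← Finset.sum_mul]
    have := mul_le_mul_of_nonneg_right hmS (mul_nonneg (hPpos z hz).le hE)
    linarith
  linarith

end globalWeight

section smoothing

open MeasureTheory Convolution

variable {n : ℕ} {r f g : Pt n → ℝ} {c c1 ε : ℝ} {K : Set (Pt n)}

/-- A function which is `C²` near a compact set has a compactly supported `C²` model. -/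
theorem exists_compactSupport_eventuallyEq (hK : IsCompact K) (hf : ∀ z ∈ K, ContDiffAt ℝ 2 f z) :
    ∃ g : Pt n → ℝ, ContDiff ℝ 2 g ∧ HasCompactSupport g ∧ ∀ z ∈ K, g =ᶠ[𝓝 z] f := by
  obtain ⟨R, hR⟩ := hK.isBounded.subset_ball (0 : Pt n)
  have hU : IsOpen {z : Pt n | ContDiffAt ℝ 2 f z} :=
    isOpen_iff_mem_nhds.2 fun z hz => ContDiffAt.eventually hz (by simp)
  have hUo := hU.inter (Metric.isOpen_ball (x := (0 : Pt n)) (ε := R))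
  obtain ⟨χ, h0, h1, -⟩ := exists_contMDiffMap_zero_one_nhds_of_isClosed (n := 2)
    (modelWithCornersSelf ℝ (Pt n)) hUo.isClosed_compl hK.isClosed
    (Set.disjoint_left.2 fun z hz hzK => hz ⟨hf z hzK, hR hzK⟩)
  have hχ : ContDiff ℝ 2 χ := χ.contMDiff.contDiff
  rw [eventually_nhdsSet_iff_forall] at h0 h1
  have hzero : ∀ z, z ∉ {z : Pt n | ContDiffAt ℝ 2 f z} ∩ Metric.ball 0 R →
      (fun y => χ y * f y) =ᶠ[𝓝 z] fun _ => 0 := fun z hz => by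
    filter_upwards [h0 z hz] with y hy
    rw [hy, zero_mul]
  refine ⟨fun y => χ y * f y, contDiff_iff_contDiffAt.2 fun z => ?_, ?_, fun z hz => ?_⟩
  · by_cases hz : z ∈ {z : Pt n | ContDiffAt ℝ 2 f z} ∩ Metric.ball 0 R
    · exact hχ.contDiffAt.mul hz.1
    · exact contDiffAt_const.congr_of_eventuallyEq (hzero z hz)
  · refine HasCompactSupport.of_support_subset_isCompact (isCompact_closedBall (0 : Pt n) R) fun z hz => ?_
    by_contra hzR
    refine hz (hzero z (fun h => hzR (Metric.ball_subset_closedBall h.2))).eq_of_nhds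
  · filter_upwards [h1 z hz] with y hy
    rw [hy, one_mul]

theorem normSq_pW_cR_sub (X z : Pt n) :
    normSq (pW (cR n f) X z - pW (cR n g) X z) = (1 / 4) *
      ((fderiv ℝ f z X - fderiv ℝ g z X) ^ 2 + (fderiv ℝ f z (I • X) - fderiv ℝ g z (I • X)) ^ 2) := by
  rw [pW_cR, pW_cR, normSq_apply]
  simp
  ring

theorem norm_sq_le_esq (X : Pt n) : ‖X‖ ^ 2 ≤ esq X := by
  have h : ‖X‖ ≤ √(esq X) := by
    refine (pi_norm_le_iff_of_nonneg (Real.sqrt_nonneg _)).2 fun j => ?_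
    refine Real.le_sqrt_of_sq_le ?_
    rw [← normSq_eq_norm_sq]
    exact Finset.single_le_sum (f := fun j => normSq (X j)) (fun _ _ => normSq_nonneg _) (Finset.mem_univ j)
  calc ‖X‖ ^ 2 ≤ √(esq X) ^ 2 := pow_le_pow_left₀ (norm_nonneg _) h 2
    _ = esq X := Real.sq_sqrt (esq_nonneg _)

theorem norm_I_smul (X : Pt n) : ‖I • X‖ = ‖X‖ := by rw [norm_smul, norm_I, one_mul]

theorem exists_modulus_fderiv {F : Type*} [NormedAddCommGroup F] [NormedSpace ℝ F] {u : Pt n → F}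
    (hu : ContDiff ℝ 1 u) (hc : HasCompactSupport u) (hε : 0 < ε) :
    ∃ t > 0, ∀ x y, dist x y < t → ‖fderiv ℝ u x - fderiv ℝ u y‖ ≤ ε := by
  have h1 : HasCompactSupport (fderiv ℝ u) := hc.fderiv (𝕜 := ℝ)
  have h2 := h1.uniformContinuous_of_continuous (hu.continuous_fderiv (by norm_num))
  obtain ⟨t, ht, h⟩ := Metric.uniformContinuous_iff.1 h2 ε hε
  refine ⟨t, ht, fun x y hxy => ?_⟩
  rw [← dist_eq_norm]
  exact (h hxy).le

/-- Mollification is close in the `C²` sense. -/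
theorem exists_mollification (hg : ContDiff ℝ 2 g) (hgc : HasCompactSupport g) (hε : 0 < ε) :
    ∃ G : Pt n → ℝ, ContDiff ℝ ∞ G ∧ ∀ z L, |hs G L z - hs g L z| ≤ ε * esq L ∧
      normSq (pW (cR n G) L z - pW (cR n g) L z) ≤ ε ^ 2 * esq L := by
  have hd1 : Continuous (fderiv ℝ g) := hg.continuous_fderiv (by norm_num)
  have hg1 : ContDiff ℝ 1 (fderiv ℝ g) := hg.fderiv_right (by norm_num)
  have hc1 : HasCompactSupport (fderiv ℝ g) := hgc.fderiv (𝕜 := ℝ)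
  obtain ⟨t1, ht1, hu1⟩ := exists_modulus_fderiv (hg.of_le (by norm_num) : ContDiff ℝ 1 g) hgc hε
  obtain ⟨t2, ht2, hu2⟩ := exists_modulus_fderiv hg1 hc1 hε
  have ht : 0 < min t1 t2 := lt_min ht1 ht2
  obtain ⟨φ, hφr⟩ : ∃ φ : ContDiffBump (0 : Pt n), φ.rOut = min t1 t2 :=
    ⟨⟨min t1 t2 / 2, min t1 t2, half_pos ht, half_lt_self ht⟩, rfl⟩
  have hφ : LocallyIntegrable (φ.normed volume) := φ.continuous_normed.locallyIntegrable
  have hf1 : ∀ z X, fderiv ℝ (g ⋆[ContinuousLinearMap.lsmul ℝ ℝ, volume] (φ.normed volume)) z X =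
      ((φ.normed volume) ⋆[ContinuousLinearMap.lsmul ℝ ℝ, volume] fun y => fderiv ℝ g y X) z := by
    intro z X
    rw [fderiv_convolution_apply (hg.of_le (by norm_num)) hgc hφ, convolution_eq_swap, convolution]
    refine integral_congr_ae (Filter.Eventually.of_forall fun y => ?_)
    simp [mul_comm]
  have hf2 : ∀ z X, hs (g ⋆[ContinuousLinearMap.lsmul ℝ ℝ, volume] (φ.normed volume)) X z =
      ((φ.normed volume) ⋆[ContinuousLinearMap.lsmul ℝ ℝ, volume] hs g X) z := fun z X =>
    hs_convolution hg hgc hφ z X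
  have hb1 : ∀ z X, |fderiv ℝ (g ⋆[ContinuousLinearMap.lsmul ℝ ℝ, volume] (φ.normed volume)) z X -
      fderiv ℝ g z X| ≤ ε * ‖X‖ := by
    intro z X
    rw [hf1, ← Real.dist_eq]
    refine φ.dist_normed_convolution_le (hd1.clm_apply continuous_const).aestronglyMeasurable fun x hx => ?_
    rw [Real.dist_eq, ← sub_apply]
    refine ((fderiv ℝ g x - fderiv ℝ g z).le_opNorm X).trans ?_
    gcongr
    exact hu1 x z ((Metric.mem_ball.1 hx).trans_le (hφr.trans_le (min_le_left _ _)))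
  refine ⟨g ⋆[ContinuousLinearMap.lsmul ℝ ℝ, volume] (φ.normed volume), ?_, fun z L => ⟨?_, ?_⟩⟩
  · exact φ.hasCompactSupport_normed.contDiff_convolution_right _ hg.continuous.locallyIntegrable
      φ.contDiff_normed
  · rw [hf2, ← Real.dist_eq]
    refine φ.dist_normed_convolution_le (continuous_hs hg L).aestronglyMeasurable fun x hx => ?_
    have hD : ‖fderiv ℝ (fderiv ℝ g) x - fderiv ℝ (fderiv ℝ g) z‖ ≤ ε :=
      hu2 x z ((Metric.mem_ball.1 hx).trans_le (hφr.trans_le (min_le_right _ _)))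
    have hb : ∀ Y : Pt n, |fderiv ℝ (fderiv ℝ g) x Y Y - fderiv ℝ (fderiv ℝ g) z Y Y| ≤ ε * ‖Y‖ ^ 2 := by
      intro Y
      have := ((fderiv ℝ (fderiv ℝ g) x - fderiv ℝ (fderiv ℝ g) z).le_opNorm₂ Y Y)
      rw [sub_apply, sub_apply, Real.norm_eq_abs, mul_assoc, ← sq] at this
      exact this.trans (mul_le_mul_of_nonneg_right hD (sq_nonneg _))
    rw [Real.dist_eq, hs_eq hg.contDiffAt, hs_eq hg.contDiffAt]
    have b1 := abs_le.1 (hb L)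
    have b2 := abs_le.1 (hb (I • L))
    rw [norm_I_smul] at b2
    have b3 := mul_le_mul_of_nonneg_left (norm_sq_le_esq L) hε.le
    have b4 : 0 ≤ ε * ‖L‖ ^ 2 := by positivity
    exact abs_le.2 ⟨by linarith [b1.1, b2.1], by linarith [b1.2, b2.2]⟩
  · rw [normSq_pW_cR_sub]
    have b1 := sq_le_sq' (abs_le.1 (hb1 z L)).1 (abs_le.1 (hb1 z L)).2
    have b2 := sq_le_sq' (abs_le.1 (hb1 z (I • L))).1 (abs_le.1 (hb1 z (I • L))).2
    rw [norm_I_smul] at b2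
    rw [mul_pow] at b1 b2
    have b3 := mul_le_mul_of_nonneg_left (norm_sq_le_esq L) (sq_nonneg ε)
    have b4 : 0 ≤ ε ^ 2 * ‖L‖ ^ 2 := by positivity
    linarith

/-- Riccati subsolutions along a compact set can be smoothed. -/
theorem exists_smooth_weight (hK : IsCompact K) (hf : ∀ z ∈ K, ContDiffAt ℝ 2 f z) (hc : 0 < c)
    (hc1 : c < c1) (hε : 0 < ε) (hric : ∀ z ∈ K, ∀ L, ricc r f c1 L z ≤ ε * esq L) :
    ∃ G : Pt n → ℝ, ContDiff ℝ ∞ G ∧ ∀ z ∈ K, ∀ L, ricc r G c L z ≤ 2 * ε * esq L := by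
  obtain ⟨g, hg, hgc, hgf⟩ := exists_compactSupport_eventuallyEq hK hf
  set A := c * c1 / (c1 - c) with hA
  have hA0 : 0 ≤ A := div_nonneg (mul_nonneg hc.le (hc.trans hc1).le) (sub_pos.2 hc1).le
  set δ := min 1 (ε / (1 + A)) with hδ
  have hδ0 : 0 < δ := lt_min one_pos (div_pos hε (by linarith))
  have hδ1 : δ * (1 + A) ≤ ε := (le_div_iff₀ (by linarith)).1 (min_le_right _ _)
  have hδ2 : δ ^ 2 ≤ δ := by
    have := min_le_left 1 (ε / (1 + A))
    nlinarith
  obtain ⟨G, hG, hGg⟩ := exists_mollification hg hgc hδ0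
  refine ⟨G, hG, fun z hz L => ?_⟩
  have e1 : hs g L z = hs f L z := hs_congr (hgf z hz)
  have e2 : pW (cR n g) L z = pW (cR n f) L z := by
    refine pW_congr ?_
    filter_upwards [hgf z hz] with y hy
    simp [cR, hy]
  obtain ⟨b1, b2⟩ := hGg z L
  have h0 := hric z hz L
  have hE := esq_nonneg L
  rw [e1] at b1
  rw [e2] at b2
  rw [ricc] at h0 ⊢
  have hN := normSq_add_le hc hc1 (wv r z L + pW (cR n f) L z) (pW (cR n G) L z - pW (cR n f) L z)
  rw [add_add_sub_cancel, ← hA] at hN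
  have b3 := (abs_le.1 b1).2
  have b4 : A * normSq (pW (cR n G) L z - pW (cR n f) L z) ≤ A * (δ * esq L) :=
    mul_le_mul_of_nonneg_left (b2.trans (mul_le_mul_of_nonneg_right hδ2 hE)) hA0
  have b5 := mul_le_mul_of_nonneg_right hδ1 hE
  linarith

end smoothing

section directionB

variable {n : ℕ} {r ρ : Pt n → ℝ} {Ω V V' : Set (Pt n)} {s : ℕ∞}

theorem exists_condition_of_strictPSH (hn : n ≠ 0) (h : IsDefining n s Ω r V) (hs3 : 3 ≤ s)
    (hpsc : ∀ ρ V, IsDefining n s Ω ρ V → LeviPseudoconvex n ρ Ω)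
    (hbdd : Bornology.IsBounded Ω) (h' : IsDefining n 1 Ω ρ V') {η η₁ : ℝ} (hη1 : η < 1)
    (hη : StrictPSHOn n (fun z => -((-ρ z) ^ η)) Ω) (h0 : 0 < η₁) (hlt : η₁ < η) :
    ∃ ρ', IsDefining n s Ω ρ' V ∧ ∀ p ∈ weakPts n ρ' Ω, ∀ L ∈ nullSp n ρ' p,
      ((η₁ / (1 - η₁) : ℝ) : ℂ) * omegaWedge (dAngelo n ρ') (L, 0) (0, conjVec L) p -
          delbOmega (dAngelo n ρ') (L, 0) (0, conjVec L) p ≤ 0 := by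
  have hK : IsCompact (frontier Ω) :=
    hbdd.isCompact_closure.of_isClosed_subset isClosed_frontier frontier_subset_closure
  obtain ⟨R, hR⟩ := (hK.image (contDiff_esq (n := n) (k := 0)).continuous).bddAbove
  have hR' : ∀ z ∈ frontier Ω, esq z ≤ max R 0 := fun z hz => le_max_of_le_left (hR ⟨z, hz, rfl⟩)
  obtain ⟨β, hβ1, hβη⟩ := exists_between hlt
  have hcβ := div_one_sub_lt hβ1 (hβη.trans hη1)
  have hc0 : 0 < η₁ / (1 - η₁) := div_pos h0 (by linarith)
  obtain ⟨cf, hcf, hcf'⟩ := exists_between hcβ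
  obtain ⟨cg, hcg, hcg'⟩ := exists_between hcf'
  obtain ⟨cp, hcp, hcp'⟩ := exists_between hcg'
  obtain ⟨ε, hε, htilt⟩ := riccati_tilt (n := n) hc0 hcf (le_max_right R 0)
  obtain ⟨ψ, hψ⟩ := exists_glued_weight (ε := ε / 16) hK (hc0.trans (hcf.trans hcg)) hcp (by positivity)
    fun p hp => exists_patch hn h hs3 h' hη1 hη (h0.trans hβ1) hβη
      (hc0.trans (hcf.trans (hcg.trans hcp))) hcp' hp (by positivity : 0 < ε / 16)
  obtain ⟨G, hG, hGr⟩ := exists_smooth_weight (ε := 2 * (ε / 16)) hK (fun z hz => (hψ z hz).1)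
    (hc0.trans hcf) hcg (by positivity) fun z hz => (hψ z hz).2
  have hGc : ∀ k : ℕ∞, ContDiff ℝ k G := fun k => hG.of_le (WithTop.coe_le_coe.2 le_top)
  have hEc : ∀ k : ℕ∞, ContDiff ℝ k fun y : Pt n => -ε * esq y := fun k =>
    contDiff_const.mul contDiff_esq
  have hFc : ∀ k : ℕ∞, ContDiff ℝ k fun y => G y + -ε * esq y := fun k => (hGc k).add (hEc k)
  have hr' := h.mul_exp hs3 (hFc s)
  refine ⟨_, hr', fun p hp L hL => ?_⟩
  have hpf := hp.1
  have h3 := h.contDiffAt_three hs3 (h.frontier_subset hpf)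
  have h2 : ContDiffAt ℝ 2 r p := h3.of_le (by norm_num)
  have hr0 := h.eq_zero hpf
  have hg := h.gradSq_ne_zero hpf
  rcases eq_or_ne L 0 with rfl | hL0
  · simp [omegaWedge, delbOmega, delbEval, conjVec]
  refine (condition_iff (hr'.contDiffAt_three hs3 (h.frontier_subset hpf)) (hr'.gradSq_ne_zero hpf)
    hL _).2 ⟨?_, kc_im_eq_zero hr' hs3 (hpsc _ _ hr') hpf hL⟩
  have hL' : L ∈ nullSp n r p := (nullSp_mul_exp h2 (hFc 2).contDiffAt hr0).1 hL
  rw [kc_mul_exp h3 (hFc 3).contDiffAt hr0 hg hL', wv_mul_exp h2 (hFc 2).contDiffAt hr0 hg hL'.1,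
    add_re, ofReal_re, hs_add (hGc 2).contDiffAt (hEc 2).contDiffAt,
    pW_cR_add ((hGc 1).contDiffAt.differentiableAt (by norm_num))
      ((hEc 1).contDiffAt.differentiableAt (by norm_num)), ← add_assoc, ← add_assoc]
  refine (htilt _ _ L p hL0 (hR' p hpf) ?_).le
  have := hGr p hpf L
  rw [ricc] at this
  linarith

theorem DFexp_nonneg (ρ : Pt n → ℝ) (Ω : Set (Pt n)) : 0 ≤ DFexp n ρ Ω :=
  Real.sSup_nonneg fun _ hx => hx.1.le

theorem DFexp_le_one (ρ : Pt n → ℝ) (Ω : Set (Pt n)) : DFexp n ρ Ω ≤ 1 :=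
  Real.sSup_le (fun _ hx => hx.2.1.le) zero_le_one

theorem DFindex_nonneg (n : ℕ) (Ω : Set (Pt n)) : 0 ≤ DFindex n Ω :=
  Real.sSup_nonneg fun _ ⟨_, _, _, hx⟩ => hx ▸ DFexp_nonneg _ _

theorem IsDefining.le_DFindex (h : IsDefining n 1 Ω ρ V) {η : ℝ} (h0 : 0 < η) (h1 : η < 1)
    (hη : StrictPSHOn n (fun z => -((-ρ z) ^ η)) Ω) : η ≤ DFindex n Ω := by
  have e1 : η ≤ DFexp n ρ Ω := le_csSup ⟨1, fun _ hx => hx.2.1.le⟩ ⟨h0, h1, hη⟩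
  have e2 : DFexp n ρ Ω ≤ DFindex n Ω :=
    le_csSup ⟨1, fun _ ⟨_, _, _, hx⟩ => hx ▸ DFexp_le_one _ _⟩ ⟨ρ, V, h, rfl⟩
  exact e1.trans e2

end directionB

end

/-- Theorem 1.1, Diederich–Fornaess part: characterization of the
Diederich–Fornaess index in terms of the D'Angelo 1-form. -/
theorem DFindex_eq_sup_dAngelo
    (n k : ℕ) (hn : 2 ≤ n) (hk : 3 ≤ k)
    (Ω : Set (Pt n)) (hopen : IsOpen Ω) (hconn : IsConnected Ω)
    (hbdd : Bornology.IsBounded Ω)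
    (hbdry : ∃ ρ V, IsDefining n (k : ℕ∞) Ω ρ V)
    (hpsc : ∀ ρ V, IsDefining n (k : ℕ∞) Ω ρ V → LeviPseudoconvex n ρ Ω) :
    DFindex n Ω = sSup {η₁ : ℝ | ∃ ρ V, IsDefining n (k : ℕ∞) Ω ρ V ∧ 0 < η₁ ∧ η₁ < 1 ∧
      ∀ p ∈ weakPts n ρ Ω, ∀ L ∈ nullSp n ρ p,
        ((η₁ / (1 - η₁) : ℝ) : ℂ) * omegaWedge (dAngelo n ρ) (L, 0) (0, conjVec L) p -
          delbOmega (dAngelo n ρ) (L, 0) (0, conjVec L) p ≤ 0} := by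
  have hs3 : (3 : ℕ∞) ≤ (k : ℕ∞) := by exact_mod_cast hk
  obtain ⟨r, V, hr⟩ := hbdry
  set B : Set ℝ := {η₁ : ℝ | ∃ ρ V, IsDefining n (k : ℕ∞) Ω ρ V ∧ 0 < η₁ ∧ η₁ < 1 ∧
      ∀ p ∈ weakPts n ρ Ω, ∀ L ∈ nullSp n ρ p,
        ((η₁ / (1 - η₁) : ℝ) : ℂ) * omegaWedge (dAngelo n ρ) (L, 0) (0, conjVec L) p -
          delbOmega (dAngelo n ρ) (L, 0) (0, conjVec L) p ≤ 0}
  have hB0 : 0 ≤ sSup B := Real.sSup_nonneg fun _ ⟨_, _, _, hx, _⟩ => hx.le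
  have hB1 : BddAbove B := ⟨1, fun _ ⟨_, _, _, _, hx, _⟩ => hx.le⟩
  refine le_antisymm (Real.sSup_le ?_ hB0) (Real.sSup_le ?_ (DFindex_nonneg n Ω))
  · rintro _ ⟨ρ, V', h', rfl⟩
    refine Real.sSup_le (fun η ⟨_, hη1, hη⟩ => ?_) hB0
    refine le_of_forall_lt_imp_le_of_dense fun a ha => ?_
    rcases le_or_gt a 0 with ha0 | ha0
    · exact ha0.trans hB0
    obtain ⟨ρ', hρ', hc⟩ := exists_condition_of_strictPSH (by omega) hr hs3 hpsc hbdd h' hη1 hη ha0 ha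
    exact le_csSup hB1 ⟨ρ', V, hρ', ha0, ha.trans hη1, hc⟩
  · rintro η₁ ⟨ρ, V', h', _, hη1, hc⟩
    refine le_of_forall_lt_imp_le_of_dense fun a ha => ?_
    rcases le_or_gt a 0 with ha0 | ha0
    · exact ha0.trans (DFindex_nonneg n Ω)
    obtain ⟨ρ', hρ', hη⟩ := exists_strictPSH_of_condition h' hs3 hpsc hbdd ha0 ha hη1 hc
    exact hρ'.le_DFindex ha0 (ha.trans hη1) hη
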